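/- Let p ∈ [1,∞] and q⃗ = (q₁,q₂,q₃) with 1 < q_j < ∞ for each j and 2/p + 1/q̄ < 2, where 1/q̄ := 1/q₁+1/q₂+1/q₃. There exists a constant ε > 0, depending only on p and q⃗, such that: if (u,Π) is a suitable weak solution of the 3D Navier-Stokes equations on Q(1) and ‖u‖_{L^p_t L^{q⃗}_x(Q(1))} + ‖Π‖_{L¹(Q(1))} ≤ ε, then u is essentially bounded on Q(1/2). -/

import Mathlib

open MeasureTheory ENNReal Set Metric Filter

noncomputable section

/-- Euclidean 3-space. -/
abbrev E3 : Type := EuclideanSpace ℝ (Fin 3)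

/-- The point (x₁,x₂,x₃) of ℝ³. -/
def pt3 (x1 x2 x3 : ℝ) : E3 := (WithLp.equiv 2 (Fin 3 → ℝ)).symm ![x1, x2, x3]

/-- Anisotropic Lebesgue (quasi-)norm `‖f‖_{L^{q⃗}(Ω)}` with finite exponents:
iterated L^{q₁}, L^{q₂}, L^{q₃} norms in x₁, x₂, x₃ of f extended by 0 outside Ω. -/
def anisoNorm (q1 q2 q3 : ℝ) (Ω : Set E3) (f : E3 → ℝ) : ℝ≥0∞ :=
  (∫⁻ x3 : ℝ, (∫⁻ x2 : ℝ, (∫⁻ x1 : ℝ,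
      (ENNReal.ofReal |Ω.indicator f (pt3 x1 x2 x3)|) ^ q1) ^ (q2 / q1)) ^ (q3 / q2)) ^ (1 / q3)

/-- Mixed norm `‖f‖_{L^p_t L^{q⃗}_x(Q(r))}`, time exponent `p ∈ [1,∞]`,
where `Q(r) = B(r) × (−r²,0)`. -/
def mixedNorm (p : ℝ≥0∞) (q1 q2 q3 r : ℝ) (f : E3 → ℝ → ℝ) : ℝ≥0∞ :=
  if p = ∞ then
    essSup (fun t => anisoNorm q1 q2 q3 (ball (0 : E3) r) (fun x => f x t))
      (volume.restrict (Ioo (-(r^2)) 0))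
  else
    (∫⁻ t in Ioo (-(r^2)) 0,
        (anisoNorm q1 q2 q3 (ball (0 : E3) r) (fun x => f x t)) ^ p.toReal) ^ (1 / p.toReal)

/-- Partial derivative in the i-th coordinate direction. -/
def pd (i : Fin 3) (f : E3 → ℝ) (x : E3) : ℝ := fderiv ℝ f x (EuclideanSpace.single i 1)

/-- Laplacian. -/
def lap (f : E3 → ℝ) (x : E3) : ℝ := ∑ i : Fin 3, pd i (fun y => pd i f y) x

/-- Scalar test functions compactly supported in `Q(R) = B(R) × (−R²,0)`. -/
def IsTest (R : ℝ) (φ : E3 → ℝ → ℝ) : Prop :=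
  ContDiff ℝ (⊤ : ℕ∞) (fun z : E3 × ℝ => φ z.1 z.2) ∧
  HasCompactSupport (fun z : E3 × ℝ => φ z.1 z.2) ∧
  tsupport (fun z : E3 × ℝ => φ z.1 z.2) ⊆ (ball (0 : E3) R) ×ˢ (Ioo (-(R^2)) 0)

/-- Vector test functions compactly supported in `Q(R) = B(R) × (−R²,0)`. -/
def IsTestV (R : ℝ) (w : E3 → ℝ → E3) : Prop :=
  ContDiff ℝ (⊤ : ℕ∞) (fun z : E3 × ℝ => w z.1 z.2) ∧
  HasCompactSupport (fun z : E3 × ℝ => w z.1 z.2) ∧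
  tsupport (fun z : E3 × ℝ => w z.1 z.2) ⊆ (ball (0 : E3) R) ×ˢ (Ioo (-(R^2)) 0)

/-- A suitable weak solution `(u, P)` of the 3D Navier–Stokes equations on
`Q(R) = B(R) × (−R²,0)`: `u ∈ L^∞_t L²_x` with a distributional spatial gradient
`gu ∈ L²(Q(R))`, pressure `P ∈ L^{3/2}(Q(R))`, the equations hold in the sense of
distributions, and the local energy inequality holds. -/
structure SuitableWeakSolution (R : ℝ) (u : E3 → ℝ → E3) (P : E3 → ℝ → ℝ) where
  /-- the distributional spatial gradient: `gu x t i j = ∂ⱼuᵢ(x,t)` -/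
  gu : E3 → ℝ → Fin 3 → Fin 3 → ℝ
  meas_u : Measurable (Function.uncurry u)
  meas_gu : Measurable (Function.uncurry gu)
  meas_press : Measurable (Function.uncurry P)
  /-- `u ∈ L^∞(−R²,0; L²(B(R)))` -/
  bdd_L2 : essSup (fun t => ∫⁻ x in ball (0 : E3) R, ((‖u x t‖₊ : ℝ≥0∞)) ^ 2)
      (volume.restrict (Ioo (-(R^2)) 0)) < ∞
  /-- `∇u ∈ L²(Q(R))` -/
  grad_L2 : (∫⁻ t in Ioo (-(R^2)) 0, ∫⁻ x in ball (0 : E3) R,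
      ENNReal.ofReal (∑ i : Fin 3, ∑ j : Fin 3, (gu x t i j) ^ 2)) < ∞
  /-- `P ∈ L^{3/2}(Q(R))` -/
  press_L32 : (∫⁻ t in Ioo (-(R^2)) 0, ∫⁻ x in ball (0 : E3) R,
      (ENNReal.ofReal |P x t|) ^ (3/2 : ℝ)) < ∞
  /-- `gu` is the distributional spatial gradient of `u` on `Q(R)` -/
  is_grad : ∀ φ : E3 → ℝ → ℝ, IsTest R φ → ∀ i j : Fin 3,
      (∫ t in Ioo (-(R^2)) 0, ∫ x in ball (0 : E3) R, u x t i * pd j (fun y => φ y t) x)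
        = - ∫ t in Ioo (-(R^2)) 0, ∫ x in ball (0 : E3) R, gu x t i j * φ x t
  /-- `∂ₜu − Δu + (u·∇)u + ∇P = 0` in the sense of distributions on `Q(R)` -/
  weak_NS : ∀ w : E3 → ℝ → E3, IsTestV R w →
      (∫ t in Ioo (-(R^2)) 0, ∫ x in ball (0 : E3) R,
        (-(∑ i : Fin 3, u x t i * deriv (fun s => w x s i) t)
          - (∑ i : Fin 3, u x t i * lap (fun y => w y t i) x)
          - (∑ i : Fin 3, ∑ j : Fin 3, u x t i * u x t j * pd i (fun y => w y t j) x)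
          - P x t * (∑ j : Fin 3, pd j (fun y => w y t j) x))) = 0
  /-- `div u = 0` in the sense of distributions on `Q(R)` -/
  weak_div : ∀ ψ : E3 → ℝ → ℝ, IsTest R ψ →
      (∫ t in Ioo (-(R^2)) 0, ∫ x in ball (0 : E3) R,
        ∑ i : Fin 3, u x t i * pd i (fun y => ψ y t) x) = 0
  /-- the local energy inequality -/
  local_energy : ∀ φ : E3 → ℝ → ℝ, IsTest R φ → (∀ x t, 0 ≤ φ x t) →
      ∀ᵐ t ∂(volume.restrict (Ioo (-(R^2)) 0)),
        (∫ x in ball (0 : E3) R, ‖u x t‖ ^ 2 * φ x t)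
          + 2 * ∫ s in Ioo (-(R^2)) t, ∫ x in ball (0 : E3) R,
              (∑ i : Fin 3, ∑ j : Fin 3, (gu x s i j) ^ 2) * φ x s
        ≤ (∫ s in Ioo (-(R^2)) t, ∫ x in ball (0 : E3) R,
              ‖u x s‖ ^ 2 * (deriv (fun τ => φ x τ) s + lap (fun y => φ y s) x))
          + ∫ s in Ioo (-(R^2)) t, ∫ x in ball (0 : E3) R,
              (∑ i : Fin 3, u x s i * pd i (fun y => φ y s) x) * (‖u x s‖ ^ 2 + 2 * P x s)

/-- `(0,0)` is a regular point of `u`: `u` is essentially bounded on some `Q(r)`, `r > 0`. -/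
def RegularPoint (u : E3 → ℝ → E3) : Prop :=
  ∃ r > (0 : ℝ), ∃ M : ℝ,
    ∀ᵐ z : E3 × ℝ ∂(volume.restrict ((ball (0 : E3) r) ×ˢ (Ioo (-(r^2)) 0))),
      ‖u z.1 z.2‖ ≤ M

/-! ### Radial calculus -/

theorem pd_hasFDerivAt {f : E3 → ℝ} {f' : E3 →L[ℝ] ℝ} {x : E3} (h : HasFDerivAt f f' x) (i : Fin 3) :
    pd i f x = f' (EuclideanSpace.single i 1) := by
  simp [pd, h.fderiv]

theorem hasFDerivAt_normsq (a z : E3) :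
    HasFDerivAt (fun y : E3 => ‖y - a‖ ^ 2) (2 • (innerSL ℝ (z - a))) z := by
  have := (HasFDerivAt.norm_sq ((hasFDerivAt_id z).sub_const a))
  simpa using this

theorem pd_radial {F : ℝ → ℝ} {F' : ℝ} (a z : E3) (h : HasDerivAt F F' (‖z - a‖ ^ 2)) (i : Fin 3) :
    pd i (fun y => F (‖y - a‖ ^ 2)) z = 2 * (z i - a i) * F' := by
  have := h.comp_hasFDerivAt z (hasFDerivAt_normsq a z)
  have h2 := pd_hasFDerivAt this i
  simp only [Function.comp_def] at h2
  rw [h2]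
  simp [EuclideanSpace.inner_single_right]
  ring

theorem hasFDerivAt_coord (i : Fin 3) (z : E3) :
    HasFDerivAt (fun y : E3 => y i) (EuclideanSpace.proj i : E3 →L[ℝ] ℝ) z :=
  (EuclideanSpace.proj i : E3 →L[ℝ] ℝ).hasFDerivAt

theorem pd_mul {f g : E3 → ℝ} {x : E3} (hf : DifferentiableAt ℝ f x) (hg : DifferentiableAt ℝ g x)
    (i : Fin 3) : pd i (fun y => f y * g y) x = pd i f x * g x + f x * pd i g x := by
  have h := pd_hasFDerivAt (hf.hasFDerivAt.mul hg.hasFDerivAt) i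
  have e : f * g = fun y => f y * g y := rfl
  rw [e] at h
  rw [h]
  simp [pd]; ring

theorem pd_coord (i j : Fin 3) (a z : E3) : pd j (fun y => y i - a i) z = if i = j then 1 else 0 := by
  rw [pd_hasFDerivAt ((hasFDerivAt_coord i z).sub_const (a i))]
  simp

theorem pd_radial2 {F F1 : ℝ → ℝ} {F2 : ℝ} (a z : E3) (h : ∀ τ, 0 ≤ τ → HasDerivAt F (F1 τ) τ)
    (h2 : HasDerivAt F1 F2 (‖z - a‖ ^ 2)) (i j : Fin 3) :
    pd j (fun w => pd i (fun y => F (‖y - a‖ ^ 2)) w) z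
      = (if i = j then 2 * F1 (‖z - a‖ ^ 2) else 0) + 4 * (z i - a i) * (z j - a j) * F2 := by
  have e1 : (fun w => pd i (fun y => F (‖y - a‖ ^ 2)) w)
      = fun w => (w i - a i) * (2 * F1 (‖w - a‖ ^ 2)) := by
    funext w
    rw [pd_radial a w (h _ (by positivity))]; ring
  have hF1 : HasDerivAt (fun τ => 2 * F1 τ) (2 * F2) (‖z - a‖ ^ 2) := h2.const_mul 2
  have d1 : DifferentiableAt ℝ (fun y : E3 => y i - a i) z :=
    ((hasFDerivAt_coord i z).sub_const (a i)).differentiableAt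
  have d2 : DifferentiableAt ℝ (fun y : E3 => 2 * F1 (‖y - a‖ ^ 2)) z :=
    (HasDerivAt.comp_hasFDerivAt (h₂ := fun τ => 2 * F1 τ) z hF1
      (hasFDerivAt_normsq a z)).differentiableAt
  rw [e1, pd_mul d1 d2, pd_coord, pd_radial (F := fun τ => 2 * F1 τ) a z hF1]
  split_ifs <;> ring

theorem normsq_E3 (z : E3) : ‖z‖ ^ 2 = z 0 ^ 2 + z 1 ^ 2 + z 2 ^ 2 := by
  rw [EuclideanSpace.real_norm_sq_eq, Fin.sum_univ_three]

theorem lap_radial {F F1 : ℝ → ℝ} {F2 : ℝ} (a z : E3) (h : ∀ τ, 0 ≤ τ → HasDerivAt F (F1 τ) τ)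
    (h2 : HasDerivAt F1 F2 (‖z - a‖ ^ 2)) :
    lap (fun y => F (‖y - a‖ ^ 2)) z = 6 * F1 (‖z - a‖ ^ 2) + 4 * ‖z - a‖ ^ 2 * F2 := by
  unfold lap
  simp only [pd_radial2 a z h h2, Fin.sum_univ_three, if_true]
  have := normsq_E3 (z - a)
  simp only [PiLp.sub_apply] at this
  rw [this]; ring

theorem abs_coord_le (z : E3) (i : Fin 3) : |z i| ≤ ‖z‖ := by
  simpa using PiLp.norm_apply_le z i

/-! ### The profile -/
def mT (τ : ℝ) : ℝ := Real.smoothTransition (2 * τ - 1)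

theorem mT_contDiff : ContDiff ℝ (⊤ : ℕ∞) mT := by
  unfold mT
  exact Real.smoothTransition.contDiff.comp (by fun_prop)

theorem mT_nonneg (τ : ℝ) : 0 ≤ mT τ := Real.smoothTransition.nonneg _
theorem mT_le_one (τ : ℝ) : mT τ ≤ 1 := Real.smoothTransition.le_one _
theorem mT_zero {τ : ℝ} (h : τ ≤ 1/2) : mT τ = 0 :=
  Real.smoothTransition.zero_of_nonpos (by linarith)
theorem mT_one {τ : ℝ} (h : 1 ≤ τ) : mT τ = 1 :=
  Real.smoothTransition.one_of_one_le (by linarith)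

def eT (τ : ℝ) : ℝ := (1/2) * τ ^ (-(3/2) : ℝ) * mT τ

theorem eT_contDiff : ContDiff ℝ (⊤ : ℕ∞) eT := by
  rw [contDiff_iff_contDiffAt]
  intro τ
  by_cases h : τ < 1/2
  · have : eT =ᶠ[nhds τ] fun _ => 0 := by
      filter_upwards [Iio_mem_nhds h] with σ hσ
      simp [eT, mT_zero (le_of_lt hσ)]
    exact contDiffAt_const.congr_of_eventuallyEq this
  · unfold eT
    exact (contDiffAt_const.mul (contDiffAt_id.rpow_const_of_ne (by simp; linarith))).mul
      mT_contDiff.contDiffAt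

theorem mT_deriv_bdd : ∃ C, 0 < C ∧ ∀ τ, 0 < τ → |deriv mT τ| ≤ C * τ⁻¹ := by
  have hc : Continuous (deriv mT) := mT_contDiff.continuous_deriv (by norm_num)
  obtain ⟨C, hC⟩ := (isCompact_Icc (a := (0:ℝ)) (b := 1)).exists_bound_of_continuousOn hc.continuousOn
  refine ⟨|C| + 1, by positivity, fun τ hτ => ?_⟩
  by_cases h : τ ≤ 1
  · have h1 := hC τ ⟨hτ.le, h⟩
    have h2 : 1 ≤ τ⁻¹ := (one_le_inv₀ hτ).2 h
    rw [Real.norm_eq_abs] at h1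
    nlinarith [le_abs_self C, abs_nonneg C]
  · have : mT =ᶠ[nhds τ] fun _ => 1 := by
      filter_upwards [Ioi_mem_nhds (not_le.1 h)] with σ hσ using mT_one (le_of_lt hσ)
    rw [this.deriv_eq]; simp; positivity

theorem eT_hasDeriv (τ : ℝ) : HasDerivAt eT (deriv eT τ) τ :=
  (eT_contDiff.differentiable (by norm_num)).differentiableAt.hasDerivAt

theorem eT_deriv {τ : ℝ} (h : 0 < τ) :
    deriv eT τ = -(3/4) * τ ^ (-(5/2) : ℝ) * mT τ + (1/2) * τ ^ (-(3/2) : ℝ) * deriv mT τ := by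
  have h1 : HasDerivAt (fun τ : ℝ => (1/2) * τ ^ (-(3/2) : ℝ)) ((1/2) * (-(3/2) * τ ^ (-(3/2) - 1 : ℝ))) τ :=
    (Real.hasDerivAt_rpow_const (Or.inl h.ne')).const_mul _
  have h2 : HasDerivAt mT (deriv mT τ) τ :=
    (mT_contDiff.differentiable (by norm_num)).differentiableAt.hasDerivAt
  have := (h1.mul h2).deriv
  have e : (fun τ : ℝ => (1/2) * τ ^ (-(3/2) : ℝ)) * mT = eT := by
    funext σ; simp [eT]
  rw [e] at this
  rw [this]
  have e2 : (-(3/2) - 1 : ℝ) = -(5/2) := by norm_num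
  rw [e2]
  ring

def AT (τ : ℝ) : ℝ := 1 + ∫ σ in τ..1, eT σ

theorem AT_hasDeriv (τ : ℝ) : HasDerivAt AT (- eT τ) τ := by
  have hc : Continuous eT := eT_contDiff.continuous
  have := intervalIntegral.integral_hasDerivAt_left (hc.intervalIntegrable τ 1)
    (hc.stronglyMeasurableAtFilter _ _) hc.continuousAt
  exact this.const_add 1

theorem AT_contDiff : ContDiff ℝ (⊤ : ℕ∞) AT := by
  rw [contDiff_infty_iff_deriv]
  refine ⟨fun τ => (AT_hasDeriv τ).differentiableAt, ?_⟩
  have : deriv AT = fun τ => - eT τ := funext fun τ => (AT_hasDeriv τ).deriv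
  rw [this]; exact eT_contDiff.neg

theorem AT_eq {τ : ℝ} (h : 1 ≤ τ) : AT τ = τ ^ (-(1/2) : ℝ) := by
  have : ∫ σ in τ..1, eT σ = ∫ σ in τ..1, (1/2) * σ ^ (-(3/2) : ℝ) := by
    apply intervalIntegral.integral_congr
    intro σ hσ
    rw [uIcc_of_ge h] at hσ
    simp [eT, mT_one hσ.1]
  rw [AT, this, intervalIntegral.integral_const_mul, integral_rpow]
  · norm_num
    ring
  · right
    rw [uIcc_of_ge h]
    refine ⟨by norm_num, ?_⟩
    simp


theorem deriv_mT_of_one_le {τ : ℝ} (h : 1 ≤ τ) : deriv mT τ = 0 := by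
  apply IsLocalMax.deriv_eq_zero
  filter_upwards with σ
  rw [mT_one h]; exact mT_le_one σ

theorem deriv_mT_nonneg (τ : ℝ) : 0 ≤ deriv mT τ := by
  have : Monotone mT := by
    intro a b hab
    exact Real.smoothTransition.monotone (by linarith)
  exact this.deriv_nonneg

theorem eT_zero {τ : ℝ} (h : τ ≤ 1/2) : eT τ = 0 := by simp [eT, mT_zero h]

theorem deriv_eT_zero {τ : ℝ} (h : τ < 1/2) : deriv eT τ = 0 := by
  have : eT =ᶠ[nhds τ] fun _ => 0 := by
    filter_upwards [Iio_mem_nhds h] with σ hσ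
    exact eT_zero (le_of_lt hσ)
  rw [this.deriv_eq]; simp

/-- the radial mollifier profile -/
def rho0 (σ : ℝ) : ℝ := 6 * eT σ + 4 * σ * deriv eT σ

theorem rho0_eq {σ : ℝ} (h : 0 < σ) : rho0 σ = 2 * σ ^ (-(1/2) : ℝ) * deriv mT σ := by
  rw [rho0, eT_deriv h, eT]
  have e1 : σ ^ (-(3/2) : ℝ) = σ * σ ^ (-(5/2) : ℝ) := by
    nth_rewrite 2 [← Real.rpow_one σ]
    rw [← Real.rpow_add h]; norm_num
  have e2 : σ ^ (-(1/2) : ℝ) = σ * σ ^ (-(3/2) : ℝ) := by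
    nth_rewrite 2 [← Real.rpow_one σ]
    rw [← Real.rpow_add h]; norm_num
  rw [e2, e1]; ring

theorem rho0_contDiff : ContDiff ℝ (⊤ : ℕ∞) rho0 := by
  have : ContDiff ℝ (⊤ : ℕ∞) (deriv eT) := (contDiff_infty_iff_deriv.1 eT_contDiff).2
  have := eT_contDiff
  unfold rho0
  fun_prop

theorem rho0_of_one_le {σ : ℝ} (h : 1 ≤ σ) : rho0 σ = 0 := by
  rw [rho0_eq (by linarith), deriv_mT_of_one_le h]; simp

theorem rho0_nonneg (σ : ℝ) : 0 ≤ rho0 σ := by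
  by_cases h : 0 < σ
  · rw [rho0_eq h]
    have := deriv_mT_nonneg σ
    positivity
  · rw [rho0, eT_zero (by linarith), deriv_eT_zero (by linarith)]; simp

theorem eT_bound {τ : ℝ} (h : 0 < τ) : |eT τ| ≤ τ ^ (-(3/2) : ℝ) := by
  rw [eT, abs_of_nonneg (by have := mT_nonneg τ; positivity)]
  have h1 := mT_le_one τ
  have h2 := mT_nonneg τ
  have h3 : 0 ≤ τ ^ (-(3/2) : ℝ) := by positivity
  nlinarith

theorem eT_deriv_bound : ∃ C, 0 < C ∧ ∀ τ, 0 < τ → |deriv eT τ| ≤ C * τ ^ (-(5/2) : ℝ) := by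
  obtain ⟨C, hC, h⟩ := mT_deriv_bdd
  refine ⟨1 + C, by positivity, fun τ hτ => ?_⟩
  rw [eT_deriv hτ]
  have e1 : τ ^ (-(5/2) : ℝ) = τ⁻¹ * τ ^ (-(3/2) : ℝ) := by
    rw [← Real.rpow_neg_one τ, ← Real.rpow_add hτ]; norm_num
  have h3 : 0 ≤ τ ^ (-(3/2) : ℝ) := by positivity
  have h5 : 0 ≤ τ ^ (-(5/2) : ℝ) := by positivity
  have a1 : |-(3/4) * τ ^ (-(5/2) : ℝ) * mT τ| ≤ τ ^ (-(5/2) : ℝ) := by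
    rw [abs_mul, abs_mul, abs_of_nonneg (mT_nonneg τ), abs_of_nonneg h5, abs_neg]
    have h1 := mT_le_one τ
    have h2 := mT_nonneg τ
    rw [abs_of_nonneg (by norm_num)]
    nlinarith
  have a2 : |(1/2) * τ ^ (-(3/2) : ℝ) * deriv mT τ| ≤ C * τ ^ (-(5/2) : ℝ) := by
    rw [abs_mul, abs_mul, abs_of_nonneg h3, e1, abs_of_nonneg (by norm_num)]
    have := h τ hτ
    have h6 := mul_le_mul_of_nonneg_left this h3
    have : 0 ≤ |deriv mT τ| := abs_nonneg _
    nlinarith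
  exact (abs_add_le _ _).trans (by linarith)

/-- scaled profiles -/
def gF (r τ : ℝ) : ℝ := r⁻¹ * AT (τ / r ^ 2)
def gF1 (r τ : ℝ) : ℝ := - ((r ^ 3)⁻¹ * eT (τ / r ^ 2))
def gF2 (r τ : ℝ) : ℝ := - ((r ^ 5)⁻¹ * deriv eT (τ / r ^ 2))

theorem gF_hasDeriv {r : ℝ} (hr : 0 < r) (τ : ℝ) : HasDerivAt (gF r) (gF1 r τ) τ := by
  have h1 : HasDerivAt (fun τ : ℝ => τ / r ^ 2) (1 / r ^ 2) τ := (hasDerivAt_id τ).div_const _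
  have := ((AT_hasDeriv (τ / r ^ 2)).comp τ h1).const_mul r⁻¹
  refine this.congr_deriv ?_
  simp only [gF1]; field_simp

theorem gF1_hasDeriv {r : ℝ} (hr : 0 < r) (τ : ℝ) : HasDerivAt (gF1 r) (gF2 r τ) τ := by
  have h1 : HasDerivAt (fun τ : ℝ => τ / r ^ 2) (1 / r ^ 2) τ := (hasDerivAt_id τ).div_const _
  have := (((eT_hasDeriv (τ / r ^ 2)).comp τ h1).const_mul (r^3)⁻¹).neg
  refine this.congr_deriv ?_
  simp only [gF2]; field_simp

theorem rpow_scale {r τ : ℝ} (hr : 0 < r) (hτ : 0 < τ) (n : ℕ) :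
    (τ / r ^ 2) ^ (-((n:ℝ)/2)) = r ^ n * τ ^ (-((n:ℝ)/2)) := by
  rw [Real.div_rpow hτ.le (by positivity), Real.rpow_neg (x := r ^ 2) (by positivity),
    ← Real.rpow_natCast r 2, ← Real.rpow_mul hr.le]
  push_cast
  rw [show (2:ℝ) * (n / 2) = n by ring, Real.rpow_natCast]
  field_simp

theorem gF1_bound {r τ : ℝ} (hr : 0 < r) (hτ : 0 < τ) : |gF1 r τ| ≤ τ ^ (-(3/2) : ℝ) := by
  have h1 := eT_bound (τ := τ / r ^ 2) (by positivity)
  have h2 := rpow_scale hr hτ 3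
  push_cast at h2
  rw [h2] at h1
  rw [gF1, abs_neg, abs_mul, abs_of_pos (by positivity : 0 < (r^3)⁻¹)]
  calc _ ≤ (r ^ 3)⁻¹ * (r ^ 3 * τ ^ (-(3/2) : ℝ)) := by gcongr
    _ = _ := by field_simp

theorem gF2_bound : ∃ C, 0 < C ∧ ∀ r τ : ℝ, 0 < r → 0 < τ → |gF2 r τ| ≤ C * τ ^ (-(5/2) : ℝ) := by
  obtain ⟨C, hC, h⟩ := eT_deriv_bound
  refine ⟨C, hC, fun r τ hr hτ => ?_⟩
  have h1 := h (τ / r ^ 2) (by positivity)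
  have h2 := rpow_scale hr hτ 5
  push_cast at h2
  rw [h2] at h1
  rw [gF2, abs_neg, abs_mul, abs_of_pos (by positivity : 0 < (r^5)⁻¹)]
  calc _ ≤ (r ^ 5)⁻¹ * (C * (r ^ 5 * τ ^ (-(5/2) : ℝ))) := by gcongr
    _ = _ := by field_simp

theorem gF_far {r τ : ℝ} (hr : 0 < r) (h : r ^ 2 ≤ τ) : gF r τ = τ ^ (-(1/2) : ℝ) := by
  have hτ : 0 < τ := lt_of_lt_of_le (by positivity) h
  have h2 := rpow_scale hr hτ 1
  push_cast at h2
  rw [gF, AT_eq ((one_le_div (by positivity)).2 h), h2]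
  field_simp

theorem gF1_far {r τ : ℝ} (hr : 0 < r) (h : r ^ 2 ≤ τ) : gF1 r τ = - ((1/2) * τ ^ (-(3/2) : ℝ)) := by
  have hτ : 0 < τ := lt_of_lt_of_le (by positivity) h
  have h2 := rpow_scale hr hτ 3
  push_cast at h2
  rw [gF1, eT, mT_one ((one_le_div (by positivity)).2 h), h2]
  field_simp

theorem gF2_far {r τ : ℝ} (hr : 0 < r) (h : r ^ 2 ≤ τ) : gF2 r τ = (3/4) * τ ^ (-(5/2) : ℝ) := by
  have hτ : 0 < τ := lt_of_lt_of_le (by positivity) h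
  have h2 := rpow_scale hr hτ 5
  push_cast at h2
  have h1 := (one_le_div (by positivity)).2 h
  rw [gF2, eT_deriv (by positivity), mT_one h1, deriv_mT_of_one_le h1, h2]
  field_simp; simp

/-- the test function `Γ_r - Γ_h` centred at `x` -/
def PsiF (r h τ : ℝ) : ℝ := gF r τ - gF h τ
def Psi (r h : ℝ) (x y : E3) : ℝ := PsiF r h (‖y - x‖ ^ 2)
/-- its gradient and hessian, and mollifier -/
def k1 (r h : ℝ) (i : Fin 3) (z : E3) : ℝ := 2 * z i * (gF1 r (‖z‖ ^ 2) - gF1 h (‖z‖ ^ 2))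
def k2 (r h : ℝ) (i j : Fin 3) (z : E3) : ℝ :=
  (if i = j then 2 * (gF1 r (‖z‖ ^ 2) - gF1 h (‖z‖ ^ 2)) else 0)
    + 4 * z i * z j * (gF2 r (‖z‖ ^ 2) - gF2 h (‖z‖ ^ 2))
def rho (r : ℝ) (z : E3) : ℝ := (r ^ 3)⁻¹ * rho0 (‖z‖ ^ 2 / r ^ 2)


theorem PsiF_hasDeriv {r h : ℝ} (hr : 0 < r) (hh : 0 < h) (τ : ℝ) : HasDerivAt (PsiF r h) (gF1 r τ - gF1 h τ) τ :=
  (gF_hasDeriv hr τ).sub (gF_hasDeriv hh τ)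

theorem PsiF1_hasDeriv {r h : ℝ} (hr : 0 < r) (hh : 0 < h) (τ : ℝ) :
    HasDerivAt (fun τ => gF1 r τ - gF1 h τ) (gF2 r τ - gF2 h τ) τ :=
  (gF1_hasDeriv hr τ).sub (gF1_hasDeriv hh τ)

theorem pd_Psi {r h : ℝ} (hr : 0 < r) (hh : 0 < h) (x y : E3) (i : Fin 3) : pd i (Psi r h x) y = k1 r h i (y - x) := by
  have := pd_radial x y (PsiF_hasDeriv hr hh _) i
  simp only [k1, PiLp.sub_apply]; exact this

theorem pd_pd_Psi {r h : ℝ} (hr : 0 < r) (hh : 0 < h) (x y : E3) (i j : Fin 3) :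
    pd j (fun w => pd i (Psi r h x) w) y = k2 r h i j (y - x) := by
  have := pd_radial2 x y (fun τ _ => PsiF_hasDeriv hr hh τ) (PsiF1_hasDeriv hr hh _) i j
  simp only [k2, PiLp.sub_apply]; exact this

theorem lap_Psi {r h : ℝ} (hr : 0 < r) (hh : 0 < h) (x y : E3) : lap (Psi r h x) y = rho h (y - x) - rho r (y - x) := by
  have := lap_radial x y (fun τ _ => PsiF_hasDeriv hr hh τ) (PsiF1_hasDeriv hr hh _)
  have e : Psi r h x = fun y => PsiF r h (‖y - x‖ ^ 2) := rfl
  rw [e, this]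
  simp only [rho, rho0, gF1, gF2]
  field_simp
  ring

theorem Psi_contDiff (r h : ℝ) (x : E3) : ContDiff ℝ (⊤ : ℕ∞) (Psi r h x) := by
  have h1 : ContDiff ℝ (⊤ : ℕ∞) (PsiF r h) := by
    unfold PsiF gF
    have := AT_contDiff
    fun_prop
  unfold Psi
  exact h1.comp ((contDiff_norm_sq ℝ).comp (by fun_prop))

theorem k1_zero {r h : ℝ} (hr : 0 < r) (hh : 0 < h) (hrh : r ≤ h) (i : Fin 3) {z : E3} (hz : h ≤ ‖z‖) : k1 r h i z = 0 := by
  have h1 : h ^ 2 ≤ ‖z‖ ^ 2 := by gcongr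
  have h2 : r ^ 2 ≤ ‖z‖ ^ 2 := by apply le_trans _ h1; gcongr
  simp [k1, gF1_far hr h2, gF1_far hh h1]

theorem k2_zero {r h : ℝ} (hr : 0 < r) (hh : 0 < h) (hrh : r ≤ h) (i j : Fin 3) {z : E3} (hz : h ≤ ‖z‖) : k2 r h i j z = 0 := by
  have h1 : h ^ 2 ≤ ‖z‖ ^ 2 := by gcongr
  have h2 : r ^ 2 ≤ ‖z‖ ^ 2 := by apply le_trans _ h1; gcongr
  simp [k2, gF1_far hr h2, gF1_far hh h1, gF2_far hr h2, gF2_far hh h1]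

theorem Psi_zero {r h : ℝ} (hr : 0 < r) (hh : 0 < h) (hrh : r ≤ h) {x y : E3} (hz : h ≤ ‖y - x‖) : Psi r h x y = 0 := by
  have h1 : h ^ 2 ≤ ‖y - x‖ ^ 2 := by gcongr
  have h2 : r ^ 2 ≤ ‖y - x‖ ^ 2 := by apply le_trans _ h1; gcongr
  simp [Psi, PsiF, gF_far hr h2, gF_far hh h1]

theorem Psi_tsupport {r h : ℝ} (hr : 0 < r) (hh : 0 < h) (hrh : r ≤ h) (x : E3) : tsupport (Psi r h x) ⊆ closedBall x h := by
  apply closure_minimal _ isClosed_closedBall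
  intro y hy
  by_contra hc
  rw [mem_closedBall, dist_eq_norm, not_le] at hc
  exact hy (Psi_zero hr hh hrh hc.le)


theorem normpow (z : E3) (hz : z ≠ 0) (n : ℕ) : (‖z‖ ^ 2) ^ (-((n:ℝ)/2)) = (‖z‖ ^ n)⁻¹ := by
  have : 0 < ‖z‖ := norm_pos_iff.2 hz
  rw [← Real.rpow_natCast ‖z‖ 2, ← Real.rpow_mul (by positivity), ← Real.rpow_natCast,
    ← Real.rpow_neg (by positivity)]
  congr 1; push_cast; ring

theorem k1_bound {r h : ℝ} (hr : 0 < r) (hh : 0 < h) (i : Fin 3) (z : E3) :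
    |k1 r h i z| ≤ 4 * (‖z‖ ^ 2)⁻¹ := by
  by_cases hz : z = 0
  · subst hz; simp [k1]
  have hp : 0 < ‖z‖ := norm_pos_iff.2 hz
  have e := normpow z hz 3
  push_cast at e
  have b1 := gF1_bound hr (τ := ‖z‖ ^ 2) (by positivity)
  have b2 := gF1_bound hh (τ := ‖z‖ ^ 2) (by positivity)
  rw [e] at b1 b2
  rw [k1, abs_mul, abs_mul, abs_two]
  calc 2 * |z i| * |gF1 r (‖z‖ ^ 2) - gF1 h (‖z‖ ^ 2)|
      ≤ 2 * ‖z‖ * ((‖z‖ ^ 3)⁻¹ + (‖z‖ ^ 3)⁻¹) := by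
        gcongr
        · exact abs_coord_le z i
        · exact (abs_sub _ _).trans (add_le_add b1 b2)
    _ = _ := by field_simp; ring

theorem k2_bound : ∃ C, 0 < C ∧ ∀ (r h : ℝ), 0 < r → 0 < h → ∀ (i j : Fin 3) (z : E3), z ≠ 0 →
    |k2 r h i j z| ≤ C * (‖z‖ ^ 3)⁻¹ := by
  obtain ⟨C, hC, hb⟩ := gF2_bound
  refine ⟨4 + 8 * C, by positivity, fun r h hr hh i j z hz => ?_⟩
  have hp : 0 < ‖z‖ := norm_pos_iff.2 hz
  have e := normpow z hz 3
  have e5 := normpow z hz 5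
  push_cast at e e5
  have b1 := gF1_bound hr (τ := ‖z‖ ^ 2) (by positivity)
  have b2 := gF1_bound hh (τ := ‖z‖ ^ 2) (by positivity)
  have b3 := hb r (‖z‖ ^ 2) hr (by positivity)
  have b4 := hb h (‖z‖ ^ 2) hh (by positivity)
  rw [e] at b1 b2
  rw [e5] at b3 b4
  have c1 : |(if i = j then 2 * (gF1 r (‖z‖ ^ 2) - gF1 h (‖z‖ ^ 2)) else 0)| ≤ 4 * (‖z‖ ^ 3)⁻¹ := by
    split_ifs
    · rw [abs_mul, abs_two]
      have := (abs_sub (gF1 r (‖z‖ ^ 2)) (gF1 h (‖z‖ ^ 2)))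
      linarith
    · simp
  have c2 : |4 * z i * z j * (gF2 r (‖z‖ ^ 2) - gF2 h (‖z‖ ^ 2))| ≤ 8 * C * (‖z‖ ^ 3)⁻¹ := by
    rw [abs_mul, abs_mul, abs_mul, abs_of_pos (by norm_num : (0:ℝ) < 4)]
    calc _ ≤ 4 * ‖z‖ * ‖z‖ * (C * (‖z‖ ^ 5)⁻¹ + C * (‖z‖ ^ 5)⁻¹) := by
          gcongr
          · exact abs_coord_le z i
          · exact abs_coord_le z j
          · exact (abs_sub _ _).trans (add_le_add b3 b4)
      _ = _ := by field_simp; ring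
  rw [k2]
  exact (abs_add_le _ _).trans (by linarith)

/-! mollifier facts -/
theorem rho_nonneg {r : ℝ} (hr : 0 < r) (z : E3) : 0 ≤ rho r z := by
  have := rho0_nonneg (‖z‖ ^ 2 / r ^ 2)
  unfold rho; positivity

theorem rho_contDiff (r : ℝ) : ContDiff ℝ (⊤ : ℕ∞) (rho r) := by
  unfold rho
  have h1 : ContDiff ℝ (⊤ : ℕ∞) (fun z : E3 => ‖z‖ ^ 2 / r ^ 2) := (contDiff_norm_sq ℝ).div_const _
  exact contDiff_const.mul (rho0_contDiff.comp h1)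

theorem rho_zero {r : ℝ} (hr : 0 < r) {z : E3} (hz : r ≤ ‖z‖) : rho r z = 0 := by
  have : 1 ≤ ‖z‖ ^ 2 / r ^ 2 := by rw [one_le_div (by positivity)]; gcongr
  simp [rho, rho0_of_one_le this]

theorem rho_hasCompactSupport {r : ℝ} (hr : 0 < r) : HasCompactSupport (rho r) := by
  apply HasCompactSupport.of_support_subset_isCompact (isCompact_closedBall (0 : E3) r)
  intro z hz
  by_contra hc
  rw [mem_closedBall, dist_eq_norm, sub_zero, not_le] at hc
  exact hz (rho_zero hr hc.le)

theorem rho_scale {r : ℝ} (hr : 0 < r) (z : E3) : rho r z = (r ^ 3)⁻¹ * rho 1 (r⁻¹ • z) := by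
  simp only [rho, norm_smul, norm_inv, Real.norm_eq_abs, abs_of_pos hr]
  simp; left; congr 1; field_simp

theorem rho_bound : ∃ C, 0 < C ∧ (∀ r : ℝ, 0 < r → ∀ z, |rho r z| ≤ C * (r ^ 3)⁻¹) ∧
    (∀ r : ℝ, 0 < r → ∀ z z', |rho r z - rho r z'| ≤ C * (r ^ 4)⁻¹ * ‖z - z'‖) := by
  obtain ⟨C, hC⟩ := (rho_hasCompactSupport one_pos).exists_bound_of_continuous (rho_contDiff 1).continuous
  obtain ⟨K, hK⟩ := ContDiff.lipschitzWith_of_hasCompactSupport (rho_hasCompactSupport one_pos)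
    (rho_contDiff 1) (by norm_num)
  refine ⟨|C| + K + 1, by positivity, fun r hr z => ?_, fun r hr z z' => ?_⟩
  · rw [rho_scale hr, abs_mul, abs_of_pos (by positivity), mul_comm]
    gcongr
    have := hC (r⁻¹ • z)
    rw [Real.norm_eq_abs] at this
    have h2 : (0:ℝ) ≤ K := K.2
    linarith [le_abs_self C]
  · rw [rho_scale hr, rho_scale hr, ← mul_sub, abs_mul, abs_of_pos (by positivity)]
    have := hK.dist_le_mul (r⁻¹ • z) (r⁻¹ • z')
    rw [Real.dist_eq, dist_eq_norm, ← smul_sub, norm_smul, norm_inv, Real.norm_eq_abs, abs_of_pos hr] at this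
    have h2 : (0:ℝ) ≤ K := K.2
    calc _ ≤ (r^3)⁻¹ * (K * (r⁻¹ * ‖z - z'‖)) := by gcongr
      _ ≤ (r^3)⁻¹ * ((|C| + K + 1) * (r⁻¹ * ‖z - z'‖)) := by
        gcongr; linarith [abs_nonneg C]
      _ = _ := by field_simp

def c0 : ℝ := ∫ z, rho 1 z

theorem rho_integrable {r : ℝ} (hr : 0 < r) : Integrable (rho r) :=
  (rho_contDiff r).continuous.integrable_of_hasCompactSupport (rho_hasCompactSupport hr)

theorem c0_pos : 0 < c0 := by
  have hn : 0 ≤ c0 := integral_nonneg (rho_nonneg one_pos)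
  rcases hn.eq_or_lt with h | h
  swap; · exact h
  exfalso
  rw [c0, eq_comm, integral_eq_zero_iff_of_nonneg (rho_nonneg one_pos) (rho_integrable one_pos)] at h
  have h1 : rho 1 = 0 := (Continuous.ae_eq_iff_eq _ (rho_contDiff 1).continuous continuous_const).1 h
  have h2 : ∀ τ, 0 < τ → deriv mT τ = 0 := by
    intro τ hτ
    have := congrFun h1 (EuclideanSpace.single 0 (Real.sqrt τ))
    simp [rho, Real.sq_sqrt hτ.le, rho0_eq hτ] at this
    rcases this with h | h
    · rw [Real.rpow_eq_zero hτ.le (by norm_num)] at h; linarith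
    · exact h
  obtain ⟨c, hc, he⟩ := exists_deriv_eq_slope mT (a := 1/2) (b := 1) (by norm_num)
    mT_contDiff.continuous.continuousOn
    (mT_contDiff.differentiable (by norm_num)).differentiableOn
  rw [h2 c (by linarith [hc.1]), mT_one le_rfl, mT_zero le_rfl] at he
  norm_num at he

theorem rho_integral {r : ℝ} (hr : 0 < r) : ∫ z, rho r z = c0 := by
  simp_rw [rho_scale hr]
  rw [integral_const_mul, Measure.integral_comp_smul]
  simp [c0, abs_of_pos hr]
  field_simp

/-! ### Truncated power kernels -/
/-- truncated Riesz kernel -/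
def kn {E : Type*} [NormedAddCommGroup E] (a h : ℝ) (z : E) : ℝ≥0∞ :=
  if ‖z‖ < h then ‖z‖ₑ ^ (-a) else 0

theorem kn_neg {E : Type*} [NormedAddCommGroup E] (a h : ℝ) (z : E) : kn a h (-z) = kn a h z := by
  simp [kn]

theorem kn_sub_comm {E : Type*} [NormedAddCommGroup E] (a h : ℝ) (x y : E) :
    kn a h (x - y) = kn a h (y - x) := by
  rw [← kn_neg, neg_sub]

theorem kn_measurable {E : Type*} [NormedAddCommGroup E] [MeasurableSpace E] [OpensMeasurableSpace E]
    (a h : ℝ) : Measurable (kn a h : E → ℝ≥0∞) := by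
  unfold kn
  apply Measurable.ite (measurableSet_lt measurable_norm measurable_const)
  · fun_prop
  · exact measurable_const

theorem lintegral_comp_smul_E {E : Type*} [NormedAddCommGroup E] [NormedSpace ℝ E] [MeasurableSpace E]
    [BorelSpace E] [FiniteDimensional ℝ E] (μ : Measure E) [μ.IsAddHaarMeasure]
    {r : ℝ} (hr : 0 < r) {f : E → ℝ≥0∞} (hf : Measurable f) :
    ∫⁻ x, f (r • x) ∂μ = ENNReal.ofReal ((r ^ Module.finrank ℝ E)⁻¹) * ∫⁻ x, f x ∂μ := by
  have h1 := Measure.map_addHaar_smul μ hr.ne'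
  have h2 := lintegral_map (μ := μ) hf (measurable_const_smul r)
  rw [← h2, h1, lintegral_smul_measure, abs_of_pos (by positivity), smul_eq_mul]

theorem kn_lintegral {E : Type*} [NormedAddCommGroup E] [NormedSpace ℝ E] [MeasurableSpace E]
    [BorelSpace E] [FiniteDimensional ℝ E] [Nontrivial E] (μ : Measure E) [μ.IsAddHaarMeasure] (a : ℝ)
    (ha : a < Module.finrank ℝ E) :
    ∃ C : ℝ≥0∞, C ≠ ∞ ∧ ∀ h : ℝ, 0 < h →
      ∫⁻ z, kn a h z ∂μ = C * ENNReal.ofReal h ^ ((Module.finrank ℝ E : ℝ) - a) := by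
  refine ⟨∫⁻ z, kn a 1 z ∂μ, ?_, fun h hh => ?_⟩
  · have h1 : IntegrableOn (fun x : E => ‖x‖ ^ (-a)) (ball (0 : E) 1) μ := by
      rw [integrableOn_fun_norm_addHaar μ (f := fun y => y ^ (-a))]
      have hd : 0 < Module.finrank ℝ E := Module.finrank_pos
      have : IntegrableOn (fun y : ℝ => y ^ ((Module.finrank ℝ E : ℝ) - 1 - a)) (Ioo 0 1) := by
        rw [intervalIntegral.integrableOn_Ioo_rpow_iff one_pos]
        linarith
      refine this.congr_fun (fun y hy => ?_) measurableSet_Ioo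
      simp only [smul_eq_mul]
      rw [← Real.rpow_natCast, ← Real.rpow_add hy.1, Nat.cast_sub hd]
      congr 1; push_cast; ring
    have h2 := h1.2
    rw [hasFiniteIntegral_iff_enorm] at h2
    refine ne_of_lt (lt_of_le_of_lt ?_ h2)
    rw [← lintegral_indicator measurableSet_ball]
    apply lintegral_mono_ae
    have : ∀ᵐ z ∂μ, z ≠ 0 := by simp [ae_iff]
    filter_upwards [this] with z hz
    simp only [kn, indicator, mem_ball, dist_zero_right]
    split_ifs
    · have hp : 0 < ‖z‖ := norm_pos_iff.2 hz
      rw [← ofReal_norm, ENNReal.ofReal_rpow_of_pos hp, ← ofReal_norm,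
        Real.norm_of_nonneg (by positivity)]
    · exact le_rfl
  · have e : ∀ z : E, kn a h z = ENNReal.ofReal h ^ (-a) * kn a 1 (h⁻¹ • z) := by
      intro z
      have n1 : ‖h⁻¹ • z‖ = h⁻¹ * ‖z‖ := by rw [norm_smul, norm_inv, Real.norm_of_nonneg hh.le]
      have n2 : ‖h⁻¹ • z‖ < 1 ↔ ‖z‖ < h := by
        rw [n1, inv_mul_lt_iff₀ hh, mul_one]
      simp only [kn, n2]
      split_ifs
      · rw [← ENNReal.mul_rpow_of_ne_top (by simp) (by simp)]
        congr 1
        rw [← ofReal_norm, ← ofReal_norm, n1, ← ENNReal.ofReal_mul hh.le]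
        congr 1; field_simp
      · simp
    simp_rw [e]
    rw [lintegral_const_mul' _ _ (by
        apply ENNReal.rpow_ne_top_of_ne_zero <;> simp [hh]),
      lintegral_comp_smul_E μ (inv_pos.2 hh) (kn_measurable a 1), inv_pow, inv_inv, mul_comm _ (∫⁻ _, _ ∂_),
      mul_comm, mul_assoc, ENNReal.ofReal_pow hh.le, ← ENNReal.rpow_natCast,
      ← ENNReal.rpow_add _ _ (by simp [hh]) (by simp)]
    rfl

theorem kn3 (a : ℝ) (ha : a < 3) : ∃ C : ℝ≥0∞, C ≠ ∞ ∧ ∀ h : ℝ, 0 < h →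
      ∫⁻ z : E3, kn a h z = C * ENNReal.ofReal h ^ (3 - a) := by
  have := kn_lintegral (volume : Measure E3) a (by simpa using ha)
  simpa using this

theorem kn1d (a : ℝ) (ha : a < 1) : ∃ C : ℝ≥0∞, C ≠ ∞ ∧ ∀ h : ℝ, 0 < h →
      ∫⁻ z : ℝ, kn a h z = C * ENNReal.ofReal h ^ (1 - a) := by
  have := kn_lintegral (volume : Measure ℝ) a (by simpa using ha)
  simpa using this

/-! ### Iterated integral -/
theorem pt3_eq (x1 x2 x3 : ℝ) : pt3 x1 x2 x3 = WithLp.toLp 2 ![x1, x2, x3] := rfl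

theorem pt3_meas : Measurable (fun p : ℝ × ℝ × ℝ => pt3 p.2.2 p.2.1 p.1) := by
  simp only [pt3_eq]
  apply (MeasurableEquiv.toLp 2 (Fin 3 → ℝ)).measurable.comp
  rw [measurable_pi_iff]
  intro i
  fin_cases i <;> simp <;> fun_prop

theorem pt3_mp : MeasurePreserving (fun p : ℝ × ℝ × ℝ => pt3 p.2.2 p.2.1 p.1) := by
  have h1 := (volume_preserving_piFinSuccAbove (fun _ : Fin 3 => ℝ) 2).symm
  have h2 := (volume_preserving_finTwoArrow ℝ).symm
  have h3 : MeasurePreserving (fun p : ℝ × ℝ => (p.2, p.1)) := Measure.measurePreserving_swap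
  have h4 := (MeasurePreserving.id (volume : Measure ℝ)).prod (h2.comp h3)
  have h5 := (PiLp.volume_preserving_toLp (Fin 3)).comp (h1.comp h4)
  have e : (fun p : ℝ × ℝ × ℝ => pt3 p.2.2 p.2.1 p.1) = (WithLp.toLp 2 ∘
      (MeasurableEquiv.piFinSuccAbove (fun _ : Fin 3 => ℝ) 2).symm ∘
      Prod.map id ((MeasurableEquiv.finTwoArrow (α := ℝ)).symm ∘ fun p : ℝ × ℝ => (p.2, p.1))) := by
    funext p
    simp only [pt3_eq, Function.comp]
    congr 1
    funext i
    fin_cases i <;> rfl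
  rw [e]
  exact h5

theorem lintegral_E3 {f : E3 → ℝ≥0∞} (hf : Measurable f) :
    ∫⁻ x, f x = ∫⁻ x3 : ℝ, ∫⁻ x2 : ℝ, ∫⁻ x1 : ℝ, f (pt3 x1 x2 x3) := by
  rw [← pt3_mp.lintegral_comp hf, Measure.volume_eq_prod, lintegral_prod _ (by
    exact (hf.comp pt3_meas).aemeasurable)]
  congr 1; funext x3
  have : Measurable (fun q : ℝ × ℝ => f (pt3 q.2 q.1 x3)) :=
    hf.comp (pt3_meas.comp (measurable_const.prodMk measurable_id))
  rw [Measure.volume_eq_prod, lintegral_prod _ this.aemeasurable]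

/-! ### Admissible weights -/
def Adm (w : E3 → ℝ≥0∞) (W : ℝ≥0∞) (γ τ : ℝ) : Prop :=
  ∀ y : E3, ∀ h : ℝ, 0 < h → ∫⁻ x, w x * kn γ h (x - y) ≤ W * ENNReal.ofReal h ^ τ

theorem kn_prod_le {γ1 γ2 γ3 h : ℝ} (h1 : 0 < γ1) (h2 : 0 < γ2) (h3 : 0 < γ3) (z : E3) :
    kn (γ1 + γ2 + γ3) h z ≤ kn γ1 h (z 0) * kn γ2 h (z 1) * kn γ3 h (z 2) := by
  have key : ∀ (i : Fin 3) {γ : ℝ}, 0 < γ → ‖z‖ < h → ‖z‖ₑ ^ (-γ) ≤ kn γ h (z i) := by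
    intro i γ hγ hz
    have h0 : ‖z i‖ ≤ ‖z‖ := PiLp.norm_apply_le z i
    rw [kn, if_pos (h0.trans_lt hz)]
    rw [ENNReal.rpow_neg, ENNReal.rpow_neg, ENNReal.inv_le_inv]
    apply ENNReal.rpow_le_rpow _ hγ.le
    rw [← ofReal_norm, ← ofReal_norm]
    exact ENNReal.ofReal_le_ofReal h0
  by_cases hz : ‖z‖ < h
  · have e0 : kn (γ1 + γ2 + γ3) h z = ‖z‖ₑ ^ (-(γ1 + γ2 + γ3)) := if_pos hz
    rw [e0]
    have e : ‖z‖ₑ ^ (-(γ1 + γ2 + γ3)) = ‖z‖ₑ ^ (-γ1) * ‖z‖ₑ ^ (-γ2) * ‖z‖ₑ ^ (-γ3) := by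
      by_cases h0 : z = 0
      · subst h0
        have a1 : -γ1 < 0 := by linarith
        have a2 : -γ2 < 0 := by linarith
        have a3 : -γ3 < 0 := by linarith
        have a4 : -(γ1 + γ2 + γ3) < 0 := by linarith
        simp [ENNReal.zero_rpow_of_neg, a1, a2, a3, a4, -neg_add_rev]
      · have : ‖z‖ₑ ≠ 0 := by simpa using h0
        rw [← ENNReal.rpow_add _ _ this (by simp), ← ENNReal.rpow_add _ _ this (by simp)]
        congr 1; ring
    rw [e]
    exact mul_le_mul' (mul_le_mul' (key 0 h1 hz) (key 1 h2 hz)) (key 2 h3 hz)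
  · have e0 : kn (γ1 + γ2 + γ3) h z = 0 := if_neg hz
    rw [e0]; exact zero_le

theorem kn_rpow {E : Type*} [NormedAddCommGroup E] (a h q : ℝ) (hq : 0 < q) (z : E) :
    kn a h z ^ q = kn (a * q) h z := by
  unfold kn
  split_ifs
  · rw [← ENNReal.rpow_mul]; congr 1; ring
  · simp [hq]

/-- one-dimensional Hölder against a truncated kernel -/
theorem holder1 {q γ : ℝ} (hq : 1 < q) (hγ : γ < 1 - 1 / q) :
    ∃ C : ℝ≥0∞, C ≠ ∞ ∧ ∀ (f : ℝ → ℝ≥0∞), AEMeasurable f → ∀ (y h : ℝ), 0 < h →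
      ∫⁻ x, f x * kn γ h (x - y) ≤ C * ENNReal.ofReal h ^ (1 - 1 / q - γ) * (∫⁻ x, f x ^ q) ^ (1 / q) := by
  set q' := Real.conjExponent q with hq'
  have hc : q.HolderConjugate q' := Real.HolderConjugate.conjExponent hq
  have hq'0 : 0 < q' := hc.symm.pos
  have hinv : 1 - 1 / q = 1 / q' := by
    have := hc.inv_add_inv_eq_one
    rw [one_div, one_div]; linarith
  obtain ⟨C, hC, hk⟩ := kn1d (γ * q') (by
    rw [hinv] at hγ
    calc γ * q' < 1 / q' * q' := by gcongr
      _ = 1 := by field_simp)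
  refine ⟨C ^ (1 / q'), by simp [hC, hq'0.le], fun f hf y h hh => ?_⟩
  have hm : Measurable (fun x : ℝ => kn γ h (x - y)) := (kn_measurable γ h).comp (measurable_id.sub_const y)
  have := ENNReal.lintegral_mul_le_Lp_mul_Lq volume hc hf hm.aemeasurable
  refine this.trans (le_of_eq ?_)
  simp_rw [kn_rpow _ _ _ hq'0]
  rw [lintegral_sub_right_eq_self (fun x : ℝ => kn (γ * q') h x) y, hk h hh,
    ENNReal.mul_rpow_of_nonneg _ _ (by positivity), ← ENNReal.rpow_mul, mul_comm]
  congr 3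
  rw [hinv]; field_simp

theorem adm_aniso {q1 q2 q3 γ : ℝ} (hq1 : 1 < q1) (hq2 : 1 < q2) (hq3 : 1 < q3) (hγ0 : 0 < γ)
    (hγ : γ < 3 - (1/q1 + 1/q2 + 1/q3)) :
    ∃ C : ℝ≥0∞, C ≠ ∞ ∧ ∀ (Ω : Set E3) (f : E3 → ℝ), Measurable f → MeasurableSet Ω →
      Adm (fun x => ENNReal.ofReal |Ω.indicator f x|) (C * anisoNorm q1 q2 q3 Ω f) γ
        (3 - (1/q1 + 1/q2 + 1/q3) - γ) := by
  set S := 1/q1 + 1/q2 + 1/q3 with hS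
  have i1 : 1 / q1 < 1 := by rw [div_lt_one (by linarith)]; exact hq1
  have i2 : 1 / q2 < 1 := by rw [div_lt_one (by linarith)]; exact hq2
  have i3 : 1 / q3 < 1 := by rw [div_lt_one (by linarith)]; exact hq3
  have hS3 : 0 < 3 - S := by linarith
  have hl : γ / (3 - S) < 1 := by rw [div_lt_one hS3]; exact hγ
  have hl0 : 0 < γ / (3 - S) := by positivity
  set l := γ / (3 - S) with hldef
  have hsum : l * (1 - 1/q1) + l * (1 - 1/q2) + l * (1 - 1/q3) = γ := by
    rw [← mul_add, ← mul_add, hldef, div_mul_eq_mul_div, div_eq_iff hS3.ne', hS]; ring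
  have gg : ∀ q : ℝ, 1 / q < 1 → l * (1 - 1 / q) < 1 - 1 / q := fun q hq => by nlinarith
  have g0 : ∀ q : ℝ, 1 / q < 1 → 0 < l * (1 - 1 / q) := fun q hq => mul_pos hl0 (by linarith)
  obtain ⟨C1, hC1, H1⟩ := holder1 hq1 (gg q1 i1)
  obtain ⟨C2, hC2, H2⟩ := holder1 hq2 (gg q2 i2)
  obtain ⟨C3, hC3, H3⟩ := holder1 hq3 (gg q3 i3)
  set γ1 := l * (1 - 1/q1)
  set γ2 := l * (1 - 1/q2)
  set γ3 := l * (1 - 1/q3)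
  refine ⟨C1 * C2 * C3, by finiteness, fun Ω f hf hΩ y h hh => ?_⟩
  set w : E3 → ℝ≥0∞ := fun x => ENNReal.ofReal |Ω.indicator f x| with hw
  have wm : Measurable w := ENNReal.measurable_ofReal.comp (hf.indicator hΩ).norm
  have wm3 : Measurable (fun p : ℝ × ℝ × ℝ => w (pt3 p.2.2 p.2.1 p.1)) := wm.comp pt3_meas
  have km : Measurable (fun x : E3 => kn γ h (x - y)) := (kn_measurable γ h).comp (measurable_id.sub_const y)
  have hh0 : ENNReal.ofReal h ≠ 0 := by simp [hh]
  set A1 : ℝ≥0∞ := C1 * ENNReal.ofReal h ^ (1 - 1 / q1 - γ1) with hA1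
  set A2 : ℝ≥0∞ := C2 * ENNReal.ofReal h ^ (1 - 1 / q2 - γ2) with hA2
  set A3 : ℝ≥0∞ := C3 * ENNReal.ofReal h ^ (1 - 1 / q3 - γ3) with hA3
  have fin : ∀ a : ℝ, ENNReal.ofReal h ^ a ≠ ∞ := fun a => ENNReal.rpow_ne_top_of_ne_zero hh0 (by simp)
  have f1 : A1 ≠ ∞ := ENNReal.mul_ne_top hC1 (fin _)
  have f2 : A2 ≠ ∞ := ENNReal.mul_ne_top hC2 (fin _)
  have f3 : A3 ≠ ∞ := ENNReal.mul_ne_top hC3 (fin _)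
  -- inner functions
  set I1 : ℝ × ℝ → ℝ≥0∞ := fun p => ∫⁻ x1, w (pt3 x1 p.2 p.1) ^ q1 with hI1
  have I1m : Measurable I1 := by
    have : Measurable (fun p : (ℝ × ℝ) × ℝ => w (pt3 p.2 p.1.2 p.1.1) ^ q1) :=
      (wm3.comp (by fun_prop : Measurable (fun p : (ℝ × ℝ) × ℝ => (p.1.1, p.1.2, p.2)))).pow_const q1
    exact this.lintegral_prod_right'
  set I2 : ℝ → ℝ≥0∞ := fun x3 => ∫⁻ x2, I1 (x3, x2) ^ (q2 / q1) with hI2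
  have I2m : Measurable I2 := (I1m.pow_const _).lintegral_prod_right'
  have kn_fin : ∀ (γ h : ℝ) (a : ℝ), a ≠ 0 → kn γ h a ≠ ∞ := by
    intro γ h a ha
    unfold kn
    split_ifs
    · exact ENNReal.rpow_ne_top_of_ne_zero (by simpa using ha) (by simp)
    · simp
  calc ∫⁻ x, w x * kn γ h (x - y)
      = ∫⁻ x3 : ℝ, ∫⁻ x2 : ℝ, ∫⁻ x1 : ℝ, w (pt3 x1 x2 x3) * kn γ h (pt3 x1 x2 x3 - y) :=
        lintegral_E3 (wm.mul km)
    _ ≤ ∫⁻ x3 : ℝ, (∫⁻ x2 : ℝ, (∫⁻ x1 : ℝ, w (pt3 x1 x2 x3) * kn γ1 h (x1 - y 0))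
          * kn γ2 h (x2 - y 1)) * kn γ3 h (x3 - y 2) := by
        refine lintegral_mono_ae ?_
        filter_upwards [(by simp [ae_iff] : ∀ᵐ x3 : ℝ, x3 ≠ y 2)] with x3 h3
        rw [← lintegral_mul_const' _ _ (kn_fin _ _ _ (sub_ne_zero.2 h3))]
        refine lintegral_mono_ae ?_
        filter_upwards [(by simp [ae_iff] : ∀ᵐ x3 : ℝ, x3 ≠ y 1)] with x2 h2
        rw [← lintegral_mul_const' _ _ (kn_fin _ _ _ (sub_ne_zero.2 h2)),
          ← lintegral_mul_const' _ _ (kn_fin _ _ _ (sub_ne_zero.2 h3))]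
        refine lintegral_mono fun x1 => ?_
        rw [← hsum, mul_assoc, mul_assoc]
        gcongr
        have := kn_prod_le (h := h) (g0 q1 i1) (g0 q2 i2) (g0 q3 i3) (pt3 x1 x2 x3 - y)
        simp only [pt3_eq, PiLp.sub_apply, Matrix.cons_val] at this
        rw [← mul_assoc]
        exact this
    _ ≤ ∫⁻ x3 : ℝ, (∫⁻ x2 : ℝ, (A1 * I1 (x3, x2) ^ (1 / q1))
          * kn γ2 h (x2 - y 1)) * kn γ3 h (x3 - y 2) := by
        gcongr with x3 x2
        refine H1 _ ?_ _ _ hh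
        exact (wm3.comp (by fun_prop : Measurable (fun a : ℝ => (x3, x2, a)))).aemeasurable
    _ ≤ ∫⁻ x3 : ℝ, (A1 * (A2 * I2 x3 ^ (1 / q2))) * kn γ3 h (x3 - y 2) := by
        gcongr with x3
        simp_rw [mul_assoc A1]
        rw [lintegral_const_mul' _ _ f1]
        gcongr
        refine (H2 (fun x2 => I1 (x3, x2) ^ (1 / q1)) ?_ _ _ hh).trans (le_of_eq ?_)
        · exact ((I1m.comp (by fun_prop : Measurable (fun a : ℝ => (x3, a)))).pow_const _).aemeasurable
        · simp_rw [← ENNReal.rpow_mul]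
          rw [hI2]
          simp only [one_div_mul_eq_div, hA2]
    _ ≤ A1 * A2 * (A3 * (∫⁻ x3, I2 x3 ^ (q3 / q2)) ^ (1 / q3)) := by
        simp_rw [← mul_assoc A1, mul_assoc (A1 * A2)]
        rw [lintegral_const_mul' _ _ (ENNReal.mul_ne_top f1 f2)]
        gcongr
        refine (H3 (fun x3 => I2 x3 ^ (1 / q2)) ?_ _ _ hh).trans (le_of_eq ?_)
        · exact (I2m.pow_const _).aemeasurable
        · simp_rw [← ENNReal.rpow_mul]
          simp only [one_div_mul_eq_div]; rfl
    _ = C1 * C2 * C3 * anisoNorm q1 q2 q3 Ω f * ENNReal.ofReal h ^ (3 - S - γ) := by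
        have e : ENNReal.ofReal h ^ (3 - S - γ) = ENNReal.ofReal h ^ (1 - 1 / q1 - γ1) *
            ENNReal.ofReal h ^ (1 - 1 / q2 - γ2) * ENNReal.ofReal h ^ (1 - 1 / q3 - γ3) := by
          rw [← ENNReal.rpow_add _ _ hh0 (by simp), ← ENNReal.rpow_add _ _ hh0 (by simp)]
          congr 1; rw [← hsum, hS]; ring
        rw [e, hA1, hA2, hA3]
        have : anisoNorm q1 q2 q3 Ω f = (∫⁻ x3, I2 x3 ^ (q3 / q2)) ^ (1 / q3) := rfl
        rw [this]; ring

theorem adm_one {γ : ℝ} (hγ : γ < 3) :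
    ∃ C : ℝ≥0∞, C ≠ ∞ ∧ Adm (fun _ => 1) C γ (3 - γ) := by
  obtain ⟨C, hC, h⟩ := kn3 γ hγ
  refine ⟨C, hC, fun y s hs => ?_⟩
  simp only [one_mul]
  rw [lintegral_sub_right_eq_self (fun x : E3 => kn γ s x) y, h s hs]

theorem adm_L2 {γ : ℝ} (hγ : γ < 3 / 2) :
    ∃ C : ℝ≥0∞, C ≠ ∞ ∧ ∀ w : E3 → ℝ≥0∞, Measurable w →
      Adm w (C * (∫⁻ x, w x ^ 2) ^ (1/2 : ℝ)) γ (3 / 2 - γ) := by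
  obtain ⟨C, hC, h⟩ := kn3 (γ * 2) (by linarith)
  refine ⟨C ^ (1/2 : ℝ), by simp [hC], fun w hw y s hs => ?_⟩
  have hm : Measurable (fun x : E3 => kn γ s (x - y)) := (kn_measurable γ s).comp (measurable_id.sub_const y)
  have := ENNReal.lintegral_mul_le_Lp_mul_Lq volume Real.HolderConjugate.two_two hw.aemeasurable hm.aemeasurable
  refine this.trans (le_of_eq ?_)
  simp_rw [kn_rpow _ _ _ (two_pos : (0:ℝ) < 2)]
  rw [lintegral_sub_right_eq_self (fun x : E3 => kn (γ * 2) s x) y, h s hs,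
    ENNReal.mul_rpow_of_nonneg _ _ (by positivity), ← ENNReal.rpow_mul]
  rw [show (3 - γ * 2) * (1/2) = 3/2 - γ by ring]
  simp only [ENNReal.rpow_two]
  ring

/-! ### Slices -/
def gn (g : E3 → Fin 3 → Fin 3 → ℝ) (x : E3) : ℝ≥0∞ :=
  ENNReal.ofReal (√(∑ i : Fin 3, ∑ j : Fin 3, (g x i j) ^ 2))

structure Slice (u : E3 → E3) (g : E3 → Fin 3 → Fin 3 → ℝ) (P : E3 → ℝ) : Prop where
  mu : Measurable u
  mg : Measurable g
  mP : Measurable P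
  Lu : ∫⁻ x, ‖u x‖ₑ ^ 2 < ∞
  Lg : ∫⁻ x, gn g x ^ 2 < ∞
  LP : ∫⁻ x, ‖P x‖ₑ < ∞
  u0 : ∀ x, x ∉ ball (0 : E3) 1 → u x = 0
  g0 : ∀ x, x ∉ ball (0 : E3) 1 → g x = 0
  P0 : ∀ x, x ∉ ball (0 : E3) 1 → P x = 0
  grad : ∀ ψ : E3 → ℝ, ContDiff ℝ (⊤ : ℕ∞) ψ → HasCompactSupport ψ → tsupport ψ ⊆ ball 0 1 →
    ∀ i j : Fin 3, ∫ x, u x i * pd j ψ x = - ∫ x, g x i j * ψ x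
  div : ∀ ψ : E3 → ℝ, ContDiff ℝ (⊤ : ℕ∞) ψ → HasCompactSupport ψ → tsupport ψ ⊆ ball 0 1 →
    ∫ x, ∑ i : Fin 3, u x i * pd i ψ x = 0
  press : ∀ ψ : E3 → ℝ, ContDiff ℝ (⊤ : ℕ∞) ψ → HasCompactSupport ψ → tsupport ψ ⊆ ball 0 1 →
    ∫ x, P x * lap ψ x = - ∫ x, ∑ i : Fin 3, ∑ j : Fin 3, u x i * u x j * pd j (fun y => pd i ψ y) x

theorem gn_meas {g : E3 → Fin 3 → Fin 3 → ℝ} (hg : Measurable g) : Measurable (gn g) := by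
  unfold gn
  have : ∀ i j, Measurable (fun x => g x i j) := fun i j =>
    (measurable_pi_apply j).comp ((measurable_pi_apply i).comp hg)
  fun_prop

theorem le_gn (g : E3 → Fin 3 → Fin 3 → ℝ) (x : E3) (i j : Fin 3) : ‖g x i j‖ₑ ≤ gn g x := by
  rw [← ofReal_norm]
  apply ENNReal.ofReal_le_ofReal
  apply Real.le_sqrt_of_sq_le
  rw [Real.norm_eq_abs, sq_abs]
  calc (g x i j) ^ 2 ≤ ∑ j : Fin 3, (g x i j) ^ 2 :=
        Finset.single_le_sum (f := fun j => (g x i j) ^ 2) (fun j _ => sq_nonneg _) (Finset.mem_univ j)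
    _ ≤ _ := Finset.single_le_sum (f := fun i => ∑ j : Fin 3, (g x i j) ^ 2)
        (fun i _ => Finset.sum_nonneg fun j _ => sq_nonneg _) (Finset.mem_univ i)

theorem enorm_coord_le (v : E3) (i : Fin 3) : ‖v i‖ₑ ≤ ‖v‖ₑ := by
  rw [← ofReal_norm, ← ofReal_norm]
  exact ENNReal.ofReal_le_ofReal (PiLp.norm_apply_le v i)

/-- a function of finite square integral vanishing outside the unit ball is integrable -/
theorem l1_of_l2 {f : E3 → ℝ≥0∞} (hf : Measurable f) (h2 : ∫⁻ x, f x ^ 2 < ∞)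
    (h0 : ∀ x, x ∉ ball (0 : E3) 1 → f x = 0) : ∫⁻ x, f x < ∞ := by
  have : ∀ x, f x ≤ (ball (0:E3) 1).indicator 1 x + f x ^ 2 := by
    intro x
    by_cases hx : x ∈ ball (0:E3) 1
    · simp only [indicator_of_mem hx, Pi.one_apply]
      by_cases h1 : f x ≤ 1
      · exact h1.trans (by simp)
      · have : 1 ≤ f x := (not_le.1 h1).le
        calc f x = f x * 1 := by simp
          _ ≤ f x * f x := by gcongr
          _ ≤ _ := by rw [sq]; simp
    · simp [h0 x hx]
  refine (lintegral_mono this).trans_lt ?_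
  rw [lintegral_add_right _ (by fun_prop), lintegral_indicator_one measurableSet_ball]
  exact ENNReal.add_lt_top.2 ⟨measure_ball_lt_top, h2⟩

theorem Slice.ui_int {u g P} (S : Slice u g P) (i : Fin 3) : Integrable (fun x => u x i) := by
  have m : Measurable (fun x => u x i) := by have := S.mu; fun_prop
  refine ⟨m.aestronglyMeasurable, ?_⟩
  rw [hasFiniteIntegral_iff_enorm]
  refine (lintegral_mono fun x => enorm_coord_le (u x) i).trans_lt ?_
  exact l1_of_l2 S.mu.enorm S.Lu (fun x hx => by simp [S.u0 x hx])

theorem Slice.gij_int {u g P} (S : Slice u g P) (i j : Fin 3) : Integrable (fun x => g x i j) := by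
  have m : Measurable (fun x => g x i j) := 
    (measurable_pi_apply j).comp ((measurable_pi_apply i).comp S.mg)
  refine ⟨m.aestronglyMeasurable, ?_⟩
  rw [hasFiniteIntegral_iff_enorm]
  refine (lintegral_mono fun x => le_gn g x i j).trans_lt ?_
  exact l1_of_l2 (gn_meas S.mg) S.Lg (fun x hx => by simp [gn, S.g0 x hx])

theorem Slice.P_int {u g P} (S : Slice u g P) : Integrable P :=
  ⟨S.mP.aestronglyMeasurable, by rw [hasFiniteIntegral_iff_enorm]; exact S.LP⟩

theorem Slice.uu_int {u g P} (S : Slice u g P) (i j : Fin 3) : Integrable (fun x => u x i * u x j) := by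
  have m : ∀ i, Measurable (fun x => u x i) := by have := S.mu; fun_prop
  refine ⟨((m i).mul (m j)).aestronglyMeasurable, ?_⟩
  rw [hasFiniteIntegral_iff_enorm]
  refine (lintegral_mono fun x => ?_).trans_lt S.Lu
  rw [enorm_mul, sq]
  exact mul_le_mul' (enorm_coord_le (u x) i) (enorm_coord_le (u x) j)

/-! ### Mollification at Lebesgue points -/
theorem leb {v : E3 → ℝ} (hv : Integrable v) :
    ∀ᵐ x, Tendsto (fun n : ℕ => ∫ y, v y * rho (1 / ((n:ℝ) + 1)) (y - x)) atTop (nhds (c0 * v x)) := by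
  obtain ⟨C, hC, hb, -⟩ := rho_bound
  filter_upwards [IsUnifLocDoublingMeasure.ae_tendsto_average_norm_sub (μ := (volume : Measure E3))
    hv.locallyIntegrable 1] with x hx
  have hpos : ∀ n : ℕ, (0:ℝ) < 1 / ((n:ℝ) + 1) := fun n => by positivity
  have hd : Tendsto (fun n : ℕ => 1 / ((n:ℝ) + 1)) atTop (nhdsWithin 0 (Ioi 0)) := by
    rw [tendsto_nhdsWithin_iff]
    exact ⟨tendsto_one_div_add_atTop_nhds_zero_nat, Eventually.of_forall hpos⟩
  have h1 := hx (fun _ : ℕ => x) (fun n : ℕ => 1 / ((n:ℝ) + 1)) hd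
    (Eventually.of_forall fun n => mem_closedBall_self (by rw [one_mul]; exact (hpos n).le))
  rw [tendsto_iff_norm_sub_tendsto_zero]
  set V := (volume : Measure E3).real (ball (0 : E3) 1)
  have h2 := h1.const_mul (C * V)
  rw [mul_zero] at h2
  refine squeeze_zero (fun n => norm_nonneg _) (fun n => ?_) h2
  set r := 1 / ((n:ℝ) + 1)
  have hr : 0 < r := hpos n
  have ri : Integrable (fun y => rho r (y - x)) := (rho_integrable hr).comp_sub_right x
  have rbd : ∀ z, ‖rho r z‖ ≤ C * (r^3)⁻¹ := hb r hr
  have i1 : Integrable (fun y => v y * rho r (y - x)) := by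
    have := hv.bdd_mul (c := C * (r^3)⁻¹) (f := fun y => rho r (y - x)) ri.aestronglyMeasurable
      (Eventually.of_forall fun y => rbd _)
    simpa only [mul_comm] using this
  have e1 : ∫ y, rho r (y - x) = c0 := by
    rw [integral_sub_right_eq_self (fun y => rho r y) x, rho_integral hr]
  have e2 : (∫ y, v y * rho r (y - x)) - c0 * v x = ∫ y, (v y - v x) * rho r (y - x) := by
    simp_rw [sub_mul]
    rw [integral_sub i1 (ri.const_mul _), integral_const_mul, e1, mul_comm c0]
  rw [e2]
  have il : IntegrableOn (fun y => ‖v y - v x‖) (closedBall x r) :=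
    (hv.integrableOn.sub (integrableOn_const (by exact (measure_closedBall_lt_top).ne))).norm
  calc ‖∫ y, (v y - v x) * rho r (y - x)‖ ≤ ∫ y, ‖(v y - v x) * rho r (y - x)‖ := norm_integral_le_integral_norm _
    _ = ∫ y in closedBall x r, ‖(v y - v x) * rho r (y - x)‖ := by
        rw [setIntegral_eq_integral_of_forall_compl_eq_zero]
        intro y hy
        rw [rho_zero hr]; simp
        rw [mem_closedBall, dist_eq_norm] at hy; exact (not_le.1 hy).le
    _ ≤ ∫ y in closedBall x r, C * (r^3)⁻¹ * ‖v y - v x‖ := by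
        apply integral_mono_of_nonneg
        · exact Eventually.of_forall fun y => norm_nonneg _
        · exact il.const_mul _
        · refine Eventually.of_forall fun y => ?_
          simp only [norm_mul]
          rw [mul_comm]
          gcongr; exact rbd _
    _ = C * V * ⨍ y in closedBall x r, ‖v y - v x‖ := by
        rw [integral_const_mul, setAverage_eq, measureReal_def,
          Measure.addHaar_closedBall _ _ hr.le, ENNReal.toReal_mul, smul_eq_mul]
        have : V = (volume (ball (0:E3) 1)).toReal := rfl
        rw [this]
        have hp : (0:ℝ) < (volume (ball (0:E3) 1)).toReal :=
          ENNReal.toReal_pos (measure_ball_pos _ _ one_pos).ne' measure_ball_lt_top.ne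
        rw [ENNReal.toReal_ofReal (by positivity)]
        simp only [finrank_euclideanSpace, Fintype.card_fin]
        field_simp

theorem pd_contDiff {f : E3 → ℝ} (hf : ContDiff ℝ (⊤ : ℕ∞) f) (j : Fin 3) : ContDiff ℝ (⊤ : ℕ∞) (pd j f) := by
  unfold pd
  exact (hf.fderiv_right (m := (⊤ : ℕ∞)) (by simp)).clm_apply contDiff_const

theorem pd_tsupport (f : E3 → ℝ) (j : Fin 3) : tsupport (pd j f) ⊆ tsupport f := by
  refine (closure_mono ?_).trans (tsupport_fderiv_subset ℝ)
  intro x hx hc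
  apply hx
  simp [pd, hc]

theorem pd_hcs {f : E3 → ℝ} (hf : HasCompactSupport f) (j : Fin 3) : HasCompactSupport (pd j f) :=
  hf.of_isClosed_subset (isClosed_tsupport _) (pd_tsupport f j)

theorem int_mul_cc {v k : E3 → ℝ} (hv : Integrable v) (hk : Continuous k) (hc : HasCompactSupport k) :
    Integrable (fun x => v x * k x) := by
  obtain ⟨C, hC⟩ := hc.exists_bound_of_continuous hk
  have := hv.bdd_mul (c := C) (f := k) hk.aestronglyMeasurable (Eventually.of_forall hC)
  simpa only [mul_comm] using this

theorem Psi_hcs {r h : ℝ} (hr : 0 < r) (hh : 0 < h) (hrh : r ≤ h) (x : E3) : HasCompactSupport (Psi r h x) :=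
  (isCompact_closedBall x h).of_isClosed_subset (isClosed_tsupport _) (Psi_tsupport hr hh hrh x)

theorem rho_sh_cont (r : ℝ) (x : E3) : Continuous (fun y => rho r (y - x)) :=
  (rho_contDiff r).continuous.comp (by fun_prop)

theorem rho_sh_hcs {r : ℝ} (hr : 0 < r) (x : E3) : HasCompactSupport (fun y => rho r (y - x)) :=
  (rho_hasCompactSupport hr).comp_homeomorph (Homeomorph.subRight x)

theorem repU {u g P} (S : Slice u g P) {r h : ℝ} (hr : 0 < r) (hrh : r ≤ h) {x : E3}
    (hx : closedBall x h ⊆ ball 0 1) (i : Fin 3) :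
    ∫ y, u y i * rho r (y - x) = (∫ y, u y i * rho h (y - x)) + ∑ j, ∫ y, g y i j * k1 r h j (y - x) := by
  have hh : 0 < h := hr.trans_le hrh
  have hcs := Psi_hcs hr hh hrh x
  have h1 : ∀ j, ∫ y, u y i * k2 r h j j (y - x) = - ∫ y, g y i j * k1 r h j (y - x) := by
    intro j
    have := S.grad (pd j (Psi r h x)) (pd_contDiff (Psi_contDiff r h x) j) (pd_hcs hcs j)
      (((pd_tsupport _ j).trans (Psi_tsupport hr hh hrh x)).trans hx) i j
    have e : ∀ y, pd j (pd j (Psi r h x)) y = k2 r h j j (y - x) := fun y => pd_pd_Psi hr hh x y j j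
    simp_rw [e, pd_Psi hr hh] at this
    exact this
  have h2 : ∀ j, Integrable (fun y => u y i * k2 r h j j (y - x)) := by
    intro j
    have e : (fun y => k2 r h j j (y - x)) = pd j (pd j (Psi r h x)) :=
      funext fun y => (pd_pd_Psi hr hh x y j j).symm
    have := int_mul_cc (S.ui_int i) (pd_contDiff (pd_contDiff (Psi_contDiff r h x) j) j).continuous
      (pd_hcs (pd_hcs hcs j) j)
    rw [← e] at this; exact this
  have h3 : ∀ y, ∑ j, k2 r h j j (y - x) = rho h (y - x) - rho r (y - x) := by
    intro y
    rw [← lap_Psi hr hh]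
    simp only [lap, pd_pd_Psi hr hh]
  have h4 : ∫ y, u y i * (rho h (y - x) - rho r (y - x)) = - ∑ j, ∫ y, g y i j * k1 r h j (y - x) := by
    simp_rw [← h3, Finset.mul_sum]
    rw [integral_finsetSum _ (fun j _ => h2 j), ← Finset.sum_neg_distrib]
    exact Finset.sum_congr rfl fun j _ => h1 j
  simp_rw [mul_sub] at h4
  rw [integral_sub (int_mul_cc (S.ui_int i) (rho_sh_cont h x) (rho_sh_hcs hh x))
    (int_mul_cc (S.ui_int i) (rho_sh_cont r x) (rho_sh_hcs hr x))] at h4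
  linarith

theorem integral_pd_zero {f : E3 → ℝ} (hf : ContDiff ℝ (⊤ : ℕ∞) f) (hc : HasCompactSupport f) (j : Fin 3) :
    ∫ x, pd j f x = 0 := by
  have hp : Integrable (pd j f) := (pd_contDiff hf j).continuous.integrable_of_hasCompactSupport (pd_hcs hc j)
  have hp0 : Integrable f := hf.continuous.integrable_of_hasCompactSupport hc
  have := integral_mul_fderiv_eq_neg_fderiv_mul_of_integrable (μ := (volume : Measure E3)) (𝕜 := ℝ)
    (f := fun _ : E3 => (1:ℝ)) (g := f) (v := EuclideanSpace.single j 1) (by simp) (by simpa using! hp)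
    (by simpa using hp0) (fun x _ => by fun_prop) (fun x _ => hf.differentiable (by simp) x)
  simpa using! this

theorem repP {u g P} (S : Slice u g P) {r h : ℝ} (hr : 0 < r) (hrh : r ≤ h) {x : E3}
    (hx : closedBall x h ⊆ ball 0 1) (F : Fin 3 → Fin 3 → ℝ) :
    ∫ y, P y * rho r (y - x) = (∫ y, P y * rho h (y - x)) +
      ∑ i, ∑ j, ∫ y, (u y i * u y j - F i j) * k2 r h i j (y - x) := by
  have hh : 0 < h := hr.trans_le hrh
  have hcs := Psi_hcs hr hh hrh x
  have h1 := S.press (Psi r h x) (Psi_contDiff r h x) hcs ((Psi_tsupport hr hh hrh x).trans hx)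
  simp_rw [lap_Psi hr hh, pd_pd_Psi hr hh] at h1
  have e : ∀ i j, (fun y => k2 r h i j (y - x)) = pd j (pd i (Psi r h x)) := fun i j => 
      funext fun y => (pd_pd_Psi hr hh x y i j).symm
  have cd : ∀ i j, Continuous (fun y => k2 r h i j (y - x)) := fun i j => by
    rw [e]; exact (pd_contDiff (pd_contDiff (Psi_contDiff r h x) i) j).continuous
  have cs : ∀ i j, HasCompactSupport (fun y => k2 r h i j (y - x)) := fun i j => by
    rw [e]; exact pd_hcs (pd_hcs hcs i) j
  have h2 : ∀ i j, Integrable (fun y => u y i * u y j * k2 r h i j (y - x)) := fun i j =>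
    int_mul_cc (S.uu_int i j) (cd i j) (cs i j)
  have h0 : ∀ i j, ∫ y, k2 r h i j (y - x) = 0 := by
    intro i j
    have := integral_pd_zero (pd_contDiff (Psi_contDiff r h x) i) (pd_hcs hcs i) j
    rw [← e] at this; exact this
  have h3 : ∀ i j, ∫ y, (u y i * u y j - F i j) * k2 r h i j (y - x) = ∫ y, u y i * u y j * k2 r h i j (y - x) := by
    intro i j
    simp_rw [sub_mul]
    rw [integral_sub (h2 i j) (((cd i j).integrable_of_hasCompactSupport (cs i j)).const_mul _),
      integral_const_mul, h0]; simp
  simp_rw [h3]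
  rw [integral_finsetSum _ (fun i _ => integrable_finsetSum _ fun j _ => h2 i j)] at h1
  simp_rw [integral_finsetSum _ (fun j _ => h2 _ j)] at h1
  simp_rw [mul_sub] at h1
  rw [integral_sub (int_mul_cc S.P_int (rho_sh_cont h x) (rho_sh_hcs hh x))
    (int_mul_cc S.P_int (rho_sh_cont r x) (rho_sh_hcs hr x))] at h1
  linarith

/-! ### Hölder estimate of the kernel k1 -/
theorem clm_norm_le (L : E3 →L[ℝ] ℝ) : ‖L‖ ≤ ∑ j : Fin 3, |L (EuclideanSpace.single j 1)| := by
  refine L.opNorm_le_bound (Finset.sum_nonneg fun _ _ => abs_nonneg _) fun v => ?_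
  have e : v = ∑ j : Fin 3, v j • (EuclideanSpace.single j (1:ℝ) : E3) := by
    ext i; fin_cases i <;> simp [Fin.sum_univ_three]
  conv_lhs => rw [e]
  rw [map_sum, Finset.sum_mul]
  refine (norm_sum_le _ _).trans (Finset.sum_le_sum fun j _ => ?_)
  rw [map_smul, norm_smul, mul_comm, Real.norm_eq_abs]
  gcongr; exact PiLp.norm_apply_le v j

theorem k1_holder_real {κ : ℝ} (hκ : 0 < κ) (hκ1 : κ ≤ 1) : ∃ C, 0 < C ∧ ∀ (r h : ℝ), 0 < r → 0 < h → ∀ (i : Fin 3) (z z' : E3),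
    z ≠ 0 → z' ≠ 0 → |k1 r h i z - k1 r h i z'| ≤ C * ‖z - z'‖ ^ κ * (‖z‖ ^ (-(2 + κ)) + ‖z'‖ ^ (-(2 + κ))) := by
  obtain ⟨C, hC, hb⟩ := k2_bound
  refine ⟨24 * C + 36, by positivity, fun r h hr hh i z z' hz hz' => ?_⟩
  have pz : 0 < ‖z‖ := norm_pos_iff.2 hz
  have pz' : 0 < ‖z'‖ := norm_pos_iff.2 hz'
  set d := ‖z - z'‖ with hd
  have d0 : 0 ≤ d := norm_nonneg _
  have split : ∀ a : ℝ, 0 < a → a ^ (-(2 + κ)) = (a ^ 2)⁻¹ * (a ^ κ)⁻¹ := fun a ha => by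
    rw [Real.rpow_neg ha.le, Real.rpow_add ha, mul_inv]; simp
  by_cases hcase : d ≤ ‖z‖ / 2
  · have hmv : ‖k1 r h i z' - k1 r h i z‖ ≤ (3 * C * ((‖z‖ / 2) ^ 3)⁻¹) * ‖z' - z‖ := by
      refine Convex.norm_image_sub_le_of_norm_hasFDerivWithin_le (s := closedBall z (‖z‖ / 2))
        (f' := fun w => fderiv ℝ (k1 r h i) w) (𝕜 := ℝ) ?_ ?_ (convex_closedBall _ _)
        (mem_closedBall_self (by positivity)) (by rw [mem_closedBall, dist_comm, dist_eq_norm]; exact hcase)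
      · intro w _
        have e : k1 r h i = pd i (Psi r h 0) := funext fun y => by rw [pd_Psi hr hh]; simp
        rw [e]
        exact ((pd_contDiff (Psi_contDiff r h 0) i).differentiable (by simp) w).hasFDerivAt.hasFDerivWithinAt
      · intro w hw
        rw [mem_closedBall, dist_eq_norm] at hw
        have hw2 : ‖z‖ / 2 ≤ ‖w‖ := by
          have := norm_sub_norm_le z w
          rw [norm_sub_rev] at hw; linarith
        have hw0 : w ≠ 0 := by rintro rfl; simp at hw2; linarith
        refine (clm_norm_le _).trans ?_
        have : ∀ j : Fin 3, |fderiv ℝ (k1 r h i) w (EuclideanSpace.single j 1)| ≤ C * ((‖z‖ / 2) ^ 3)⁻¹ := by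
          intro j
          have e : k1 r h i = fun w => pd i (Psi r h 0) w := funext fun y => by rw [pd_Psi hr hh]; simp
          have e2 := pd_pd_Psi hr hh 0 w i j
          rw [← e, sub_zero] at e2
          have e3 : fderiv ℝ (k1 r h i) w (EuclideanSpace.single j 1) = k2 r h i j w := e2
          rw [e3]
          refine (hb r h hr hh i j w hw0).trans ?_
          gcongr
        refine (Finset.sum_le_sum fun j _ => this j).trans (le_of_eq ?_)
        simp; ring
    rw [abs_sub_comm, ← Real.norm_eq_abs]
    refine hmv.trans ?_
    rw [norm_sub_rev, ← hd]
    have h1 : d ≤ d ^ κ * ‖z‖ * (‖z‖ ^ κ)⁻¹ := by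
      rcases d0.eq_or_lt with h0 | h0
      · rw [← h0]; positivity
      · have e : d = d ^ κ * d ^ (1 - κ) := by rw [← Real.rpow_add h0]; simp
        have e2 : ‖z‖ * (‖z‖ ^ κ)⁻¹ = ‖z‖ ^ (1 - κ) := by
          rw [Real.rpow_sub pz, Real.rpow_one]; rfl
        rw [mul_assoc, e2]
        conv_lhs => rw [e]
        gcongr
        linarith
    calc 3 * C * ((‖z‖ / 2) ^ 3)⁻¹ * d ≤ 3 * C * ((‖z‖ / 2) ^ 3)⁻¹ * (d ^ κ * ‖z‖ * (‖z‖ ^ κ)⁻¹) := by gcongr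
      _ = 24 * C * d ^ κ * ((‖z‖ ^ 2)⁻¹ * (‖z‖ ^ κ)⁻¹) := by field_simp; ring
      _ = 24 * C * d ^ κ * ‖z‖ ^ (-(2 + κ)) := by rw [split _ pz]
      _ ≤ _ := by
        gcongr
        · linarith
        · have : 0 ≤ ‖z'‖ ^ (-(2 + κ)) := by positivity
          linarith
  · push Not at hcase
    have hz3 : ‖z'‖ ≤ 3 * d := by
      have := norm_sub_norm_le z' z
      rw [norm_sub_rev] at this; linarith
    have gen : ∀ w : E3, w ≠ 0 → ‖w‖ ≤ 3 * d → |k1 r h i w| ≤ 36 * d ^ κ * ‖w‖ ^ (-(2 + κ)) := by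
      intro w hw hle
      have pw : 0 < ‖w‖ := norm_pos_iff.2 hw
      refine (k1_bound hr hh i w).trans ?_
      rw [split _ pw]
      have : ‖w‖ ^ κ ≤ 9 * d ^ κ := by
        calc ‖w‖ ^ κ ≤ (3 * d) ^ κ := by gcongr
          _ = 3 ^ κ * d ^ κ := by rw [Real.mul_rpow (by norm_num) d0]
          _ ≤ 3 ^ (1:ℝ) * d ^ κ := by gcongr; norm_num
          _ ≤ _ := by gcongr; norm_num
      calc 4 * (‖w‖ ^ 2)⁻¹ = 4 * ‖w‖ ^ κ * ((‖w‖ ^ 2)⁻¹ * (‖w‖ ^ κ)⁻¹) := by field_simp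
        _ ≤ 4 * (9 * d ^ κ) * ((‖w‖ ^ 2)⁻¹ * (‖w‖ ^ κ)⁻¹) := by gcongr
        _ = _ := by ring
    calc |k1 r h i z - k1 r h i z'| ≤ |k1 r h i z| + |k1 r h i z'| := abs_sub _ _
      _ ≤ 36 * d ^ κ * ‖z‖ ^ (-(2 + κ)) + 36 * d ^ κ * ‖z'‖ ^ (-(2 + κ)) :=
        add_le_add (gen z hz (by linarith)) (gen z' hz' hz3)
      _ = 36 * d ^ κ * (‖z‖ ^ (-(2 + κ)) + ‖z'‖ ^ (-(2 + κ))) := by ring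
      _ ≤ _ := by gcongr; linarith

theorem k1_holder {κ : ℝ} (hκ : 0 < κ) (hκ1 : κ ≤ 1) : ∃ C : ℝ≥0∞, C ≠ ∞ ∧ ∀ (r h : ℝ), 0 < r → r ≤ h → ∀ (i : Fin 3) (z z' : E3),
    ‖k1 r h i z - k1 r h i z'‖ₑ ≤ C * ‖z - z'‖ₑ ^ κ * (kn (2 + κ) h z + kn (2 + κ) h z') := by
  obtain ⟨C, hC, hb⟩ := k1_holder_real hκ hκ1
  refine ⟨ENNReal.ofReal (2 * C), ENNReal.ofReal_ne_top, fun r h hr hrh i z z' => ?_⟩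
  have hh : 0 < h := hr.trans_le hrh
  by_cases hzz : z = z'
  · subst hzz; simp
  have hd : 0 < ‖z - z'‖ := norm_pos_iff.2 (sub_ne_zero.2 hzz)
  have hd1 : ENNReal.ofReal (2 * C) * ‖z - z'‖ₑ ^ κ ≠ 0 := by
    apply mul_ne_zero
    · simp [hC]
    · rw [← ofReal_norm, ENNReal.ofReal_rpow_of_pos hd]
      simp only [ne_eq, ENNReal.ofReal_eq_zero, not_le]; positivity
  have top : ∀ w : E3, w = 0 → kn (2 + κ) h w = ∞ := by
    rintro w rfl
    have : -(2 + κ) < 0 := by linarith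
    simp [kn, hh, ENNReal.zero_rpow_of_neg this, -neg_add_rev]
  by_cases hz : z = 0
  · rw [top z hz, top_add, ENNReal.mul_top hd1]; exact le_top
  by_cases hz' : z' = 0
  · rw [top z' hz', add_top, ENNReal.mul_top hd1]; exact le_top
  have pz : 0 < ‖z‖ := norm_pos_iff.2 hz
  have pz' : 0 < ‖z'‖ := norm_pos_iff.2 hz'
  have main := hb r h hr hh i z z' hz hz'
  have knv : ∀ w : E3, w ≠ 0 → ‖w‖ < h → kn (2 + κ) h w = ENNReal.ofReal (‖w‖ ^ (-(2 + κ))) := by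
    intro w hw hwh
    rw [kn, if_pos hwh, ← ofReal_norm, ENNReal.ofReal_rpow_of_pos (norm_pos_iff.2 hw)]
  have fin : ∀ (a : ℝ), |k1 r h i z - k1 r h i z'| ≤ C * ‖z - z'‖ ^ κ * (2 * a) → 0 ≤ a →
      ENNReal.ofReal a ≤ kn (2 + κ) h z + kn (2 + κ) h z' →
      ‖k1 r h i z - k1 r h i z'‖ₑ ≤ ENNReal.ofReal (2 * C) * ‖z - z'‖ₑ ^ κ * (kn (2 + κ) h z + kn (2 + κ) h z') := by
    intro a ha ha0 hk
    refine le_trans ?_ (mul_le_mul_right hk _)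
    rw [← ofReal_norm, ← ofReal_norm (z - z'), ENNReal.ofReal_rpow_of_pos hd, ← ENNReal.ofReal_mul (by positivity),
      ← ENNReal.ofReal_mul (by positivity)]
    apply ENNReal.ofReal_le_ofReal
    rw [Real.norm_eq_abs]; linarith
  have anti : ∀ a b : ℝ, 0 < a → a ≤ b → b ^ (-(2 + κ)) ≤ a ^ (-(2 + κ)) := fun a b ha hab =>
    Real.rpow_le_rpow_of_nonpos ha hab (by linarith)
  by_cases c1 : ‖z‖ < h
  · by_cases c2 : ‖z'‖ < h
    · refine fin (‖z‖ ^ (-(2 + κ)) + ‖z'‖ ^ (-(2 + κ))) (main.trans ?_) (by positivity) ?_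
      · gcongr
        have : 0 ≤ ‖z‖ ^ (-(2 + κ)) + ‖z'‖ ^ (-(2 + κ)) := by positivity
        linarith
      · rw [knv z hz c1, knv z' hz' c2, ENNReal.ofReal_add (by positivity) (by positivity)]
    · refine fin (‖z‖ ^ (-(2 + κ))) (main.trans ?_) (by positivity) (by rw [knv z hz c1]; simp)
      gcongr
      have := anti ‖z‖ ‖z'‖ pz (by linarith)
      linarith
  · by_cases c2 : ‖z'‖ < h
    · refine fin (‖z'‖ ^ (-(2 + κ))) (main.trans ?_) (by positivity) (by rw [knv z' hz' c2]; simp)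
      gcongr
      have := anti ‖z'‖ ‖z‖ pz' (by linarith)
      linarith
    · rw [k1_zero hr hh hrh i (not_lt.1 c1), k1_zero hr hh hrh i (not_lt.1 c2)]; simp

theorem enorm_le_sum (v : E3) : ‖v‖ₑ ≤ ∑ i : Fin 3, ‖v i‖ₑ := by
  have e : v = ∑ j : Fin 3, v j • (EuclideanSpace.single j (1:ℝ) : E3) := by
    ext i; fin_cases i <;> simp [Fin.sum_univ_three]
  conv_lhs => rw [e]
  refine (enorm_sum_le _ _).trans (Finset.sum_le_sum fun i _ => ?_)
  rw [enorm_smul]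
  have : ‖(EuclideanSpace.single i (1:ℝ) : E3)‖ₑ = 1 := by rw [← ofReal_norm]; simp
  rw [this, mul_one]

theorem kn_zero_of_lt {h : ℝ} {z : E3} (hz : ‖z‖ < h) : kn 0 h z = 1 := by simp [kn, hz]
theorem kn_of_le {a h : ℝ} {z : E3} (hz : h ≤ ‖z‖) : kn a h z = 0 := if_neg (not_lt.2 hz)

theorem rho_kn : ∃ C : ℝ≥0∞, C ≠ ∞ ∧ ∀ h : ℝ, 0 < h → ∀ z, ‖rho h z‖ₑ ≤ C * ENNReal.ofReal h ^ (-3 : ℝ) * kn 0 h z := by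
  obtain ⟨C, hC, hb, -⟩ := rho_bound
  refine ⟨ENNReal.ofReal C, ENNReal.ofReal_ne_top, fun h hh z => ?_⟩
  by_cases hz : ‖z‖ < h
  · rw [kn_zero_of_lt hz, mul_one, ENNReal.ofReal_rpow_of_pos hh, ← ENNReal.ofReal_mul hC.le, ← ofReal_norm]
    apply ENNReal.ofReal_le_ofReal
    refine (hb h hh z).trans (le_of_eq ?_)
    rw [Real.rpow_neg hh.le]; norm_cast
  · rw [rho_zero hh (not_lt.1 hz)]; simp

theorem rho_holder {κ : ℝ} (hκ : 0 < κ) (hκ1 : κ ≤ 1) : ∃ C : ℝ≥0∞, C ≠ ∞ ∧ ∀ h : ℝ, 0 < h → ∀ z z',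
    ‖rho h z - rho h z'‖ₑ ≤ C * (‖z - z'‖ₑ ^ κ * ENNReal.ofReal h ^ (-(3 + κ))) * (kn 0 h z + kn 0 h z') := by
  obtain ⟨C, hC, hb, hl⟩ := rho_bound
  refine ⟨ENNReal.ofReal (2 * C), ENNReal.ofReal_ne_top, fun h hh z z' => ?_⟩
  by_cases hzz : z = z'
  · subst hzz; simp
  have hd : 0 < ‖z - z'‖ := norm_pos_iff.2 (sub_ne_zero.2 hzz)
  have main : ‖rho h z - rho h z'‖ₑ ≤ ENNReal.ofReal (2 * C) * (‖z - z'‖ₑ ^ κ * ENNReal.ofReal h ^ (-(3 + κ))) := by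
    rw [← ofReal_norm, ← ofReal_norm (z - z'), ENNReal.ofReal_rpow_of_pos hd, ENNReal.ofReal_rpow_of_pos hh,
      ← ENNReal.ofReal_mul (by positivity), ← ENNReal.ofReal_mul (by positivity)]
    apply ENNReal.ofReal_le_ofReal
    have e : h ^ (-(3 + κ)) = (h ^ 3)⁻¹ * (h ^ κ)⁻¹ := by
      rw [Real.rpow_neg hh.le, Real.rpow_add hh, mul_inv]; norm_cast
    rw [e, Real.norm_eq_abs]
    set d := ‖z - z'‖
    by_cases hdh : d ≤ h
    · refine (hl h hh z z').trans ?_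
      have h1 : d ≤ h * (d ^ κ * (h ^ κ)⁻¹) := by
        have e1 : d = d ^ κ * d ^ (1 - κ) := by rw [← Real.rpow_add hd]; simp
        have e2 : h * (h ^ κ)⁻¹ = h ^ (1 - κ) := by rw [Real.rpow_sub hh, Real.rpow_one]; rfl
        calc d = d ^ κ * d ^ (1 - κ) := e1
          _ ≤ d ^ κ * h ^ (1 - κ) := by gcongr
          _ = _ := by rw [← e2]; ring
      calc C * (h ^ 4)⁻¹ * d ≤ C * (h ^ 4)⁻¹ * (h * (d ^ κ * (h ^ κ)⁻¹)) := by gcongr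
        _ = C * (d ^ κ * ((h ^ 3)⁻¹ * (h ^ κ)⁻¹)) := by field_simp
        _ ≤ _ := by gcongr; linarith
    · have h1 : 1 ≤ d ^ κ * (h ^ κ)⁻¹ := by
        rw [← div_eq_mul_inv, one_le_div (by positivity)]
        gcongr; linarith
      calc |rho h z - rho h z'| ≤ |rho h z| + |rho h z'| := abs_sub _ _
        _ ≤ C * (h ^ 3)⁻¹ + C * (h ^ 3)⁻¹ := add_le_add (hb h hh z) (hb h hh z')
        _ = 2 * C * (h ^ 3)⁻¹ * 1 := by ring
        _ ≤ 2 * C * (h ^ 3)⁻¹ * (d ^ κ * (h ^ κ)⁻¹) := by gcongr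
        _ = _ := by ring
  by_cases c1 : ‖z‖ < h
  · rw [kn_zero_of_lt c1]
    exact main.trans (le_mul_of_one_le_right bot_le (by simp))
  · by_cases c2 : ‖z'‖ < h
    · rw [kn_zero_of_lt c2]
      exact main.trans (le_mul_of_one_le_right bot_le (by simp))
    · rw [rho_zero hh (not_lt.1 c1), rho_zero hh (not_lt.1 c2)]; simp

theorem enorm_int_mul_le (v k : E3 → ℝ) : ‖∫ y, v y * k y‖ₑ ≤ ∫⁻ y, ‖v y‖ₑ * ‖k y‖ₑ := by
  refine (enorm_integral_le_lintegral_enorm _).trans (le_of_eq ?_)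
  simp_rw [enorm_mul]

def Phi (κ h : ℝ) (G U : E3 → ℝ≥0∞) (x : E3) : ℝ≥0∞ :=
  (∫⁻ y, G y * kn (2 + κ) h (y - x)) + ENNReal.ofReal h ^ (-(3 + κ)) * ∫⁻ y, U y * kn 0 h (y - x)

/-- Lebesgue points -/
def LebPt (v : E3 → ℝ) (x : E3) : Prop :=
  Tendsto (fun n : ℕ => ∫ y, v y * rho (1 / ((n:ℝ) + 1)) (y - x)) atTop (nhds (c0 * v x))

theorem ev_small {h : ℝ} (hh : 0 < h) : ∀ᶠ n : ℕ in atTop, 1 / ((n:ℝ) + 1) ≤ h :=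
  (tendsto_one_div_add_atTop_nhds_zero_nat.eventually_lt_const hh).mono fun _ h => h.le

theorem kn_sh_meas (a h : ℝ) (x : E3) : Measurable (fun y : E3 => kn a h (y - x)) :=
  (kn_measurable a h).comp (measurable_id.sub_const x)

theorem hold1 {κ : ℝ} (hκ : 0 < κ) : ∃ C : ℝ≥0∞, C ≠ ∞ ∧ ∀ u g P, Slice u g P →
    ∀ (h : ℝ) (x : E3), 0 < h → closedBall x h ⊆ ball 0 1 → (∀ i : Fin 3, LebPt (fun y => u y i) x) →
    ‖u x‖ₑ ≤ C * ENNReal.ofReal h ^ κ * Phi κ h (gn g) (fun y => ‖u y‖ₑ) x := by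
  obtain ⟨C, hC, hb⟩ := rho_kn
  refine ⟨3 * (ENNReal.ofReal c0)⁻¹ * (C + 12), ?_, fun u g P S h x hh hx hL => ?_⟩
  · have := c0_pos; finiteness [show ENNReal.ofReal c0 ≠ 0 by simpa using c0_pos]
  have hh0 : ENNReal.ofReal h ≠ 0 := by simp [hh]
  have c00 : ENNReal.ofReal c0 ≠ 0 := by simpa using c0_pos
  set Φ := Phi κ h (gn g) (fun y => ‖u y‖ₑ) x with hΦ
  set D := ENNReal.ofReal h ^ κ * Φ with hD
  have fin : ∀ a : ℝ, ENNReal.ofReal h ^ a ≠ ∞ := fun a => ENNReal.rpow_ne_top_of_ne_zero hh0 (by simp)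
  have b1 : ∀ i, ‖∫ y, u y i * rho h (y - x)‖ₑ ≤ C * D := by
    intro i
    refine (enorm_int_mul_le _ _).trans ?_
    calc ∫⁻ y, ‖u y i‖ₑ * ‖rho h (y - x)‖ₑ ≤ ∫⁻ y, C * ENNReal.ofReal h ^ (-3 : ℝ) * (‖u y‖ₑ * kn 0 h (y - x)) := by
          refine lintegral_mono fun y => ?_
          calc _ ≤ ‖u y‖ₑ * (C * ENNReal.ofReal h ^ (-3 : ℝ) * kn 0 h (y - x)) :=
                mul_le_mul' (enorm_coord_le _ i) (hb h hh _)
            _ = _ := by ring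
      _ = C * (ENNReal.ofReal h ^ κ * (ENNReal.ofReal h ^ (-(3 + κ)) * ∫⁻ y, ‖u y‖ₑ * kn 0 h (y - x))) := by
          rw [lintegral_const_mul' _ _ (ENNReal.mul_ne_top hC (fin _)), ← mul_assoc (ENNReal.ofReal h ^ κ),
            ← ENNReal.rpow_add _ _ hh0 (by simp), show κ + -(3 + κ) = -3 by ring, mul_assoc]
      _ ≤ _ := by rw [hD, hΦ, Phi]; gcongr; exact le_add_self
  have b2 : ∀ r, 0 < r → r ≤ h → ∀ i j, ‖∫ y, g y i j * k1 r h j (y - x)‖ₑ ≤ 4 * D := by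
    intro r hr hrh i j
    refine (enorm_int_mul_le _ _).trans ?_
    have p : ∀ z : E3, ‖k1 r h j z‖ₑ ≤ 4 * ENNReal.ofReal h ^ κ * kn (2 + κ) h z := by
      intro z
      by_cases hz : ‖z‖ < h
      · by_cases hz0 : z = 0
        · subst hz0; simp [k1]
        have pz : 0 < ‖z‖ := norm_pos_iff.2 hz0
        rw [kn, if_pos hz, ← ofReal_norm, ← ofReal_norm z, ENNReal.ofReal_rpow_of_pos pz, ENNReal.ofReal_rpow_of_pos hh,
          show (4 : ℝ≥0∞) = ENNReal.ofReal 4 by simp,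
          ← ENNReal.ofReal_mul (by positivity), ← ENNReal.ofReal_mul (by positivity)]
        apply ENNReal.ofReal_le_ofReal
        refine (k1_bound hr hh j z).trans ?_
        rw [Real.rpow_neg pz.le, Real.rpow_add pz, mul_inv]
        have : 1 ≤ h ^ κ * (‖z‖ ^ κ)⁻¹ := by
          rw [← div_eq_mul_inv, one_le_div (by positivity)]; gcongr
        calc 4 * (‖z‖ ^ 2)⁻¹ ≤ 4 * (‖z‖ ^ 2)⁻¹ * (h ^ κ * (‖z‖ ^ κ)⁻¹) := le_mul_of_one_le_right (by positivity) this
          _ = _ := by rw [← Real.rpow_natCast]; push_cast; ring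
      · rw [k1_zero hr hh hrh j (not_lt.1 hz)]; simp
    calc ∫⁻ y, ‖g y i j‖ₑ * ‖k1 r h j (y - x)‖ₑ ≤ ∫⁻ y, 4 * ENNReal.ofReal h ^ κ * (gn g y * kn (2 + κ) h (y - x)) := by
          refine lintegral_mono fun y => ?_
          calc _ ≤ gn g y * (4 * ENNReal.ofReal h ^ κ * kn (2 + κ) h (y - x)) :=
                mul_le_mul' (le_gn g y i j) (p _)
            _ = _ := by ring
      _ = 4 * (ENNReal.ofReal h ^ κ * ∫⁻ y, gn g y * kn (2 + κ) h (y - x)) := by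
          rw [lintegral_const_mul' _ _ (ENNReal.mul_ne_top (by simp) (fin _)), mul_assoc]
      _ ≤ _ := by rw [hD, hΦ, Phi]; gcongr; exact le_self_add
  have key : ∀ i, ENNReal.ofReal c0 * ‖u x i‖ₑ ≤ (C + 12) * D := by
    intro i
    have t := (hL i).enorm
    have e : ‖c0 * u x i‖ₑ = ENNReal.ofReal c0 * ‖u x i‖ₑ := by
      rw [enorm_mul, Real.enorm_of_nonneg c0_pos.le]
    rw [← e]
    refine le_of_tendsto t ((ev_small hh).mono fun n hn => ?_)
    rw [repU S (by positivity) hn hx i]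
    refine (enorm_add_le _ _).trans ?_
    rw [add_mul]
    refine add_le_add (b1 i) ((enorm_sum_le _ _).trans ?_)
    refine (Finset.sum_le_sum fun j _ => b2 _ (by positivity) hn i j).trans (le_of_eq ?_)
    simp; rw [← mul_assoc]; norm_num
  have key2 : ∀ i, ‖u x i‖ₑ ≤ (ENNReal.ofReal c0)⁻¹ * ((C + 12) * D) := by
    intro i
    rw [← ENNReal.div_eq_inv_mul, ENNReal.le_div_iff_mul_le (Or.inl c00) (Or.inl (by simp)), mul_comm]
    exact key i
  refine (enorm_le_sum _).trans ((Finset.sum_le_sum fun i _ => key2 i).trans (le_of_eq ?_))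
  simp only [Finset.sum_const, Finset.card_univ, Fintype.card_fin, nsmul_eq_mul]
  push_cast
  rw [hD]; ring

theorem hold2 {κ : ℝ} (hκ : 0 < κ) (hκ1 : κ ≤ 1) : ∃ C : ℝ≥0∞, C ≠ ∞ ∧ ∀ u g P, Slice u g P →
    ∀ (h : ℝ) (x x' : E3), 0 < h → closedBall x h ⊆ ball 0 1 → closedBall x' h ⊆ ball 0 1 →
    (∀ i : Fin 3, LebPt (fun y => u y i) x) → (∀ i : Fin 3, LebPt (fun y => u y i) x') →
    ‖u x - u x'‖ₑ ≤ C * ‖x - x'‖ₑ ^ κ * (Phi κ h (gn g) (fun y => ‖u y‖ₑ) x + Phi κ h (gn g) (fun y => ‖u y‖ₑ) x') := by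
  obtain ⟨C, hC, hb⟩ := rho_holder hκ hκ1
  obtain ⟨C', hC', hb'⟩ := k1_holder hκ hκ1
  refine ⟨3 * (ENNReal.ofReal c0)⁻¹ * (C + 3 * C'), ?_, fun u g P S h x x' hh hx hx' hL hL' => ?_⟩
  · have := c0_pos; finiteness [show ENNReal.ofReal c0 ≠ 0 by simpa using c0_pos]
  have hh0 : ENNReal.ofReal h ≠ 0 := by simp [hh]
  have c00 : ENNReal.ofReal c0 ≠ 0 := by simpa using c0_pos
  set Φ := Phi κ h (gn g) (fun y => ‖u y‖ₑ) x with hΦ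
  set Φ' := Phi κ h (gn g) (fun y => ‖u y‖ₑ) x' with hΦ'
  set dk := ‖x - x'‖ₑ ^ κ with hdk
  have dkf : dk ≠ ∞ := by rw [hdk]; simp [hκ.le]
  set D := dk * (Φ + Φ') with hD
  have fin : ∀ a : ℝ, ENNReal.ofReal h ^ a ≠ ∞ := fun a => ENNReal.rpow_ne_top_of_ne_zero hh0 (by simp)
  have ed : ∀ y : E3, ‖(y - x) - (y - x')‖ₑ = ‖x - x'‖ₑ := fun y => by
    have : (y - x) - (y - x') = -(x - x') := by abel
    rw [this, enorm_neg]
  have um := S.mu.enorm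
  have gm := gn_meas S.mg
  have b1 : ∀ i, ‖∫ y, u y i * (rho h (y - x) - rho h (y - x'))‖ₑ ≤ C * D := by
    intro i
    refine (enorm_int_mul_le _ _).trans ?_
    calc ∫⁻ y, ‖u y i‖ₑ * ‖rho h (y - x) - rho h (y - x')‖ₑ
          ≤ ∫⁻ y, C * (dk * ENNReal.ofReal h ^ (-(3 + κ))) * (‖u y‖ₑ * kn 0 h (y - x) + ‖u y‖ₑ * kn 0 h (y - x')) := by
          refine lintegral_mono fun y => ?_
          have := hb h hh (y - x) (y - x')
          rw [ed] at this
          calc _ ≤ ‖u y‖ₑ * (C * (dk * ENNReal.ofReal h ^ (-(3 + κ))) * (kn 0 h (y - x) + kn 0 h (y - x'))) :=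
                mul_le_mul' (enorm_coord_le _ i) this
            _ = _ := by ring
      _ = C * (dk * (ENNReal.ofReal h ^ (-(3 + κ)) * (∫⁻ y, ‖u y‖ₑ * kn 0 h (y - x)) + 
            ENNReal.ofReal h ^ (-(3 + κ)) * (∫⁻ y, ‖u y‖ₑ * kn 0 h (y - x')))) := by
          rw [lintegral_const_mul' _ _ (ENNReal.mul_ne_top hC (ENNReal.mul_ne_top dkf (fin _))),
            lintegral_add_left (f := fun y => ‖u y‖ₑ * kn 0 h (y - x)) (um.mul (kn_sh_meas _ _ _))]
          ring
      _ ≤ _ := by rw [hD, hΦ, hΦ', Phi, Phi]; gcongr <;> exact le_add_self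
  have b2 : ∀ r, 0 < r → r ≤ h → ∀ i j, ‖∫ y, g y i j * (k1 r h j (y - x) - k1 r h j (y - x'))‖ₑ ≤ C' * D := by
    intro r hr hrh i j
    refine (enorm_int_mul_le _ _).trans ?_
    calc ∫⁻ y, ‖g y i j‖ₑ * ‖k1 r h j (y - x) - k1 r h j (y - x')‖ₑ 
          ≤ ∫⁻ y, C' * dk * (gn g y * kn (2 + κ) h (y - x) + gn g y * kn (2 + κ) h (y - x')) := by
          refine lintegral_mono fun y => ?_
          have := hb' r h hr hrh j (y - x) (y - x')
          rw [ed] at this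
          calc _ ≤ gn g y * (C' * dk * (kn (2 + κ) h (y - x) + kn (2 + κ) h (y - x'))) :=
                mul_le_mul' (le_gn g y i j) this
            _ = _ := by ring
      _ = C' * (dk * ((∫⁻ y, gn g y * kn (2 + κ) h (y - x)) + ∫⁻ y, gn g y * kn (2 + κ) h (y - x'))) := by
          rw [lintegral_const_mul' _ _ (ENNReal.mul_ne_top hC' dkf), 
            lintegral_add_left (f := fun y => gn g y * kn (2 + κ) h (y - x)) (gm.mul (kn_sh_meas _ _ _)), mul_assoc]
      _ ≤ _ := by rw [hD, hΦ, hΦ', Phi, Phi]; gcongr <;> exact le_self_add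
  have k1c : ∀ r, 0 < r → r ≤ h → ∀ i j (x : E3), Integrable (fun y => g y i j * k1 r h j (y - x)) := by
    intro r hr hrh i j x
    have e : (fun y => k1 r h j (y - x)) = pd j (Psi r h x) := funext fun y => (pd_Psi hr hh x y j).symm
    have := int_mul_cc (S.gij_int i j) (pd_contDiff (Psi_contDiff r h x) j).continuous (pd_hcs (Psi_hcs hr hh hrh x) j)
    rw [← e] at this; exact this
  have key : ∀ i, ENNReal.ofReal c0 * ‖u x i - u x' i‖ₑ ≤ (C + 3 * C') * D := by
    intro i
    have t := ((hL i).sub (hL' i)).enorm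
    have e : ‖c0 * u x i - c0 * u x' i‖ₑ = ENNReal.ofReal c0 * ‖u x i - u x' i‖ₑ := by
      rw [← mul_sub, enorm_mul, Real.enorm_of_nonneg c0_pos.le]
    rw [← e]
    refine le_of_tendsto t ((ev_small hh).mono fun n hn => ?_)
    have hr : (0:ℝ) < 1 / ((n:ℝ) + 1) := by positivity
    rw [repU S hr hn hx i, repU S hr hn hx' i, add_sub_add_comm, ← Finset.sum_sub_distrib,
      ← integral_sub (int_mul_cc (S.ui_int i) (rho_sh_cont h x) (rho_sh_hcs hh x))
        (int_mul_cc (S.ui_int i) (rho_sh_cont h x') (rho_sh_hcs hh x'))]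
    simp_rw [← integral_sub (k1c _ hr hn i _ x) (k1c _ hr hn i _ x'), ← mul_sub]
    refine (enorm_add_le _ _).trans ?_
    rw [add_mul]
    refine add_le_add (b1 i) ((enorm_sum_le _ _).trans ?_)
    refine (Finset.sum_le_sum fun j _ => b2 _ hr hn i j).trans (le_of_eq ?_)
    simp; rw [← mul_assoc]
  have key2 : ∀ i, ‖(u x - u x') i‖ₑ ≤ (ENNReal.ofReal c0)⁻¹ * ((C + 3 * C') * D) := by
    intro i
    rw [← ENNReal.div_eq_inv_mul, ENNReal.le_div_iff_mul_le (Or.inl c00) (Or.inl (by simp)), mul_comm]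
    exact key i
  refine (enorm_le_sum _).trans ((Finset.sum_le_sum fun i _ => key2 i).trans (le_of_eq ?_))
  simp only [Finset.sum_const, Finset.card_univ, Fintype.card_fin, nsmul_eq_mul]
  push_cast
  rw [hD]; ring

def near (s : ℝ) (u : E3 → E3) (x : E3) : ℝ≥0∞ :=
  ∫⁻ y, kn 3 s (y - x) * (‖u y - u x‖ₑ * (‖u y‖ₑ + ‖u x‖ₑ))

theorem uu_diff (a b : E3) (i j : Fin 3) :
    ‖a i * a j - b i * b j‖ₑ ≤ ‖a - b‖ₑ * (‖a‖ₑ + ‖b‖ₑ) := by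
  have e : a i * a j - b i * b j = (a - b) i * a j + b i * (a - b) j := by
    simp only [PiLp.sub_apply]; ring
  rw [e, mul_add]
  refine (enorm_add_le _ _).trans (add_le_add ?_ ?_)
  · rw [enorm_mul]; exact mul_le_mul' (enorm_coord_le _ _) (enorm_coord_le _ _)
  · rw [enorm_mul, mul_comm]; exact mul_le_mul' (enorm_coord_le _ _) (enorm_coord_le _ _)

theorem press_near : ∃ C : ℝ≥0∞, C ≠ ∞ ∧ ∀ u g P, Slice u g P →
    ∀ (s : ℝ) (x : E3), 0 < s → closedBall x s ⊆ ball 0 1 → LebPt P x →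
    ‖c0 * P x - ∫ y, P y * rho s (y - x)‖ₑ ≤ C * near s u x := by
  obtain ⟨C, hC, hb⟩ := k2_bound
  refine ⟨9 * ENNReal.ofReal C, by finiteness, fun u g P S s x hs hx hL => ?_⟩
  have t := (hL.sub_const (∫ y, P y * rho s (y - x))).enorm
  refine le_of_tendsto t ((ev_small hs).mono fun n hn => ?_)
  have hr : (0:ℝ) < 1 / ((n:ℝ) + 1) := by positivity
  rw [repP S hr hn hx (fun i j => u x i * u x j), add_sub_cancel_left]
  have b : ∀ i j, ‖∫ y, (u y i * u y j - u x i * u x j) * k2 (1 / ((n:ℝ) + 1)) s i j (y - x)‖ₑ ≤ ENNReal.ofReal C * near s u x := by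
    intro i j
    refine (enorm_int_mul_le _ _).trans ?_
    rw [near, ← lintegral_const_mul' _ _ ENNReal.ofReal_ne_top]
    refine lintegral_mono fun y => ?_
    by_cases hz : ‖y - x‖ < s
    · by_cases h0 : y - x = 0
      · have : y = x := sub_eq_zero.1 h0
        subst this; simp
      have k : ‖k2 (1 / ((n:ℝ) + 1)) s i j (y - x)‖ₑ ≤ ENNReal.ofReal C * kn 3 s (y - x) := by
        have pz : 0 < ‖y - x‖ := norm_pos_iff.2 h0
        rw [kn, if_pos hz, ← ofReal_norm, ← ofReal_norm, ENNReal.ofReal_rpow_of_pos pz, ← ENNReal.ofReal_mul hC.le]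
        apply ENNReal.ofReal_le_ofReal
        refine (hb _ _ hr hs i j _ h0).trans (le_of_eq ?_)
        rw [Real.rpow_neg pz.le]; norm_cast
      calc _ ≤ (‖u y - u x‖ₑ * (‖u y‖ₑ + ‖u x‖ₑ)) * (ENNReal.ofReal C * kn 3 s (y - x)) :=
            mul_le_mul' (uu_diff _ _ _ _) k
        _ = _ := by ring
    · rw [k2_zero hr hs hn i j (not_lt.1 hz)]; simp
  refine (enorm_sum_le _ _).trans ?_
  refine (Finset.sum_le_sum fun i _ => (enorm_sum_le _ _).trans (Finset.sum_le_sum fun j _ => b i j)).trans (le_of_eq ?_)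
  simp only [Finset.sum_const, Finset.card_univ, Fintype.card_fin, nsmul_eq_mul]
  push_cast
  ring

theorem c0_ne : ENNReal.ofReal c0 ≠ 0 := by simpa using c0_pos

theorem le_c0 {a b : ℝ≥0∞} (h : ENNReal.ofReal c0 * a ≤ b) : a ≤ (ENNReal.ofReal c0)⁻¹ * b := by
  rw [← ENNReal.div_eq_inv_mul, ENNReal.le_div_iff_mul_le (Or.inl c0_ne) (Or.inl (by simp)), mul_comm]
  exact h

theorem press_A : ∃ C : ℝ≥0∞, C ≠ ∞ ∧ ∀ u g P, Slice u g P →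
    ∀ (s : ℝ) (x : E3), 0 < s → closedBall x s ⊆ ball 0 1 → LebPt P x →
    ‖P x‖ₑ ≤ C * (ENNReal.ofReal s ^ (-3 : ℝ) * (∫⁻ y, ‖P y‖ₑ) + near s u x) := by
  obtain ⟨C, hC, hb⟩ := press_near
  obtain ⟨C', hC', hb'⟩ := rho_kn
  refine ⟨(ENNReal.ofReal c0)⁻¹ * (C' + C), by finiteness [c0_ne], fun u g P S s x hs hx hL => ?_⟩
  rw [mul_assoc]
  apply le_c0
  have e : c0 * P x = (∫ y, P y * rho s (y - x)) + (c0 * P x - ∫ y, P y * rho s (y - x)) := by ring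
  rw [← Real.enorm_of_nonneg c0_pos.le, ← enorm_mul, e]
  refine (enorm_add_le _ _).trans ?_
  have h1 : ‖∫ y, P y * rho s (y - x)‖ₑ ≤ C' * (ENNReal.ofReal s ^ (-3 : ℝ) * (∫⁻ y, ‖P y‖ₑ)) := by
    refine (enorm_int_mul_le _ _).trans ?_
    have hs0 : ENNReal.ofReal s ≠ 0 := by simp [hs]
    rw [← mul_assoc, ← lintegral_const_mul' _ _ (ENNReal.mul_ne_top hC' (ENNReal.rpow_ne_top_of_ne_zero hs0 (by simp)))]
    refine lintegral_mono fun y => ?_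
    rw [mul_comm]
    gcongr
    refine (hb' s hs _).trans ?_
    refine mul_le_of_le_one_right bot_le ?_
    unfold kn; split_ifs <;> simp
  calc _ ≤ C' * (ENNReal.ofReal s ^ (-3 : ℝ) * (∫⁻ y, ‖P y‖ₑ)) + C * near s u x := add_le_add h1 (hb _ _ _ S s x hs hx hL)
    _ ≤ (C' + C) * (ENNReal.ofReal s ^ (-3 : ℝ) * (∫⁻ y, ‖P y‖ₑ)) + (C' + C) * near s u x := by gcongr <;> simp
    _ = _ := by ring

theorem press_B : ∃ C : ℝ≥0∞, C ≠ ∞ ∧ ∀ u g P, Slice u g P →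
    ∀ (s : ℝ) (x x0 : E3) (c : ℝ), 0 < s → closedBall x s ⊆ ball 0 1 → LebPt P x →
    ‖P x - c0⁻¹ * ∫ y, P y * rho s (y - x0)‖ₑ ≤ C * (ENNReal.ofReal s ^ (-4 : ℝ) * ‖x - x0‖ₑ *
      (∫⁻ y in ball x0 (s + ‖x - x0‖), ‖P y - c‖ₑ) + near s u x) := by
  obtain ⟨C, hC, hb⟩ := press_near
  obtain ⟨C', hC', hb'⟩ := rho_holder one_pos le_rfl
  refine ⟨(ENNReal.ofReal c0)⁻¹ * (2 * C' + C), by finiteness [c0_ne], fun u g P S s x x0 c hs hx hL => ?_⟩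
  rw [mul_assoc]
  apply le_c0
  have i1 := fun x => int_mul_cc S.P_int (rho_sh_cont s x) (rho_sh_hcs hs x)
  have i2 : ∀ x : E3, ∫ y, rho s (y - x) = c0 := fun x => by
    rw [integral_sub_right_eq_self (fun y => rho s y) x, rho_integral hs]
  have i3 : ∀ x : E3, Integrable (fun y => rho s (y - x)) := fun x => (rho_integrable hs).comp_sub_right x
  have i4 : ∫ y, (P y - c) * (rho s (y - x) - rho s (y - x0)) = (∫ y, P y * rho s (y - x)) - ∫ y, P y * rho s (y - x0) := by
    have e : ∀ y, (P y - c) * (rho s (y - x) - rho s (y - x0)) = (P y * rho s (y - x) - P y * rho s (y - x0)) - (c * rho s (y - x) - c * rho s (y - x0)) := fun y => by ring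
    simp_rw [e]
    rw [integral_sub (f := fun y => P y * rho s (y - x) - P y * rho s (y - x0)) (g := fun y => c * rho s (y - x) - c * rho s (y - x0)) ((i1 x).sub (i1 x0)) (((i3 x).const_mul c).sub ((i3 x0).const_mul c)),
      integral_sub (i1 x) (i1 x0), integral_sub ((i3 x).const_mul c) ((i3 x0).const_mul c), integral_const_mul, integral_const_mul, i2, i2]
    ring
  have e : c0 * (P x - c0⁻¹ * ∫ y, P y * rho s (y - x0)) = (∫ y, (P y - c) * (rho s (y - x) - rho s (y - x0))) + (c0 * P x - ∫ y, P y * rho s (y - x)) := by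
    rw [i4]; have := c0_pos; field_simp; ring
  rw [← Real.enorm_of_nonneg c0_pos.le, ← enorm_mul, e]
  refine (enorm_add_le _ _).trans ?_
  have hs0 : ENNReal.ofReal s ≠ 0 := by simp [hs]
  have h1 : ‖∫ y, (P y - c) * (rho s (y - x) - rho s (y - x0))‖ₑ ≤ 2 * C' * (ENNReal.ofReal s ^ (-4 : ℝ) * ‖x - x0‖ₑ *
      (∫⁻ y in ball x0 (s + ‖x - x0‖), ‖P y - c‖ₑ)) := by
    refine (enorm_int_mul_le _ _).trans ?_
    rw [← mul_assoc, ← lintegral_const_mul' _ _ (ENNReal.mul_ne_top (by finiteness) (ENNReal.mul_ne_top (ENNReal.rpow_ne_top_of_ne_zero hs0 (by simp)) (by simp))),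
      ← lintegral_indicator measurableSet_ball]
    refine lintegral_mono fun y => ?_
    have kb : ∀ z : E3, kn 0 s z ≤ 1 := fun z => by unfold kn; split_ifs <;> simp
    by_cases hy : y ∈ ball x0 (s + ‖x - x0‖)
    · rw [indicator_of_mem hy, mul_comm]
      gcongr
      refine (hb' s hs _ _).trans ?_
      have : (y - x) - (y - x0) = -(x - x0) := by abel
      rw [this, enorm_neg, show (-(3 + 1) : ℝ) = -4 by norm_num, ENNReal.rpow_one]
      calc _ ≤ C' * (‖x - x0‖ₑ * ENNReal.ofReal s ^ (-4 : ℝ)) * (1 + 1) := by gcongr <;> exact kb _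
        _ = _ := by ring
    · rw [indicator_of_notMem hy]
      have hy' : s + ‖x - x0‖ ≤ ‖y - x0‖ := by simpa [mem_ball, dist_eq_norm] using hy
      have h2 : s ≤ ‖y - x0‖ := by linarith [norm_nonneg (x - x0)]
      have h3 : s ≤ ‖y - x‖ := by
        have := norm_add_le (y - x) (x - x0)
        rw [sub_add_sub_cancel] at this; linarith
      rw [rho_zero hs h2, rho_zero hs h3]; simp
  calc _ ≤ _ := add_le_add h1 (hb _ _ _ S s x hs hx hL)
    _ ≤ (2 * C' + C) * (ENNReal.ofReal s ^ (-4 : ℝ) * ‖x - x0‖ₑ *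
      (∫⁻ y in ball x0 (s + ‖x - x0‖), ‖P y - c‖ₑ)) + (2 * C' + C) * near s u x := by gcongr <;> simp
    _ = _ := by ring

theorem near_meas {u : E3 → E3} (hu : Measurable u) (s : ℝ) : Measurable (near s u) := by
  unfold near
  apply Measurable.lintegral_prod_right' (f := fun p : E3 × E3 => kn 3 s (p.2 - p.1) * (‖u p.2 - u p.1‖ₑ * (‖u p.2‖ₑ + ‖u p.1‖ₑ)))
  have := (kn_measurable (E := E3) 3 s)
  fun_prop

theorem mmul {α : Type*} [MeasurableSpace α] {f g : α → ℝ≥0∞} (hf : Measurable f) (hg : Measurable g) :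
    Measurable (fun x => f x * g x) := hf.mul hg

theorem add_sq_le2 (a b : ℝ≥0∞) : (a + b) ^ 2 ≤ 2 * a ^ 2 + 2 * b ^ 2 := by
  have := ENNReal.rpow_add_le_mul_rpow_add_rpow a b (p := 2) (by norm_num)
  norm_num at this
  rw [← mul_add]; exact this

theorem csL {α : Type*} [MeasurableSpace α] (μ : Measure α) {f g : α → ℝ≥0∞} (hf : AEMeasurable f μ) (hg : AEMeasurable g μ) :
    (∫⁻ x, f x * g x ∂μ) ^ 2 ≤ (∫⁻ x, f x ^ 2 ∂μ) * ∫⁻ x, g x ^ 2 ∂μ := by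
  have := ENNReal.lintegral_mul_le_Lp_mul_Lq μ Real.HolderConjugate.two_two hf hg
  have h2 : ∀ a : ℝ≥0∞, (a ^ (1/2:ℝ)) ^ 2 = a := fun a => by
    rw [← ENNReal.rpow_natCast, ← ENNReal.rpow_mul]; norm_num
  calc _ ≤ _ := pow_le_pow_left' this 2
    _ = _ := by rw [mul_pow, h2, h2]; simp

theorem kn_mul {a b h : ℝ} {z : E3} (hz : z ≠ 0) : kn a h z * kn b h z = kn (a + b) h z := by
  unfold kn
  split_ifs
  · rw [← ENNReal.rpow_add _ _ (by simpa using hz) (by simp)]; congr 1; ring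
  · simp

theorem kn_sq (a h : ℝ) (z : E3) : kn a h z ^ 2 = kn (a * 2) h z := by
  rw [← kn_rpow a h 2 two_pos, ← ENNReal.rpow_natCast]; norm_num

theorem kn_zero_sq (h : ℝ) (z : E3) : kn 0 h z ^ 2 = kn 0 h z := by
  rw [kn_sq]; norm_num

theorem kn_zero_le (γ : ℝ) (hγ : 0 ≤ γ) (h : ℝ) (z : E3) : kn 0 h z ≤ ENNReal.ofReal h ^ γ * kn γ h z := by
  by_cases hz : ‖z‖ < h
  · have hh : 0 < h := (norm_nonneg z).trans_lt hz
    rw [kn_zero_of_lt hz, kn, if_pos hz, ENNReal.rpow_neg, ← div_eq_mul_inv]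
    by_cases z0 : z = 0
    · subst z0
      rcases hγ.eq_or_lt with h' | h'
      · subst h'; simp
      · simp only [enorm_zero, ENNReal.zero_rpow_of_pos h']
        rw [ENNReal.div_zero]; · simp
        · simp [hh, h'.not_gt]
    rw [ENNReal.le_div_iff_mul_le, one_mul, ← ofReal_norm]
    · gcongr
    · left; simp [z0]
    · left; simp [hγ]
  · rw [kn_of_le (not_lt.1 hz)]; simp

theorem kn_sh_lint (a h : ℝ) (x : E3) : ∫⁻ y, kn a h (y - x) = ∫⁻ z : E3, kn a h z := by
  rw [lintegral_sub_right_eq_self (fun y : E3 => kn a h y) x]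

theorem cs_kn {κ γ : ℝ} (hγ : 1 + 2 * κ < γ) : ∃ C : ℝ≥0∞, C ≠ ∞ ∧ ∀ G : E3 → ℝ≥0∞, Measurable G →
    ∀ (h : ℝ) (x : E3), 0 < h → (∫⁻ y, G y * kn (2 + κ) h (y - x)) ^ 2 ≤
      C * ENNReal.ofReal h ^ (γ - 1 - 2 * κ) * ∫⁻ y, G y ^ 2 * kn γ h (y - x) := by
  obtain ⟨C, hC, hc⟩ := kn3 (4 + 2 * κ - γ) (by linarith)
  refine ⟨C, hC, fun G hG h x hh => ?_⟩
  have e : ∫⁻ y, G y * kn (2 + κ) h (y - x) = ∫⁻ y, (G y * kn (γ / 2) h (y - x)) * kn (2 + κ - γ / 2) h (y - x) := by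
    apply lintegral_congr_ae
    have : ∀ᵐ y : E3, y ≠ x := by simp [ae_iff]
    filter_upwards [this] with y hy
    rw [mul_assoc, kn_mul (sub_ne_zero.2 hy)]; congr 2; ring
  rw [e]
  refine (csL volume (mmul hG (kn_sh_meas _ _ _)).aemeasurable (kn_sh_meas _ _ _).aemeasurable).trans (le_of_eq ?_)
  simp_rw [mul_pow, kn_sq]
  rw [show γ / 2 * 2 = γ by ring, show (2 + κ - γ / 2) * 2 = 4 + 2 * κ - γ by ring, kn_sh_lint, hc h hh, mul_comm]
  congr 3; ring

theorem cs_kn0 : ∃ C : ℝ≥0∞, C ≠ ∞ ∧ ∀ U : E3 → ℝ≥0∞, Measurable U →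
    ∀ (h : ℝ) (x : E3), 0 < h → (∫⁻ y, U y * kn 0 h (y - x)) ^ 2 ≤
      C * ENNReal.ofReal h ^ (3 : ℝ) * ∫⁻ y, U y ^ 2 * kn 0 h (y - x) := by
  obtain ⟨C, hC, hc⟩ := kn3 0 (by norm_num)
  refine ⟨C, hC, fun U hU h x hh => ?_⟩
  have e : ∫⁻ y, U y * kn 0 h (y - x) = ∫⁻ y, (U y * kn 0 h (y - x)) * kn 0 h (y - x) := by
    simp_rw [mul_assoc, ← sq, kn_zero_sq]
  rw [e]
  refine (csL volume (mmul hU (kn_sh_meas _ _ _)).aemeasurable (kn_sh_meas _ _ _).aemeasurable).trans (le_of_eq ?_)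
  simp_rw [mul_pow, kn_zero_sq]
  rw [kn_sh_lint, hc h hh, mul_comm]
  simp

theorem kn_meas2 (a h : ℝ) : Measurable (fun p : E3 × E3 => kn a h (p.2 - p.1)) :=
  (kn_measurable (E := E3) a h).comp (measurable_snd.sub measurable_fst)

theorem kn_meas2' (a h : ℝ) : Measurable (fun p : E3 × E3 => kn a h (p.1 - p.2)) :=
  (kn_measurable (E := E3) a h).comp (measurable_fst.sub measurable_snd)

theorem ton {w F : E3 → ℝ≥0∞} {W : ℝ≥0∞} {γ τ : ℝ} (hw : Measurable w) (hF : Measurable F) (hA : Adm w W γ τ)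
    {x0 : E3} {ρ h : ℝ} (hh : 0 < h) (h0 : ∀ x, x ∉ ball x0 ρ → w x = 0) :
    ∫⁻ x, w x * ∫⁻ y, F y * kn γ h (y - x) ≤ W * ENNReal.ofReal h ^ τ * ∫⁻ y in ball x0 (ρ + h), F y := by
  have e1 : ∀ x, w x * ∫⁻ y, F y * kn γ h (y - x) = ∫⁻ y, w x * (F y * kn γ h (y - x)) := fun x => by
    rw [lintegral_const_mul]; exact hF.mul (kn_sh_meas _ _ _)
  simp_rw [e1]
  rw [lintegral_lintegral_swap]
  swap
  · have := kn_meas2 γ h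
    exact ((hw.comp measurable_fst).mul ((hF.comp measurable_snd).mul this)).aemeasurable
  rw [← lintegral_const_mul _ hF, ← lintegral_indicator measurableSet_ball]
  refine lintegral_mono fun y => ?_
  have e2 : ∀ x, w x * (F y * kn γ h (y - x)) = F y * (w x * kn γ h (x - y)) := fun x => by
    rw [kn_sub_comm]; ring
  simp_rw [e2]
  rw [lintegral_const_mul _ (mmul hw (kn_sh_meas _ _ _))]
  by_cases hy : y ∈ ball x0 (ρ + h)
  · rw [indicator_of_mem hy, mul_comm]
    gcongr; exact hA y h hh
  · rw [indicator_of_notMem hy]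
    have : ∀ x, w x * kn γ h (x - y) = 0 := by
      intro x
      by_cases hx : x ∈ ball x0 ρ
      · have : h ≤ ‖x - y‖ := by
          rw [mem_ball, dist_eq_norm] at hx hy
          have := norm_add_le (y - x) (x - x0)
          rw [sub_add_sub_cancel, norm_sub_rev y x] at this
          linarith
        rw [kn_of_le this, mul_zero]
      · rw [h0 x hx, zero_mul]
    simp [this]

theorem ton0 {w F : E3 → ℝ≥0∞} {W : ℝ≥0∞} {γ τ : ℝ} (hγ : 0 ≤ γ) (hw : Measurable w) (hF : Measurable F) (hA : Adm w W γ τ)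
    {x0 : E3} {ρ h : ℝ} (hh : 0 < h) (h0 : ∀ x, x ∉ ball x0 ρ → w x = 0) :
    ∫⁻ x, w x * ∫⁻ y, F y * kn 0 h (y - x) ≤ W * ENNReal.ofReal h ^ (γ + τ) * ∫⁻ y in ball x0 (ρ + h), F y := by
  have hh0 : ENNReal.ofReal h ≠ 0 := by simp [hh]
  have ft : ENNReal.ofReal h ^ γ ≠ ∞ := ENNReal.rpow_ne_top_of_ne_zero hh0 (by simp)
  calc _ ≤ ∫⁻ x, ENNReal.ofReal h ^ γ * (w x * ∫⁻ y, F y * kn γ h (y - x)) := by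
        refine lintegral_mono fun x => ?_
        rw [mul_left_comm, ← lintegral_const_mul' _ _ ft]
        refine mul_le_mul' le_rfl (lintegral_mono fun y => ?_)
        calc F y * kn 0 h (y - x) ≤ F y * (ENNReal.ofReal h ^ γ * kn γ h (y - x)) := by
              gcongr; exact kn_zero_le γ hγ h _
          _ = _ := by ring
    _ ≤ ENNReal.ofReal h ^ γ * (W * ENNReal.ofReal h ^ τ * ∫⁻ y in ball x0 (ρ + h), F y) := by
        rw [lintegral_const_mul' _ _ ft]; gcongr; exact ton hw hF hA hh h0
    _ = _ := by rw [ENNReal.rpow_add _ _ hh0 (by simp)]; ring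

theorem Phi_int {κ γ τ : ℝ} (hκ : 0 < κ) (hγ : 1 + 2 * κ < γ) : ∃ C : ℝ≥0∞, C ≠ ∞ ∧ ∀ (w G U : E3 → ℝ≥0∞) (W : ℝ≥0∞),
    Measurable w → Measurable G → Measurable U → Adm w W γ τ → ∀ (x0 : E3) (ρ h : ℝ), 0 < h → 
    (∀ x, x ∉ ball x0 ρ → w x = 0) →
    ∫⁻ x, w x * Phi κ h G U x ^ 2 ≤ C * W * (ENNReal.ofReal h ^ (γ + τ - 1 - 2 * κ) * (∫⁻ y in ball x0 (ρ + h), G y ^ 2) +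
      ENNReal.ofReal h ^ (γ + τ - 3 - 2 * κ) * min (∫⁻ y in ball x0 (ρ + h), U y ^ 2)
        (ENNReal.ofReal h ^ (-3 : ℝ) * (∫⁻ y in ball x0 (ρ + h), U y) ^ 2)) := by
  obtain ⟨C, hC, hc⟩ := cs_kn hγ
  obtain ⟨C', hC', hc'⟩ := cs_kn0
  refine ⟨2 * C + 2 * C' + 2, by finiteness, fun w G U W hw hG hU hA x0 ρ h hh h0 => ?_⟩
  set H := ENNReal.ofReal h with hH
  have hh0 : H ≠ 0 := by simp [hH, hh]
  have Ht : H ≠ ∞ := by simp [hH]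
  have ft : ∀ a : ℝ, H ^ a ≠ ∞ := fun a => ENNReal.rpow_ne_top_of_ne_zero hh0 Ht
  have hadd : ∀ a b : ℝ, H ^ a * H ^ b = H ^ (a + b) := fun a b => (ENNReal.rpow_add _ _ hh0 Ht).symm
  have mG : Measurable (fun x => ∫⁻ y, G y * kn (2 + κ) h (y - x)) := by
    apply Measurable.lintegral_prod_right' (f := fun p : E3 × E3 => G p.2 * kn (2 + κ) h (p.2 - p.1))
    exact (hG.comp measurable_snd).mul (kn_meas2 _ _)
  have mU : Measurable (fun x => ∫⁻ y, U y * kn 0 h (y - x)) := by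
    apply Measurable.lintegral_prod_right' (f := fun p : E3 × E3 => U p.2 * kn 0 h (p.2 - p.1))
    exact (hU.comp measurable_snd).mul (kn_meas2 _ _)
  set A1 := ∫⁻ x, w x * (∫⁻ y, G y * kn (2 + κ) h (y - x)) ^ 2 with hA1
  set A2 := ∫⁻ x, w x * (∫⁻ y, U y * kn 0 h (y - x)) ^ 2 with hA2
  have s1 : ∫⁻ x, w x * Phi κ h G U x ^ 2 ≤ 2 * A1 + 2 * H ^ (-(6 + 2 * κ)) * A2 := by
    rw [hA1, hA2, ← lintegral_const_mul _ (mmul hw (mG.pow_const 2)), ← lintegral_const_mul _ (mmul hw (mU.pow_const 2)),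
      ← lintegral_add_left ((mmul hw (mG.pow_const 2)).const_mul 2)]
    refine lintegral_mono fun x => ?_
    rw [Phi]
    calc _ ≤ w x * (2 * (∫⁻ y, G y * kn (2 + κ) h (y - x)) ^ 2 + 2 * (H ^ (-(3 + κ)) * ∫⁻ y, U y * kn 0 h (y - x)) ^ 2) := by
          gcongr
          exact add_sq_le2 _ _
      _ = _ := by
          have : (H ^ (-(3 + κ))) ^ 2 = H ^ (-(6 + 2 * κ)) := by
            rw [← ENNReal.rpow_natCast, ← ENNReal.rpow_mul]; congr 1; push_cast; ring
          rw [mul_pow, this]; ring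
  have s2 : A1 ≤ C * W * (H ^ (γ + τ - 1 - 2 * κ) * (∫⁻ y in ball x0 (ρ + h), G y ^ 2)) := by
    calc A1 ≤ ∫⁻ x, C * H ^ (γ - 1 - 2 * κ) * (w x * ∫⁻ y, G y ^ 2 * kn γ h (y - x)) := by
          refine lintegral_mono fun x => ?_
          rw [mul_left_comm]; gcongr; exact hc G hG h x hh
      _ ≤ C * H ^ (γ - 1 - 2 * κ) * (W * H ^ τ * ∫⁻ y in ball x0 (ρ + h), G y ^ 2) := by
          rw [lintegral_const_mul' _ _ (ENNReal.mul_ne_top hC (ft _))]; gcongr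
          exact ton hw (hG.pow_const 2) hA hh h0
      _ = C * W * ((H ^ (γ - 1 - 2 * κ) * H ^ τ) * ∫⁻ y in ball x0 (ρ + h), G y ^ 2) := by ring
      _ = _ := by rw [hadd, show γ - 1 - 2 * κ + τ = γ + τ - 1 - 2 * κ by ring]
  have hγ0 : 0 ≤ γ := by linarith
  have s3 : A2 ≤ C' * W * (H ^ (γ + τ + 3) * (∫⁻ y in ball x0 (ρ + h), U y ^ 2)) := by
    calc A2 ≤ ∫⁻ x, C' * H ^ (3 : ℝ) * (w x * ∫⁻ y, U y ^ 2 * kn 0 h (y - x)) := by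
          refine lintegral_mono fun x => ?_
          rw [mul_left_comm]; gcongr; exact hc' U hU h x hh
      _ ≤ C' * H ^ (3 : ℝ) * (W * H ^ (γ + τ) * ∫⁻ y in ball x0 (ρ + h), U y ^ 2) := by
          rw [lintegral_const_mul' _ _ (ENNReal.mul_ne_top hC' (ft _))]; gcongr
          exact ton0 hγ0 hw (hU.pow_const 2) hA hh h0
      _ = C' * W * ((H ^ (3 : ℝ) * H ^ (γ + τ)) * ∫⁻ y in ball x0 (ρ + h), U y ^ 2) := by ring
      _ = _ := by rw [hadd, add_comm (3:ℝ)]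
  have s4 : A2 ≤ W * (H ^ (γ + τ) * (∫⁻ y in ball x0 (ρ + h), U y) ^ 2) := by
    have kl : ∀ x ∈ ball x0 ρ, ∫⁻ y, U y * kn 0 h (y - x) ≤ ∫⁻ y in ball x0 (ρ + h), U y := by
      intro x hx
      rw [← lintegral_indicator measurableSet_ball]
      refine lintegral_mono fun y => ?_
      by_cases hy : y ∈ ball x0 (ρ + h)
      · rw [indicator_of_mem hy]
        refine mul_le_of_le_one_right bot_le ?_
        unfold kn; split_ifs <;> simp
      · have : h ≤ ‖y - x‖ := by
          rw [mem_ball, dist_eq_norm] at hx hy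
          have := norm_add_le (y - x) (x - x0)
          rw [sub_add_sub_cancel] at this
          linarith
        rw [kn_of_le this]; simp
    set X := ∫⁻ y in ball x0 (ρ + h), U y with hX
    calc A2 ≤ ∫⁻ x, X * (w x * ∫⁻ y, U y * kn 0 h (y - x)) := by
          refine lintegral_mono fun x => ?_
          by_cases hx : x ∈ ball x0 ρ
          · calc _ = (∫⁻ y, U y * kn 0 h (y - x)) * (w x * ∫⁻ y, U y * kn 0 h (y - x)) := by ring
              _ ≤ _ := by gcongr; exact kl x hx
          · simp [h0 x hx]
      _ ≤ X * (W * H ^ (γ + τ) * X) := by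
          rw [lintegral_const_mul _ (mmul hw mU)]; gcongr
          exact ton0 hγ0 hw hU hA hh h0
      _ = _ := by ring
  have s5 : H ^ (-(6 + 2 * κ)) * A2 ≤ (C' + 1) * W * (H ^ (γ + τ - 3 - 2 * κ) * min (∫⁻ y in ball x0 (ρ + h), U y ^ 2)
        (H ^ (-3 : ℝ) * (∫⁻ y in ball x0 (ρ + h), U y) ^ 2)) := by
    rcases min_choice (∫⁻ y in ball x0 (ρ + h), U y ^ 2) (H ^ (-3 : ℝ) * (∫⁻ y in ball x0 (ρ + h), U y) ^ 2) with e | e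
    · rw [e]
      calc _ ≤ H ^ (-(6 + 2 * κ)) * ((C' + 1) * W * (H ^ (γ + τ + 3) * (∫⁻ y in ball x0 (ρ + h), U y ^ 2))) := by
            gcongr; refine s3.trans ?_; gcongr; simp
        _ = (C' + 1) * W * ((H ^ (-(6 + 2 * κ)) * H ^ (γ + τ + 3)) * (∫⁻ y in ball x0 (ρ + h), U y ^ 2)) := by ring
        _ = _ := by rw [hadd, show -(6 + 2 * κ) + (γ + τ + 3) = γ + τ - 3 - 2 * κ by ring]
    · rw [e]
      calc _ ≤ H ^ (-(6 + 2 * κ)) * ((C' + 1) * (W * (H ^ (γ + τ) * (∫⁻ y in ball x0 (ρ + h), U y) ^ 2))) := by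
            gcongr; exact s4.trans (le_mul_of_one_le_left bot_le (by simp))
        _ = (C' + 1) * W * ((H ^ (-(6 + 2 * κ)) * H ^ (γ + τ)) * (∫⁻ y in ball x0 (ρ + h), U y) ^ 2) := by ring
        _ = (C' + 1) * W * ((H ^ (γ + τ - 3 - 2 * κ) * H ^ (-3 : ℝ)) * (∫⁻ y in ball x0 (ρ + h), U y) ^ 2) := by
            rw [hadd, hadd, show γ + τ - 3 - 2 * κ + -3 = -(6 + 2 * κ) + (γ + τ) by ring]
        _ = _ := by ring
  refine s1.trans ?_
  set M1 := H ^ (γ + τ - 1 - 2 * κ) * (∫⁻ y in ball x0 (ρ + h), G y ^ 2)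
  set M2 := H ^ (γ + τ - 3 - 2 * κ) * min (∫⁻ y in ball x0 (ρ + h), U y ^ 2) (H ^ (-3 : ℝ) * (∫⁻ y in ball x0 (ρ + h), U y) ^ 2)
  calc 2 * A1 + 2 * H ^ (-(6 + 2 * κ)) * A2 ≤ 2 * (C * W * M1) + 2 * ((C' + 1) * W * M2) := by
        rw [mul_assoc 2 _ A2]; gcongr
    _ ≤ (2 * C + 2 * C' + 2) * W * M1 + (2 * C + 2 * C' + 2) * W * M2 := by
        have a1 : 2 * C ≤ 2 * C + 2 * C' + 2 := by rw [add_assoc]; exact le_self_add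
        have a2 : 2 * (C' + 1) ≤ 2 * C + 2 * C' + 2 := by rw [mul_add, add_assoc, mul_one]; exact le_add_self
        rw [← mul_assoc 2, ← mul_assoc 2, ← mul_assoc 2, ← mul_assoc 2]
        gcongr
    _ = _ := by ring

theorem Phi_meas {κ h : ℝ} {G U : E3 → ℝ≥0∞} (hG : Measurable G) (hU : Measurable U) : Measurable (Phi κ h G U) := by
  have mG : Measurable (fun x => ∫⁻ y, G y * kn (2 + κ) h (y - x)) := by
    apply Measurable.lintegral_prod_right' (f := fun p : E3 × E3 => G p.2 * kn (2 + κ) h (p.2 - p.1))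
    exact (hG.comp measurable_snd).mul (kn_meas2 _ _)
  have mU : Measurable (fun x => ∫⁻ y, U y * kn 0 h (y - x)) := by
    apply Measurable.lintegral_prod_right' (f := fun p : E3 × E3 => U p.2 * kn 0 h (p.2 - p.1))
    exact (hU.comp measurable_snd).mul (kn_meas2 _ _)
  exact mG.add (mU.const_mul _)

theorem adm_conv {κ : ℝ} (hκ : 0 < κ) : ∃ C : ℝ≥0∞, C ≠ ∞ ∧ ∀ (w : E3 → ℝ≥0∞) (W : ℝ≥0∞) (γ τ : ℝ), Measurable w → 
    Adm w W γ τ → ∀ s : ℝ, 0 < s → 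
    Adm (fun y => ENNReal.ofReal s ^ κ * w y + ∫⁻ x, w x * kn (3 - κ) s (y - x)) (C * W * ENNReal.ofReal s ^ κ) γ τ := by
  obtain ⟨C, hC, hc⟩ := kn3 (3 - κ) (by linarith)
  refine ⟨1 + C, by finiteness, fun w W γ τ hw hA s hs y0 h hh => ?_⟩
  have m1 : Measurable (fun y => w y * kn γ h (y - y0)) := mmul hw (kn_sh_meas _ _ _)
  have m2 : Measurable (fun y => ENNReal.ofReal s ^ κ * (w y * kn γ h (y - y0))) := m1.const_mul _
  simp_rw [add_mul, mul_assoc]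
  rw [lintegral_add_left m2, lintegral_const_mul _ m1]
  have p1 : ENNReal.ofReal s ^ κ * ∫⁻ y, w y * kn γ h (y - y0) ≤ ENNReal.ofReal s ^ κ * (W * ENNReal.ofReal h ^ τ) := by
    gcongr; exact hA y0 h hh
  have p2 : ∫⁻ y, (∫⁻ x, w x * kn (3 - κ) s (y - x)) * kn γ h (y - y0) ≤ (C * ENNReal.ofReal s ^ κ) * (W * ENNReal.ofReal h ^ τ) := by
    have e1 : ∀ y, ∫⁻ x, w x * kn (3 - κ) s (y - x) = ∫⁻ v, w (v + y) * kn (3 - κ) s v := by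
      intro y
      rw [← lintegral_add_right_eq_self (fun x => w x * kn (3 - κ) s (y - x)) y]
      congr 1; funext v; congr 1
      rw [show y - (v + y) = -v by abel, kn_neg]
    simp_rw [e1]
    have e2 : ∀ y, (∫⁻ v, w (v + y) * kn (3 - κ) s v) * kn γ h (y - y0) = ∫⁻ v, kn (3 - κ) s v * (w (v + y) * kn γ h (y - y0)) := by
      intro y
      have m3 : Measurable (fun v => w (v + y) * kn (3 - κ) s v) := mmul (hw.comp (measurable_id.add_const y)) (kn_measurable _ _)
      rw [← lintegral_mul_const _ m3]
      congr 1; funext v; ring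
    simp_rw [e2]
    rw [lintegral_lintegral_swap]
    swap
    · have a1 : Measurable (fun p : E3 × E3 => w (p.2 + p.1)) := hw.comp (measurable_snd.add measurable_fst)
      have a2 : Measurable (fun p : E3 × E3 => kn (3 - κ) s p.2) := (kn_measurable (E := E3) _ _).comp measurable_snd
      have a3 : Measurable (fun p : E3 × E3 => kn γ h (p.1 - y0)) := (kn_sh_meas γ h y0).comp measurable_fst
      exact (a2.mul (a1.mul a3)).aemeasurable
    have e3 : ∀ v, ∫⁻ y, kn (3 - κ) s v * (w (v + y) * kn γ h (y - y0)) ≤ kn (3 - κ) s v * (W * ENNReal.ofReal h ^ τ) := by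
      intro v
      have m3 : Measurable (fun y => w (v + y) * kn γ h (y - y0)) := mmul (hw.comp (measurable_id.const_add v)) (kn_sh_meas _ _ _)
      rw [lintegral_const_mul _ m3]
      gcongr
      refine le_trans (le_of_eq ?_) (hA (v + y0) h hh)
      rw [← lintegral_add_left_eq_self (fun x => w x * kn γ h (x - (v + y0))) v]
      congr 1; funext y; simp only [add_sub_add_left_eq_sub]
    refine (lintegral_mono e3).trans (le_of_eq ?_)
    rw [lintegral_mul_const _ (kn_measurable _ _), hc s hs]; congr 3; ring
  refine (add_le_add p1 p2).trans (le_of_eq ?_)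
  ring

theorem ptN {κ : ℝ} (hκ : 0 < κ) (hκ1 : κ ≤ 1) : ∃ C : ℝ≥0∞, C ≠ ∞ ∧ ∀ u g P, Slice u g P →
    ∀ (x : E3) (s h : ℝ), 0 < h → h ≤ s → ball x (s + h) ⊆ ball 0 1 → (∀ i : Fin 3, LebPt (fun y => u y i) x) →
    ‖u x‖ₑ ^ 2 + near s u x ≤ C * ENNReal.ofReal h ^ κ * (ENNReal.ofReal s ^ κ * Phi κ h (gn g) (fun y => ‖u y‖ₑ) x ^ 2 +
      ∫⁻ y, kn (3 - κ) s (y - x) * Phi κ h (gn g) (fun y => ‖u y‖ₑ) y ^ 2) := by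
  obtain ⟨C1, hC1, h1⟩ := hold1 hκ
  obtain ⟨C2, hC2, h2⟩ := hold2 hκ hκ1
  obtain ⟨C3, hC3, h3⟩ := kn3 (3 - κ) (by linarith)
  refine ⟨C1 ^ 2 + 2 * C1 * C2 * C3 + 2 * C1 * C2, by finiteness, fun u g P S x s h hh hs hx hL => ?_⟩
  have s0 : 0 < s := hh.trans_le hs
  set Φ := Phi κ h (gn g) (fun y => ‖u y‖ₑ) with hΦ
  have mΦ : Measurable Φ := Phi_meas (gn_meas S.mg) S.mu.enorm
  set H := ENNReal.ofReal h with hH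
  set T := ENNReal.ofReal s with hT
  have hHT : H ≤ T := ENNReal.ofReal_le_ofReal hs
  have hcb : ∀ y, ‖y - x‖ < s → closedBall y h ⊆ ball 0 1 := by
    intro y hy z hz
    apply hx
    rw [mem_closedBall, dist_eq_norm] at hz
    rw [mem_ball, dist_eq_norm]
    have := norm_add_le (z - y) (y - x)
    rw [sub_add_sub_cancel] at this; linarith
  have hx0 := hcb x (by simpa using s0)
  have ux := h1 u g P S h x hh hx0 hL
  have leb' : ∀ᵐ y, ∀ i : Fin 3, LebPt (fun y => u y i) y := ae_all_iff.2 fun i => leb (S.ui_int i)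
  have p1 : ‖u x‖ₑ ^ 2 ≤ C1 ^ 2 * H ^ κ * (T ^ κ * Φ x ^ 2) := by
    calc _ ≤ (C1 * H ^ κ * Φ x) ^ 2 := pow_le_pow_left' ux 2
      _ = C1 ^ 2 * H ^ κ * (H ^ κ * Φ x ^ 2) := by ring
      _ ≤ _ := by gcongr
  have p2 : near s u x ≤ ∫⁻ y, 2 * C1 * C2 * H ^ κ * (Φ x ^ 2 * kn (3 - κ) s (y - x) + kn (3 - κ) s (y - x) * Φ y ^ 2) := by
    rw [near]
    apply lintegral_mono_ae
    have : ∀ᵐ y : E3, y ≠ x := by simp [ae_iff]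
    filter_upwards [this, leb'] with y hy hLy
    by_cases hys : ‖y - x‖ < s
    · have uy := h1 u g P S h y hh (hcb y hys) hLy
      have uxy := h2 u g P S h y x hh (hcb y hys) hx0 hLy hL
      have ek : kn 3 s (y - x) * ‖y - x‖ₑ ^ κ = kn (3 - κ) s (y - x) := by
        rw [kn, kn, if_pos hys, if_pos hys, ← ENNReal.rpow_add _ _ (by simpa [sub_eq_zero] using hy) (by simp)]
        congr 1; ring
      calc _ ≤ kn 3 s (y - x) * ((C2 * ‖y - x‖ₑ ^ κ * (Φ y + Φ x)) * (C1 * H ^ κ * Φ y + C1 * H ^ κ * Φ x)) := by gcongr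
        _ = C1 * C2 * H ^ κ * (kn 3 s (y - x) * ‖y - x‖ₑ ^ κ) * (Φ y + Φ x) ^ 2 := by ring
        _ ≤ C1 * C2 * H ^ κ * kn (3 - κ) s (y - x) * (2 * Φ y ^ 2 + 2 * Φ x ^ 2) := by
            rw [ek]; gcongr; exact add_sq_le2 _ _
        _ = _ := by ring
    · rw [kn_of_le (not_lt.1 hys)]; simp
  have p3 : near s u x ≤ 2 * C1 * C2 * H ^ κ * (C3 * T ^ κ * Φ x ^ 2 + ∫⁻ y, kn (3 - κ) s (y - x) * Φ y ^ 2) := by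
    refine p2.trans (le_of_eq ?_)
    have m3 : Measurable (fun y => Φ x ^ 2 * kn (3 - κ) s (y - x)) := (kn_sh_meas _ _ _).const_mul _
    have m4 : Measurable (fun y => Φ x ^ 2 * kn (3 - κ) s (y - x) + kn (3 - κ) s (y - x) * Φ y ^ 2) :=
      m3.add (mmul (kn_sh_meas _ _ _) (mΦ.pow_const 2))
    rw [lintegral_const_mul _ m4, lintegral_add_left m3,
      lintegral_const_mul _ (kn_sh_meas _ _ _), kn_sh_lint, h3 s s0, show 3 - (3 - κ) = κ by ring]
    ring
  set Z := ∫⁻ y, kn (3 - κ) s (y - x) * Φ y ^ 2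
  refine (add_le_add p1 p3).trans ?_
  calc C1 ^ 2 * H ^ κ * (T ^ κ * Φ x ^ 2) + 2 * C1 * C2 * H ^ κ * (C3 * T ^ κ * Φ x ^ 2 + Z)
      = (C1 ^ 2 + 2 * C1 * C2 * C3) * H ^ κ * (T ^ κ * Φ x ^ 2) + (2 * C1 * C2) * H ^ κ * Z := by ring
    _ ≤ (C1 ^ 2 + 2 * C1 * C2 * C3 + 2 * C1 * C2) * H ^ κ * (T ^ κ * Φ x ^ 2) + (C1 ^ 2 + 2 * C1 * C2 * C3 + 2 * C1 * C2) * H ^ κ * Z := by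
        have a1 : C1 ^ 2 + 2 * C1 * C2 * C3 ≤ C1 ^ 2 + 2 * C1 * C2 * C3 + 2 * C1 * C2 := le_self_add
        have a2 : 2 * C1 * C2 ≤ C1 ^ 2 + 2 * C1 * C2 * C3 + 2 * C1 * C2 := le_add_self
        exact add_le_add (mul_le_mul' (mul_le_mul' a1 le_rfl) le_rfl) (mul_le_mul' (mul_le_mul' a2 le_rfl) le_rfl)
    _ = _ := by ring

theorem lemN {κ γ τ : ℝ} (hκ : 0 < κ) (hκ1 : κ ≤ 1) (hγ : 1 + 2 * κ < γ) : ∃ C : ℝ≥0∞, C ≠ ∞ ∧ ∀ u g P, Slice u g P →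
    ∀ (w : E3 → ℝ≥0∞) (W : ℝ≥0∞), Measurable w → Adm w W γ τ → ∀ (x0 : E3) (ρ s h : ℝ), 0 < h → h ≤ s → 
    ball x0 (ρ + s + h) ⊆ ball 0 1 → 
    ∫⁻ x in ball x0 ρ, w x * (‖u x‖ₑ ^ 2 + near s u x) ≤ C * W * ENNReal.ofReal s ^ κ * 
      (ENNReal.ofReal h ^ (γ + τ - 1 - κ) * (∫⁻ y in ball x0 (ρ + s + h), gn g y ^ 2) +
      ENNReal.ofReal h ^ (γ + τ - 3 - κ) * min (∫⁻ y in ball x0 (ρ + s + h), ‖u y‖ₑ ^ 2)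
        (ENNReal.ofReal h ^ (-3 : ℝ) * (∫⁻ y in ball x0 (ρ + s + h), ‖u y‖ₑ) ^ 2)) := by
  obtain ⟨C1, hC1, h1⟩ := ptN hκ hκ1
  obtain ⟨C2, hC2, h2⟩ := adm_conv hκ
  obtain ⟨C3, hC3, h3⟩ := Phi_int (τ := τ) hκ hγ
  refine ⟨C1 * C2 * C3, by finiteness, fun u g P S w W hw hA x0 ρ s h hh hs hx => ?_⟩
  have s0 : 0 < s := hh.trans_le hs
  set Φ := Phi κ h (gn g) (fun y => ‖u y‖ₑ) with hΦ
  have mΦ : Measurable Φ := Phi_meas (gn_meas S.mg) S.mu.enorm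
  have mΦ2 : Measurable (fun x => Φ x ^ 2) := mΦ.pow_const 2
  set H := ENNReal.ofReal h with hH
  have hh0 : H ≠ 0 := by simp [hH, hh]
  have Ht : H ≠ ∞ := by simp [hH]
  have ft : ∀ a : ℝ, H ^ a ≠ ∞ := fun a => ENNReal.rpow_ne_top_of_ne_zero hh0 Ht
  set T := ENNReal.ofReal s with hT
  set w1 := (ball x0 ρ).indicator w with hw1
  have mw1 : Measurable w1 := hw.indicator measurableSet_ball
  have A1 : Adm w1 W γ τ := fun y r hr => by
    refine le_trans (lintegral_mono fun x => ?_) (hA y r hr)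
    gcongr; exact indicator_le_self _ _ x
  have A2 := h2 w1 W γ τ mw1 A1 s s0
  set w2 := (fun y => T ^ κ * w1 y + ∫⁻ x, w1 x * kn (3 - κ) s (y - x)) with hw2
  have mc : Measurable (fun y => ∫⁻ x, w1 x * kn (3 - κ) s (y - x)) := by
    apply Measurable.lintegral_prod_right' (f := fun p : E3 × E3 => w1 p.2 * kn (3 - κ) s (p.1 - p.2))
    exact (mw1.comp measurable_snd).mul (kn_meas2' _ _)
  have mw2 : Measurable w2 := (mw1.const_mul _).add mc
  have z1 : ∀ x, x ∉ ball x0 ρ → w1 x = 0 := fun x hx => indicator_of_notMem hx _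
  have z2 : ∀ x, x ∉ ball x0 (ρ + s) → w2 x = 0 := by
    intro x hx
    have a : w1 x = 0 := z1 x fun hx' => hx (ball_subset_ball (by linarith) hx')
    have b : ∀ y, w1 y * kn (3 - κ) s (x - y) = 0 := by
      intro y
      by_cases hy : y ∈ ball x0 ρ
      · have : s ≤ ‖x - y‖ := by
          rw [mem_ball, dist_eq_norm] at hx hy
          have := norm_add_le (x - y) (y - x0)
          rw [sub_add_sub_cancel] at this; linarith
        rw [kn_of_le this, mul_zero]
      · rw [z1 y hy, zero_mul]
    simp [hw2, a, b]
  have leb' : ∀ᵐ y, ∀ i : Fin 3, LebPt (fun y => u y i) y := ae_all_iff.2 fun i => leb (S.ui_int i)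
  have q1 : ∫⁻ x in ball x0 ρ, w x * (‖u x‖ₑ ^ 2 + near s u x) ≤ ∫⁻ x, C1 * H ^ κ * (T ^ κ * (w1 x * Φ x ^ 2) + w1 x * ∫⁻ y, kn (3 - κ) s (y - x) * Φ y ^ 2) := by
    rw [← lintegral_indicator measurableSet_ball]
    apply lintegral_mono_ae
    filter_upwards [leb'] with x hLx
    by_cases hxb : x ∈ ball x0 ρ
    · rw [indicator_of_mem hxb]
      have e : w1 x = w x := indicator_of_mem hxb _
      have := h1 u g P S x s h hh hs ((ball_subset_ball' (by rw [mem_ball] at hxb; linarith)).trans hx) hLx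
      calc _ ≤ w x * _ := mul_le_mul' le_rfl this
        _ = _ := by rw [e]; ring
    · rw [indicator_of_notMem hxb]; exact bot_le
  have m1 : Measurable (fun x => w1 x * Φ x ^ 2) := mmul mw1 mΦ2
  have m2 : Measurable (fun x => T ^ κ * (w1 x * Φ x ^ 2)) := m1.const_mul _
  have q2 : ∫⁻ x, w1 x * ∫⁻ y, kn (3 - κ) s (y - x) * Φ y ^ 2 = ∫⁻ y, (∫⁻ x, w1 x * kn (3 - κ) s (y - x)) * Φ y ^ 2 := by
    have e1 : ∀ x, w1 x * ∫⁻ y, kn (3 - κ) s (y - x) * Φ y ^ 2 = ∫⁻ y, w1 x * kn (3 - κ) s (y - x) * Φ y ^ 2 := fun x => by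
      rw [← lintegral_const_mul _ (mmul (kn_sh_meas _ _ _) mΦ2)]; simp_rw [mul_assoc]
    simp_rw [e1]
    rw [lintegral_lintegral_swap]
    · congr 1; funext y
      have : Measurable (fun x => kn (3 - κ) s (y - x)) := by simp_rw [kn_sub_comm _ _ y]; exact kn_sh_meas _ _ _
      rw [lintegral_mul_const _ (mmul mw1 this)]
    · exact (((mw1.comp measurable_fst).mul (kn_meas2 _ _)).mul (mΦ2.comp measurable_snd)).aemeasurable
  have q3 : ∫⁻ x in ball x0 ρ, w x * (‖u x‖ₑ ^ 2 + near s u x) ≤ C1 * H ^ κ * ∫⁻ y, w2 y * Φ y ^ 2 := by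
    refine q1.trans (le_of_eq ?_)
    rw [lintegral_const_mul' _ _ (ENNReal.mul_ne_top hC1 (ft _)), lintegral_add_left m2, q2,
      ← lintegral_add_left m2]
    congr 2; funext y; rw [hw2]; ring
  have q4 := h3 w2 (gn g) (fun y => ‖u y‖ₑ) _ mw2 (gn_meas S.mg) S.mu.enorm A2 x0 (ρ + s) h hh z2
  refine q3.trans ((mul_le_mul' le_rfl q4).trans (le_of_eq ?_))
  have e1 : H ^ (γ + τ - 1 - κ) = H ^ κ * H ^ (γ + τ - 1 - 2 * κ) := by
    rw [← ENNReal.rpow_add _ _ hh0 Ht]; congr 1; ring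
  have e2 : H ^ (γ + τ - 3 - κ) = H ^ κ * H ^ (γ + τ - 3 - 2 * κ) := by
    rw [← ENNReal.rpow_add _ _ hh0 Ht]; congr 1; ring
  rw [e1, e2]
  ring

/-! ### Passing from space-time distributions to a.e. time slices -/
abbrev muT : Measure ℝ := volume.restrict (Ioo (-1) 0)
abbrev muB : Measure E3 := volume.restrict (ball (0:E3) 1)

theorem J_bdd (J : E3 → ℝ) (hJ : Continuous J) : ∃ C, ∀ x ∈ closedBall (0:E3) 1, ‖J x‖ ≤ C :=
  (isCompact_closedBall (0:E3) 1).exists_bound_of_continuousOn hJ.continuousOn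

theorem int_mul_J {a : E3 → ℝ} (ha : Integrable a muB) {J : E3 → ℝ} (hJ : Continuous J) :
    Integrable (fun x => a x * J x) muB := by
  obtain ⟨C, hC⟩ := J_bdd J hJ
  have := ha.bdd_mul (c := C) (f := J) hJ.aestronglyMeasurable
    (by filter_upwards [ae_restrict_mem measurableSet_ball] with x hx using hC x (ball_subset_closedBall hx))
  simpa only [mul_comm] using this

theorem ae_all {ι : Type} [Fintype ι] (T : Set (ι → E3 → ℝ)) (hT : ∀ J ∈ T, ∀ i, Continuous (J i))
    (a : ι → ℝ → E3 → ℝ) (ha : ∀ i, Integrable (Function.uncurry (a i)) (muT.prod muB))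
    (h : ∀ J ∈ T, ∀ θ : ℝ → ℝ, ContDiff ℝ (⊤ : ℕ∞) θ → HasCompactSupport θ → tsupport θ ⊆ Ioo (-1) 0 →
      ∫ t in Ioo (-1:ℝ) 0, θ t * ∫ x in ball (0:E3) 1, ∑ i, a i t x * J i x = 0) :
    ∀ᵐ t ∂muT, ∀ J ∈ T, ∫ x in ball (0:E3) 1, ∑ i, a i t x * J i x = 0 := by
  -- fixed J
  have fixed : ∀ J ∈ T, ∀ᵐ t ∂muT, ∫ x in ball (0:E3) 1, ∑ i, a i t x * J i x = 0 := by
    intro J hJ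
    have i1 : Integrable (fun z : ℝ × E3 => ∑ i, a i z.1 z.2 * J i z.2) (muT.prod muB) := by
      apply integrable_finsetSum
      intro i _
      obtain ⟨C, hC⟩ := J_bdd (J i) (hT J hJ i)
      have hc : Continuous (fun z : ℝ × E3 => J i z.2) := (hT J hJ i).comp continuous_snd
      have := (ha i).bdd_mul (c := C) (f := fun z : ℝ × E3 => J i z.2) hc.aestronglyMeasurable
        (by
          have : ∀ᵐ z ∂(muT.prod muB), z.2 ∈ ball (0:E3) 1 := by
            rw [Measure.prod_restrict]
            filter_upwards [ae_restrict_mem (measurableSet_Ioo.prod measurableSet_ball)] with z hz using hz.2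
          filter_upwards [this] with z hz using hC _ (ball_subset_closedBall hz))
      simpa only [mul_comm, Function.uncurry] using this
    have i2 := i1.integral_prod_left
    have i3 : LocallyIntegrableOn (fun t => ∫ x in ball (0:E3) 1, ∑ i, a i t x * J i x) (Ioo (-1:ℝ) 0) volume :=
      IntegrableOn.locallyIntegrableOn i2
    have := isOpen_Ioo.ae_eq_zero_of_integral_contDiff_smul_eq_zero i3 (by
      intro θ h1 h2 h3
      have := h J hJ θ h1 h2 h3
      rw [setIntegral_eq_integral_of_forall_compl_eq_zero] at this
      · exact this
      · intro t ht
        rw [image_eq_zero_of_notMem_tsupport (fun hc => ht (h3 hc)), zero_mul])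
    rw [ae_restrict_iff' measurableSet_Ioo]
    exact this
  let jet : T → C(closedBall (0:E3) 1, ι → ℝ) := fun J =>
    ⟨fun x i => J.1 i x.1, continuous_pi fun i => (hT J.1 J.2 i).comp continuous_subtype_val⟩
  rcases T.eq_empty_or_nonempty with he | hne
  · simp [he]
  have : Nonempty (range jet) := ⟨⟨jet ⟨_, hne.some_mem⟩, mem_range_self _⟩⟩
  let d := TopologicalSpace.denseSeq (range jet)
  have hd := TopologicalSpace.denseRange_denseSeq (range jet)
  have hJn : ∀ n, ∃ J : T, jet J = (d n).1 := fun n => (d n).2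
  choose Jn hJn using hJn
  have A : ∀ᵐ t ∂muT, ∀ n, ∫ x in ball (0:E3) 1, ∑ i, a i t x * (Jn n).1 i x = 0 :=
    ae_all_iff.2 fun n => fixed _ (Jn n).2
  have B : ∀ᵐ t ∂muT, ∀ i, Integrable (a i t) muB :=
    ae_all_iff.2 fun i => (ha i).prod_right_ae
  filter_upwards [A, B] with t hA hB J hJ
  set K : ℝ := ∫ x in ball (0:E3) 1, ∑ i, ‖a i t x‖
  have hK : 0 ≤ K := integral_nonneg fun x => Finset.sum_nonneg fun i _ => norm_nonneg _
  have key : ∀ ε > 0, ‖∫ x in ball (0:E3) 1, ∑ i, a i t x * J i x‖ ≤ ε * K := by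
    intro ε hε
    obtain ⟨y, hy, n, hn⟩ := Metric.dense_iff.1 hd ⟨jet ⟨J, hJ⟩, mem_range_self _⟩ ε hε
    have hy' : dist (jet (Jn n)) (jet ⟨J, hJ⟩) < ε := by
      have := mem_ball.1 hy
      rw [← hn, Subtype.dist_eq] at this
      rw [hJn n]; exact this
    have hb : ∀ i, ∀ x ∈ ball (0:E3) 1, ‖J i x - (Jn n).1 i x‖ ≤ ε := by
      intro i x hx
      have h1 := (ContinuousMap.dist_apply_le_dist (f := jet (Jn n)) (g := jet ⟨J, hJ⟩) ⟨x, ball_subset_closedBall hx⟩).trans hy'.le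
      have h2 := (dist_le_pi_dist _ _ i).trans h1
      rw [dist_comm, dist_eq_norm] at h2
      exact h2
    have e : ∫ x in ball (0:E3) 1, ∑ i, a i t x * J i x
        = ∫ x in ball (0:E3) 1, ∑ i, a i t x * (J i x - (Jn n).1 i x) := by
      have : ∀ x, ∑ i, a i t x * (J i x - (Jn n).1 i x) = ∑ i, a i t x * J i x - ∑ i, a i t x * (Jn n).1 i x := by
        intro x; rw [← Finset.sum_sub_distrib]; simp only [mul_sub]
      simp_rw [this]
      rw [integral_sub (integrable_finsetSum _ fun i _ => int_mul_J (hB i) (hT J hJ i))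
        (integrable_finsetSum _ fun i _ => int_mul_J (hB i) (hT _ (Jn n).2 i)), hA n, sub_zero]
    rw [e]
    calc _ ≤ ∫ x in ball (0:E3) 1, ε * ∑ i, ‖a i t x‖ := by
          apply norm_integral_le_of_norm_le
          · exact (integrable_finsetSum _ fun i _ => (hB i).norm).const_mul _
          · filter_upwards [ae_restrict_mem measurableSet_ball] with x hx
            refine (norm_sum_le _ _).trans ?_
            rw [Finset.mul_sum]
            refine Finset.sum_le_sum fun i _ => ?_
            rw [norm_mul, mul_comm]
            exact mul_le_mul_of_nonneg_right (hb i x hx) (norm_nonneg _)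
      _ = ε * K := by rw [integral_const_mul]
  have : ‖∫ x in ball (0:E3) 1, ∑ i, a i t x * J i x‖ ≤ 0 := by
    apply _root_.le_of_forall_pos_le_add
    intro δ hδ
    have := key (δ / (K + 1)) (by positivity)
    refine this.trans ?_
    rw [zero_add, div_mul_eq_mul_div, div_le_iff₀ (by positivity)]
    nlinarith
  exact norm_le_zero_iff.1 this

theorem pd_cmul (c : ℝ) {f : E3 → ℝ} {x : E3} (hf : DifferentiableAt ℝ f x) (i : Fin 3) :
    pd i (fun y => c * f y) x = c * pd i f x := by
  unfold pd
  rw [fderiv_const_mul hf]; rfl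

theorem pd_comm {f : E3 → ℝ} (hf : ContDiff ℝ (⊤ : ℕ∞) f) (i j : Fin 3) :
    pd i (fun y => pd j f y) = pd j (fun y => pd i f y) := by
  ext x
  have hs := (hf.contDiffAt (x := x)).isSymmSndFDerivAt (by simp; exact WithTop.coe_le_coe.2 (le_top : (2:ℕ∞) ≤ ⊤))
  have hd : DifferentiableAt ℝ (fderiv ℝ f) x :=
    (hf.fderiv_right (m := (⊤ : ℕ∞)) (by simp)).differentiable (by simp) x
  have e : ∀ i j : Fin 3, pd i (fun y => pd j f y) x = fderiv ℝ (fderiv ℝ f) x (EuclideanSpace.single i 1) (EuclideanSpace.single j 1) := by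
    intro i j
    unfold pd
    rw [fderiv_clm_apply hd (by fun_prop)]
    simp
  rw [e, e]
  exact hs _ _

theorem isTest_prod {θ : ℝ → ℝ} {ψ : E3 → ℝ} (h1 : ContDiff ℝ (⊤ : ℕ∞) θ) (h2 : HasCompactSupport θ)
    (h3 : tsupport θ ⊆ Ioo (-1) 0) (h4 : ContDiff ℝ (⊤ : ℕ∞) ψ) (h5 : HasCompactSupport ψ)
    (h6 : tsupport ψ ⊆ ball 0 1) : IsTest 1 (fun x t => θ t * ψ x) := by
  have hs : tsupport (fun z : E3 × ℝ => θ z.2 * ψ z.1) ⊆ tsupport ψ ×ˢ tsupport θ := by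
    refine closure_minimal ?_ ((isClosed_tsupport _).prod (isClosed_tsupport _))
    intro z hz
    have := hz
    rw [Function.mem_support] at this
    exact ⟨subset_tsupport _ (right_ne_zero_of_mul this), subset_tsupport _ (left_ne_zero_of_mul this)⟩
  refine ⟨(h1.comp contDiff_snd).mul (h4.comp contDiff_fst), ?_, ?_⟩
  · exact (h5.isCompact.prod h2.isCompact).of_isClosed_subset (isClosed_tsupport _) hs
  · refine hs.trans (prod_mono h6 ?_)
    simpa using h3

theorem isTestV_prod {θ : ℝ → ℝ} {ψ : E3 → ℝ} (h1 : ContDiff ℝ (⊤ : ℕ∞) θ) (h2 : HasCompactSupport θ)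
    (h3 : tsupport θ ⊆ Ioo (-1) 0) (h4 : ContDiff ℝ (⊤ : ℕ∞) ψ) (h5 : HasCompactSupport ψ)
    (h6 : tsupport ψ ⊆ ball 0 1) :
    IsTestV 1 (fun x t => WithLp.toLp 2 (fun i : Fin 3 => θ t * pd i ψ x)) := by
  have hs : tsupport (fun z : E3 × ℝ => (WithLp.toLp 2 (fun i : Fin 3 => θ z.2 * pd i ψ z.1) : E3)) ⊆ tsupport ψ ×ˢ tsupport θ := by
    refine closure_minimal ?_ ((isClosed_tsupport _).prod (isClosed_tsupport _))
    intro z hz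
    by_contra hc
    apply hz
    have : ∀ i : Fin 3, θ z.2 * pd i ψ z.1 = 0 := by
      intro i
      rw [mem_prod, not_and_or] at hc
      rcases hc with hc | hc
      · rw [image_eq_zero_of_notMem_tsupport (fun h => hc (pd_tsupport ψ i h)), mul_zero]
      · rw [image_eq_zero_of_notMem_tsupport hc, zero_mul]
    ext i; simp [this]
  refine ⟨?_, ?_, ?_⟩
  · rw [contDiff_euclidean]
    intro i
    exact (h1.comp contDiff_snd).mul ((pd_contDiff h4 i).comp contDiff_fst)
  · exact (h5.isCompact.prod h2.isCompact).of_isClosed_subset (isClosed_tsupport _) hs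
  · refine hs.trans (prod_mono h6 ?_)
    simpa using h3

theorem int_of {f : ℝ → E3 → ℝ} {G : ℝ → E3 → ℝ≥0∞} (hf : Measurable (Function.uncurry f))
    (hle : ∀ t x, ‖f t x‖ₑ ≤ 1 + G t x) (hG : ∫⁻ t, ∫⁻ x, G t x ∂muB ∂muT < ∞) :
    Integrable (Function.uncurry f) (muT.prod muB) := by
  refine ⟨hf.aestronglyMeasurable, ?_⟩
  rw [hasFiniteIntegral_iff_enorm, lintegral_prod _ hf.enorm.aemeasurable]
  have : ∫⁻ t, ∫⁻ x, (1 + G t x) ∂muB ∂muT < ∞ := by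
    simp_rw [lintegral_add_left measurable_const, lintegral_one]
    refine ENNReal.add_lt_top.2 ⟨?_, hG⟩
    rw [lintegral_const]
    refine ENNReal.mul_lt_top ?_ ?_
    · simpa using measure_ball_lt_top
    · simp
  exact (lintegral_mono fun t => lintegral_mono fun x => hle t x).trans_lt this

/-- extension by zero, time first -/
def xt {α : Type*} [Zero α] (f : E3 → ℝ → α) (t : ℝ) (x : E3) : α := (ball (0:E3) 1).indicator (fun y => f y t) x

theorem xt_in {α : Type*} [Zero α] (f : E3 → ℝ → α) (t : ℝ) {x : E3} (hx : x ∈ ball (0:E3) 1) : xt f t x = f x t :=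
  indicator_of_mem hx _

theorem xt_out {α : Type*} [Zero α] (f : E3 → ℝ → α) (t : ℝ) {x : E3} (hx : x ∉ ball (0:E3) 1) : xt f t x = 0 :=
  indicator_of_notMem hx _

theorem xt_meas {α : Type*} [Zero α] [MeasurableSpace α] {f : E3 → ℝ → α} (hf : Measurable (Function.uncurry f)) :
    Measurable (Function.uncurry (xt f)) := by
  have h1 : Measurable (fun z : ℝ × E3 => f z.2 z.1) := hf.comp measurable_swap
  have h2 := h1.indicator (measurable_snd (measurableSet_ball (x := (0:E3)) (ε := 1)))
  convert h2 using 1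
  ext z
  simp only [Function.uncurry, xt, indicator]; rfl

theorem one_neg_sq : (-(1^2) : ℝ) = -1 := by norm_num

theorem xt_u_int {u P} (S : SuitableWeakSolution 1 u P) :
    (∃ K : ℝ≥0∞, K ≠ ∞ ∧ ∀ᵐ t ∂muT, ∫⁻ x, ‖xt u t x‖ₑ ^ 2 ≤ K) ∧
    ∫⁻ t, ∫⁻ x, ‖xt u t x‖ₑ ^ 2 ∂muB ∂muT < ∞ := by
  have h := S.bdd_L2
  rw [one_neg_sq] at h
  have e : ∀ t, ∫⁻ x, ‖xt u t x‖ₑ ^ 2 = ∫⁻ x in ball (0:E3) 1, (‖u x t‖₊ : ℝ≥0∞) ^ 2 := by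
    intro t
    rw [← lintegral_indicator measurableSet_ball]
    refine lintegral_congr fun x => ?_
    by_cases hx : x ∈ ball (0:E3) 1
    · rw [xt_in u t hx, indicator_of_mem hx]; rfl
    · rw [xt_out u t hx, indicator_of_notMem hx]; simp
  have hb : ∀ᵐ t ∂muT, ∫⁻ x, ‖xt u t x‖ₑ ^ 2 ≤ essSup (fun t => ∫⁻ x in ball (0 : E3) 1, (‖u x t‖₊ : ℝ≥0∞) ^ 2) muT := by
    filter_upwards [_root_.ae_le_essSup (μ := muT) (f := fun t => ∫⁻ x in ball (0 : E3) 1, (‖u x t‖₊ : ℝ≥0∞) ^ 2)] with t ht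
    rw [e]; exact ht
  refine ⟨⟨_, h.ne, hb⟩, ?_⟩
  refine (lintegral_mono_ae (hb.mono fun t ht => (lintegral_mono' Measure.restrict_le_self le_rfl).trans ht)).trans_lt ?_
  rw [lintegral_const]
  exact ENNReal.mul_lt_top h (by simp)

theorem xt_g_int {u P} (S : SuitableWeakSolution 1 u P) :
    ∫⁻ t, ∫⁻ x, gn (xt S.gu t) x ^ 2 ∂muB ∂muT < ∞ ∧ ∫⁻ t, (∫⁻ x, gn (xt S.gu t) x ^ 2) ∂muT < ∞ := by
  have h := S.grad_L2
  rw [one_neg_sq] at h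
  have e : ∀ t, ∫⁻ x, gn (xt S.gu t) x ^ 2 = ∫⁻ x in ball (0 : E3) 1,
      ENNReal.ofReal (∑ i : Fin 3, ∑ j : Fin 3, (S.gu x t i j) ^ 2) := by
    intro t
    rw [← lintegral_indicator measurableSet_ball]
    refine lintegral_congr fun x => ?_
    have : ∀ M : Fin 3 → Fin 3 → ℝ, ENNReal.ofReal (√(∑ i : Fin 3, ∑ j : Fin 3, (M i j) ^ 2)) ^ 2 = 
        ENNReal.ofReal (∑ i : Fin 3, ∑ j : Fin 3, (M i j) ^ 2) := by
      intro M
      rw [← ENNReal.ofReal_pow (Real.sqrt_nonneg _), Real.sq_sqrt]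
      exact Finset.sum_nonneg fun i _ => Finset.sum_nonneg fun j _ => sq_nonneg _
    unfold gn
    rw [this]
    by_cases hx : x ∈ ball (0:E3) 1
    · rw [xt_in _ t hx, indicator_of_mem hx]
    · rw [xt_out _ t hx, indicator_of_notMem hx]; simp
  have h2 : ∫⁻ t, (∫⁻ x, gn (xt S.gu t) x ^ 2) ∂muT < ∞ := by simp_rw [e]; exact h
  exact ⟨(lintegral_mono fun t => lintegral_mono' Measure.restrict_le_self le_rfl).trans_lt h2, h2⟩

theorem xt_P_int {u P} (S : SuitableWeakSolution 1 u P) :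
    ∫⁻ t, ∫⁻ x, ‖xt P t x‖ₑ ∂muB ∂muT < ∞ := by
  have h := S.press_L32
  rw [one_neg_sq] at h
  have m : Measurable (Function.uncurry P) := S.meas_press
  have hle : ∀ a : ℝ≥0∞, a ≤ 1 + a ^ (3/2 : ℝ) := by
    intro a
    rcases le_total a 1 with ha | ha
    · exact ha.trans le_self_add
    · calc a = a ^ (1:ℝ) := by simp
        _ ≤ a ^ (3/2:ℝ) := ENNReal.rpow_le_rpow_of_exponent_le ha (by norm_num)
        _ ≤ _ := le_add_self
  calc ∫⁻ t, ∫⁻ x, ‖xt P t x‖ₑ ∂muB ∂muT ≤ ∫⁻ t, ∫⁻ x, (1 + ENNReal.ofReal |P x t| ^ (3/2:ℝ)) ∂muB ∂muT := by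
        refine lintegral_mono fun t => setLIntegral_mono' measurableSet_ball fun x hx => ?_
        rw [xt_in P t hx, ← ofReal_norm, Real.norm_eq_abs]
        exact hle _
    _ < ∞ := by
        simp_rw [lintegral_add_left measurable_const, lintegral_one]
        refine ENNReal.add_lt_top.2 ⟨?_, h⟩
        rw [lintegral_const]
        refine ENNReal.mul_lt_top ?_ ?_
        · simpa using measure_ball_lt_top
        · simp

theorem pd_sum {ι : Type} {s : Finset ι} {f : ι → E3 → ℝ} {x : E3} (hf : ∀ k ∈ s, DifferentiableAt ℝ (f k) x) (i : Fin 3) :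
    pd i (fun y => ∑ k ∈ s, f k y) x = ∑ k ∈ s, pd i (f k) x := by
  unfold pd
  rw [fderiv_fun_sum hf]
  simp

theorem int_mul_J2 {a : ℝ → E3 → ℝ} (ha : Integrable (Function.uncurry a) (muT.prod muB)) {J : E3 → ℝ} (hJ : Continuous J) :
    Integrable (fun z : ℝ × E3 => a z.1 z.2 * J z.2) (muT.prod muB) := by
  obtain ⟨C, hC⟩ := J_bdd J hJ
  have hc : Continuous (fun z : ℝ × E3 => J z.2) := hJ.comp continuous_snd
  have := ha.bdd_mul (c := C) (f := fun z : ℝ × E3 => J z.2) hc.aestronglyMeasurable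
    (by
      have : ∀ᵐ z ∂(muT.prod muB), z.2 ∈ ball (0:E3) 1 := by
        rw [Measure.prod_restrict]
        filter_upwards [ae_restrict_mem (measurableSet_Ioo.prod measurableSet_ball)] with z hz using hz.2
      filter_upwards [this] with z hz using hC _ (ball_subset_closedBall hz))
  simpa only [mul_comm, Function.uncurry] using this

theorem split_int {ι : Type} [Fintype ι] (a : ι → ℝ → E3 → ℝ)
    (ha : ∀ i, Integrable (Function.uncurry (a i)) (muT.prod muB)) (J : ι → E3 → ℝ) (hJ : ∀ i, Continuous (J i))
    {θ : ℝ → ℝ} (h1 : Continuous θ) (h2 : HasCompactSupport θ) :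
    ∫ t in Ioo (-1:ℝ) 0, θ t * ∫ x in ball (0:E3) 1, ∑ i, a i t x * J i x
      = ∑ i, ∫ t in Ioo (-1:ℝ) 0, ∫ x in ball (0:E3) 1, a i t x * (θ t * J i x) := by
  have B : ∀ᵐ t ∂muT, ∀ i, Integrable (a i t) muB :=
    ae_all_iff.2 fun i => (ha i).prod_right_ae
  obtain ⟨C, hC⟩ := h2.exists_bound_of_continuous h1
  have i1 : ∀ i, Integrable (fun t => θ t * ∫ x in ball (0:E3) 1, a i t x * J i x) muT := fun i =>
    (int_mul_J2 (ha i) (hJ i)).integral_prod_left.bdd_mul h1.aestronglyMeasurable (Eventually.of_forall hC)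
  calc _ = ∫ t in Ioo (-1:ℝ) 0, ∑ i, θ t * ∫ x in ball (0:E3) 1, a i t x * J i x := by
        refine integral_congr_ae ?_
        filter_upwards [B] with t ht
        rw [integral_finsetSum _ fun i _ => int_mul_J (ht i) (hJ i), Finset.mul_sum]
    _ = ∑ i, ∫ t in Ioo (-1:ℝ) 0, θ t * ∫ x in ball (0:E3) 1, a i t x * J i x := integral_finsetSum _ fun i _ => i1 i
    _ = _ := by
        refine Finset.sum_congr rfl fun i _ => integral_congr_ae (Eventually.of_forall fun t => ?_)
        simp only
        rw [← integral_const_mul]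
        congr 1; ext x; ring

theorem le_one_add_sq (a : ℝ≥0∞) : a ≤ 1 + a ^ 2 := by
  rcases le_total a 1 with ha | ha
  · exact ha.trans le_self_add
  · calc a = a * 1 := by simp
      _ ≤ a * a := by gcongr
      _ = a ^ 2 := by rw [sq]
      _ ≤ _ := le_add_self

theorem xt_ui {u P} (S : SuitableWeakSolution 1 u P) (i : Fin 3) :
    Integrable (Function.uncurry fun t x => xt u t x i) (muT.prod muB) := by
  refine int_of (G := fun t x => ‖xt u t x‖ₑ ^ 2) ?_ (fun t x => ?_) (xt_u_int S).2
  · have := xt_meas S.meas_u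
    have h2 : Measurable (fun v : E3 => v i) := by fun_prop
    exact h2.comp this
  · exact (enorm_coord_le _ _).trans (le_one_add_sq _)

theorem xt_uu {u P} (S : SuitableWeakSolution 1 u P) (i j : Fin 3) :
    Integrable (Function.uncurry fun t x => xt u t x i * xt u t x j) (muT.prod muB) := by
  refine int_of (G := fun t x => ‖xt u t x‖ₑ ^ 2) ?_ (fun t x => ?_) (xt_u_int S).2
  · have := xt_meas S.meas_u
    have h2 : Measurable (fun v : E3 => v i * v j) := by fun_prop
    exact h2.comp this
  · rw [enorm_mul, sq]
    exact (mul_le_mul' (enorm_coord_le _ i) (enorm_coord_le _ j)).trans le_add_self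

theorem xt_gij {u P} (S : SuitableWeakSolution 1 u P) (i j : Fin 3) :
    Integrable (Function.uncurry fun t x => xt S.gu t x i j) (muT.prod muB) := by
  refine int_of (G := fun t x => gn (xt S.gu t) x ^ 2) ?_ (fun t x => ?_) (xt_g_int S).1
  · exact (measurable_pi_apply j).comp ((measurable_pi_apply i).comp (xt_meas S.meas_gu))
  · exact (le_gn _ x i j).trans (le_one_add_sq _)

theorem xt_Pi {u P} (S : SuitableWeakSolution 1 u P) :
    Integrable (Function.uncurry fun t x => xt P t x) (muT.prod muB) :=
  int_of (G := fun t x => ‖xt P t x‖ₑ) (xt_meas S.meas_press) (fun _ _ => le_add_self) (xt_P_int S)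

def Tst (ψ : E3 → ℝ) : Prop := ContDiff ℝ (⊤ : ℕ∞) ψ ∧ HasCompactSupport ψ ∧ tsupport ψ ⊆ ball (0:E3) 1

theorem Tst.pd {ψ} (h : Tst ψ) (i : Fin 3) : Tst (pd i ψ) :=
  ⟨pd_contDiff h.1 i, pd_hcs h.2.1 i, (pd_tsupport _ i).trans h.2.2⟩

theorem Tst.sum {ι : Type} {s : Finset ι} {ψ : ι → E3 → ℝ} (h : ∀ i, Tst (ψ i)) : Tst (fun x => ∑ i ∈ s, ψ i x) := by
  classical
  induction s using Finset.induction_on with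
  | empty => simp only [Finset.sum_empty]; exact ⟨contDiff_const, HasCompactSupport.zero, by simp [tsupport, Function.support]⟩
  | insert a s ha ih =>
    simp only [Finset.sum_insert ha]
    refine ⟨(h a).1.add ih.1, (h a).2.1.add ih.2.1, ?_⟩
    exact (tsupport_add (ψ a) (fun x => ∑ i ∈ s, ψ i x)).trans (union_subset (h a).2.2 ih.2.2)

theorem Tst.lap {ψ} (h : Tst ψ) : Tst (lap ψ) := by
  have : _root_.lap ψ = fun x => ∑ i ∈ Finset.univ, _root_.pd i (fun y => _root_.pd i ψ y) x := rfl
  rw [this]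
  exact Tst.sum fun i => (h.pd i).pd i

theorem Tst.diff {ψ} (h : Tst ψ) : Differentiable ℝ ψ := h.1.differentiable (by simp)

theorem slice_grad {u P} (S : SuitableWeakSolution 1 u P) (i j : Fin 3) :
    ∀ᵐ t ∂muT, ∀ ψ, Tst ψ → ∫ x in ball (0:E3) 1, (xt u t x i * pd j ψ x + xt S.gu t x i j * ψ x) = 0 := by
  let T : Set (Bool → E3 → ℝ) := {J | ∃ ψ, Tst ψ ∧ J = fun b => if b then pd j ψ else ψ}
  have hT : ∀ J ∈ T, ∀ b, Continuous (J b) := by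
    rintro J ⟨ψ, h, rfl⟩ b
    cases b
    · exact h.1.continuous
    · exact (pd_contDiff h.1 j).continuous
  have ha : ∀ b : Bool, Integrable (Function.uncurry fun t x => if b then xt u t x i else xt S.gu t x i j) (muT.prod muB) := by
    intro b
    cases b
    · exact xt_gij S i j
    · exact xt_ui S i
  have := ae_all T hT (fun b t x => if b then xt u t x i else xt S.gu t x i j) ha (by
    rintro J ⟨ψ, h, rfl⟩ θ h1 h2 h3
    rw [split_int _ ha _ (hT _ ⟨ψ, h, rfl⟩) h1.continuous h2]
    have := S.is_grad _ (isTest_prod h1 h2 h3 h.1 h.2.1 h.2.2) i j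
    rw [one_neg_sq] at this
    simp only [Fintype.sum_bool, if_true, Bool.false_eq_true, if_false]
    rw [add_eq_zero_iff_eq_neg]
    convert this using 1
    · refine integral_congr_ae (Eventually.of_forall fun t => setIntegral_congr_fun measurableSet_ball fun x hx => ?_)
      simp only
      rw [xt_in u t hx, pd_cmul _ (h.diff x)]
    · congr 1
      refine integral_congr_ae (Eventually.of_forall fun t => setIntegral_congr_fun measurableSet_ball fun x hx => ?_)
      rw [xt_in _ t hx])
  filter_upwards [this] with t ht ψ hψ
  have := ht _ ⟨ψ, hψ, rfl⟩
  simpa using this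

theorem slice_div {u P} (S : SuitableWeakSolution 1 u P) :
    ∀ᵐ t ∂muT, ∀ ψ, Tst ψ → ∫ x in ball (0:E3) 1, ∑ i, xt u t x i * pd i ψ x = 0 := by
  let T : Set (Fin 3 → E3 → ℝ) := {J | ∃ ψ, Tst ψ ∧ J = fun i => pd i ψ}
  have hT : ∀ J ∈ T, ∀ b, Continuous (J b) := by
    rintro J ⟨ψ, h, rfl⟩ b
    exact (pd_contDiff h.1 b).continuous
  have := ae_all T hT (fun i t x => xt u t x i) (xt_ui S) (by
    rintro J ⟨ψ, h, rfl⟩ θ h1 h2 h3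
    have := S.weak_div _ (isTest_prod h1 h2 h3 h.1 h.2.1 h.2.2)
    rw [one_neg_sq] at this
    refine Eq.trans ?_ this
    refine integral_congr_ae (Eventually.of_forall fun t => ?_)
    simp only
    rw [← integral_const_mul]
    refine setIntegral_congr_fun measurableSet_ball fun x hx => ?_
    rw [xt_in u t hx, Finset.mul_sum]
    refine Finset.sum_congr rfl fun i _ => ?_
    rw [pd_cmul _ (h.diff x)]; ring)
  filter_upwards [this] with t ht ψ hψ
  exact ht _ ⟨ψ, hψ, rfl⟩

theorem slice_press {u P} (S : SuitableWeakSolution 1 u P) :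
    ∀ᵐ t ∂muT, ∀ ψ, Tst ψ → ∫ x in ball (0:E3) 1, (xt P t x * lap ψ x +
      ∑ z : Fin 3 × Fin 3, xt u t x z.1 * xt u t x z.2 * pd z.1 (fun y => pd z.2 ψ y) x) = 0 := by
  let T : Set (Option (Fin 3 × Fin 3) → E3 → ℝ) := {J | ∃ ψ, Tst ψ ∧ J = fun o => match o with
    | none => lap ψ
    | some z => pd z.1 (fun y => pd z.2 ψ y)}
  have hT : ∀ J ∈ T, ∀ b, Continuous (J b) := by
    rintro J ⟨ψ, h, rfl⟩ b
    cases b with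
    | none => exact h.lap.1.continuous
    | some z => exact ((h.pd z.2).pd z.1).1.continuous
  let a : Option (Fin 3 × Fin 3) → ℝ → E3 → ℝ := fun o t x => match o with
    | none => xt P t x
    | some z => xt u t x z.1 * xt u t x z.2
  have ha : ∀ o, Integrable (Function.uncurry (a o)) (muT.prod muB) := by
    intro o
    cases o with
    | none => exact xt_Pi S
    | some z => exact xt_uu S z.1 z.2
  have := ae_all T hT a ha (by
    rintro J ⟨ψ, h, rfl⟩ θ h1 h2 h3
    have := S.weak_NS _ (isTestV_prod h1 h2 h3 h.1 h.2.1 h.2.2)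
    rw [one_neg_sq] at this
    have B : ∀ᵐ t ∂muT, ∀ i, Integrable (a i t) muB :=
      ae_all_iff.2 fun i => (ha i).prod_right_ae
    have Bu : ∀ᵐ t ∂muT, ∀ i, Integrable (fun x => xt u t x i) muB :=
      ae_all_iff.2 fun i => (xt_ui S i).prod_right_ae
    rw [← neg_eq_zero]
    refine Eq.trans ?_ this
    rw [← integral_neg]
    refine integral_congr_ae ?_
    filter_upwards [slice_div S, B, Bu] with t hd hB hBu
    have d1 := hd _ h
    have d2 := hd _ h.lap
    have key : ∀ x ∈ ball (0:E3) 1, (-(∑ i : Fin 3, u x t i * deriv (fun s => θ s * pd i ψ x) t)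
          - (∑ i : Fin 3, u x t i * lap (fun y => θ t * pd i ψ y) x)
          - (∑ i : Fin 3, ∑ j : Fin 3, u x t i * u x t j * pd i (fun y => θ t * pd j ψ y) x)
          - P x t * (∑ j : Fin 3, pd j (fun y => θ t * pd j ψ y) x))
        = (-(deriv θ t)) * (∑ i, xt u t x i * pd i ψ x) + (-(θ t)) * (∑ i, xt u t x i * pd i (lap ψ) x)
          + (-(θ t)) * (∑ o, a o t x * (match o with
            | none => lap ψ x
            | some z => pd z.1 (fun y => pd z.2 ψ y) x)) := by
      intro x hx
      have e1 : ∀ i, deriv (fun s => θ s * pd i ψ x) t = deriv θ t * pd i ψ x := fun i =>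
        deriv_mul_const ((h1.differentiable (by simp)) t) _
      have e2 : ∀ i j, pd i (fun y => θ t * pd j ψ y) x = θ t * pd i (fun y => pd j ψ y) x := fun i j =>
        pd_cmul _ ((h.pd j).diff x) i
      have e3 : ∀ i, lap (fun y => θ t * pd i ψ y) x = θ t * pd i (lap ψ) x := by
        intro i
        have e4 : lap ψ = fun x => ∑ k, pd k (fun y => pd k ψ y) x := rfl
        have e5 : pd i (lap ψ) x = ∑ k, pd i (fun x => pd k (fun y => pd k ψ y) x) x := by
          rw [e4]
          exact pd_sum (f := fun k => pd k (fun y => pd k ψ y)) (fun k _ => ((h.pd k).pd k).diff x) i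
        rw [e5, lap, Finset.mul_sum]
        refine Finset.sum_congr rfl fun k _ => ?_
        have e6 : (fun y => pd k (fun y => θ t * pd i ψ y) y) = fun y => θ t * pd k (fun y => pd i ψ y) y := by
          ext y
          exact pd_cmul _ ((h.pd i).diff y) k
        rw [e6]
        have hki : Tst (fun y => pd k (fun y => pd i ψ y) y) := (h.pd i).pd k
        rw [pd_cmul _ (hki.diff x) k]
        have e7 : (fun y => pd k (fun y => pd i ψ y) y) = (fun y => pd i (fun y => pd k ψ y) y) := pd_comm h.1 k i
        rw [e7, pd_comm (h.pd k).1 k i]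
      simp only [e1, e2, e3]
      rw [xt_in u t hx, Fintype.sum_option, Fintype.sum_prod_type]
      simp only [a, xt_in u t hx, xt_in P t hx, lap, Fin.sum_univ_three]
      ring
    rw [setIntegral_congr_fun measurableSet_ball key]
    have j1 : Integrable (fun x => ∑ i, xt u t x i * pd i ψ x) muB :=
      integrable_finsetSum _ fun i _ => int_mul_J (hBu i) (h.pd i).1.continuous
    have j2 : Integrable (fun x => ∑ i, xt u t x i * pd i (lap ψ) x) muB :=
      integrable_finsetSum _ fun i _ => int_mul_J (hBu i) (h.lap.pd i).1.continuous
    have j3 : Integrable (fun x => ∑ o, a o t x * (match o with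
            | none => lap ψ x
            | some z => pd z.1 (fun y => pd z.2 ψ y) x)) muB := by
      refine integrable_finsetSum _ fun o _ => ?_
      have := int_mul_J (hB o) (hT _ ⟨ψ, h, rfl⟩ o)
      cases o <;> exact this
    rw [integral_add (f := fun x => (-(deriv θ t)) * (∑ i, xt u t x i * pd i ψ x) + (-(θ t)) * (∑ i, xt u t x i * pd i (lap ψ) x))
        ((j1.const_mul _).add (j2.const_mul _)) (j3.const_mul _), integral_add (j1.const_mul _) (j2.const_mul _),
        integral_const_mul, integral_const_mul, integral_const_mul, d1, d2, mul_zero, mul_zero, zero_add, zero_add, neg_mul]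
    congr 2)
  filter_upwards [this] with t ht ψ hψ
  have := ht _ ⟨ψ, hψ, rfl⟩
  simpa [Fintype.sum_option, a] using this

theorem slice_of {u P} (S : SuitableWeakSolution 1 u P) :
    ∀ᵐ t ∂muT, Slice (xt u t) (xt S.gu t) (xt P t) := by
  obtain ⟨K, hK, hb⟩ := (xt_u_int S).1
  have hg : ∀ᵐ t ∂muT, ∫⁻ x, gn (xt S.gu t) x ^ 2 < ∞ := by
    refine ae_lt_top' ?_ (xt_g_int S).2.ne
    have h1 : Measurable (fun z : ℝ × E3 => gn (xt S.gu z.1) z.2 ^ 2) := by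
      have h := xt_meas S.meas_gu
      have : ∀ i j, Measurable (fun z : ℝ × E3 => xt S.gu z.1 z.2 i j) := fun i j =>
        (measurable_pi_apply j).comp ((measurable_pi_apply i).comp h)
      unfold gn
      fun_prop
    exact h1.lintegral_prod_right'.aemeasurable
  have gl : ∀ {f : E3 → ℝ}, (∀ x, x ∉ ball (0:E3) 1 → f x = 0) → ∫ x in ball (0:E3) 1, f x = ∫ x, f x :=
    fun hf => setIntegral_eq_integral_of_forall_compl_eq_zero hf
  filter_upwards [hb, hg, (xt_Pi S).prod_right_ae, ae_all_iff.2 fun i => ae_all_iff.2 fun j => slice_grad S i j,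
    slice_div S, slice_press S, ae_all_iff.2 fun i => (xt_ui S i).prod_right_ae,
    ae_all_iff.2 fun i => ae_all_iff.2 fun j => (xt_gij S i j).prod_right_ae,
    ae_all_iff.2 fun i => ae_all_iff.2 fun j => (xt_uu S i j).prod_right_ae] with t hb hg hP h1 h2 h3 iu ig iuu
  simp only [Function.uncurry] at hP iu ig iuu
  refine ⟨(xt_meas S.meas_u).of_uncurry_left, (xt_meas S.meas_gu).of_uncurry_left, (xt_meas S.meas_press).of_uncurry_left,
    hb.trans_lt hK.lt_top, hg, ?_, fun x hx => xt_out _ _ hx, fun x hx => xt_out _ _ hx, fun x hx => xt_out _ _ hx, ?_, ?_, ?_⟩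
  · have := hP.2
    rw [hasFiniteIntegral_iff_enorm] at this
    rw [← setLIntegral_eq_of_support_subset (s := ball (0:E3) 1)]
    · exact this
    · intro x hx
      by_contra hc
      exact hx (by simp [xt_out P t hc])
  · intro ψ a b c i j
    have h := h1 i j ψ ⟨a, b, c⟩
    have T : Tst ψ := ⟨a, b, c⟩
    rw [integral_add (int_mul_J (iu i) (T.pd j).1.continuous) (int_mul_J (ig i j) a.continuous),
      gl fun x hx => by simp [xt_out u t hx], gl fun x hx => by simp [xt_out _ t hx]] at h
    linarith
  · intro ψ a b c
    have h := h2 ψ ⟨a, b, c⟩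
    rwa [gl fun x hx => by simp [xt_out u t hx]] at h
  · intro ψ a b c
    have h := h3 ψ ⟨a, b, c⟩
    have T : Tst ψ := ⟨a, b, c⟩
    rw [integral_add (int_mul_J hP T.lap.1.continuous) (integrable_finsetSum _ fun (z : Fin 3 × Fin 3) _ =>
      int_mul_J (iuu z.1 z.2) ((T.pd z.2).pd z.1).1.continuous),
      gl fun x hx => by simp [xt_out P t hx], gl fun x hx => by simp [xt_out _ t hx]] at h
    have e : (∫ x, ∑ i : Fin 3, ∑ j : Fin 3, xt u t x i * xt u t x j * pd j (fun y => pd i ψ y) x)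
        = ∫ x, ∑ z : Fin 3 × Fin 3, xt u t x z.1 * xt u t x z.2 * pd z.1 (fun y => pd z.2 ψ y) x := by
      congr 1; ext x
      rw [Fintype.sum_prod_type, Finset.sum_comm]
      refine Finset.sum_congr rfl fun i _ => Finset.sum_congr rfl fun j _ => ?_
      ring
    rw [e]; linarith

structure Good (u : ℝ → E3 → E3) (g : ℝ → E3 → Fin 3 → Fin 3 → ℝ) (P : ℝ → E3 → ℝ) : Prop where
  mu : Measurable (Function.uncurry u)
  mg : Measurable (Function.uncurry g)
  mP : Measurable (Function.uncurry P)
  slice : ∀ᵐ t ∂muT, Slice (u t) (g t) (P t)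
  bdd : ∃ K : ℝ≥0∞, K ≠ ∞ ∧ ∀ᵐ t ∂muT, ∫⁻ x, ‖u t x‖ₑ ^ 2 ≤ K
  grad : ∫⁻ t, (∫⁻ x, gn (g t) x ^ 2) ∂muT < ∞
  energy : ∀ (Φ : E3 → ℝ → ℝ) (N : ℕ) (φ : ℕ → E3 → ℝ → ℝ) (c : ℕ → ℝ → ℝ), IsTest 1 Φ → (∀ x t, 0 ≤ Φ x t) →
    (∀ k s, Tst (fun x => φ k x s)) → (∀ x s, Φ x s = ∑ k ∈ Finset.range N, φ k x s) →
    ∀ᵐ t ∂muT, (∫⁻ x, ‖u t x‖ₑ ^ 2 * ENNReal.ofReal (Φ x t))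
        + 2 * ∫⁻ s in Ioo (-1) t, ∫⁻ x, gn (g s) x ^ 2 * ENNReal.ofReal (Φ x s)
      ≤ (∫⁻ s in Ioo (-1) t, ∫⁻ x, ‖u s x‖ₑ ^ 2 * ENNReal.ofReal (deriv (fun τ => Φ x τ) s + lap (fun y => Φ y s) x))
        + ∫⁻ s in Ioo (-1) t, ∫⁻ x, ∑ k ∈ Finset.range N, ‖u s x‖ₑ * ‖fderiv ℝ (fun y => φ k y s) x‖ₑ
            * (‖u s x‖ₑ ^ 2 + 2 * ‖P s x - c k s‖ₑ)

theorem sum_pd_eq (v : E3) (f : E3 → ℝ) (x : E3) : ∑ i : Fin 3, v i * pd i f x = fderiv ℝ f x v := by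
  have e : v = ∑ j : Fin 3, v j • (EuclideanSpace.single j (1:ℝ) : E3) := by
    ext i
    fin_cases i <;> simp [Fin.sum_univ_three]
  conv_rhs => rw [e]
  rw [map_sum]
  simp [pd]

theorem ofReal_int_le {α : Type*} [MeasurableSpace α] {μ : Measure α} (f : α → ℝ) :
    ENNReal.ofReal (∫ x, f x ∂μ) ≤ ∫⁻ x, ENNReal.ofReal (f x) ∂μ := by
  by_cases hf : Integrable f μ
  · calc ENNReal.ofReal (∫ x, f x ∂μ) ≤ ENNReal.ofReal (∫ x, max (f x) 0 ∂μ) :=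
          ENNReal.ofReal_le_ofReal (integral_mono hf (hf.pos_part) fun x => le_max_left _ _)
      _ = ∫⁻ x, ENNReal.ofReal (max (f x) 0) ∂μ :=
          ofReal_integral_eq_lintegral_ofReal hf.pos_part (Eventually.of_forall fun x => le_max_right _ _)
      _ = _ := by
          refine lintegral_congr fun x => ?_
          rcases le_total (f x) 0 with h | h
          · rw [max_eq_right h, ENNReal.ofReal_of_nonpos h]; simp
          · rw [max_eq_left h]
  · rw [integral_undef hf]; simp

theorem gn_meas2 {g : ℝ → E3 → Fin 3 → Fin 3 → ℝ} (h : Measurable (Function.uncurry g)) :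
    Measurable (fun z : ℝ × E3 => gn (g z.1) z.2) := by
  have : ∀ i j, Measurable (fun z : ℝ × E3 => g z.1 z.2 i j) := fun i j =>
    (measurable_pi_apply j).comp ((measurable_pi_apply i).comp h)
  unfold gn
  fun_prop

theorem gn_sq (g : E3 → Fin 3 → Fin 3 → ℝ) (x : E3) :
    gn g x ^ 2 = ENNReal.ofReal (∑ i : Fin 3, ∑ j : Fin 3, (g x i j) ^ 2) := by
  unfold gn
  rw [← ENNReal.ofReal_pow (Real.sqrt_nonneg _), Real.sq_sqrt]
  exact Finset.sum_nonneg fun i _ => Finset.sum_nonneg fun j _ => sq_nonneg _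

theorem good_energy {u P} (S : SuitableWeakSolution 1 u P) (Φ : E3 → ℝ → ℝ) (N : ℕ) (φ : ℕ → E3 → ℝ → ℝ)
    (c : ℕ → ℝ → ℝ) (hΦ : IsTest 1 Φ) (h0 : ∀ x t, 0 ≤ Φ x t)
    (hT : ∀ k s, Tst (fun x => φ k x s)) (hsum : ∀ x s, Φ x s = ∑ k ∈ Finset.range N, φ k x s) :
    ∀ᵐ t ∂muT, (∫⁻ x, ‖xt u t x‖ₑ ^ 2 * ENNReal.ofReal (Φ x t))
        + 2 * ∫⁻ s in Ioo (-1) t, ∫⁻ x, gn (xt S.gu s) x ^ 2 * ENNReal.ofReal (Φ x s)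
      ≤ (∫⁻ s in Ioo (-1) t, ∫⁻ x, ‖xt u s x‖ₑ ^ 2 * ENNReal.ofReal (deriv (fun τ => Φ x τ) s + lap (fun y => Φ y s) x))
        + ∫⁻ s in Ioo (-1) t, ∫⁻ x, ∑ k ∈ Finset.range N, ‖xt u s x‖ₑ * ‖fderiv ℝ (fun y => φ k y s) x‖ₑ
            * (‖xt u s x‖ₑ ^ 2 + 2 * ‖xt P s x - c k s‖ₑ) := by
  have hE := S.local_energy Φ hΦ h0
  rw [one_neg_sq] at hE
  obtain ⟨M, hM⟩ := hΦ.2.1.exists_bound_of_continuous hΦ.1.continuous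
  have hM' : ∀ x t, ‖Φ x t‖ ≤ M := fun x t => hM (x, t)
  have hΦm : Measurable (fun z : ℝ × E3 => Φ z.2 z.1) := hΦ.1.continuous.measurable.comp measurable_swap
  -- integrability of |g|²Φ
  have ig : Integrable (fun z : ℝ × E3 => (∑ i : Fin 3, ∑ j : Fin 3, (xt S.gu z.1 z.2 i j) ^ 2)) (muT.prod volume) := by
    have mm : Measurable (fun z : ℝ × E3 => (∑ i : Fin 3, ∑ j : Fin 3, (xt S.gu z.1 z.2 i j) ^ 2)) := by
      have : ∀ i j, Measurable (fun z : ℝ × E3 => xt S.gu z.1 z.2 i j) := fun i j =>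
        (measurable_pi_apply j).comp ((measurable_pi_apply i).comp (xt_meas S.meas_gu))
      fun_prop
    refine ⟨mm.aestronglyMeasurable, ?_⟩
    rw [hasFiniteIntegral_iff_enorm, lintegral_prod _ mm.enorm.aemeasurable]
    refine lt_of_eq_of_lt ?_ (xt_g_int S).2
    refine lintegral_congr fun t => lintegral_congr fun x => ?_
    rw [gn_sq, ← ofReal_norm, Real.norm_of_nonneg]
    exact Finset.sum_nonneg fun i _ => Finset.sum_nonneg fun j _ => sq_nonneg _
  have igΦ : Integrable (fun z : ℝ × E3 => (∑ i : Fin 3, ∑ j : Fin 3, (xt S.gu z.1 z.2 i j) ^ 2) * Φ z.2 z.1) (muT.prod volume) := by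
    have := ig.bdd_mul (c := M) hΦm.aestronglyMeasurable (Eventually.of_forall fun z => hM' z.2 z.1)
    simpa only [mul_comm] using this
  have gnn : ∀ s x, 0 ≤ (∑ i : Fin 3, ∑ j : Fin 3, (xt S.gu s x i j) ^ 2) * Φ x s := fun s x =>
    mul_nonneg (Finset.sum_nonneg fun i _ => Finset.sum_nonneg fun j _ => sq_nonneg _) (h0 x s)
  have gl : ∀ {f : E3 → ℝ}, (∀ x, x ∉ ball (0:E3) 1 → f x = 0) → ∫ x in ball (0:E3) 1, f x = ∫ x, f x :=
    fun hf => setIntegral_eq_integral_of_forall_compl_eq_zero hf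
  filter_upwards [hE, slice_of S, ae_restrict_mem measurableSet_Ioo] with t hE hS ht
  have hsub : (volume.restrict (Ioo (-1) t) : Measure ℝ) ≤ muT :=
    Measure.restrict_mono (Ioo_subset_Ioo le_rfl ht.2.le) le_rfl
  -- first term
  have A : ∫⁻ x, ‖xt u t x‖ₑ ^ 2 * ENNReal.ofReal (Φ x t) = ENNReal.ofReal (∫ x in ball (0 : E3) 1, ‖u x t‖ ^ 2 * Φ x t) := by
    have e : ∫ x in ball (0 : E3) 1, ‖u x t‖ ^ 2 * Φ x t = ∫ x, ‖xt u t x‖ ^ 2 * Φ x t := by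
      rw [← gl fun x hx => by simp [xt_out u t hx]]
      exact setIntegral_congr_fun measurableSet_ball fun x hx => by simp only [xt_in u t hx]
    have i2 : Integrable (fun x => ‖xt u t x‖ ^ 2) := by
      refine ⟨(hS.mu.norm.pow_const 2).aestronglyMeasurable, ?_⟩
      rw [hasFiniteIntegral_iff_enorm]
      refine lt_of_eq_of_lt (lintegral_congr fun x => ?_) hS.Lu
      rw [enorm_pow, enorm_norm]
    have i3 : Integrable (fun x => ‖xt u t x‖ ^ 2 * Φ x t) := by
      have m : Measurable (fun x => Φ x t) := hΦ.1.continuous.measurable.comp (measurable_id.prodMk measurable_const)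
      have := i2.bdd_mul (c := M) m.aestronglyMeasurable (Eventually.of_forall fun x => hM' x t)
      simpa only [mul_comm] using this
    rw [e, ofReal_integral_eq_lintegral_ofReal i3 (Eventually.of_forall fun x => mul_nonneg (by positivity) (h0 x t))]
    refine lintegral_congr fun x => ?_
    rw [ENNReal.ofReal_mul (by positivity), ENNReal.ofReal_pow (norm_nonneg _), ofReal_norm]
  have B : ∫⁻ s in Ioo (-1) t, ∫⁻ x, gn (xt S.gu s) x ^ 2 * ENNReal.ofReal (Φ x s) = ENNReal.ofReal (∫ s in Ioo (-1) t, ∫ x in ball (0 : E3) 1,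
              (∑ i : Fin 3, ∑ j : Fin 3, (S.gu x s i j) ^ 2) * Φ x s) := by
    have e : ∀ s, ∫ x in ball (0 : E3) 1, (∑ i : Fin 3, ∑ j : Fin 3, (S.gu x s i j) ^ 2) * Φ x s
        = ∫ x, (∑ i : Fin 3, ∑ j : Fin 3, (xt S.gu s x i j) ^ 2) * Φ x s := by
      intro s
      rw [← gl fun x hx => by simp [xt_out _ s hx]]
      exact setIntegral_congr_fun measurableSet_ball fun x hx => by simp only [xt_in _ s hx]
    simp_rw [e]
    rw [ofReal_integral_eq_lintegral_ofReal (igΦ.integral_prod_left.mono_measure hsub)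
      (Eventually.of_forall fun s => integral_nonneg fun x => gnn s x)]
    have h2 := (Measure.absolutelyContinuous_of_le hsub).ae_le igΦ.prod_right_ae
    refine lintegral_congr_ae ?_
    filter_upwards [h2] with s hs
    rw [ofReal_integral_eq_lintegral_ofReal hs (Eventually.of_forall fun x => gnn s x)]
    refine lintegral_congr fun x => ?_
    rw [ENNReal.ofReal_mul (Finset.sum_nonneg fun i _ => Finset.sum_nonneg fun j _ => sq_nonneg _), gn_sq]
  rw [A, B]
  have e2 : ∀ a b : ℝ, 0 ≤ a → 0 ≤ b → ENNReal.ofReal a + 2 * ENNReal.ofReal b = ENNReal.ofReal (a + 2 * b) := by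
    intro a b ha hb
    rw [ENNReal.ofReal_add ha (by positivity), ENNReal.ofReal_mul (by norm_num)]; simp
  rw [e2 _ _ (integral_nonneg fun x => mul_nonneg (by positivity) (h0 x t))
    (integral_nonneg fun s => integral_nonneg fun x => mul_nonneg
      (Finset.sum_nonneg fun i _ => Finset.sum_nonneg fun j _ => sq_nonneg _) (h0 x s))]
  refine (ENNReal.ofReal_le_ofReal hE).trans (ENNReal.ofReal_add_le.trans (add_le_add ?_ ?_))
  · refine (ofReal_int_le _).trans (lintegral_mono fun s => (ofReal_int_le _).trans ?_)
    rw [← lintegral_indicator measurableSet_ball]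
    refine lintegral_mono fun x => ?_
    by_cases hx : x ∈ ball (0:E3) 1
    · rw [indicator_of_mem hx, xt_in u s hx, ENNReal.ofReal_mul (by positivity), ENNReal.ofReal_pow (norm_nonneg _), ofReal_norm]
    · rw [indicator_of_notMem hx]; exact bot_le
  · refine (Real.ofReal_le_enorm _).trans ((enorm_integral_le_lintegral_enorm _).trans ?_)
    have h2 := (Measure.absolutelyContinuous_of_le hsub).ae_le (slice_of S)
    refine lintegral_mono_ae ?_
    filter_upwards [h2] with s hs
    have hdiff : ∀ x i, pd i (fun y => Φ y s) x = ∑ k ∈ Finset.range N, pd i (fun y => φ k y s) x := by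
      intro x i
      have : (fun y => Φ y s) = fun y => ∑ k ∈ Finset.range N, φ k y s := by ext y; exact hsum y s
      rw [this]
      exact pd_sum (f := fun k y => φ k y s) (fun k _ => (hT k s).diff x) i
    have e3 : (∫ x in ball (0 : E3) 1, (∑ i : Fin 3, u x s i * pd i (fun y => Φ y s) x) * (‖u x s‖ ^ 2 + 2 * P x s))
        = ∫ x, (∑ i : Fin 3, xt u s x i * pd i (fun y => Φ y s) x) * (‖xt u s x‖ ^ 2 + 2 * xt P s x) := by
      rw [← gl fun x hx => by simp [xt_out _ s hx]]
      exact setIntegral_congr_fun measurableSet_ball fun x hx => by simp only [xt_in _ s hx]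
    have idiv : ∀ k, Integrable (fun x => ∑ i : Fin 3, xt u s x i * pd i (fun y => φ k y s) x) := fun k =>
      integrable_finsetSum _ fun i _ => int_mul_cc (hs.ui_int i) ((hT k s).pd i).1.continuous ((hT k s).pd i).2.1
    have icor : Integrable (fun x => ∑ k ∈ Finset.range N, 2 * c k s * ∑ i : Fin 3, xt u s x i * pd i (fun y => φ k y s) x) :=
      integrable_finsetSum _ fun k _ => (idiv k).const_mul _
    have hcor : ∫ x, (∑ k ∈ Finset.range N, 2 * c k s * ∑ i : Fin 3, xt u s x i * pd i (fun y => φ k y s) x) = 0 := by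
      rw [integral_finsetSum _ fun k _ => (idiv k).const_mul _]
      refine Finset.sum_eq_zero fun k _ => ?_
      rw [integral_const_mul, hs.div _ (hT k s).1 (hT k s).2.1 (hT k s).2.2, mul_zero]
    have e4 : ∫ x, (∑ i : Fin 3, xt u s x i * pd i (fun y => Φ y s) x) * (‖xt u s x‖ ^ 2 + 2 * xt P s x)
        = ∫ x, ∑ k ∈ Finset.range N, (∑ i : Fin 3, xt u s x i * pd i (fun y => φ k y s) x) * (‖xt u s x‖ ^ 2 + 2 * (xt P s x - c k s)) := by
      have e5 : ∀ x, ∑ k ∈ Finset.range N, (∑ i : Fin 3, xt u s x i * pd i (fun y => φ k y s) x) * (‖xt u s x‖ ^ 2 + 2 * (xt P s x - c k s))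
          = (∑ i : Fin 3, xt u s x i * pd i (fun y => Φ y s) x) * (‖xt u s x‖ ^ 2 + 2 * xt P s x)
            - ∑ k ∈ Finset.range N, 2 * c k s * ∑ i : Fin 3, xt u s x i * pd i (fun y => φ k y s) x := by
        intro x
        have e6 : ∑ i : Fin 3, xt u s x i * pd i (fun y => Φ y s) x
            = ∑ k ∈ Finset.range N, ∑ i : Fin 3, xt u s x i * pd i (fun y => φ k y s) x := by
          rw [Finset.sum_comm]
          refine Finset.sum_congr rfl fun i _ => ?_
          rw [hdiff, Finset.mul_sum]
        rw [e6, Finset.sum_mul, ← Finset.sum_sub_distrib]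
        refine Finset.sum_congr rfl fun k _ => ?_
        ring
      simp_rw [e5]
      by_cases hi : Integrable (fun x => (∑ i : Fin 3, xt u s x i * pd i (fun y => Φ y s) x) * (‖xt u s x‖ ^ 2 + 2 * xt P s x))
      · rw [integral_sub hi icor, hcor, sub_zero]
      · rw [integral_undef hi, integral_undef]
        intro hc
        apply hi
        have := hc.add icor
        refine this.congr (Eventually.of_forall fun x => ?_)
        simp
    rw [e3, e4]
    refine (enorm_integral_le_lintegral_enorm _).trans (lintegral_mono fun x => ?_)
    refine (enorm_sum_le _ _).trans (Finset.sum_le_sum fun k _ => ?_)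
    rw [enorm_mul, sum_pd_eq]
    refine mul_le_mul' ?_ ?_
    · rw [mul_comm]
      exact ContinuousLinearMap.le_opENorm _ _
    · refine (enorm_add_le _ _).trans (add_le_add ?_ ?_)
      · rw [enorm_pow, enorm_norm]
      · rw [enorm_mul]
        refine mul_le_mul' (le_of_eq ?_) le_rfl
        rw [← ofReal_norm]; norm_num

theorem good_of {u P} (S : SuitableWeakSolution 1 u P) : Good (xt u) (xt S.gu) (xt P) :=
  ⟨xt_meas S.meas_u, xt_meas S.meas_gu, xt_meas S.meas_press, slice_of S, (xt_u_int S).1, (xt_g_int S).2,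
    fun Φ N φ c a b d e => good_energy S Φ N φ c a b d e⟩

/-- Choice of the mollification scale `h`. -/
theorem num_h {b p : ℝ} (hb : 0 < b) (hb2 : b < 2) (hp : 2 / b < p) : ∃ m : ℝ, 0 ≤ m ∧ ∀ l n : ℝ, 0 < l → l ≤ 1 → 0 ≤ n →
    ∃ h : ℝ, 0 < h ∧ h ≤ l ^ (1 / b) ∧ n * h ^ b ≤ l ∧
      (n * h ^ (b - 2) * (h ^ (-3 : ℝ) * n ^ 2) ≤ l ^ (-m) * n ∨ n * h ^ (b - 2) ≤ l * n ^ p) := by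
  set a := 2 / b with ha
  have a0 : 0 < a := by positivity
  have pa : 0 < p - a := by linarith
  set e1 := a / (p - a) with he1
  have e10 : 0 < e1 := by positivity
  set e0 := (1 + e1) / b with he0
  have e00 : 0 < e0 := by positivity
  refine ⟨e0 * (5 - b) + 2 * e1, by nlinarith, fun l n hl hl1 hn => ?_⟩
  by_cases hc : n ≤ l ^ (-e1)
  · refine ⟨l ^ e0, by positivity, ?_, ?_, Or.inl ?_⟩
    · apply Real.rpow_le_rpow_of_exponent_ge hl hl1
      rw [he0]; gcongr; linarith
    · rw [← Real.rpow_mul hl.le, show e0 * b = 1 + e1 by rw [he0]; field_simp]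
      calc n * l ^ (1 + e1) ≤ l ^ (-e1) * l ^ (1 + e1) := by gcongr
        _ = l := by rw [← Real.rpow_add hl]; simp
    · rw [← Real.rpow_mul hl.le, ← Real.rpow_mul hl.le]
      calc n * l ^ (e0 * (b - 2)) * (l ^ (e0 * -3) * n ^ 2) ≤
          n * l ^ (e0 * (b - 2)) * (l ^ (e0 * -3) * (l ^ (-e1)) ^ 2) := by gcongr
        _ = (l ^ (e0 * (b - 2)) * l ^ (e0 * -3) * (l ^ (-e1) * l ^ (-e1))) * n := by ring
        _ = _ := by
          rw [← Real.rpow_add hl, ← Real.rpow_add hl, ← Real.rpow_add hl]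
          congr 2; ring
  · push Not at hc
    have l1 : 1 ≤ l ^ (-e1) := Real.one_le_rpow_of_pos_of_le_one_of_nonpos hl hl1 (by linarith)
    have n1 : 1 < n := l1.trans_lt hc
    have n0 : 0 < n := by linarith
    refine ⟨(l / n) ^ (1 / b), by positivity, ?_, ?_, Or.inr ?_⟩
    · apply Real.rpow_le_rpow (by positivity) _ (by positivity)
      exact div_le_self hl.le n1.le
    · rw [← Real.rpow_mul (by positivity), show 1 / b * b = 1 by field_simp, Real.rpow_one]
      exact le_of_eq (by field_simp)
    · rw [← Real.rpow_mul (by positivity), show 1 / b * (b - 2) = 1 + -a by rw [ha]; field_simp; ring,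
        Real.rpow_add (by positivity), Real.rpow_one, Real.div_rpow hl.le n0.le, Real.rpow_neg n0.le, Real.rpow_neg hl.le]
      have k1 : (l ^ a)⁻¹ ≤ n ^ (p - a) := by
        calc (l ^ a)⁻¹ = (l ^ (-e1)) ^ (p - a) := by
              rw [← Real.rpow_mul hl.le, ← Real.rpow_neg hl.le]; congr 1; rw [he1]; field_simp
          _ ≤ _ := Real.rpow_le_rpow (by positivity) hc.le pa.le
      calc n * (l / n * ((l ^ a)⁻¹ / (n ^ a)⁻¹)) = l * ((l ^ a)⁻¹ * n ^ a) := by field_simp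
        _ ≤ l * (n ^ (p - a) * n ^ a) := by gcongr
        _ = _ := by rw [← Real.rpow_add n0]; simp

theorem slice0 {q1 q2 q3 p : ℝ} (hq1 : 1 < q1) (hq2 : 1 < q2) (hq3 : 1 < q3) (hp0 : 0 < p)
    (hpq : 2 / p + (1/q1 + 1/q2 + 1/q3) < 2) :
    ∃ (b m : ℝ) (C : ℝ≥0∞), 0 < b ∧ b < 2 ∧ 0 ≤ m ∧ C ≠ ∞ ∧ 1 ≤ C ∧ ∀ u g P, Slice u g P → ∀ N,
    N = anisoNorm q1 q2 q3 (ball 0 1) (fun x => ‖u x‖) → (∫⁻ x, ‖u x‖ₑ ≤ C * N) ∧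
    ∀ ρ s l : ℝ, 0 < l → l ≤ 1 → l ^ (1 / b) ≤ s → s ≤ 1 → ball (0 : E3) (ρ + 2 * s) ⊆ ball 0 1 →
    ∫⁻ x in ball 0 ρ, ‖u x‖ₑ * (‖u x‖ₑ ^ 2 + near s u x) ≤
      C * (ENNReal.ofReal l * (∫⁻ x in ball 0 (ρ + 2 * s), gn g x ^ 2) + ENNReal.ofReal l ^ (-m) * N +
        ENNReal.ofReal l * N ^ p * (∫⁻ x in ball 0 (ρ + 2 * s), ‖u x‖ₑ ^ 2)) := by
  set S := 1/q1 + 1/q2 + 1/q3 with hS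
  have S0 : 0 < S := by positivity
  have p0 : 0 < 2 / p := by positivity
  set d := 2 - S - 2 / p with hd
  have d0 : 0 < d := by linarith
  set κ := d / 4 with hκ
  have κ0 : 0 < κ := by positivity
  set γ := 1 + 3 * κ with hγ
  set b := 2 - S - κ with hb
  have b0 : 0 < b := by linarith
  have bp : 2 / b < p := by
    rw [div_lt_iff₀ b0, mul_comm, ← div_lt_iff₀ hp0]; linarith
  obtain ⟨m, m0, hm⟩ := num_h b0 (by linarith) bp
  obtain ⟨C1, hC1, h1⟩ := adm_aniso (γ := γ) hq1 hq2 hq3 (by positivity) (by rw [← hS]; linarith)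
  rw [← hS] at h1
  obtain ⟨C2, hC2, h2⟩ := lemN (κ := κ) (γ := γ) (τ := 3 - S - γ) κ0 (by linarith) (by linarith)
  set C3 := ENNReal.ofReal 2 ^ (3 - S - γ) * 2 ^ γ * C1 with hC3
  have C3t : C3 ≠ ∞ := by
    rw [hC3]
    refine ENNReal.mul_ne_top (ENNReal.mul_ne_top ?_ ?_) hC1
    · exact ENNReal.rpow_ne_top_of_ne_zero (by simp) (by simp)
    · exact ENNReal.rpow_ne_top_of_ne_zero (by simp) (by simp)
  refine ⟨b, m, 1 + C3 + C2 * C1 * (1 + C3 ^ 2), b0, by linarith, m0, by finiteness, by rw [add_assoc]; exact le_self_add, ?_⟩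
  intro u g P Sl N hN
  set C := 1 + C3 + C2 * C1 * (1 + C3 ^ 2) with hC
  have Cne : C ≠ 0 := by rw [hC, add_assoc]; simp
  have hA : Adm (fun x => ‖u x‖ₑ) (C1 * N) γ (3 - S - γ) := by
    have := h1 (ball 0 1) (fun x => ‖u x‖) Sl.mu.norm measurableSet_ball
    rw [← hN] at this
    convert this using 2 with x
    by_cases hx : x ∈ ball (0 : E3) 1
    · rw [indicator_of_mem hx, abs_norm, ofReal_norm]
    · rw [indicator_of_notMem hx, Sl.u0 x hx]; simp
  have L1 : ∫⁻ x, ‖u x‖ₑ ≤ C3 * N := by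
    have := hA 0 2 (by norm_num)
    have k : ∀ x, ‖u x‖ₑ ≤ 2 ^ γ * (‖u x‖ₑ * kn γ 2 (x - 0)) := by
      intro x
      by_cases hx : x ∈ ball (0 : E3) 1
      · have hx' : ‖x‖ < 1 := by simpa using hx
        rw [sub_zero, kn, if_pos (by linarith)]
        calc ‖u x‖ₑ = ‖u x‖ₑ * 1 := by rw [mul_one]
          _ ≤ ‖u x‖ₑ * (2 ^ γ * ‖x‖ₑ ^ (-γ)) := by
            gcongr
            calc (1 : ℝ≥0∞) ≤ 2 ^ γ * 1 ^ (-γ) := by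
                  rw [ENNReal.one_rpow, mul_one]; exact ENNReal.one_le_rpow (by norm_num) (by positivity)
              _ ≤ _ := by
                gcongr 2 ^ γ * ?_
                rw [ENNReal.rpow_neg, ENNReal.rpow_neg]
                gcongr
                rw [← ofReal_norm, ← ENNReal.ofReal_one]
                exact ENNReal.ofReal_le_ofReal hx'.le
          _ = _ := by ring
      · rw [Sl.u0 x hx]; simp
    calc ∫⁻ x, ‖u x‖ₑ ≤ ∫⁻ x, 2 ^ γ * (‖u x‖ₑ * kn γ 2 (x - 0)) := lintegral_mono k
      _ = 2 ^ γ * ∫⁻ x, (‖u x‖ₑ * kn γ 2 (x - 0)) := lintegral_const_mul' _ _ (ENNReal.rpow_ne_top_of_ne_zero (by simp) (by simp))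
      _ ≤ 2 ^ γ * (C1 * N * ENNReal.ofReal 2 ^ (3 - S - γ)) := by gcongr
      _ = C3 * N := by rw [hC3]; ring
  refine ⟨L1.trans ?_, fun ρ s l hl hl1 hls hs1 hb1 => ?_⟩
  · gcongr; rw [hC, add_assoc, add_left_comm]; exact le_self_add
  by_cases Nt : N = ∞
  · have : ENNReal.ofReal l ^ (-m) * N = ∞ := by
      rw [Nt]; apply ENNReal.mul_top
      rw [Ne, ENNReal.rpow_eq_zero_iff]
      simp [hl]
    rw [this]; simp [Cne]
  obtain ⟨h, h0, hl2, k1, k2⟩ := hm l N.toReal hl hl1 ENNReal.toReal_nonneg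
  have hs : h ≤ s := hl2.trans hls
  have hsub : ball (0 : E3) (ρ + s + h) ⊆ ball 0 (ρ + 2 * s) := ball_subset_ball (by linarith)
  have main := h2 u g P Sl (fun x => ‖u x‖ₑ) (C1 * N) Sl.mu.enorm hA 0 ρ s h h0 hs (hsub.trans hb1)
  rw [show γ + (3 - S - γ) - 1 - κ = b by ring, show γ + (3 - S - γ) - 3 - κ = b - 2 by ring] at main
  have sk : ENNReal.ofReal s ^ κ ≤ 1 := by
    apply ENNReal.rpow_le_one _ κ0.le
    rw [← ENNReal.ofReal_one]; exact ENNReal.ofReal_le_ofReal hs1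
  set G := ∫⁻ x in ball 0 (ρ + 2 * s), gn g x ^ 2 with hG
  set U := ∫⁻ x in ball 0 (ρ + 2 * s), ‖u x‖ₑ ^ 2 with hU
  have G1 : ∫⁻ y in ball 0 (ρ + s + h), gn g y ^ 2 ≤ G := lintegral_mono_set hsub
  have U1 : ∫⁻ y in ball 0 (ρ + s + h), ‖u y‖ₑ ^ 2 ≤ U := lintegral_mono_set hsub
  have I1 : ∫⁻ y in ball 0 (ρ + s + h), ‖u y‖ₑ ≤ C3 * N := (setLIntegral_le_lintegral _ _).trans L1
  have NR : N = ENNReal.ofReal N.toReal := (ENNReal.ofReal_toReal Nt).symm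
  have n0 : 0 ≤ N.toReal := ENNReal.toReal_nonneg
  have K1 : N * ENNReal.ofReal h ^ b ≤ ENNReal.ofReal l := by
    rw [NR, ENNReal.ofReal_rpow_of_pos h0, ← ENNReal.ofReal_mul n0]
    exact ENNReal.ofReal_le_ofReal k1
  have K2 : N * ENNReal.ofReal h ^ (b - 2) * min U (ENNReal.ofReal h ^ (-3 : ℝ) * (C3 * N) ^ 2) ≤
      (1 + C3 ^ 2) * (ENNReal.ofReal l ^ (-m) * N + ENNReal.ofReal l * N ^ p * U) := by
    rcases k2 with k2 | k2
    · have : N * ENNReal.ofReal h ^ (b - 2) * (ENNReal.ofReal h ^ (-3 : ℝ) * N ^ 2) ≤ ENNReal.ofReal l ^ (-m) * N := by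
        rw [NR, ENNReal.ofReal_rpow_of_pos h0, ENNReal.ofReal_rpow_of_pos h0, ENNReal.ofReal_rpow_of_pos hl,
          ← ENNReal.ofReal_pow n0, ← ENNReal.ofReal_mul n0, ← ENNReal.ofReal_mul (by positivity), ← ENNReal.ofReal_mul (by positivity), ← ENNReal.ofReal_mul (by positivity)]
        exact ENNReal.ofReal_le_ofReal k2
      calc _ ≤ N * ENNReal.ofReal h ^ (b - 2) * (ENNReal.ofReal h ^ (-3 : ℝ) * (C3 * N) ^ 2) := by
            gcongr; exact min_le_right _ _
        _ = C3 ^ 2 * (N * ENNReal.ofReal h ^ (b - 2) * (ENNReal.ofReal h ^ (-3 : ℝ) * N ^ 2)) := by ring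
        _ ≤ (1 + C3 ^ 2) * (ENNReal.ofReal l ^ (-m) * N + ENNReal.ofReal l * N ^ p * U) := by
          gcongr
          · exact le_add_self
          · exact this.trans le_self_add
    · have : N * ENNReal.ofReal h ^ (b - 2) ≤ ENNReal.ofReal l * N ^ p := by
        rw [NR, ENNReal.ofReal_rpow_of_pos h0, ENNReal.ofReal_rpow_of_nonneg n0 hp0.le, ← ENNReal.ofReal_mul n0, ← ENNReal.ofReal_mul hl.le]
        exact ENNReal.ofReal_le_ofReal k2
      calc _ ≤ ENNReal.ofReal l * N ^ p * U := by
            gcongr; exact min_le_left _ _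
        _ = 1 * (0 + ENNReal.ofReal l * N ^ p * U) := by ring
        _ ≤ _ := by
          gcongr
          · exact le_self_add
          · exact bot_le
  calc _ ≤ _ := main
    _ ≤ C2 * (C1 * N) * 1 * (ENNReal.ofReal h ^ b * G + ENNReal.ofReal h ^ (b - 2) * min U (ENNReal.ofReal h ^ (-3 : ℝ) * (C3 * N) ^ 2)) := by
      gcongr
    _ = C2 * C1 * (N * ENNReal.ofReal h ^ b * G + N * ENNReal.ofReal h ^ (b - 2) * min U (ENNReal.ofReal h ^ (-3 : ℝ) * (C3 * N) ^ 2)) := by ring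
    _ ≤ C2 * C1 * (ENNReal.ofReal l * G + (1 + C3 ^ 2) * (ENNReal.ofReal l ^ (-m) * N + ENNReal.ofReal l * N ^ p * U)) := by gcongr
    _ ≤ C2 * C1 * ((1 + C3 ^ 2) * (ENNReal.ofReal l * G) + (1 + C3 ^ 2) * (ENNReal.ofReal l ^ (-m) * N + ENNReal.ofReal l * N ^ p * U)) := by
      refine mul_le_mul_right (add_le_add_left ?_ _) _
      calc ENNReal.ofReal l * G = 1 * (ENNReal.ofReal l * G) := (one_mul _).symm
        _ ≤ _ := by gcongr; exact le_self_add
    _ = C2 * C1 * (1 + C3 ^ 2) * (ENNReal.ofReal l * G + ENNReal.ofReal l ^ (-m) * N + ENNReal.ofReal l * N ^ p * U) := by ring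
    _ ≤ _ := by
      gcongr; exact le_add_self

abbrev Th : ℝ → ℝ := Real.smoothTransition

theorem Th_cd : ContDiff ℝ (⊤ : ℕ∞) Th := Real.smoothTransition.contDiff
theorem Th1_cd : ContDiff ℝ (⊤ : ℕ∞) (deriv Th) := (contDiff_infty_iff_deriv.1 Th_cd).2
theorem Th_hd (τ : ℝ) : HasDerivAt Th (deriv Th τ) τ :=
  (Th_cd.differentiable (by norm_num)).differentiableAt.hasDerivAt
theorem Th1_hd (τ : ℝ) : HasDerivAt (deriv Th) (deriv (deriv Th) τ) τ :=
  (Th1_cd.differentiable (by norm_num)).differentiableAt.hasDerivAt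

theorem Th1_nonneg (τ : ℝ) : 0 ≤ deriv Th τ := Real.smoothTransition.monotone.deriv_nonneg

theorem Th1_zero {τ : ℝ} (h : τ ≤ 0) : deriv Th τ = 0 := by
  apply IsLocalMin.deriv_eq_zero
  filter_upwards with σ
  rw [Th, Real.smoothTransition.zero_of_nonpos h]; exact Real.smoothTransition.nonneg σ

theorem Th1_one {τ : ℝ} (h : 1 ≤ τ) : deriv Th τ = 0 := by
  apply IsLocalMax.deriv_eq_zero
  filter_upwards with σ
  rw [Th, Real.smoothTransition.one_of_one_le h]; exact Real.smoothTransition.le_one σ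

theorem Th2_zero {τ : ℝ} (h : τ ≤ 0) : deriv (deriv Th) τ = 0 := by
  apply IsLocalMin.deriv_eq_zero
  filter_upwards with σ
  rw [Th1_zero h]; exact Th1_nonneg σ

theorem Th2_one {τ : ℝ} (h : 1 ≤ τ) : deriv (deriv Th) τ = 0 := by
  apply IsLocalMin.deriv_eq_zero
  filter_upwards with σ
  rw [Th1_one h]; exact Th1_nonneg σ

theorem Th_bdd : ∃ K : ℝ, 1 ≤ K ∧ ∀ τ, |deriv Th τ| ≤ K ∧ |deriv (deriv Th) τ| ≤ K := by
  have h1 : HasCompactSupport (deriv Th) := by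
    refine HasCompactSupport.intro (isCompact_Icc (a := (0:ℝ)) (b := 1)) fun x hx => ?_
    by_cases h : x ≤ 0
    · exact Th1_zero h
    · exact Th1_one (by by_contra h2; exact hx ⟨by linarith, by linarith⟩)
  obtain ⟨C1, hC1⟩ := Th1_cd.continuous.bounded_above_of_compact_support h1
  obtain ⟨C2, hC2⟩ := (Th1_cd.continuous_deriv (by norm_num)).bounded_above_of_compact_support h1.deriv
  refine ⟨1 + |C1| + |C2|, by have := abs_nonneg C1; have := abs_nonneg C2; linarith, fun τ => ⟨?_, ?_⟩⟩
  · have := hC1 τ; rw [Real.norm_eq_abs] at this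
    have := le_abs_self C1; have := abs_nonneg C2; linarith
  · have := hC2 τ; rw [Real.norm_eq_abs] at this
    have := le_abs_self C2; have := abs_nonneg C1; linarith

theorem fderiv_radial {F : ℝ → ℝ} {F' : ℝ} (a z : E3) (h : HasDerivAt F F' (‖z - a‖ ^ 2)) :
    ‖fderiv ℝ (fun y => F (‖y - a‖ ^ 2)) z‖ ≤ 2 * ‖z - a‖ * |F'| := by
  have := (h.comp_hasFDerivAt z (hasFDerivAt_normsq a z)).fderiv
  simp only [Function.comp_def] at this
  rw [this, norm_smul, Real.norm_eq_abs, mul_comm]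
  gcongr
  rw [two_nsmul]
  refine (norm_add_le _ _).trans ?_
  rw [innerSL_apply_norm]; linarith

/-- Profile of the radial cutoff. -/
def cF (a b σ : ℝ) : ℝ := Th ((b ^ 2 - σ) / (b ^ 2 - a ^ 2))
def cF1 (a b σ : ℝ) : ℝ := -((b ^ 2 - a ^ 2)⁻¹ * deriv Th ((b ^ 2 - σ) / (b ^ 2 - a ^ 2)))
def cF2 (a b σ : ℝ) : ℝ := (b ^ 2 - a ^ 2)⁻¹ ^ 2 * deriv (deriv Th) ((b ^ 2 - σ) / (b ^ 2 - a ^ 2))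

theorem cF_hd (a b σ : ℝ) : HasDerivAt (cF a b) (cF1 a b σ) σ := by
  have h1 : HasDerivAt (fun σ : ℝ => (b ^ 2 - σ) / (b ^ 2 - a ^ 2)) ((-1) / (b ^ 2 - a ^ 2)) σ :=
    ((hasDerivAt_id σ).const_sub _).div_const _
  refine ((Th_hd _).comp σ h1).congr_deriv ?_
  simp only [cF1]; ring

theorem cF1_hd (a b σ : ℝ) : HasDerivAt (cF1 a b) (cF2 a b σ) σ := by
  have h1 : HasDerivAt (fun σ : ℝ => (b ^ 2 - σ) / (b ^ 2 - a ^ 2)) ((-1) / (b ^ 2 - a ^ 2)) σ :=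
    ((hasDerivAt_id σ).const_sub _).div_const _
  refine (((Th1_hd _).comp σ h1).const_mul ((b ^ 2 - a ^ 2)⁻¹)).neg.congr_deriv ?_
  simp only [cF2]; ring

theorem cF_cd (a b : ℝ) : ContDiff ℝ (⊤ : ℕ∞) (cF a b) := by
  unfold cF
  exact Th_cd.comp (by fun_prop)

theorem cF_nonneg (a b σ : ℝ) : 0 ≤ cF a b σ := Real.smoothTransition.nonneg _
theorem cF_le (a b σ : ℝ) : cF a b σ ≤ 1 := Real.smoothTransition.le_one _

theorem cF_one {a b σ : ℝ} (h : 0 < b ^ 2 - a ^ 2) (hσ : σ ≤ a ^ 2) : cF a b σ = 1 := by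
  apply Real.smoothTransition.one_of_one_le
  rw [one_le_div h]; linarith

theorem cF_zero {a b σ : ℝ} (h : 0 < b ^ 2 - a ^ 2) (hσ : b ^ 2 ≤ σ) : cF a b σ = 0 ∧ cF1 a b σ = 0 ∧ cF2 a b σ = 0 := by
  have : (b ^ 2 - σ) / (b ^ 2 - a ^ 2) ≤ 0 := div_nonpos_of_nonpos_of_nonneg (by linarith) h.le
  refine ⟨Real.smoothTransition.zero_of_nonpos this, ?_, ?_⟩
  · rw [cF1, Th1_zero this]; simp
  · rw [cF2, Th2_zero this]; simp

theorem cF_one' {a b σ : ℝ} (h : 0 < b ^ 2 - a ^ 2) (hσ : σ ≤ a ^ 2) : cF1 a b σ = 0 ∧ cF2 a b σ = 0 := by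
  have : 1 ≤ (b ^ 2 - σ) / (b ^ 2 - a ^ 2) := by rw [one_le_div h]; linarith
  refine ⟨?_, ?_⟩
  · rw [cF1, Th1_one this]; simp
  · rw [cF2, Th2_one this]; simp

theorem cF_bdd : ∃ K : ℝ, 1 ≤ K ∧ ∀ a b σ : ℝ, 0 < b ^ 2 - a ^ 2 →
    |cF1 a b σ| ≤ K * (b ^ 2 - a ^ 2)⁻¹ ∧ |cF2 a b σ| ≤ K * (b ^ 2 - a ^ 2)⁻¹ ^ 2 := by
  obtain ⟨K, hK, h⟩ := Th_bdd
  refine ⟨K, hK, fun a b σ hd => ⟨?_, ?_⟩⟩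
  · rw [cF1, abs_neg, abs_mul, abs_of_pos (by positivity), mul_comm]
    gcongr; exact (h _).1
  · rw [cF2, abs_mul, abs_of_pos (by positivity), mul_comm]
    gcongr; exact (h _).2

theorem normsq_cd (a : E3) : ContDiff ℝ (⊤ : ℕ∞) (fun y : E3 => ‖y - a‖ ^ 2) :=
  (contDiff_id.sub contDiff_const).norm_sq ℝ

/-- A radial function with compactly supported profile is a test function. -/
theorem Tst_radial {F : ℝ → ℝ} (hF : ContDiff ℝ (⊤ : ℕ∞) F) (x0 : E3) {b : ℝ} (hb : 0 ≤ b) (h0 : ∀ σ, b ^ 2 ≤ σ → F σ = 0)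
    (hsub : closedBall x0 b ⊆ ball 0 1) : Tst (fun y => F (‖y - x0‖ ^ 2)) := by
  have hs : tsupport (fun y => F (‖y - x0‖ ^ 2)) ⊆ closedBall x0 b := by
    refine closure_minimal (fun y hy => ?_) isClosed_closedBall
    by_contra hc
    rw [mem_closedBall, dist_eq_norm, not_le] at hc
    exact hy (h0 _ (by gcongr))
  refine ⟨hF.comp (normsq_cd x0), ?_, hs.trans hsub⟩
  exact (isCompact_closedBall x0 b).of_isClosed_subset (isClosed_tsupport _) hs

theorem cmp_set {α : Type*} [MeasurableSpace α] {μ : Measure α} {A B : Set α} (hA : MeasurableSet A) (hB : MeasurableSet B)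
    {f g : α → ℝ≥0∞} (h1 : ∀ x ∈ A, x ∈ B → f x ≤ g x) (h2 : ∀ x ∈ A, x ∉ B → f x = 0) :
    ∫⁻ x in A, f x ∂μ ≤ ∫⁻ x in B, g x ∂μ := by
  rw [← lintegral_indicator hA, ← lintegral_indicator hB]
  refine lintegral_mono fun x => ?_
  by_cases ha : x ∈ A
  · rw [indicator_of_mem ha]
    by_cases hb : x ∈ B
    · rw [indicator_of_mem hb]; exact h1 x ha hb
    · rw [h2 x ha hb]; exact bot_le
  · rw [indicator_of_notMem ha]; exact bot_le

theorem limI {f : ℝ → ℝ≥0∞} {K : ℝ≥0∞} (h : ∀ᵐ t ∂muT, ∫⁻ τ in Ioo (-1) t, f τ ≤ K) :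
    ∫⁻ τ in Ioo (-1) 0, f τ ≤ K := by
  have e : Ioo (-1 : ℝ) 0 = ⋃ n : ℕ, Ioo (-1 : ℝ) (-(1 / ((n : ℝ) + 1))) := by
    ext t
    simp only [mem_Ioo, mem_iUnion]
    constructor
    · rintro ⟨h1, h2⟩
      obtain ⟨n, hn⟩ := exists_nat_one_div_lt (show 0 < -t by linarith)
      exact ⟨n, h1, by linarith⟩
    · rintro ⟨n, h1, h2⟩
      have : 0 < 1 / ((n : ℝ) + 1) := by positivity
      exact ⟨h1, by linarith⟩
  have mono : Monotone fun n : ℕ => Ioo (-1 : ℝ) (-(1 / ((n : ℝ) + 1))) := by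
    intro m n hmn
    apply Ioo_subset_Ioo_right
    have : (m : ℝ) ≤ n := by exact_mod_cast hmn
    have : 1 / ((n : ℝ) + 1) ≤ 1 / ((m : ℝ) + 1) := by gcongr
    linarith
  rw [e, setLIntegral_iUnion_of_directed _ (directed_of_isDirected_le mono)]
  refine iSup_le fun n => ?_
  have hn : 0 < 1 / ((n : ℝ) + 1) := by positivity
  have hn1 : 1 / ((n : ℝ) + 1) ≤ 1 := by rw [div_le_one (by positivity)]; linarith [Nat.cast_nonneg (α := ℝ) n]
  have h2 : ∀ᵐ t ∂(volume.restrict (Ioo (-(1 / ((n : ℝ) + 1))) 0)), ∫⁻ τ in Ioo (-1) t, f τ ≤ K :=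
    ae_restrict_of_ae_restrict_of_subset (Ioo_subset_Ioo_left (by linarith)) h
  have : NeBot (ae (volume.restrict (Ioo (-(1 / ((n : ℝ) + 1))) 0))) := by
    rw [ae_restrict_neBot]; simp; positivity
  obtain ⟨t, ht, ht2⟩ := (h2.and (ae_restrict_mem measurableSet_Ioo)).exists
  exact (lintegral_mono_set (Ioo_subset_Ioo_right ht2.1.le)).trans ht

theorem energy_cut : ∃ C : ℝ≥0∞, C ≠ ∞ ∧ ∀ u g P, Good u g P → ∀ ρ s : ℝ, 1/2 ≤ ρ → 0 < s → ρ + s < 1 → ∀ D : ℝ≥0∞,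
    D = (∫⁻ τ in Ioo (-(ρ+s)^2) 0, ∫⁻ x in ball 0 (ρ+s), (‖u τ x‖ₑ^2 + ‖u τ x‖ₑ*(‖u τ x‖ₑ^2 + 2*‖P τ x‖ₑ))) →
    (∀ᵐ t ∂muT, -ρ^2 < t → ∫⁻ x in ball 0 ρ, ‖u t x‖ₑ^2 ≤ C * ENNReal.ofReal s ^ (-2:ℝ) * D) ∧
    ∫⁻ τ in Ioo (-ρ^2) 0, ∫⁻ x in ball 0 ρ, gn (g τ) x^2 ≤ C * ENNReal.ofReal s ^ (-2:ℝ) * D := by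
  obtain ⟨K, hK, hb⟩ := cF_bdd
  obtain ⟨K', hK', hb'⟩ := Th_bdd
  refine ⟨ENNReal.ofReal (2 * (10 * K + K')), by finiteness, fun u g P H ρ s hρ hs hρs D hD => ?_⟩
  set b := ρ + s with hbd
  set d := b ^ 2 - ρ ^ 2 with hd
  have ds : s ≤ d := by rw [hd, hbd]; nlinarith
  have d0 : 0 < d := by linarith
  have b0 : 0 < b := by linarith
  have s1 : s ≤ 1 := by linarith
  have di : d⁻¹ ≤ s⁻¹ := inv_anti₀ hs ds
  have si : 1 ≤ s⁻¹ := (one_le_inv₀ hs).2 s1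
  have di0 : 0 < d⁻¹ := by positivity
  set A := (10 * K + K') * s⁻¹ ^ 2 with hA
  have A0 : 0 ≤ A := by positivity
  set χ : E3 → ℝ := fun y => cF ρ b (‖y - 0‖ ^ 2) with hχ
  have Tχ : Tst χ := Tst_radial (cF_cd ρ b) 0 b0.le (fun σ hσ => (cF_zero d0 hσ).1) (closedBall_subset_ball hρs)
  set η : ℝ → ℝ := fun t => Th ((t + b ^ 2) / d) with hη
  have η_hd : ∀ t, HasDerivAt η (deriv Th ((t + b ^ 2) / d) * (1 / d)) t := fun t =>
    (Th_hd _).comp t (((hasDerivAt_id t).add_const _).div_const _)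
  have η_cd : ContDiff ℝ (⊤ : ℕ∞) η := Th_cd.comp (by fun_prop)
  have η_zero : ∀ t, t ≤ - b ^ 2 → (t + b ^ 2) / d ≤ 0 := fun t ht =>
    div_nonpos_of_nonpos_of_nonneg (by linarith) d0.le
  set ζ : ℕ → ℝ → ℝ := fun n t => Th (-2 * ((n:ℝ) + 1) * t - 1) with hζ
  set θ : ℕ → ℝ → ℝ := fun n t => η t * ζ n t with hθ
  have θ_cd : ∀ n, ContDiff ℝ (⊤ : ℕ∞) (θ n) := fun n => η_cd.mul (Th_cd.comp (by fun_prop))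
  have θ_nonneg : ∀ n t, 0 ≤ θ n t := fun n t => mul_nonneg (Real.smoothTransition.nonneg _) (Real.smoothTransition.nonneg _)
  have θ_le : ∀ n t, θ n t ≤ 1 := fun n t => mul_le_one₀ (Real.smoothTransition.le_one _) (Real.smoothTransition.nonneg _) (Real.smoothTransition.le_one _)
  have θ_supp : ∀ n, tsupport (θ n) ⊆ Icc (-b ^ 2) (-(1 / (2 * ((n:ℝ) + 1)))) := fun n => by
    refine closure_minimal (fun t ht => ?_) isClosed_Icc
    by_contra hc
    apply ht
    by_cases h1 : t ≤ - b ^ 2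
    · simp only [hθ, hη]; rw [Th, Real.smoothTransition.zero_of_nonpos (η_zero t h1), zero_mul]
    · have h2 : -(1 / (2 * ((n:ℝ) + 1))) < t := by
        by_contra h3; exact hc ⟨by linarith, by linarith⟩
      have h4 : -1 < 2 * ((n:ℝ) + 1) * t := by
        have : 0 < 2 * ((n:ℝ) + 1) := by positivity
        calc -1 = 2 * ((n:ℝ) + 1) * (-(1 / (2 * ((n:ℝ) + 1)))) := by field_simp
          _ < _ := by gcongr
      simp only [hθ, hζ]; rw [Th, Real.smoothTransition.zero_of_nonpos (by linarith), mul_zero]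
  have θ_hcs : ∀ n, HasCompactSupport (θ n) := fun n =>
    isCompact_Icc.of_isClosed_subset (isClosed_tsupport _) (θ_supp n)
  have hT : ∀ n, IsTest 1 (fun x t => θ n t * χ x) := fun n => by
    refine isTest_prod (θ_cd n) (θ_hcs n) ((θ_supp n).trans fun t ht => ⟨?_, ?_⟩) Tχ.1 Tχ.2.1 Tχ.2.2
    · have := ht.1; nlinarith
    · have h2 := ht.2
      have : 0 < 1 / (2 * ((n:ℝ) + 1)) := by positivity
      linarith
  have hE : ∀ᵐ t ∂muT, ∀ n : ℕ, _ := ae_all_iff.2 fun n => H.energy (fun x t => θ n t * χ x) 1 (fun _ x t => θ n t * χ x) (fun _ _ => 0) (hT n)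
    (fun x t => mul_nonneg (θ_nonneg n t) (cF_nonneg _ _ _))
    (fun _ t => ⟨contDiff_const.mul Tχ.1, Tχ.2.1.mul_left, (tsupport_mul_subset_right).trans Tχ.2.2⟩) (by simp)
  have key : ∀ᵐ t ∂muT, (-ρ^2 < t → ∫⁻ x in ball 0 ρ, ‖u t x‖ₑ^2 ≤ 2 * (ENNReal.ofReal A * D)) ∧
      ∫⁻ τ in Ioo (-1) t, (Ioo (-ρ^2) 0).indicator (fun τ => ∫⁻ x in ball 0 ρ, gn (g τ) x^2) τ ≤ 2 * (ENNReal.ofReal A * D) := by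
    filter_upwards [hE, ae_restrict_mem measurableSet_Ioo] with t ht htm
    obtain ⟨n, hn⟩ := exists_nat_one_div_lt (show 0 < -t by linarith [htm.2])
    have ζ0 : ∀ τ, τ ≤ -(1 / ((n:ℝ) + 1)) → ζ n τ = 1 := fun τ hτ => by
      apply Real.smoothTransition.one_of_one_le
      have : 2 * ((n:ℝ) + 1) * τ ≤ 2 * ((n:ℝ) + 1) * (-(1 / ((n:ℝ) + 1))) := by gcongr
      have e : 2 * ((n:ℝ) + 1) * (-(1 / ((n:ℝ) + 1))) = -2 := by field_simp
      linarith
    have θd : ∀ τ, τ < t → deriv (θ n) τ = deriv Th ((τ + b ^ 2) / d) * (1 / d) := fun τ hτ => by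
      have : θ n =ᶠ[nhds τ] η := by
        filter_upwards [Iio_mem_nhds hτ] with σ hσ
        rw [mem_Iio] at hσ
        simp only [hθ]; rw [ζ0 σ (by linarith), mul_one]
      rw [this.deriv_eq, (η_hd τ).deriv]
    have θ1 : ∀ τ, τ ≤ t → -ρ ^ 2 < τ → θ n τ = 1 := fun τ hτ h2 => by
      simp only [hθ]; rw [ζ0 τ (by linarith), mul_one]
      apply Real.smoothTransition.one_of_one_le
      rw [one_le_div d0, hd]; linarith
    have χ1 : ∀ x ∈ ball (0:E3) ρ, χ x = 1 := fun x hx => by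
      apply cF_one d0
      rw [sub_zero]; rw [mem_ball_zero_iff] at hx; gcongr
    have χ0 : ∀ x, x ∉ ball (0:E3) b → b ^ 2 ≤ ‖x - 0‖ ^ 2 := fun x hx => by
      rw [mem_ball_zero_iff, not_lt] at hx
      rw [sub_zero]; gcongr
    have θ0 : ∀ τ, τ ∉ Ioo (-b ^ 2) 0 → τ < t → θ n τ = 0 ∧ deriv (θ n) τ = 0 := fun τ h1 h2 => by
      have : τ ≤ -b ^ 2 := by
        by_contra h3; exact h1 ⟨by linarith, by linarith [htm.2]⟩
      refine ⟨?_, ?_⟩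
      · simp only [hθ, hη]; rw [Th, Real.smoothTransition.zero_of_nonpos (η_zero τ this), zero_mul]
      · rw [θd τ h2, Th1_zero (η_zero τ this), zero_mul]
    have lapχ : ∀ x, lap χ x = 6 * cF1 ρ b (‖x - 0‖ ^ 2) + 4 * ‖x - 0‖ ^ 2 * cF2 ρ b (‖x - 0‖ ^ 2) := fun x =>
      lap_radial 0 x (fun τ _ => cF_hd ρ b τ) (cF1_hd ρ b _)
    have gχ : ∀ x, ‖fderiv ℝ χ x‖ ≤ 2 * ‖x - 0‖ * |cF1 ρ b (‖x - 0‖ ^ 2)| := fun x =>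
      fderiv_radial 0 x (cF_hd ρ b _)
    have dv : ∀ x τ, deriv (fun τ => θ n τ * χ x) τ + lap (fun y => θ n τ * χ y) x = deriv (θ n) τ * χ x + θ n τ * lap χ x := by
      intro x τ
      rw [deriv_mul_const ((θ_cd n).differentiable (by norm_num)).differentiableAt]
      congr 1
      unfold lap
      rw [Finset.mul_sum]
      refine Finset.sum_congr rfl fun i _ => ?_
      have : (fun y => pd i (fun y => θ n τ * χ y) y) = fun y => θ n τ * pd i χ y :=
        funext fun y => pd_cmul _ Tχ.diff.differentiableAt i
      rw [this, pd_cmul _ ((Tχ.pd i).diff.differentiableAt)]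
    have fd : ∀ x τ, fderiv ℝ (fun y => θ n τ * χ y) x = θ n τ • fderiv ℝ χ x := fun x τ =>
      fderiv_const_mul Tχ.diff.differentiableAt _
    have xb : ∀ x ∈ ball (0:E3) b, ‖x - 0‖ ≤ 1 := fun x hx => by
      rw [mem_ball_zero_iff] at hx; rw [sub_zero]; linarith
    have d2 : d⁻¹ ^ 2 ≤ s⁻¹ ^ 2 := by gcongr
    have d1 : d⁻¹ ≤ s⁻¹ ^ 2 := by nlinarith
    have R1 : ∫⁻ τ in Ioo (-1) t, ∫⁻ x, ‖u τ x‖ₑ ^ 2 * ENNReal.ofReal (deriv (fun τ => θ n τ * χ x) τ + lap (fun y => θ n τ * χ y) x) ≤ ENNReal.ofReal A * D := by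
      rw [hD, ← lintegral_const_mul' _ _ (by finiteness)]
      refine cmp_set measurableSet_Ioo measurableSet_Ioo (fun τ h1 h2 => ?_) (fun τ h1 h2 => ?_)
      · rw [← lintegral_const_mul' _ _ (by finiteness), ← setLIntegral_univ]
        refine cmp_set MeasurableSet.univ measurableSet_ball (fun x _ hx => ?_) (fun x _ hx => ?_)
        · rw [mul_comm]
          gcongr
          · rw [dv, θd τ h1.2]
            have k1 : deriv Th ((τ + b ^ 2) / d) * (1 / d) * χ x ≤ K' * s⁻¹ ^ 2 * 1 := by
              rw [one_div]
              have c0 : 0 ≤ χ x := cF_nonneg _ _ _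
              have c1 : χ x ≤ 1 := cF_le _ _ _
              have c2 : deriv Th ((τ + b ^ 2) / d) ≤ K' := (le_abs_self _).trans (hb' _).1
              gcongr
            have k2 : |lap χ x| ≤ 10 * K * s⁻¹ ^ 2 := by
              rw [lapχ]
              obtain ⟨b1, b2⟩ := hb ρ b (‖x - 0‖ ^ 2) d0
              rw [← hd] at b1 b2
              calc _ ≤ |6 * cF1 ρ b (‖x - 0‖ ^ 2)| + |4 * ‖x - 0‖ ^ 2 * cF2 ρ b (‖x - 0‖ ^ 2)| := abs_add_le _ _
                _ = 6 * |cF1 ρ b (‖x - 0‖ ^ 2)| + 4 * ‖x - 0‖ ^ 2 * |cF2 ρ b (‖x - 0‖ ^ 2)| := by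
                  rw [abs_mul, abs_mul, abs_of_pos (by norm_num : (0:ℝ) < 6), abs_of_nonneg (by positivity : 0 ≤ 4 * ‖x - 0‖ ^ 2)]
                _ ≤ 6 * (K * d⁻¹) + 4 * 1 ^ 2 * (K * d⁻¹ ^ 2) := by
                  have := xb x hx
                  gcongr
                _ ≤ 6 * (K * s⁻¹ ^ 2) + 4 * 1 ^ 2 * (K * s⁻¹ ^ 2) := by gcongr
                _ = _ := by ring
            have k3 : θ n τ * lap χ x ≤ 1 * (10 * K * s⁻¹ ^ 2) :=
              (mul_le_mul_of_nonneg_left ((le_abs_self _).trans k2) (θ_nonneg n τ)).trans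
                (mul_le_mul_of_nonneg_right (θ_le n τ) (by positivity))
            rw [hA]; linarith
          · exact le_self_add
        · obtain ⟨c1, c2, c3⟩ := cF_zero d0 (χ0 x hx)
          have : χ x = 0 := c1
          rw [dv, this, lapχ, c2, c3]; simp
      · refine (lintegral_congr fun x => ?_).trans lintegral_zero
        obtain ⟨c1, c2⟩ := θ0 τ h2 h1.2
        rw [dv, c1, c2]; simp
    have R2 : ∫⁻ τ in Ioo (-1) t, ∫⁻ x, ∑ k ∈ Finset.range 1, ‖u τ x‖ₑ * ‖fderiv ℝ (fun y => θ n τ * χ y) x‖ₑ * (‖u τ x‖ₑ ^ 2 + 2 * ‖P τ x - 0‖ₑ) ≤ ENNReal.ofReal A * D := by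
      rw [hD, ← lintegral_const_mul' _ _ (by finiteness)]
      refine cmp_set measurableSet_Ioo measurableSet_Ioo (fun τ h1 h2 => ?_) (fun τ h1 h2 => ?_)
      · rw [← lintegral_const_mul' _ _ (by finiteness), ← setLIntegral_univ]
        refine cmp_set MeasurableSet.univ measurableSet_ball (fun x _ hx => ?_) (fun x _ hx => ?_)
        · rw [Finset.sum_range_one, fd, sub_zero]
          have k : ‖θ n τ • fderiv ℝ χ x‖ₑ ≤ ENNReal.ofReal A := by
            rw [← ofReal_norm, norm_smul, Real.norm_of_nonneg (θ_nonneg n τ)]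
            apply ENNReal.ofReal_le_ofReal
            have b1 := (hb ρ b (‖x - 0‖ ^ 2) d0).1
            rw [← hd] at b1
            calc θ n τ * ‖fderiv ℝ χ x‖ ≤ 1 * (2 * ‖x - 0‖ * |cF1 ρ b (‖x - 0‖ ^ 2)|) :=
                  mul_le_mul (θ_le n τ) (gχ x) (norm_nonneg _) zero_le_one
              _ ≤ 1 * (2 * 1 * (K * s⁻¹ ^ 2)) := by
                have := xb x hx
                gcongr
                exact b1.trans (by gcongr)
              _ ≤ A := by
                rw [hA]
                have : 0 ≤ (8 * K + K') * s⁻¹ ^ 2 := by positivity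
                linarith
          calc _ = ‖θ n τ • fderiv ℝ χ x‖ₑ * (‖u τ x‖ₑ * (‖u τ x‖ₑ ^ 2 + 2 * ‖P τ x‖ₑ)) := by ring
            _ ≤ _ := by
              gcongr; exact le_add_self
        · have : ‖fderiv ℝ χ x‖ ≤ 0 := by
            refine (gχ x).trans ?_
            rw [(cF_zero d0 (χ0 x hx)).2.1]; simp
          rw [norm_le_zero_iff] at this
          rw [Finset.sum_range_one, fd, this, smul_zero, ← ofReal_norm (0 : E3 →L[ℝ] ℝ), norm_zero, ENNReal.ofReal_zero, mul_zero, zero_mul]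
      · refine (lintegral_congr fun x => ?_).trans lintegral_zero
        obtain ⟨c1, c2⟩ := θ0 τ h2 h1.2
        rw [Finset.sum_range_one, fd, c1, zero_smul, ← ofReal_norm (0 : E3 →L[ℝ] ℝ), norm_zero, ENNReal.ofReal_zero, mul_zero, zero_mul]
    have hn' := (ht n).trans (add_le_add R1 R2)
    rw [← two_mul] at hn'
    refine ⟨fun hρt => ?_, ?_⟩
    · refine le_trans ?_ (le_self_add.trans hn')
      rw [← setLIntegral_univ (f := fun x => ‖u t x‖ₑ ^ 2 * _)]
      refine cmp_set measurableSet_ball MeasurableSet.univ (fun x hx _ => ?_) (fun x _ hx => absurd (mem_univ _) hx)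
      rw [θ1 t le_rfl hρt, χ1 x hx]; simp
    · refine le_trans ?_ (le_add_self.trans hn')
      refine le_trans ?_ (le_mul_of_one_le_left' one_le_two)
      refine setLIntegral_mono' measurableSet_Ioo fun τ hτ => ?_
      by_cases hi : τ ∈ Ioo (-ρ^2) 0
      · rw [indicator_of_mem hi, ← setLIntegral_univ (f := fun x => gn (g τ) x ^ 2 * _)]
        refine cmp_set measurableSet_ball MeasurableSet.univ (fun x hx _ => ?_) (fun x _ hx => absurd (mem_univ _) hx)
        rw [θ1 τ hτ.2.le hi.1, χ1 x hx]; simp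
      · rw [indicator_of_notMem hi]; exact bot_le
  have eA : 2 * (ENNReal.ofReal A * D) = ENNReal.ofReal (2 * (10 * K + K')) * ENNReal.ofReal s ^ (-2:ℝ) * D := by
    rw [ENNReal.ofReal_rpow_of_pos hs, ← ENNReal.ofReal_mul (by positivity), ← mul_assoc]
    congr 1
    rw [show (2:ℝ≥0∞) = ENNReal.ofReal 2 by simp, ← ENNReal.ofReal_mul (by norm_num)]
    congr 1
    rw [hA, show (-2:ℝ) = ((-2:ℤ):ℝ) by norm_num, Real.rpow_intCast]
    rw [zpow_neg, inv_pow]; norm_cast; ring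
  rw [← eA]
  refine ⟨key.mono fun t h => h.1, ?_⟩
  have := limI (key.mono fun t h => h.2)
  refine le_trans ?_ this
  refine cmp_set measurableSet_Ioo measurableSet_Ioo (fun τ h1 h2 => ?_) (fun τ h1 h2 => ?_)
  · rw [indicator_of_mem h1]
  · exact absurd ⟨by have := h1.1; nlinarith, h1.2⟩ h2

theorem sq_le_cub (a : ℝ≥0∞) : a ^ 2 ≤ a + a * a ^ 2 := by
  rcases le_total a 1 with h | h
  · calc a ^ 2 = a * a := sq a
      _ ≤ a * 1 := by gcongr
      _ ≤ _ := by rw [mul_one]; exact le_self_add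
  · calc a ^ 2 = 1 * a ^ 2 := (one_mul _).symm
      _ ≤ a * a ^ 2 := by gcongr
      _ ≤ _ := le_add_self

theorem l1_l2 (x0 : E3) (ρ : ℝ) {f : E3 → ℝ≥0∞} (hf : Measurable f) :
    ∫⁻ x in ball x0 ρ, f x ≤ (volume (ball x0 ρ)) ^ (1/2:ℝ) * (∫⁻ x in ball x0 ρ, f x ^ 2) ^ (1/2:ℝ) := by
  have := csL (volume.restrict (ball x0 ρ)) (f := fun _ => 1) (g := f) aemeasurable_const hf.aemeasurable
  simp only [one_mul, one_pow, lintegral_const, Measure.restrict_apply MeasurableSet.univ, univ_inter] at this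
  rw [← ENNReal.mul_rpow_of_nonneg _ _ (by norm_num)]
  calc _ = ((∫⁻ x in ball x0 ρ, f x) ^ 2) ^ (1/2:ℝ) := by
        rw [← ENNReal.rpow_natCast, ← ENNReal.rpow_mul]; norm_num
    _ ≤ _ := by gcongr

theorem slice1 {q1 q2 q3 p : ℝ} (hq1 : 1 < q1) (hq2 : 1 < q2) (hq3 : 1 < q3) (hp0 : 0 < p)
    (hpq : 2 / p + (1/q1 + 1/q2 + 1/q3) < 2) :
    ∃ (b m : ℝ) (C : ℝ≥0∞), 0 < b ∧ b < 2 ∧ 0 ≤ m ∧ C ≠ ∞ ∧ ∀ u g P, Slice u g P → ∀ N,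
    N = anisoNorm q1 q2 q3 (ball 0 1) (fun x => ‖u x‖) → 
    ∀ ρ s l : ℝ, 0 < l → l ≤ 1 → l ^ (1 / b) ≤ s → s ≤ 1 → ρ + 2 * s ≤ 1 →
    ∫⁻ x in ball 0 ρ, (‖u x‖ₑ ^ 2 + ‖u x‖ₑ * (‖u x‖ₑ ^ 2 + 2 * ‖P x‖ₑ)) ≤
      C * (ENNReal.ofReal l * (∫⁻ x in ball 0 (ρ + 2 * s), gn g x ^ 2) + ENNReal.ofReal l ^ (-m) * N +
        ENNReal.ofReal l * N ^ p * (∫⁻ x in ball 0 (ρ + 2 * s), ‖u x‖ₑ ^ 2) +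
        ENNReal.ofReal s ^ (-3:ℝ) * (∫⁻ x in ball 0 (ρ + 2 * s), ‖u x‖ₑ ^ 2) ^ (1/2:ℝ) * ∫⁻ x, ‖P x‖ₑ) := by
  obtain ⟨b, m, C, b0, b2, m0, hC, hC1, h⟩ := slice0 hq1 hq2 hq3 hp0 hpq
  obtain ⟨C', hC', h'⟩ := press_A
  set V := (volume (ball (0:E3) 1)) ^ (1/2:ℝ) with hV
  have Vt : V ≠ ∞ := ENNReal.rpow_ne_top_of_nonneg (by norm_num) measure_ball_lt_top.ne
  refine ⟨b, m, C + (2 + 2 * C') * C + 2 * C' * V, b0, b2, m0, by finiteness, fun u g P Sl N hN ρ s l hl hl1 hls hs1 hρ => ?_⟩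
  obtain ⟨k1, k2⟩ := h u g P Sl N hN
  have s0 : 0 < s := lt_of_lt_of_le (by positivity) hls
  have k2 := k2 ρ s l hl hl1 hls hs1 (ball_subset_ball hρ)
  set π := ∫⁻ x, ‖P x‖ₑ with hπ
  set U := ∫⁻ x in ball 0 (ρ + 2 * s), ‖u x‖ₑ ^ 2 with hU
  set G := ∫⁻ x in ball 0 (ρ + 2 * s), gn g x ^ 2 with hG
  have pw : ∀ᵐ x ∂(volume.restrict (ball (0:E3) ρ)), ‖u x‖ₑ ^ 2 + ‖u x‖ₑ * (‖u x‖ₑ ^ 2 + 2 * ‖P x‖ₑ) ≤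
      ‖u x‖ₑ + ((2 + 2 * C') * (‖u x‖ₑ * (‖u x‖ₑ ^ 2 + near s u x)) + 2 * C' * (ENNReal.ofReal s ^ (-3:ℝ) * π) * ‖u x‖ₑ) := by
    filter_upwards [ae_restrict_of_ae (leb Sl.P_int), ae_restrict_mem measurableSet_ball] with x hx hxb
    have := h' u g P Sl s x s0 (fun y hy => ?_) hx
    · calc _ ≤ (‖u x‖ₑ + ‖u x‖ₑ * ‖u x‖ₑ ^ 2) + ‖u x‖ₑ * (‖u x‖ₑ ^ 2 + 2 * (C' * (ENNReal.ofReal s ^ (-3:ℝ) * π + near s u x))) := by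
            gcongr; exact sq_le_cub _
        _ = ‖u x‖ₑ + ((2 * (‖u x‖ₑ * ‖u x‖ₑ ^ 2) + 2 * C' * (‖u x‖ₑ * near s u x)) + 2 * C' * (ENNReal.ofReal s ^ (-3:ℝ) * π) * ‖u x‖ₑ) := by ring
        _ ≤ ‖u x‖ₑ + (((2 + 2 * C') * (‖u x‖ₑ * ‖u x‖ₑ ^ 2) + (2 + 2 * C') * (‖u x‖ₑ * near s u x)) + 2 * C' * (ENNReal.ofReal s ^ (-3:ℝ) * π) * ‖u x‖ₑ) := by
            gcongr
            · exact le_self_add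
            · exact le_add_self
        _ = _ := by ring
    · rw [mem_closedBall] at hy
      rw [mem_ball] at hxb ⊢
      have := dist_triangle y x 0
      linarith
  have mu := Sl.mu.enorm
  have mn := near_meas Sl.mu s
  have I1 : ∫⁻ x in ball 0 ρ, ‖u x‖ₑ ≤ C * N := (setLIntegral_le_lintegral _ _).trans k1
  have I2 : ∫⁻ x in ball 0 ρ, ‖u x‖ₑ ≤ V * U ^ (1/2:ℝ) := by
    refine (l1_l2 0 ρ mu).trans ?_
    rw [hV]
    exact mul_le_mul' (ENNReal.rpow_le_rpow (measure_mono (ball_subset_ball (by linarith))) (by norm_num)) (ENNReal.rpow_le_rpow (lintegral_mono_set (ball_subset_ball (by linarith))) (by norm_num))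
  have l1 : 1 ≤ ENNReal.ofReal l ^ (-m) := by
    rw [ENNReal.rpow_neg, ENNReal.one_le_inv]
    exact ENNReal.rpow_le_one (by rw [← ENNReal.ofReal_one]; exact ENNReal.ofReal_le_ofReal hl1) m0
  calc _ ≤ _ := lintegral_mono_ae pw
    _ = (∫⁻ x in ball 0 ρ, ‖u x‖ₑ) + ((2 + 2 * C') * (∫⁻ x in ball 0 ρ, (‖u x‖ₑ * (‖u x‖ₑ ^ 2 + near s u x))) + 2 * C' * (ENNReal.ofReal s ^ (-3:ℝ) * π) * ∫⁻ x in ball 0 ρ, ‖u x‖ₑ) := by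
      rw [lintegral_add_left mu, lintegral_add_left (by fun_prop), lintegral_const_mul _ (by fun_prop), lintegral_const_mul _ mu]
    _ ≤ C * N + ((2 + 2 * C') * (C * (ENNReal.ofReal l * G + ENNReal.ofReal l ^ (-m) * N +
        ENNReal.ofReal l * N ^ p * U)) + 2 * C' * (ENNReal.ofReal s ^ (-3:ℝ) * π) * (V * U ^ (1/2:ℝ))) := by
      gcongr
    _ ≤ C * (ENNReal.ofReal l ^ (-m) * N) + ((2 + 2 * C') * (C * (ENNReal.ofReal l * G + ENNReal.ofReal l ^ (-m) * N +
        ENNReal.ofReal l * N ^ p * U)) + 2 * C' * (ENNReal.ofReal s ^ (-3:ℝ) * π) * (V * U ^ (1/2:ℝ))) := by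
      gcongr
      calc N = 1 * N := (one_mul _).symm
        _ ≤ _ := by gcongr
    _ = C * (0 + ENNReal.ofReal l ^ (-m) * N + 0 + 0) + (2 + 2 * C') * C * (ENNReal.ofReal l * G + ENNReal.ofReal l ^ (-m) * N +
        ENNReal.ofReal l * N ^ p * U + 0) + 2 * C' * V * (0 + 0 + 0 + ENNReal.ofReal s ^ (-3:ℝ) * U ^ (1/2:ℝ) * π) := by ring
    _ ≤ C * (ENNReal.ofReal l * G + ENNReal.ofReal l ^ (-m) * N +
        ENNReal.ofReal l * N ^ p * U + ENNReal.ofReal s ^ (-3:ℝ) * U ^ (1/2:ℝ) * π) + (2 + 2 * C') * C * (ENNReal.ofReal l * G + ENNReal.ofReal l ^ (-m) * N +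
        ENNReal.ofReal l * N ^ p * U + ENNReal.ofReal s ^ (-3:ℝ) * U ^ (1/2:ℝ) * π) + 2 * C' * V * (ENNReal.ofReal l * G + ENNReal.ofReal l ^ (-m) * N +
        ENNReal.ofReal l * N ^ p * U + ENNReal.ofReal s ^ (-3:ℝ) * U ^ (1/2:ℝ) * π) := by
      gcongr <;> exact bot_le
    _ = _ := by ring

theorem aniso_meas {q1 q2 q3 : ℝ} {u : ℝ → E3 → E3} (hu : Measurable (Function.uncurry u)) :
    Measurable (fun t => anisoNorm q1 q2 q3 (ball 0 1) (fun x => ‖u t x‖)) := by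
  unfold anisoNorm
  have hp : Measurable (fun z : ((ℝ × ℝ) × ℝ) × ℝ => pt3 z.2 z.1.2 z.1.1.2) := by
    unfold pt3
    apply Continuous.measurable
    apply (PiLp.continuous_toLp 2 _).comp
    refine continuous_pi fun i => ?_
    fin_cases i <;> simp <;> fun_prop
  have h0 : Measurable (fun z : ((ℝ × ℝ) × ℝ) × ℝ => ENNReal.ofReal |(ball (0:E3) 1).indicator (fun x => ‖u z.1.1.1 x‖) (pt3 z.2 z.1.2 z.1.1.2)|) := by
    have h1 : Measurable (fun z : ((ℝ × ℝ) × ℝ) × ℝ => ‖u z.1.1.1 (pt3 z.2 z.1.2 z.1.1.2)‖) := by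
      have : Measurable (fun z : ((ℝ × ℝ) × ℝ) × ℝ => (z.1.1.1, pt3 z.2 z.1.2 z.1.1.2)) := by fun_prop
      exact (hu.comp this).norm
    have h2 := h1.indicator (hp (measurableSet_ball (x := (0:E3)) (ε := 1)))
    have h3 : Measurable (fun z => ENNReal.ofReal |z|) := by fun_prop
    exact h3.comp h2
  have h1 := (Measurable.lintegral_prod_right' (ν := (volume : Measure ℝ)) (h0.pow_const q1)).pow_const (q2 / q1)
  have h2 := (Measurable.lintegral_prod_right' (ν := (volume : Measure ℝ)) h1).pow_const (q3 / q2)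
  exact (Measurable.lintegral_prod_right' (ν := (volume : Measure ℝ)) h2).pow_const (1 / q3)

/-- The local energy on the cylinder of radius `ρ`. -/
def EE (u : ℝ → E3 → E3) (g : ℝ → E3 → Fin 3 → Fin 3 → ℝ) (ρ : ℝ) : ℝ≥0∞ :=
  essSup (fun t => ∫⁻ x in ball 0 ρ, ‖u t x‖ₑ ^ 2) (volume.restrict (Ioo (-ρ^2) 0))
    + ∫⁻ t in Ioo (-ρ^2) 0, ∫⁻ x in ball 0 ρ, gn (g t) x ^ 2

theorem young2 {η : ℝ≥0∞} (h0 : η ≠ 0) (ht : η ≠ ∞) (E B : ℝ≥0∞) :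
    E ^ (1/2:ℝ) * B ≤ η * E + η⁻¹ * B ^ 2 := by
  have e2 : E = E ^ (1/2:ℝ) * E ^ (1/2:ℝ) := by
    rw [← ENNReal.rpow_add_of_nonneg _ _ (by norm_num) (by norm_num)]; norm_num
  set a := E ^ (1/2:ℝ) with ha
  rw [e2]
  rcases le_total B (η * a) with h | h
  · calc a * B ≤ a * (η * a) := by gcongr
      _ = η * (a * a) := by ring
      _ ≤ _ := le_self_add
  · have : a ≤ η⁻¹ * B := by
      calc a = η⁻¹ * η * a := by rw [ENNReal.inv_mul_cancel h0 ht, one_mul]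
        _ = η⁻¹ * (η * a) := by ring
        _ ≤ _ := by gcongr
    calc a * B ≤ η⁻¹ * B * B := by gcongr
      _ = η⁻¹ * B ^ 2 := by ring
      _ ≤ _ := le_add_self

theorem int_muT_sub {f : ℝ → ℝ≥0∞} {r : ℝ} (h0 : 0 ≤ r) (h1 : r ≤ 1) :
    ∫⁻ t in Ioo (-r^2) 0, f t ≤ ∫⁻ t, f t ∂muT := by
  unfold muT
  refine lintegral_mono_set (Ioo_subset_Ioo ?_ le_rfl)
  nlinarith

theorem step1a {q1 q2 q3 p : ℝ} (hq1 : 1 < q1) (hq2 : 1 < q2) (hq3 : 1 < q3) (hp0 : 0 < p)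
    (hpq : 2 / p + (1/q1 + 1/q2 + 1/q3) < 2) :
    ∃ (M : ℝ) (C : ℝ≥0∞), 0 ≤ M ∧ C ≠ ∞ ∧ ∀ η : ℝ, 0 < η → η ≤ 1 → ∃ A : ℝ≥0∞, A ≠ ∞ ∧
      ∀ u g P, Good u g P → ∀ N : ℝ → ℝ≥0∞, (∀ t, N t = anisoNorm q1 q2 q3 (ball 0 1) (fun x => ‖u t x‖)) →
      ∀ ε : ℝ≥0∞, ε ≤ 1 → ∫⁻ t, N t ∂muT ≤ ε → ∫⁻ t, N t ^ p ∂muT ≤ 1 → ∫⁻ t, (∫⁻ x, ‖P t x‖ₑ) ∂muT ≤ ε →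
      ∀ ρ s : ℝ, 1/2 ≤ ρ → 0 < s → ρ + 3 * s < 1 →
      EE u g ρ ≤ C * ENNReal.ofReal η * EE u g (ρ + 3 * s) + A * ENNReal.ofReal s ^ (-M) * ε := by
  obtain ⟨C1, hC1, h1⟩ := energy_cut
  obtain ⟨b, m, C2, b0, b2, m0, hC2, h2⟩ := slice1 hq1 hq2 hq3 hp0 hpq
  refine ⟨12 + 2 * m, 6 * C1 * C2, by positivity, by finiteness, fun η η0 η1 => ?_⟩
  have ηe0 : ENNReal.ofReal η ≠ 0 := by simpa using η0
  refine ⟨2 * C1 * C2 * (ENNReal.ofReal η ^ (-m) + (ENNReal.ofReal η)⁻¹), ?_, ?_⟩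
  · have : ENNReal.ofReal η ^ (-m) ≠ ∞ := by
      rw [ENNReal.ofReal_rpow_of_pos η0]; exact ENNReal.ofReal_ne_top
    have : (ENNReal.ofReal η)⁻¹ ≠ ∞ := by simpa using η0
    finiteness
  intro u g P Gd N hN ε hε iN iNp iP ρ s hρ hs hρs
  set R := ρ + 3 * s with hR
  have hs1 : s ≤ 1 := by linarith
  have ηe := ENNReal.ofReal_ne_top (r := η)
  have se0 : ENNReal.ofReal s ≠ 0 := by simpa using hs
  have se := ENNReal.ofReal_ne_top (r := s)
  have mN : Measurable N := by
    have : N = _ := funext hN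
    rw [this]; exact aniso_meas Gd.mu
  set l := η * s ^ 2 with hl
  have l0 : 0 < l := by positivity
  have ll : l ≤ s ^ 2 := by nlinarith [sq_nonneg s]
  have l1 : l ≤ 1 := by nlinarith
  have lb : l ^ (1/b) ≤ s := by
    calc l ^ (1/b) ≤ (s ^ 2) ^ (1/b) := Real.rpow_le_rpow l0.le ll (by positivity)
      _ = s ^ (2 / b) := by rw [← Real.rpow_natCast, ← Real.rpow_mul hs.le]; congr 1; push_cast; ring
      _ ≤ s ^ (1:ℝ) := Real.rpow_le_rpow_of_exponent_ge hs hs1 (by rw [le_div_iff₀ b0]; linarith)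
      _ = s := Real.rpow_one s
  set D := ∫⁻ τ in Ioo (-(ρ+s)^2) 0, ∫⁻ x in ball 0 (ρ+s), (‖u τ x‖ₑ^2 + ‖u τ x‖ₑ*(‖u τ x‖ₑ^2 + 2*‖P τ x‖ₑ)) with hD
  obtain ⟨e1, e2⟩ := h1 u g P Gd ρ s hρ hs (by linarith) D hD
  set E := EE u g R with hE
  have E1 : EE u g ρ ≤ 2 * (C1 * ENNReal.ofReal s ^ (-2:ℝ) * D) := by
    rw [two_mul]
    refine add_le_add ?_ e2
    refine essSup_le_of_ae_le _ ?_
    have : volume.restrict (Ioo (-ρ^2) 0) ≤ muT := Measure.restrict_mono (Ioo_subset_Ioo (by nlinarith) le_rfl) le_rfl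
    filter_upwards [ae_mono this e1, ae_restrict_mem measurableSet_Ioo] with t ht hm
    exact ht hm.1
  have D1 : D ≤ C2 * (ENNReal.ofReal l * E + ENNReal.ofReal l ^ (-m) * ε + ENNReal.ofReal l * E + ENNReal.ofReal s ^ (-3:ℝ) * (E ^ (1/2:ℝ) * ε)) := by
    set ν := volume.restrict (Ioo (-(ρ+s)^2) 0) with hν
    have nu1 : ν ≤ muT := Measure.restrict_mono (Ioo_subset_Ioo (by nlinarith) le_rfl) le_rfl
    have nu2 : ν ≤ volume.restrict (Ioo (-R^2) 0) := Measure.restrict_mono (Ioo_subset_Ioo (by nlinarith) le_rfl) le_rfl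
    have aeU : ∀ᵐ t ∂ν, ∫⁻ x in ball 0 R, ‖u t x‖ₑ ^ 2 ≤ E := by
      refine ae_mono nu2 ?_
      filter_upwards [ae_le_essSup (fun t => ∫⁻ x in ball 0 R, ‖u t x‖ₑ ^ 2)] with t ht
      exact ht.trans le_self_add
    have aeD : ∀ᵐ t ∂ν, ∫⁻ x in ball 0 (ρ+s), (‖u t x‖ₑ^2 + ‖u t x‖ₑ*(‖u t x‖ₑ^2 + 2*‖P t x‖ₑ)) ≤
        C2 * (ENNReal.ofReal l * (∫⁻ x in ball 0 R, gn (g t) x ^ 2) + ENNReal.ofReal l ^ (-m) * N t +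
          ENNReal.ofReal l * E * N t ^ p + ENNReal.ofReal s ^ (-3:ℝ) * E ^ (1/2:ℝ) * ∫⁻ x, ‖P t x‖ₑ) := by
      filter_upwards [ae_mono nu1 Gd.slice, aeU] with t St Ut
      refine (h2 _ _ _ St (N t) (hN t) (ρ + s) s l l0 l1 lb hs1 (by linarith)).trans ?_
      rw [show ρ + s + 2 * s = R by rw [hR]; ring, mul_right_comm (ENNReal.ofReal l) E]
      gcongr
    have mG : Measurable (fun t => ∫⁻ x in ball 0 R, gn (g t) x ^ 2) :=
      Measurable.lintegral_prod_right' (ν := volume.restrict (ball (0:E3) R)) ((gn_meas2 Gd.mg).pow_const 2)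
    have mPi : Measurable (fun t => ∫⁻ x, ‖P t x‖ₑ) :=
      Measurable.lintegral_prod_right' (ν := (volume : Measure E3)) Gd.mP.enorm
    calc D ≤ _ := lintegral_mono_ae aeD
      _ = C2 * (ENNReal.ofReal l * (∫⁻ t, (∫⁻ x in ball 0 R, gn (g t) x ^ 2) ∂ν) + ENNReal.ofReal l ^ (-m) * (∫⁻ t, N t ∂ν) +
          ENNReal.ofReal l * E * (∫⁻ t, N t ^ p ∂ν) + ENNReal.ofReal s ^ (-3:ℝ) * E ^ (1/2:ℝ) * (∫⁻ t, (∫⁻ x, ‖P t x‖ₑ) ∂ν)) := by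
        rw [lintegral_const_mul _ (by fun_prop), lintegral_add_left (by fun_prop), lintegral_add_left (by fun_prop), lintegral_add_left (by fun_prop),
          lintegral_const_mul _ mG, lintegral_const_mul _ mN, lintegral_const_mul _ (by fun_prop), lintegral_const_mul _ mPi]
      _ ≤ C2 * (ENNReal.ofReal l * E + ENNReal.ofReal l ^ (-m) * ε +
          ENNReal.ofReal l * E * 1 + ENNReal.ofReal s ^ (-3:ℝ) * E ^ (1/2:ℝ) * ε) := by
        have a1 : ∫⁻ t, (∫⁻ x in ball 0 R, gn (g t) x ^ 2) ∂ν ≤ E := by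
          refine (lintegral_mono' nu2 (le_refl (fun t => ∫⁻ x in ball 0 R, gn (g t) x ^ 2))).trans ?_
          rw [hE]; unfold EE; exact le_add_self
        have a2 := (lintegral_mono' nu1 (le_refl N)).trans iN
        have a3 := (lintegral_mono' nu1 (le_refl (fun t => N t ^ p))).trans iNp
        have a4 := (lintegral_mono' nu1 (le_refl (fun t => ∫⁻ x, ‖P t x‖ₑ))).trans iP
        beta_reduce at a2 a3 a4
        gcongr
      _ = _ := by ring
  have sl : ENNReal.ofReal l = ENNReal.ofReal η * ENNReal.ofReal s ^ (2:ℝ) := by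
    rw [hl, ENNReal.ofReal_mul η0.le, ENNReal.ofReal_pow hs.le, ← ENNReal.rpow_natCast]; norm_num
  have sr : ∀ x y : ℝ, ENNReal.ofReal s ^ x * ENNReal.ofReal s ^ y = ENNReal.ofReal s ^ (x + y) := fun x y => (ENNReal.rpow_add _ _ se0 se).symm
  have smono : ∀ x : ℝ, x ≤ 12 + 2 * m → ENNReal.ofReal s ^ (-x) ≤ ENNReal.ofReal s ^ (-(12 + 2 * m)) := fun x hx =>
    ENNReal.rpow_le_rpow_of_exponent_ge (by rw [← ENNReal.ofReal_one]; exact ENNReal.ofReal_le_ofReal hs1) (by linarith)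
  have t1 : ENNReal.ofReal s ^ (-2:ℝ) * ENNReal.ofReal l = ENNReal.ofReal η := by
    rw [sl, mul_comm, mul_assoc, sr]; norm_num
  have t2 : ENNReal.ofReal s ^ (-2:ℝ) * ENNReal.ofReal l ^ (-m) ≤ ENNReal.ofReal η ^ (-m) * ENNReal.ofReal s ^ (-(12 + 2 * m)) := by
    rw [sl, ENNReal.mul_rpow_of_ne_top ηe (by rw [ENNReal.ofReal_rpow_of_pos hs]; exact ENNReal.ofReal_ne_top), ← ENNReal.rpow_mul, mul_left_comm, sr]
    refine mul_le_mul' le_rfl ?_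
    have := smono (2 + 2 * m) (by linarith)
    rwa [show -(2 + 2 * m) = -2 + 2 * -m by ring] at this
  have t3 : ENNReal.ofReal s ^ (-2:ℝ) * (ENNReal.ofReal s ^ (-3:ℝ) * (E ^ (1/2:ℝ) * ε)) ≤ ENNReal.ofReal η * E + (ENNReal.ofReal η)⁻¹ * ENNReal.ofReal s ^ (-(12 + 2 * m)) * ε := by
    calc _ = E ^ (1/2:ℝ) * (ENNReal.ofReal s ^ (-5:ℝ) * ε) := by
          rw [show (-5:ℝ) = -2 + -3 by norm_num, ← sr]; ring
      _ ≤ _ := young2 ηe0 ηe _ _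
      _ = ENNReal.ofReal η * E + (ENNReal.ofReal η)⁻¹ * ENNReal.ofReal s ^ (-10:ℝ) * (ε * ε) := by
          rw [show (-10:ℝ) = -5 + -5 by norm_num, ← sr]; ring
      _ ≤ ENNReal.ofReal η * E + (ENNReal.ofReal η)⁻¹ * ENNReal.ofReal s ^ (-(12 + 2 * m)) * (ε * 1) := by
          have := smono 10 (by linarith)
          gcongr
      _ = _ := by rw [mul_one]
  calc EE u g ρ ≤ _ := E1
    _ ≤ 2 * (C1 * ENNReal.ofReal s ^ (-2:ℝ) * (C2 * (ENNReal.ofReal l * E + ENNReal.ofReal l ^ (-m) * ε + ENNReal.ofReal l * E + ENNReal.ofReal s ^ (-3:ℝ) * (E ^ (1/2:ℝ) * ε)))) := by gcongr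
    _ = 2 * C1 * C2 * (2 * ((ENNReal.ofReal s ^ (-2:ℝ) * ENNReal.ofReal l) * E) + (ENNReal.ofReal s ^ (-2:ℝ) * ENNReal.ofReal l ^ (-m)) * ε +
        ENNReal.ofReal s ^ (-2:ℝ) * (ENNReal.ofReal s ^ (-3:ℝ) * (E ^ (1/2:ℝ) * ε))) := by ring
    _ ≤ 2 * C1 * C2 * (2 * (ENNReal.ofReal η * E) + (ENNReal.ofReal η ^ (-m) * ENNReal.ofReal s ^ (-(12 + 2 * m))) * ε +
        (ENNReal.ofReal η * E + (ENNReal.ofReal η)⁻¹ * ENNReal.ofReal s ^ (-(12 + 2 * m)) * ε)) := by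
      rw [t1]; gcongr
    _ = _ := by ring

theorem EE_fin {u g P} (Gd : Good u g P) : ∃ K : ℝ≥0∞, K ≠ ∞ ∧ ∀ ρ : ℝ, 0 ≤ ρ → ρ ≤ 1 → EE u g ρ ≤ K := by
  obtain ⟨K, hK, h⟩ := Gd.bdd
  refine ⟨K + ∫⁻ t, (∫⁻ x, gn (g t) x ^ 2) ∂muT, by finiteness [Gd.grad], fun ρ h0 h1 => ?_⟩
  have : volume.restrict (Ioo (-ρ^2) 0) ≤ muT := Measure.restrict_mono (Ioo_subset_Ioo (by nlinarith) le_rfl) le_rfl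
  refine add_le_add (essSup_le_of_ae_le _ ?_) ?_
  · filter_upwards [ae_mono this h] with t ht
    exact (setLIntegral_le_lintegral _ _).trans ht
  · refine (int_muT_sub h0 h1).trans (lintegral_mono fun t => setLIntegral_le_lintegral _ _)

theorem step1 {q1 q2 q3 p : ℝ} (hq1 : 1 < q1) (hq2 : 1 < q2) (hq3 : 1 < q3) (hp0 : 0 < p)
    (hpq : 2 / p + (1/q1 + 1/q2 + 1/q3) < 2) :
    ∃ (A : ℝ≥0∞), A ≠ ∞ ∧
      ∀ u g P, Good u g P → ∀ N : ℝ → ℝ≥0∞, (∀ t, N t = anisoNorm q1 q2 q3 (ball 0 1) (fun x => ‖u t x‖)) →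
      ∀ ε : ℝ≥0∞, ε ≤ 1 → ∫⁻ t, N t ∂muT ≤ ε → ∫⁻ t, N t ^ p ∂muT ≤ 1 → ∫⁻ t, (∫⁻ x, ‖P t x‖ₑ) ∂muT ≤ ε →
      EE u g (7/8) ≤ A * ε := by
  obtain ⟨M, C, M0, hC, h⟩ := step1a hq1 hq2 hq3 hp0 hpq
  obtain ⟨η, η0, η1, hη⟩ : ∃ η : ℝ, 0 < η ∧ η ≤ 1 ∧ C * ENNReal.ofReal η * ENNReal.ofReal ((8/5) ^ M) ≤ 1/2 := by
    set c := C.toReal with hc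
    have hc0 : 0 ≤ c := ENNReal.toReal_nonneg
    have p0 : (0:ℝ) < (8/5:ℝ) ^ M := by positivity
    refine ⟨min 1 (1 / (2 * (c + 1) * (8/5) ^ M)), by positivity, min_le_left _ _, ?_⟩
    rw [← ENNReal.ofReal_toReal hC, ← ENNReal.ofReal_mul hc0, ← ENNReal.ofReal_mul (by positivity)]
    refine (ENNReal.ofReal_le_ofReal (q := 1/2) ?_).trans ?_
    · calc c * min 1 (1 / (2 * (c + 1) * (8/5) ^ M)) * (8/5) ^ M ≤ c * (1 / (2 * (c + 1) * (8/5) ^ M)) * (8/5) ^ M := by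
            gcongr; exact min_le_right _ _
        _ = (1/2) * (c / (c + 1)) := by field_simp
        _ ≤ (1/2) * 1 := by gcongr; rw [div_le_one (by positivity)]; linarith
        _ = 1/2 := by norm_num
    · rw [ENNReal.ofReal_div_of_pos (by norm_num)]; norm_num
  obtain ⟨A, hA, h⟩ := h η η0 η1
  refine ⟨ENNReal.ofReal (8 ^ M) * (2 * (A * ENNReal.ofReal (8 ^ M))), by finiteness, fun u g P Gd N hN ε hε iN iNp iP => ?_⟩
  have key := h u g P Gd N hN ε hε iN iNp iP
  set F := ⨆ ρ ∈ Ico (1/2:ℝ) 1, ENNReal.ofReal ((1 - ρ) ^ M) * EE u g ρ with hF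
  have leF : ∀ ρ, ρ ∈ Ico (1/2:ℝ) 1 → ENNReal.ofReal ((1 - ρ) ^ M) * EE u g ρ ≤ F := fun ρ hρ => le_iSup₂_of_le ρ hρ le_rfl
  have Ft : F ≠ ∞ := by
    obtain ⟨K, hK, hE⟩ := EE_fin Gd
    refine ne_top_of_le_ne_top hK (iSup₂_le fun ρ hρ => ?_)
    calc _ ≤ 1 * K := by
          gcongr
          · rw [← ENNReal.ofReal_one]
            exact ENNReal.ofReal_le_ofReal (Real.rpow_le_one (by linarith [hρ.2]) (by linarith [hρ.1]) M0)
          · exact hE ρ (by linarith [hρ.1]) hρ.2.le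
      _ = K := one_mul _
  have Fle : F ≤ 1/2 * F + A * ENNReal.ofReal (8 ^ M) * ε := by
    refine iSup₂_le fun ρ hρ => ?_
    set d := 1 - ρ with hd
    have d0 : 0 < d := by linarith [hρ.2]
    have k := key ρ (d / 8) hρ.1 (by positivity) (by linarith)
    have kF := leF (ρ + 3 * (d / 8)) ⟨by linarith [hρ.1], by linarith⟩
    rw [show 1 - (ρ + 3 * (d / 8)) = 5/8 * d by rw [hd]; ring] at kF
    have e1 : ENNReal.ofReal (d ^ M) = ENNReal.ofReal ((8/5) ^ M) * ENNReal.ofReal ((5/8 * d) ^ M) := by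
      rw [← ENNReal.ofReal_mul (by positivity), ← Real.mul_rpow (by norm_num) (by positivity)]
      congr 2; ring
    have e2 : ENNReal.ofReal (d ^ M) * ENNReal.ofReal (d / 8) ^ (-M) = ENNReal.ofReal (8 ^ M) := by
      rw [ENNReal.ofReal_rpow_of_pos (by positivity), ← ENNReal.ofReal_mul (by positivity)]
      congr 1
      rw [Real.div_rpow d0.le (by norm_num), Real.rpow_neg d0.le, Real.rpow_neg (by norm_num)]
      field_simp
    calc _ ≤ ENNReal.ofReal (d ^ M) * (C * ENNReal.ofReal η * EE u g (ρ + 3 * (d / 8)) + A * ENNReal.ofReal (d / 8) ^ (-M) * ε) := by gcongr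
      _ = (C * ENNReal.ofReal η) * (ENNReal.ofReal (d ^ M) * EE u g (ρ + 3 * (d / 8))) + A * (ENNReal.ofReal (d ^ M) * ENNReal.ofReal (d / 8) ^ (-M)) * ε := by ring
      _ = (C * ENNReal.ofReal η * ENNReal.ofReal ((8/5) ^ M)) * (ENNReal.ofReal ((5/8 * d) ^ M) * EE u g (ρ + 3 * (d / 8))) + A * ENNReal.ofReal (8 ^ M) * ε := by
        rw [e2, e1]; ring
      _ ≤ _ := by gcongr
  have F2 : F ≤ 2 * (A * ENNReal.ofReal (8 ^ M) * ε) := by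
    have hh : F = 1/2 * F + 1/2 * F := by
      rw [← add_mul, one_div, ENNReal.inv_two_add_inv_two, one_mul]
    have : 1/2 * F + 1/2 * F ≤ 1/2 * F + A * ENNReal.ofReal (8 ^ M) * ε := hh ▸ Fle
    have h3 := (ENNReal.add_le_add_iff_left (by finiteness)).1 this
    calc F = 2 * (1/2 * F) := by rw [two_mul]; exact hh
      _ ≤ _ := by gcongr
  have l := leF (7/8) ⟨by norm_num, by norm_num⟩
  calc EE u g (7/8) = ENNReal.ofReal (8 ^ M) * (ENNReal.ofReal ((1 - 7/8) ^ M) * EE u g (7/8)) := by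
        rw [← mul_assoc, ← ENNReal.ofReal_mul (by positivity), ← Real.mul_rpow (by norm_num) (by norm_num)]
        norm_num
    _ ≤ ENNReal.ofReal (8 ^ M) * (2 * (A * ENNReal.ofReal (8 ^ M) * ε)) := mul_le_mul' le_rfl (l.trans F2)
    _ = _ := by ring

theorem real_h {r U G : ℝ} (hr : 0 < r) (hU : 0 < U) (hG : 0 ≤ G) :
    ∃ h : ℝ, 0 < h ∧ h ≤ r / 8 ∧
      (r/8) ^ (1/8:ℝ) * (h ^ (15/8:ℝ) * G + h ^ (-1/8:ℝ) * U) ≤ 2 * (U ^ (1/3:ℝ) * (U + r ^ 2 * G) ^ (2/3:ℝ)) := by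
  set v := r ^ 2 * G / U with hv
  have v0 : 0 ≤ v := by positivity
  set μ := (1 + v) ^ (-1/2:ℝ) with hμ
  have μ0 : 0 < μ := by positivity
  have μ1 : μ ≤ 1 := Real.rpow_le_one_of_one_le_of_nonpos (by linarith) (by norm_num)
  set s := r / 8 with hs
  have s0 : 0 < s := by positivity
  refine ⟨s * μ, by positivity, by nlinarith, ?_⟩
  have m2 : μ ^ (2:ℝ) * (1 + v) = 1 := by
    rw [hμ, ← Real.rpow_mul (by linarith)]
    norm_num
    rw [Real.rpow_neg_one]; field_simp
  have e1 : s ^ (1/8:ℝ) * ((s * μ) ^ (15/8:ℝ) * G) ≤ U * μ ^ (-1/8:ℝ) := by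
    rw [Real.mul_rpow s0.le μ0.le]
    calc s ^ (1/8:ℝ) * (s ^ (15/8:ℝ) * μ ^ (15/8:ℝ) * G) = (s ^ (1/8:ℝ) * s ^ (15/8:ℝ)) * (μ ^ (15/8:ℝ) * G) := by ring
      _ = s ^ 2 * (μ ^ (15/8:ℝ) * G) := by rw [← Real.rpow_add s0]; norm_num
      _ ≤ r ^ 2 * (μ ^ (15/8:ℝ) * G) := by
        have : s ^ 2 ≤ r ^ 2 := by rw [hs]; nlinarith
        gcongr
      _ = U * (μ ^ (15/8:ℝ) * v) := by rw [hv]; field_simp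
      _ = U * (μ ^ (-1/8:ℝ) * (μ ^ (2:ℝ) * v)) := by
        rw [← mul_assoc (μ ^ (-1/8:ℝ)), ← Real.rpow_add μ0]; norm_num
      _ ≤ U * (μ ^ (-1/8:ℝ) * 1) := by
        have : μ ^ (2:ℝ) * v ≤ 1 := by
          have : 0 < μ ^ (2:ℝ) := by positivity
          nlinarith
        gcongr
      _ = _ := by rw [mul_one]
  have e2 : s ^ (1/8:ℝ) * ((s * μ) ^ (-1/8:ℝ) * U) = U * μ ^ (-1/8:ℝ) := by
    rw [Real.mul_rpow s0.le μ0.le]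
    calc s ^ (1/8:ℝ) * (s ^ (-1/8:ℝ) * μ ^ (-1/8:ℝ) * U) = (s ^ (1/8:ℝ) * s ^ (-1/8:ℝ)) * (U * μ ^ (-1/8:ℝ)) := by ring
      _ = _ := by rw [← Real.rpow_add s0]; norm_num
  have e3 : U * μ ^ (-1/8:ℝ) ≤ U ^ (1/3:ℝ) * (U + r ^ 2 * G) ^ (2/3:ℝ) := by
    have : U + r ^ 2 * G = U * (1 + v) := by rw [hv]; field_simp
    rw [this, Real.mul_rpow hU.le (by linarith), ← mul_assoc, ← Real.rpow_add hU, hμ, ← Real.rpow_mul (by linarith)]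
    norm_num
    exact mul_le_mul_of_nonneg_left (Real.rpow_le_rpow_of_exponent_le (by linarith) (by norm_num)) hU.le
  rw [mul_add, e2]
  linarith

theorem vol_ball_eq (x0 : E3) {r : ℝ} (hr : 0 ≤ r) : volume (ball x0 r) = ENNReal.ofReal (r ^ 3) * volume (ball (0:E3) 1) := by
  rw [Measure.addHaar_ball _ _ hr]; simp

theorem nearB : ∃ C : ℝ≥0∞, C ≠ ∞ ∧ ∀ u g P, Slice u g P → ∀ (x0 : E3) (r : ℝ) (U : ℝ≥0∞), 0 < r → 
    ball x0 r ⊆ ball 0 1 → U ≠ 0 → U ≠ ∞ → ∫⁻ x in ball x0 r, ‖u x‖ₑ ^ 2 ≤ U →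
    ∫⁻ x in ball x0 (3/4 * r), (‖u x‖ₑ ^ 2 + near (r/8) u x) ≤
      C * (U ^ (1/3:ℝ) * (U + ENNReal.ofReal r ^ 2 * ∫⁻ x in ball x0 r, gn g x ^ 2) ^ (2/3:ℝ)) := by
  obtain ⟨C, hC, h⟩ := lemN (κ := 1/8) (γ := 3/2) (τ := 3 - 3/2) (by norm_num) (by norm_num) (by norm_num)
  obtain ⟨C1, hC1, h1⟩ := adm_one (γ := 3/2) (by norm_num)
  refine ⟨2 * (C * C1), by finiteness, fun u g P Sl x0 r U hr hb hU0 hUt hU => ?_⟩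
  set G := ∫⁻ x in ball x0 r, gn g x ^ 2 with hG
  have Gt : G ≠ ∞ := ne_top_of_le_ne_top Sl.Lg.ne (setLIntegral_le_lintegral _ _)
  obtain ⟨k, k0, k1, hk⟩ := real_h (r := r) (U := U.toReal) (G := G.toReal) hr (ENNReal.toReal_pos hU0 hUt) ENNReal.toReal_nonneg
  have sub : ball x0 (3/4 * r + r/8 + k) ⊆ ball x0 r := ball_subset_ball (by linarith)
  have := h u g P Sl (fun _ => 1) C1 measurable_const h1 x0 (3/4 * r) (r/8) k k0 k1 (sub.trans hb)
  simp only [one_mul] at this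
  have kk := ENNReal.ofReal_le_ofReal hk
  have U0 : 0 < U.toReal := ENNReal.toReal_pos hU0 hUt
  have G0 : 0 ≤ G.toReal := ENNReal.toReal_nonneg
  rw [ENNReal.ofReal_mul (by positivity), ENNReal.ofReal_add (by positivity) (by positivity), ENNReal.ofReal_mul (by positivity), ENNReal.ofReal_mul (by positivity),
    ENNReal.ofReal_mul (by positivity), ENNReal.ofReal_mul (by positivity), ← ENNReal.ofReal_rpow_of_pos (by positivity), ← ENNReal.ofReal_rpow_of_pos k0, ← ENNReal.ofReal_rpow_of_pos k0,
    ← ENNReal.ofReal_rpow_of_pos U0, ← ENNReal.ofReal_rpow_of_pos (by positivity), ENNReal.ofReal_add (by positivity) (by positivity), ENNReal.ofReal_mul (by positivity),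
    ENNReal.ofReal_toReal hUt, ENNReal.ofReal_toReal Gt, ENNReal.ofReal_pow hr.le] at kk
  calc _ ≤ _ := this
    _ ≤ C * C1 * (ENNReal.ofReal (r/8) ^ (1/8:ℝ) * (ENNReal.ofReal k ^ (15/8:ℝ) * G + ENNReal.ofReal k ^ (-1/8:ℝ) * U)) := by
      rw [mul_assoc (C * C1), show (3/2 + (3 - 3/2) - 1 - 1/8 : ℝ) = 15/8 by norm_num, show (3/2 + (3 - 3/2) - 3 - 1/8 : ℝ) = -1/8 by norm_num]
      have a1 : ∫⁻ y in ball x0 (3/4 * r + r/8 + k), gn g y ^ 2 ≤ G := lintegral_mono_set sub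
      have a2 : min (∫⁻ y in ball x0 (3/4 * r + r/8 + k), ‖u y‖ₑ ^ 2)
        (ENNReal.ofReal k ^ (-3 : ℝ) * (∫⁻ y in ball x0 (3/4 * r + r/8 + k), ‖u y‖ₑ) ^ 2) ≤ U := (min_le_left _ _).trans ((lintegral_mono_set sub).trans hU)
      gcongr
    _ ≤ C * C1 * _ := mul_le_mul' le_rfl kk
    _ = _ := by simp; ring

theorem slice2 : ∃ C : ℝ≥0∞, C ≠ ∞ ∧ ∀ u g P, Slice u g P → ∀ (x0 : E3) (r : ℝ) (U : ℝ≥0∞) (c : ℝ), 0 < r → 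
    ball x0 r ⊆ ball 0 1 → U ≠ 0 → U ≠ ∞ → ∫⁻ x in ball x0 r, ‖u x‖ₑ ^ 2 ≤ U → ∀ (n G : ℝ≥0∞) (c' : ℝ),
    n = ∫⁻ x in ball x0 r, ‖P x - c‖ₑ → G = ∫⁻ x in ball x0 r, gn g x ^ 2 → c' = c0⁻¹ * ∫ y, P y * rho (r/8) (y - x0) →
    (∀ θ : ℝ, 0 < θ → θ ≤ 1/2 → ∫⁻ x in ball x0 (θ * r), ‖P x - c'‖ₑ ≤
      C * (ENNReal.ofReal θ ^ 4 * n + U ^ (1/3:ℝ) * (U + ENNReal.ofReal r ^ 2 * G) ^ (2/3:ℝ))) ∧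
    ∫⁻ x in ball x0 (3/4 * r), ‖u x‖ₑ * (‖u x‖ₑ ^ 2 + 2 * ‖P x - c'‖ₑ) ≤
      C * (ENNReal.ofReal r ^ (-3/2:ℝ) * U ^ (1/2:ℝ) * (n + (U + ENNReal.ofReal r ^ 2 * G))) := by
  obtain ⟨C1, hC1, h1⟩ := nearB
  obtain ⟨C2, hC2, h2⟩ := press_B
  obtain ⟨C, hC, h⟩ := lemN (κ := 1/8) (γ := 11/8) (τ := 3/2 - 11/8) (by norm_num) (by norm_num) (by norm_num)
  obtain ⟨C3, hC3, h3⟩ := adm_L2 (γ := 11/8) (by norm_num)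
  set V := volume (ball (0:E3) 1) with hV
  have Vt : V ≠ ∞ := measure_ball_lt_top.ne
  have Vt2 : V ^ (1/2:ℝ) ≠ ∞ := ENNReal.rpow_ne_top_of_nonneg (by norm_num) Vt
  set K8 := ENNReal.ofReal (8 ^ (3/2:ℝ)) with hK8
  set K4 := ENNReal.ofReal (8 ^ 4) with hK4
  refine ⟨C2 * K4 * V + C2 * C1 + (2 * C2 * K4 * V ^ (1/2:ℝ) + (1 + 2 * C2) * (C * C3 * K8)), by finiteness, fun u g P Sl x0 r U c hr hb hU0 hUt hU n G c' hn hG hc' => ?_⟩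
  have mu := Sl.mu.enorm
  have mP := Sl.mP
  have mn := near_meas Sl.mu (r/8)
  have se0 : ENNReal.ofReal (r/8) ≠ 0 := by simpa using hr
  have re0 : ENNReal.ofReal r ≠ 0 := by simpa using hr
  -- pointwise pressure bound
  have s4 : ∀ θ : ℝ, 0 < θ → ENNReal.ofReal (r/8) ^ (-4:ℝ) * ENNReal.ofReal (θ * r) = K4 * ENNReal.ofReal θ * ENNReal.ofReal r ^ (-3:ℝ) := by
    intro θ hθ
    rw [ENNReal.ofReal_rpow_of_pos (by positivity), ENNReal.ofReal_rpow_of_pos hr, hK4, ← ENNReal.ofReal_mul (by positivity), ← ENNReal.ofReal_mul (by positivity), ← ENNReal.ofReal_mul (by positivity)]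
    congr 1
    rw [show (-4:ℝ) = -((4:ℕ):ℝ) by norm_num, show (-3:ℝ) = -((3:ℕ):ℝ) by norm_num, Real.rpow_neg (by positivity), Real.rpow_neg hr.le, Real.rpow_natCast, Real.rpow_natCast]
    field_simp
    try norm_num
  have pw : ∀ θ : ℝ, 0 < θ → θ ≤ 3/4 → ∀ᵐ x ∂(volume.restrict (ball x0 (θ * r))), ‖P x - c'‖ₑ ≤ C2 * (K4 * ENNReal.ofReal θ * ENNReal.ofReal r ^ (-3:ℝ) * n + near (r/8) u x) := by
    intro θ hθ hθ1
    filter_upwards [ae_restrict_of_ae (leb Sl.P_int), ae_restrict_mem measurableSet_ball] with x hx hxb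
    rw [mem_ball, dist_eq_norm] at hxb
    have hxr : ‖x - x0‖ < 3/4 * r := hxb.trans_le (by gcongr)
    have := h2 u g P Sl (r/8) x x0 c (by positivity) (fun y hy => hb ?_) hx
    · rw [← hc'] at this
      refine this.trans ?_
      rw [← s4 θ hθ, hn]
      have a1 : ‖x - x0‖ₑ ≤ ENNReal.ofReal (θ * r) := by
        rw [← ofReal_norm]; exact ENNReal.ofReal_le_ofReal hxb.le
      have a2 : ∫⁻ y in ball x0 (r/8 + ‖x - x0‖), ‖P y - c‖ₑ ≤ ∫⁻ y in ball x0 r, ‖P y - c‖ₑ := lintegral_mono_set (ball_subset_ball (by linarith))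
      gcongr
    · rw [mem_closedBall] at hy
      rw [mem_ball]
      have := dist_triangle y x x0
      rw [dist_eq_norm x x0] at this
      linarith
  constructor
  · intro θ hθ hθ1
    have b1 := h1 u g P Sl x0 r U hr hb hU0 hUt hU
    rw [← hG] at b1
    set Z := U ^ (1/3:ℝ) * (U + ENNReal.ofReal r ^ 2 * G) ^ (2/3:ℝ) with hZ
    have vb : volume (ball x0 (θ * r)) = ENNReal.ofReal θ ^ 3 * ENNReal.ofReal r ^ (3:ℝ) * V := by
      rw [vol_ball_eq _ (by positivity), mul_pow, ENNReal.ofReal_mul (by positivity), ENNReal.ofReal_pow hθ.le, ENNReal.ofReal_pow hr.le, ← ENNReal.rpow_natCast (ENNReal.ofReal r), Nat.cast_ofNat]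
    have rr : ENNReal.ofReal r ^ (3:ℝ) * ENNReal.ofReal r ^ (-3:ℝ) = 1 := by
      rw [← ENNReal.rpow_add _ _ re0 ENNReal.ofReal_ne_top]; norm_num
    calc _ ≤ _ := lintegral_mono_ae (pw θ hθ (by linarith))
      _ = C2 * (K4 * ENNReal.ofReal θ * ENNReal.ofReal r ^ (-3:ℝ) * n * volume (ball x0 (θ * r)) + ∫⁻ x in ball x0 (θ * r), near (r/8) u x) := by
        rw [lintegral_const_mul _ (by fun_prop), lintegral_add_left (by fun_prop), setLIntegral_const]
      _ ≤ C2 * (K4 * ENNReal.ofReal θ * ENNReal.ofReal r ^ (-3:ℝ) * n * (ENNReal.ofReal θ ^ 3 * ENNReal.ofReal r ^ (3:ℝ) * V) + C1 * Z) := by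
        rw [vb]
        have : ∫⁻ x in ball x0 (θ * r), near (r/8) u x ≤ C1 * Z := by
          refine le_trans ?_ b1
          refine (lintegral_mono_set (ball_subset_ball (by gcongr; linarith))).trans (lintegral_mono fun x => le_add_self)
        gcongr
      _ = C2 * K4 * V * (ENNReal.ofReal θ ^ 4 * n) * (ENNReal.ofReal r ^ (3:ℝ) * ENNReal.ofReal r ^ (-3:ℝ)) + C2 * C1 * Z := by ring
      _ ≤ C2 * K4 * V * (ENNReal.ofReal θ ^ 4 * n + Z) + C2 * C1 * (ENNReal.ofReal θ ^ 4 * n + Z) := by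
        rw [rr, mul_one]
        gcongr
        · exact le_self_add
        · exact le_add_self
      _ = (C2 * K4 * V + C2 * C1) * (ENNReal.ofReal θ ^ 4 * n + Z) := by ring
      _ ≤ _ := mul_le_mul' le_self_add le_rfl
  · set w : E3 → ℝ≥0∞ := (ball x0 r).indicator (fun x => ‖u x‖ₑ) with hw
    have mw : Measurable w := mu.indicator measurableSet_ball
    have w2 : (∫⁻ x, w x ^ 2) ≤ U := by
      refine le_trans (le_of_eq ?_) hU
      rw [← lintegral_indicator measurableSet_ball]
      congr 1; ext x
      by_cases hx : x ∈ ball x0 r <;> simp [hw, hx]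
    have q := h u g P Sl w _ mw (h3 w mw) x0 (3/4 * r) (r/8) (r/8) (by positivity) le_rfl (by rw [show 3/4 * r + r/8 + r/8 = r by ring]; exact hb)
    rw [show 3/4 * r + r/8 + r/8 = r by ring, ← hG] at q
    have sm : ∀ x y : ℝ, ENNReal.ofReal (r/8) ^ x * ENNReal.ofReal (r/8) ^ y = ENNReal.ofReal (r/8) ^ (x + y) := fun x y => (ENNReal.rpow_add _ _ se0 ENNReal.ofReal_ne_top).symm
    have s32 : ENNReal.ofReal (r/8) ^ (-3/2:ℝ) = K8 * ENNReal.ofReal r ^ (-3/2:ℝ) := by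
      rw [ENNReal.ofReal_rpow_of_pos (by positivity), ENNReal.ofReal_rpow_of_pos hr, hK8, ← ENNReal.ofReal_mul (by positivity)]
      congr 1
      rw [Real.div_rpow hr.le (by norm_num), div_eq_mul_inv, ← Real.rpow_neg (by norm_num), mul_comm]
      norm_num
    set H := ENNReal.ofReal r ^ (-3/2:ℝ) * U ^ (1/2:ℝ) * (n + (U + ENNReal.ofReal r ^ 2 * G)) with hH
    have J1 : ∫⁻ x in ball x0 (3/4 * r), ‖u x‖ₑ * (‖u x‖ₑ ^ 2 + near (r/8) u x) ≤ C * C3 * K8 * H := by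
      calc _ = ∫⁻ x in ball x0 (3/4 * r), w x * (‖u x‖ₑ ^ 2 + near (r/8) u x) := by
            refine setLIntegral_congr_fun measurableSet_ball fun x hx => ?_
            have : x ∈ ball x0 r := ball_subset_ball (by linarith) hx
            simp only [hw, indicator_of_mem this]
        _ ≤ _ := q
        _ ≤ C * (C3 * U ^ (1/2:ℝ)) * ENNReal.ofReal (r/8) ^ (1/8:ℝ) * (ENNReal.ofReal (r/8) ^ (3/8:ℝ) * G + ENNReal.ofReal (r/8) ^ (-13/8:ℝ) * U) := by
            rw [show (11/8 + (3/2 - 11/8) - 1 - 1/8 : ℝ) = 3/8 by norm_num, show (11/8 + (3/2 - 11/8) - 3 - 1/8 : ℝ) = -13/8 by norm_num]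
            have := (min_le_left (∫⁻ y in ball x0 r, ‖u y‖ₑ ^ 2) (ENNReal.ofReal (r/8) ^ (-3 : ℝ) * (∫⁻ y in ball x0 r, ‖u y‖ₑ) ^ 2)).trans hU
            gcongr
        _ = C * C3 * U ^ (1/2:ℝ) * ((ENNReal.ofReal (r/8) ^ (1/8:ℝ) * ENNReal.ofReal (r/8) ^ (-13/8:ℝ)) * (U + (ENNReal.ofReal (r/8) ^ (2:ℝ)) * G)) := by
            rw [show (3/8:ℝ) = -13/8 + 2 by norm_num, ← sm]; ring
        _ ≤ C * C3 * U ^ (1/2:ℝ) * (K8 * ENNReal.ofReal r ^ (-3/2:ℝ) * (n + (U + ENNReal.ofReal r ^ 2 * G))) := by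
            rw [sm, show (1/8 + -13/8:ℝ) = -3/2 by norm_num, s32]
            have a0 : ENNReal.ofReal (r/8) ^ (2:ℝ) ≤ ENNReal.ofReal r ^ 2 := by
              rw [← ENNReal.rpow_natCast]
              exact ENNReal.rpow_le_rpow (ENNReal.ofReal_le_ofReal (by linarith)) (by norm_num)
            have a1 : U + ENNReal.ofReal (r/8) ^ (2:ℝ) * G ≤ n + (U + ENNReal.ofReal r ^ 2 * G) := by
              refine le_trans ?_ le_add_self
              gcongr
            gcongr
        _ = _ := by rw [hH]; ring
    have J2 : ENNReal.ofReal r ^ (-3:ℝ) * n * (∫⁻ x in ball x0 (3/4 * r), ‖u x‖ₑ) ≤ V ^ (1/2:ℝ) * H := by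
      have i1 : ∫⁻ x in ball x0 (3/4 * r), ‖u x‖ₑ ≤ (ENNReal.ofReal r ^ (3/2:ℝ) * V ^ (1/2:ℝ)) * U ^ (1/2:ℝ) := by
        refine (lintegral_mono_set (ball_subset_ball (by linarith))).trans ((l1_l2 x0 r mu).trans ?_)
        rw [vol_ball_eq _ hr.le, ENNReal.mul_rpow_of_nonneg _ _ (by norm_num), ENNReal.ofReal_pow hr.le, ← ENNReal.rpow_natCast, ← ENNReal.rpow_mul, Nat.cast_ofNat, show (3 * (1/2):ℝ) = 3/2 by norm_num]
        gcongr
      calc _ ≤ ENNReal.ofReal r ^ (-3:ℝ) * n * ((ENNReal.ofReal r ^ (3/2:ℝ) * V ^ (1/2:ℝ)) * U ^ (1/2:ℝ)) := by gcongr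
        _ = V ^ (1/2:ℝ) * ((ENNReal.ofReal r ^ (-3:ℝ) * ENNReal.ofReal r ^ (3/2:ℝ)) * U ^ (1/2:ℝ) * n) := by ring
        _ ≤ _ := by
          rw [← ENNReal.rpow_add _ _ re0 ENNReal.ofReal_ne_top, show (-3 + 3/2:ℝ) = -3/2 by norm_num, hH]
          have : n ≤ n + (U + ENNReal.ofReal r ^ 2 * G) := le_self_add
          gcongr
    calc _ ≤ ∫⁻ x in ball x0 (3/4 * r), ((1 + 2 * C2) * (‖u x‖ₑ * (‖u x‖ₑ ^ 2 + near (r/8) u x)) + 2 * C2 * K4 * (ENNReal.ofReal r ^ (-3:ℝ) * n) * ‖u x‖ₑ) := by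
          refine lintegral_mono_ae ?_
          filter_upwards [pw (3/4) (by norm_num) le_rfl] with x hx
          have t1 : ENNReal.ofReal (3/4) ≤ 1 := by rw [← ENNReal.ofReal_one]; exact ENNReal.ofReal_le_ofReal (by norm_num)
          calc _ ≤ ‖u x‖ₑ * (‖u x‖ₑ ^ 2 + 2 * (C2 * (K4 * 1 * ENNReal.ofReal r ^ (-3:ℝ) * n + near (r/8) u x))) := by
                refine mul_le_mul' le_rfl (add_le_add le_rfl (mul_le_mul' le_rfl (hx.trans ?_)))
                gcongr
            _ = (1 * (‖u x‖ₑ * ‖u x‖ₑ ^ 2) + 2 * C2 * (‖u x‖ₑ * near (r/8) u x)) + 2 * C2 * K4 * (ENNReal.ofReal r ^ (-3:ℝ) * n) * ‖u x‖ₑ := by ring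
            _ ≤ ((1 + 2 * C2) * (‖u x‖ₑ * ‖u x‖ₑ ^ 2) + (1 + 2 * C2) * (‖u x‖ₑ * near (r/8) u x)) + 2 * C2 * K4 * (ENNReal.ofReal r ^ (-3:ℝ) * n) * ‖u x‖ₑ := by
                gcongr
                · exact le_self_add
                · exact le_add_self
            _ = _ := by ring
      _ = (1 + 2 * C2) * (∫⁻ x in ball x0 (3/4 * r), (‖u x‖ₑ * (‖u x‖ₑ ^ 2 + near (r/8) u x))) + 2 * C2 * K4 * (ENNReal.ofReal r ^ (-3:ℝ) * n * ∫⁻ x in ball x0 (3/4 * r), ‖u x‖ₑ) := by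
          rw [lintegral_add_left (by fun_prop), lintegral_const_mul _ (by fun_prop), lintegral_const_mul _ mu]; ring
      _ ≤ (1 + 2 * C2) * (C * C3 * K8 * H) + 2 * C2 * K4 * (V ^ (1/2:ℝ) * H) := by gcongr
      _ = (2 * C2 * K4 * V ^ (1/2:ℝ) + (1 + 2 * C2) * (C * C3 * K8)) * H := by ring
      _ ≤ _ := mul_le_mul' le_add_self le_rfl

/-- Gaussian profile as a function of time and squared distance. -/
def Gh (τ σ : ℝ) : ℝ := Real.exp (-(3/2) * Real.log τ - σ / (4 * τ))

theorem Gh_pos (τ σ : ℝ) : 0 < Gh τ σ := Real.exp_pos _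

theorem Gh_eq {w : ℝ} (hw : 0 < w) (σ : ℝ) : Gh (w ^ 2) σ * w ^ 3 = Real.exp (-(σ / (4 * w ^ 2))) := by
  unfold Gh
  rw [Real.log_pow, sub_eq_add_neg, Real.exp_add]
  have : Real.exp (-(3/2) * (((2:ℕ):ℝ) * Real.log w)) = w⁻¹ ^ 3 := by
    rw [show -(3/2) * (((2:ℕ):ℝ) * Real.log w) = ((3:ℕ):ℝ) * Real.log w⁻¹ by rw [Real.log_inv]; push_cast; ring]
    rw [Real.exp_nat_mul, Real.exp_log (by positivity)]
  rw [this]; field_simp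

theorem exp_q {q : ℝ} (hq : 0 ≤ q) : (1 + q) ^ 3 * Real.exp (-(q / 4)) ≤ 1728 := by
  have h : 1 + q / 12 ≤ Real.exp (q / 12) := by linarith [Real.add_one_le_exp (q / 12)]
  have h3 : (1 + q / 12) ^ 3 ≤ Real.exp (q / 4) := by
    calc _ ≤ Real.exp (q / 12) ^ 3 := by gcongr
      _ = _ := by rw [← Real.exp_nat_mul]; congr 1; push_cast; ring
  rw [Real.exp_neg, ← div_eq_mul_inv, div_le_iff₀ (Real.exp_pos _)]
  calc (1 + q) ^ 3 ≤ (12 + q) ^ 3 := by gcongr; norm_num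
    _ = 1728 * (1 + q / 12) ^ 3 := by ring
    _ ≤ _ := by gcongr

theorem Gh_bd {τ p m : ℝ} (hτ : 0 < τ) (hp : 0 ≤ p) (hm : 0 < m) (h : m ^ 2 ≤ τ + p ^ 2) :
    Gh τ (p ^ 2) ≤ 1728 * m⁻¹ ^ 3 ∧ p ^ 2 / τ * Gh τ (p ^ 2) ≤ 1728 * m⁻¹ ^ 3 ∧ p / τ * Gh τ (p ^ 2) ≤ 1728 * m⁻¹ ^ 4 := by
  obtain ⟨w, hw, rfl⟩ : ∃ w : ℝ, 0 < w ∧ τ = w ^ 2 := ⟨√τ, Real.sqrt_pos.2 hτ, (Real.sq_sqrt hτ.le).symm⟩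
  obtain ⟨k, hk, rfl⟩ : ∃ k : ℝ, 0 ≤ k ∧ p = w * k := ⟨p / w, by positivity, by field_simp⟩
  set q := k ^ 2 with hq
  have q0 : 0 ≤ q := by positivity
  have e := exp_q q0
  have G := Gh_eq hw ((w * k) ^ 2)
  rw [show (w * k) ^ 2 / (4 * w ^ 2) = q / 4 by rw [hq]; field_simp] at G
  rw [← G] at e
  set g := Gh (w ^ 2) ((w * k) ^ 2) with hg
  have g0 : 0 < g := Gh_pos _ _
  have m2 : m ^ 2 ≤ w ^ 2 * (1 + q) := by rw [hq]; linarith [h, mul_pow w k 2]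
  have m1 : m ≤ w * (1 + q) := by
    apply le_of_sq_le_sq _ (by positivity)
    nlinarith [mul_nonneg (sq_nonneg w) q0, mul_nonneg (sq_nonneg w) (mul_nonneg q0 q0)]
  have k1 : k ≤ 1 + q := by rw [hq]; nlinarith [sq_nonneg (k - 1)]
  have m3 : m ^ 3 ≤ w ^ 3 * (1 + q) ^ 2 := by
    calc m ^ 3 = m * m ^ 2 := by ring
      _ ≤ (w * (1 + q)) * (w ^ 2 * (1 + q)) := by gcongr
      _ = _ := by ring
  have q1 : (1 + q) ^ 2 ≤ (1 + q) ^ 3 := by nlinarith [sq_nonneg (1 + q)]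
  refine ⟨?_, ?_, ?_⟩
  · rw [inv_pow, ← div_eq_mul_inv, le_div_iff₀ (by positivity)]
    calc g * m ^ 3 ≤ g * (w ^ 3 * (1 + q) ^ 3) := by gcongr; exact m3.trans (by gcongr)
      _ = (1 + q) ^ 3 * (g * w ^ 3) := by ring
      _ ≤ _ := e
  · rw [inv_pow, ← div_eq_mul_inv, le_div_iff₀ (by positivity)]
    have : (w * k) ^ 2 / w ^ 2 = q := by rw [hq]; field_simp
    rw [this]
    calc q * g * m ^ 3 ≤ (1 + q) * g * (w ^ 3 * (1 + q) ^ 2) := by gcongr; linarith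
      _ = (1 + q) ^ 3 * (g * w ^ 3) := by ring
      _ ≤ _ := e
  · rw [inv_pow, ← div_eq_mul_inv, le_div_iff₀ (by positivity)]
    have : (w * k) / w ^ 2 = k / w := by field_simp
    rw [this]
    calc k / w * g * m ^ 4 = k / w * g * (m ^ 2 * m ^ 2) := by ring
      _ ≤ (1 + q) / w * g * ((w ^ 2 * (1 + q)) * (w ^ 2 * (1 + q))) := by gcongr
      _ = (1 + q) ^ 3 * (g * w ^ 3) := by field_simp
      _ ≤ _ := e

theorem Gh_low {τ σ r : ℝ} (hr : 0 < r) (h1 : r ^ 2 ≤ τ) (h2 : τ ≤ 2 * r ^ 2) (h3 : σ ≤ r ^ 2) :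
    1 / 16 * r⁻¹ ^ 3 ≤ Gh τ σ := by
  have hτ : 0 < τ := lt_of_lt_of_le (by positivity) h1
  obtain ⟨w, hw, rfl⟩ : ∃ w : ℝ, 0 < w ∧ τ = w ^ 2 := ⟨√τ, Real.sqrt_pos.2 hτ, (Real.sq_sqrt hτ.le).symm⟩
  have G := Gh_eq hw σ
  have w2 : w ≤ 2 * r := by apply le_of_sq_le_sq _ (by positivity); nlinarith
  have : (1:ℝ) / 2 ≤ Real.exp (-(σ / (4 * w ^ 2))) := by
    have : σ / (4 * w ^ 2) ≤ 1 / 2 := by rw [div_le_iff₀ (by positivity)]; nlinarith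
    linarith [Real.add_one_le_exp (-(σ / (4 * w ^ 2)))]
  rw [← G] at this
  rw [inv_pow, ← div_eq_mul_inv, div_le_iff₀ (by positivity)]
  have g0 := Gh_pos (w ^ 2) σ
  have w3 : w ^ 3 ≤ (2 * r) ^ 3 := by gcongr
  nlinarith

theorem Gh_hτ {τ : ℝ} (hτ : 0 < τ) (σ : ℝ) : HasDerivAt (fun τ => Gh τ σ) ((-(3 / (2 * τ)) + σ / (4 * τ ^ 2)) * Gh τ σ) τ := by
  have h1 : HasDerivAt (fun τ : ℝ => -(3/2) * Real.log τ - σ / (4 * τ)) (-(3/2) * τ⁻¹ - (0 * (4 * τ) - σ * (4 * 1)) / (4 * τ) ^ 2) τ :=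
    ((Real.hasDerivAt_log hτ.ne').const_mul _).sub ((hasDerivAt_const τ σ).div ((hasDerivAt_id τ).const_mul 4) (by positivity))
  refine h1.exp.congr_deriv ?_
  unfold Gh
  rw [mul_comm]; congr 1; field_simp; ring

theorem Gh_hσ (τ σ : ℝ) : HasDerivAt (Gh τ) (-(1 / (4 * τ)) * Gh τ σ) σ := by
  have h1 : HasDerivAt (fun σ : ℝ => -(3/2) * Real.log τ - σ / (4 * τ)) (-(1 / (4 * τ))) σ :=
    ((hasDerivAt_id σ).div_const _).const_sub _
  refine h1.exp.congr_deriv ?_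
  unfold Gh; ring

/-- σ-derivatives of a Gaussian times a shifted profile. -/
theorem GF_hd {F F1 : ℝ → ℝ} (τ a σ : ℝ) (h : HasDerivAt F (F1 (σ + a)) (σ + a)) :
    HasDerivAt (fun σ => Gh τ σ * F (σ + a)) (Gh τ σ * (-(1 / (4 * τ)) * F (σ + a) + F1 (σ + a))) σ := by
  have h2 : HasDerivAt (fun σ => F (σ + a)) (F1 (σ + a)) σ := by
    exact (h.comp σ ((hasDerivAt_id σ).add_const a)).congr_deriv (by ring)
  exact ((Gh_hσ τ σ).mul h2).congr_deriv (by ring)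

theorem GF_hd2 {F F1 F2 : ℝ → ℝ} (τ a σ : ℝ) (h : HasDerivAt F (F1 (σ + a)) (σ + a)) (h' : HasDerivAt F1 (F2 (σ + a)) (σ + a)) :
    HasDerivAt (fun σ => Gh τ σ * (-(1 / (4 * τ)) * F (σ + a) + F1 (σ + a)))
      (Gh τ σ * ((1 / (4 * τ)) ^ 2 * F (σ + a) - (1 / (2 * τ)) * F1 (σ + a) + F2 (σ + a))) σ := by
  have h2 : HasDerivAt (fun σ => -(1 / (4 * τ)) * F (σ + a) + F1 (σ + a)) (-(1 / (4 * τ)) * F1 (σ + a) + F2 (σ + a)) σ := by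
    have a1 := (h.comp σ ((hasDerivAt_id σ).add_const a)).const_mul (-(1 / (4 * τ)))
    have a2 := h'.comp σ ((hasDerivAt_id σ).add_const a)
    exact (a1.add a2).congr_deriv (by ring)
  refine ((Gh_hσ τ σ).mul h2).congr_deriv ?_
  ring

theorem GF_hs {F F1 : ℝ → ℝ} (r2 t0 σ : ℝ) {s : ℝ} (hs : s < r2 + t0) (h : HasDerivAt F (F1 (σ + (t0 - s))) (σ + (t0 - s))) :
    HasDerivAt (fun s => Gh (r2 + t0 - s) σ * F (σ + (t0 - s)))
      (Gh (r2 + t0 - s) σ * ((3 / (2 * (r2 + t0 - s)) - σ / (4 * (r2 + t0 - s) ^ 2)) * F (σ + (t0 - s)) - F1 (σ + (t0 - s)))) s := by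
  have h2 := h.comp s (((hasDerivAt_id s).const_sub t0).const_add σ)
  have h1 := (Gh_hτ (show 0 < r2 + t0 - s by linarith) σ).comp s ((hasDerivAt_id s).const_sub (r2 + t0))
  refine (h1.mul h2).congr_deriv ?_
  simp only [Function.comp_def, id]
  ring

/-- The backward heat operator applied to a Gaussian times a cutoff. -/
theorem GF_heat {F F1 F2 : ℝ → ℝ} (h : ∀ v, HasDerivAt F (F1 v) v) (h' : ∀ v, HasDerivAt F1 (F2 v) v)
    (r2 t0 : ℝ) (x0 x : E3) {s : ℝ} (hs : s < r2 + t0) :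
    deriv (fun s => Gh (r2 + t0 - s) (‖x - x0‖ ^ 2) * F (‖x - x0‖ ^ 2 + (t0 - s))) s
      + lap (fun y => Gh (r2 + t0 - s) (‖y - x0‖ ^ 2) * F (‖y - x0‖ ^ 2 + (t0 - s))) x
    = Gh (r2 + t0 - s) (‖x - x0‖ ^ 2) * (5 * F1 (‖x - x0‖ ^ 2 + (t0 - s)) + 4 * ‖x - x0‖ ^ 2 * F2 (‖x - x0‖ ^ 2 + (t0 - s)))
      - 2 * (‖x - x0‖ ^ 2 / (r2 + t0 - s) * Gh (r2 + t0 - s) (‖x - x0‖ ^ 2)) * F1 (‖x - x0‖ ^ 2 + (t0 - s)) := by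
  rw [(GF_hs r2 t0 (‖x - x0‖ ^ 2) hs (h _)).deriv]
  rw [lap_radial x0 x (fun σ _ => GF_hd (r2 + t0 - s) (t0 - s) σ (h _)) (GF_hd2 (r2 + t0 - s) (t0 - s) _ (h _) (h' _))]
  have : r2 + t0 - s ≠ 0 := by linarith
  field_simp
  ring

theorem flux_bd {τ p m R c c' K : ℝ} (hτ : 0 < τ) (hp : 0 ≤ p) (hm : 0 < m) (h : m ^ 2 ≤ τ + p ^ 2) (hR : p ≤ R)
    (hc : |c| ≤ 1) (hc' : |c'| ≤ K) :
    2 * p * |Gh τ (p ^ 2) * (-(1 / (4 * τ)) * c + c')| ≤ 1728 * (m⁻¹ ^ 4 + 2 * R * m⁻¹ ^ 3 * K) := by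
  obtain ⟨b1, b2, b3⟩ := Gh_bd hτ hp hm h
  have g0 := Gh_pos τ (p ^ 2)
  have K0 : 0 ≤ K := (abs_nonneg _).trans hc'
  have R0 : 0 ≤ R := hp.trans hR
  rw [abs_mul, abs_of_pos g0]
  have : |-(1 / (4 * τ)) * c + c'| ≤ 1 / (4 * τ) * 1 + K := by
    refine (abs_add_le _ _).trans ?_
    rw [abs_mul, abs_neg, abs_of_pos (by positivity)]
    gcongr
  calc _ ≤ 2 * p * (Gh τ (p ^ 2) * (1 / (4 * τ) * 1 + K)) := by gcongr
    _ = 1 / 2 * (p / τ * Gh τ (p ^ 2)) + 2 * p * Gh τ (p ^ 2) * K := by field_simp; ring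
    _ ≤ 1 / 2 * (1728 * m⁻¹ ^ 4) + 2 * R * (1728 * m⁻¹ ^ 3) * K := by gcongr
    _ ≤ _ := by
      have : 0 ≤ m⁻¹ ^ 4 := by positivity
      nlinarith

/-- Truncated backward Gaussian times a space-time cutoff. -/
def hk (ζ F : ℝ → ℝ) (r2 t0 : ℝ) (x0 x : E3) (s : ℝ) : ℝ :=
  ζ s * (Gh (r2 + t0 - s) (‖x - x0‖ ^ 2) * F (‖x - x0‖ ^ 2 + (t0 - s)))

theorem cb_sub {x0 : E3} (hx0 : x0 ∈ ball (0:E3) (1/2)) : closedBall x0 (1/4) ⊆ ball 0 1 := by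
  intro y hy
  rw [mem_closedBall, dist_eq_norm] at hy
  rw [mem_ball_zero_iff] at hx0 ⊢
  have : y = (y - x0) + x0 := by abel
  rw [this]
  exact (norm_add_le _ _).trans_lt (by linarith)

theorem hk_zero {ζ F : ℝ → ℝ} {r2 t0 d : ℝ} {x0 : E3} (hr : r2 ≤ 1/256) (hd : d < r2)
    (hF0 : ∀ v, 9/256 ≤ v → F v = 0) (hζ0 : ∀ s, t0 + d ≤ s → ζ s = 0) {x : E3} {s : ℝ}
    (h : hk ζ F r2 t0 x0 x s ≠ 0) : ‖x - x0‖ ^ 2 < (1/4) ^ 2 ∧ t0 - 1/16 < s ∧ s < t0 + d := by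
  have h1 : s < t0 + d := by
    by_contra hc; apply h; rw [hk, hζ0 s (by linarith), zero_mul]
  have h2 : ‖x - x0‖ ^ 2 + (t0 - s) < 9/256 := by
    by_contra hc; apply h; rw [hk, hF0 _ (by linarith), mul_zero, mul_zero]
  refine ⟨by linarith, ?_, h1⟩
  have := sq_nonneg ‖x - x0‖
  linarith

theorem hk_test {ζ F : ℝ → ℝ} {r2 t0 d : ℝ} {x0 : E3} (hx0 : x0 ∈ ball (0:E3) (1/2)) (ht0 : -(1/4) < t0)
    (hζ : ContDiff ℝ (⊤ : ℕ∞) ζ) (hF : ContDiff ℝ (⊤ : ℕ∞) F) (hr : r2 ≤ 1/256) (hd : d < r2) (htd : t0 + d < 0)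
    (hF0 : ∀ v, 9/256 ≤ v → F v = 0) (hζ0 : ∀ s, t0 + d ≤ s → ζ s = 0) :
    IsTest 1 (hk ζ F r2 t0 x0) ∧ ∀ s, Tst (fun x => hk ζ F r2 t0 x0 x s) := by
  have hs : tsupport (fun z : E3 × ℝ => hk ζ F r2 t0 x0 z.1 z.2) ⊆ closedBall x0 (1/4) ×ˢ Icc (t0 - 1/16) (t0 + d) := by
    refine closure_minimal (fun z hz => ?_) (isClosed_closedBall.prod isClosed_Icc)
    obtain ⟨a1, a2, a3⟩ := hk_zero hr hd hF0 hζ0 hz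
    refine ⟨?_, a2.le, a3.le⟩
    rw [mem_closedBall, dist_eq_norm]
    exact le_of_sq_le_sq a1.le (by norm_num)
  refine ⟨⟨?_, ?_, ?_⟩, fun s => ?_⟩
  · rw [contDiff_iff_contDiffAt]
    rintro ⟨x, s⟩
    by_cases h : s < r2 + t0
    · have e1 : ContDiffAt ℝ (⊤ : ℕ∞) (fun z : E3 × ℝ => ‖z.1 - x0‖ ^ 2) (x, s) :=
        ((normsq_cd x0).comp contDiff_fst).contDiffAt
      have e2 : ContDiffAt ℝ (⊤ : ℕ∞) (fun z : E3 × ℝ => r2 + t0 - z.2) (x, s) := by fun_prop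
      have e3 : ContDiffAt ℝ (⊤ : ℕ∞) (fun z : E3 × ℝ => t0 - z.2) (x, s) := by fun_prop
      have ne : r2 + t0 - s ≠ 0 := by linarith
      refine ContDiffAt.mul (hζ.contDiffAt.comp (x, s) contDiffAt_snd) (ContDiffAt.mul ?_ (hF.contDiffAt.comp (x, s) (e1.add e3)))
      unfold Gh
      refine ContDiffAt.exp (ContDiffAt.sub (contDiffAt_const.mul (e2.log ne)) (e1.div (contDiffAt_const.mul e2) ?_))
      simpa using ne
    · have : (fun z : E3 × ℝ => hk ζ F r2 t0 x0 z.1 z.2) =ᶠ[nhds (x, s)] fun _ => 0 := by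
        have : {z : E3 × ℝ | t0 + d < z.2} ∈ nhds (x, s) := (isOpen_lt continuous_const continuous_snd).mem_nhds (by
          rw [mem_ofPred_eq]; linarith)
        filter_upwards [this] with z hz
        rw [hk, hζ0 _ (le_of_lt hz), zero_mul]
      exact contDiffAt_const.congr_of_eventuallyEq this
  · exact ((isCompact_closedBall x0 _).prod isCompact_Icc).of_isClosed_subset (isClosed_tsupport _) hs
  · refine hs.trans (prod_mono (cb_sub hx0) fun t ht => ⟨?_, ?_⟩)
    · have := ht.1; linarith
    · have := ht.2; linarith
  · by_cases h : s < t0 + d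
    · refine Tst_radial (F := fun σ => ζ s * (Gh (r2 + t0 - s) σ * F (σ + (t0 - s)))) ?_ x0 (b := 1/4) (by norm_num) (fun σ hσ => ?_) (cb_sub hx0)
      · refine contDiff_const.mul (ContDiff.mul ?_ (hF.comp (by fun_prop)))
        unfold Gh
        exact ContDiff.exp (by fun_prop)
      · rw [hF0 _ (by linarith), mul_zero, mul_zero]
    · have : (fun x => hk ζ F r2 t0 x0 x s) = fun _ => 0 := by
        funext x; rw [hk, hζ0 _ (by linarith), zero_mul]
      rw [this]
      exact ⟨contDiff_const, HasCompactSupport.zero, by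
        have : tsupport (fun _ : E3 => (0:ℝ)) = ∅ := tsupport_eq_empty_iff.2 rfl
        rw [this]; exact empty_subset _⟩

/-- Radii. -/
def rr (θ : ℝ) (k : ℕ) : ℝ := θ ^ k / 4

theorem rr_pos {θ : ℝ} (h : 0 < θ) (k : ℕ) : 0 < rr θ k := by unfold rr; positivity
theorem rr_succ (θ : ℝ) (k : ℕ) : rr θ (k + 1) = θ * rr θ k := by unfold rr; ring
theorem rr_zero (θ : ℝ) : rr θ 0 = 1/4 := by simp [rr]
theorem rr_le {θ : ℝ} (h : 0 < θ) (h1 : θ ≤ 1) (k : ℕ) : rr θ k ≤ 1/4 := by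
  unfold rr; have := pow_le_one₀ (n := k) h.le h1; linarith

/-- Cutoff at scale `k`. -/
def ck (θ : ℝ) (k : ℕ) (v : ℝ) : ℝ := cF (rr θ k / 2) (3/4 * rr θ k) v
def ck1 (θ : ℝ) (k : ℕ) (v : ℝ) : ℝ := cF1 (rr θ k / 2) (3/4 * rr θ k) v
def ck2 (θ : ℝ) (k : ℕ) (v : ℝ) : ℝ := cF2 (rr θ k / 2) (3/4 * rr θ k) v

theorem ck_d {θ : ℝ} (_h : 0 < θ) (k : ℕ) : (3/4 * rr θ k) ^ 2 - (rr θ k / 2) ^ 2 = 5/16 * rr θ k ^ 2 := by ring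
theorem ck_d0 {θ : ℝ} (h : 0 < θ) (k : ℕ) : 0 < (3/4 * rr θ k) ^ 2 - (rr θ k / 2) ^ 2 := by
  rw [ck_d h]; have := rr_pos h k; positivity

/-- Difference of consecutive cutoffs (`b` says whether the finer cutoff is subtracted). -/
def dk (θ : ℝ) (b : Prop) [Decidable b] (k : ℕ) (v : ℝ) : ℝ := ck θ k v - if b then ck θ (k + 1) v else 0
def dk1 (θ : ℝ) (b : Prop) [Decidable b] (k : ℕ) (v : ℝ) : ℝ := ck1 θ k v - if b then ck1 θ (k + 1) v else 0

theorem dk_hd (θ : ℝ) (b : Prop) [Decidable b] (k : ℕ) (v : ℝ) : HasDerivAt (dk θ b k) (dk1 θ b k v) v := by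
  unfold dk dk1
  by_cases hb : b
  · simp only [hb, if_true]
    exact (cF_hd _ _ v).sub (cF_hd _ _ v)
  · simp only [hb, if_false, sub_zero]
    exact cF_hd _ _ v

theorem dk_cd (θ : ℝ) (b : Prop) [Decidable b] (k : ℕ) : ContDiff ℝ (⊤ : ℕ∞) (dk θ b k) := by
  unfold dk
  by_cases hb : b
  · simp only [hb, if_true]
    exact (cF_cd _ _).sub (cF_cd _ _)
  · simp only [hb, if_false, sub_zero]
    exact cF_cd _ _

theorem dk_zero {θ : ℝ} (h : 0 < θ) (h4 : θ ≤ 1/4) (b : Prop) [Decidable b] (k : ℕ) {v : ℝ} (hv : (3/4 * rr θ k) ^ 2 ≤ v) :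
    dk θ b k v = 0 ∧ dk1 θ b k v = 0 := by
  obtain ⟨a1, a2, -⟩ := cF_zero (ck_d0 h k) hv
  have r0 := rr_pos h k
  have hv' : (3/4 * rr θ (k+1)) ^ 2 ≤ v := by
    refine le_trans ?_ hv
    rw [rr_succ]
    gcongr
    nlinarith
  obtain ⟨b1, b2, -⟩ := cF_zero (ck_d0 h (k+1)) hv'
  unfold dk dk1 ck ck1
  rw [a1, a2, b1, b2]; simp

theorem dk_zero' {θ : ℝ} (h : 0 < θ) (h4 : θ ≤ 1/4) (k : ℕ) {v : ℝ} (hv : v ≤ (θ * rr θ k / 2) ^ 2) :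
    dk θ True k v = 0 ∧ dk1 θ True k v = 0 := by
  have r0 := rr_pos h k
  have hv' : v ≤ (rr θ (k+1) / 2) ^ 2 := by rw [rr_succ]; exact hv
  have hv2 : v ≤ (rr θ k / 2) ^ 2 := by
    refine hv.trans ?_
    gcongr
    nlinarith
  unfold dk dk1 ck ck1
  rw [cF_one (ck_d0 h k) hv2, cF_one (ck_d0 h (k+1)) hv', (cF_one' (ck_d0 h k) hv2).1, (cF_one' (ck_d0 h (k+1)) hv').1]
  simp

theorem dk_le (θ : ℝ) (b : Prop) [Decidable b] (k : ℕ) (v : ℝ) : |dk θ b k v| ≤ 1 := by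
  unfold dk ck
  have a1 := cF_nonneg (rr θ k / 2) (3/4 * rr θ k) v
  have a2 := cF_le (rr θ k / 2) (3/4 * rr θ k) v
  have b1 := cF_nonneg (rr θ (k+1) / 2) (3/4 * rr θ (k+1)) v
  have b2 := cF_le (rr θ (k+1) / 2) (3/4 * rr θ (k+1)) v
  rw [abs_le]
  split_ifs <;> constructor <;> linarith

theorem dk1_le {K : ℝ} (hK : 1 ≤ K) (hb : ∀ a b σ : ℝ, 0 < b ^ 2 - a ^ 2 →
    |cF1 a b σ| ≤ K * (b ^ 2 - a ^ 2)⁻¹ ∧ |cF2 a b σ| ≤ K * (b ^ 2 - a ^ 2)⁻¹ ^ 2) {θ : ℝ} (h : 0 < θ) (h4 : θ ≤ 1/4)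
    (b : Prop) [Decidable b] (k : ℕ) (v : ℝ) : |dk1 θ b k v| ≤ 7 * K * θ⁻¹ ^ 2 * (rr θ k)⁻¹ ^ 2 := by
  have r0 := rr_pos h k
  have t1 : 1 ≤ θ⁻¹ ^ 2 := one_le_pow₀ ((one_le_inv₀ h).2 (by linarith))
  have a1 := (hb _ _ v (ck_d0 h k)).1
  have a2 := (hb _ _ v (ck_d0 h (k+1))).1
  rw [ck_d h, mul_inv, ← inv_pow] at a1 a2
  rw [rr_succ, mul_inv, mul_pow] at a2
  have A1 : |ck1 θ k v| ≤ 3.5 * K * θ⁻¹ ^ 2 * (rr θ k)⁻¹ ^ 2 := by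
    unfold ck1
    refine a1.trans ?_
    calc K * ((5/16)⁻¹ * (rr θ k)⁻¹ ^ 2) ≤ K * (3.5 * (rr θ k)⁻¹ ^ 2) := by gcongr; norm_num
      _ = 3.5 * K * 1 * (rr θ k)⁻¹ ^ 2 := by ring
      _ ≤ _ := by gcongr
  have A2 : |ck1 θ (k+1) v| ≤ 3.5 * K * θ⁻¹ ^ 2 * (rr θ k)⁻¹ ^ 2 := by
    unfold ck1
    rw [rr_succ]
    refine a2.trans ?_
    calc K * ((5/16)⁻¹ * (θ⁻¹ ^ 2 * (rr θ k)⁻¹ ^ 2)) ≤ K * (3.5 * (θ⁻¹ ^ 2 * (rr θ k)⁻¹ ^ 2)) := by gcongr; norm_num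
      _ = _ := by ring
  unfold dk1
  refine (abs_sub _ _).trans ?_
  have : |if b then ck1 θ (k + 1) v else 0| ≤ 3.5 * K * θ⁻¹ ^ 2 * (rr θ k)⁻¹ ^ 2 := by
    split_ifs
    · exact A2
    · rw [abs_zero]; positivity
  linarith

theorem dk_sum (θ : ℝ) (n : ℕ) (hn : 1 ≤ n) (v : ℝ) : ∑ k ∈ Finset.range n, dk θ (k + 1 < n) k v = ck θ 0 v := by
  obtain ⟨m, rfl⟩ : ∃ m, n = m + 1 := ⟨n - 1, by omega⟩
  rw [Finset.sum_range_succ]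
  have : ∑ k ∈ Finset.range m, dk θ (k + 1 < m + 1) k v = ∑ k ∈ Finset.range m, (ck θ k v - ck θ (k + 1) v) := by
    refine Finset.sum_congr rfl fun k hk => ?_
    unfold dk
    rw [if_pos (by rw [Finset.mem_range] at hk; omega)]
  rw [this, Finset.sum_range_sub']
  unfold dk
  rw [if_neg (by omega)]; ring

theorem limI' {f : ℝ → ℝ≥0∞} {K : ℝ≥0∞} {t0 : ℝ} (h0 : -1 < t0) (h1 : t0 ≤ 0)
    (h : ∀ᵐ t ∂muT, t < t0 → ∫⁻ τ in Ioo (-1) t, f τ ≤ K) :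
    ∫⁻ τ in Ioo (-1) t0, f τ ≤ K := by
  have e : Ioo (-1 : ℝ) t0 = ⋃ n : ℕ, Ioo (-1 : ℝ) (t0 - (1 / ((n : ℝ) + 1))) := by
    ext t
    simp only [mem_Ioo, mem_iUnion]
    constructor
    · rintro ⟨h1, h2⟩
      obtain ⟨n, hn⟩ := exists_nat_one_div_lt (show 0 < t0 - t by linarith)
      exact ⟨n, h1, by linarith⟩
    · rintro ⟨n, h1, h2⟩
      have : 0 < 1 / ((n : ℝ) + 1) := by positivity
      exact ⟨h1, by linarith⟩
  have mono : Monotone fun n : ℕ => Ioo (-1 : ℝ) (t0 - (1 / ((n : ℝ) + 1))) := by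
    intro m n hmn
    apply Ioo_subset_Ioo_right
    have : (m : ℝ) ≤ n := by exact_mod_cast hmn
    have : 1 / ((n : ℝ) + 1) ≤ 1 / ((m : ℝ) + 1) := by gcongr
    linarith
  rw [e, setLIntegral_iUnion_of_directed _ (directed_of_isDirected_le mono)]
  refine iSup_le fun n => ?_
  have hn : 0 < 1 / ((n : ℝ) + 1) := by positivity
  set a := max (-1) (t0 - (1 / ((n : ℝ) + 1))) with ha
  have at0 : a < t0 := max_lt h0 (by linarith)
  have h2 : ∀ᵐ t ∂(volume.restrict (Ioo a t0)), t < t0 → ∫⁻ τ in Ioo (-1) t, f τ ≤ K :=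
    ae_restrict_of_ae_restrict_of_subset (Ioo_subset_Ioo (le_max_left _ _) h1) h
  have : NeBot (ae (volume.restrict (Ioo a t0))) := by
    rw [ae_restrict_neBot]; simpa using at0
  obtain ⟨t, ht, ht2⟩ := (h2.and (ae_restrict_mem measurableSet_Ioo)).exists
  exact (lintegral_mono_set (Ioo_subset_Ioo_right ((le_max_right _ _).trans ht2.1.le))).trans (ht ht2.2)

/-- Gradient bound for the pieces of the heat kernel test function. -/
theorem piece_bd {K : ℝ} (hK : 1 ≤ K) (hb : ∀ a b σ : ℝ, 0 < b ^ 2 - a ^ 2 →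
    |cF1 a b σ| ≤ K * (b ^ 2 - a ^ 2)⁻¹ ∧ |cF2 a b σ| ≤ K * (b ^ 2 - a ^ 2)⁻¹ ^ 2) {θ : ℝ} (h : 0 < θ) (h4 : θ ≤ 1/4)
    {ζ : ℝ → ℝ} {t0 : ℝ} {n k : ℕ} (hkn : k < n) (x0 x : E3) {s : ℝ} (hs : s < t0) (hζ : ζ s = 1) :
    (‖fderiv ℝ (fun y => hk ζ (dk θ (k + 1 < n) k) (rr θ n ^ 2) t0 x0 y s) x‖ ≤
      1728 * (16 * θ⁻¹ ^ 4 + 112 * K * θ⁻¹ ^ 5) * (rr θ k)⁻¹ ^ 4) ∧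
    (x ∉ ball x0 (3/4 * rr θ k) ∨ s ∉ Ioo (t0 - rr θ k ^ 2) t0 →
      fderiv ℝ (fun y => hk ζ (dk θ (k + 1 < n) k) (rr θ n ^ 2) t0 x0 y s) x = 0) := by
  have r0 := rr_pos h k
  have rn := rr_pos h n
  set τ := rr θ n ^ 2 + t0 - s with hτ
  have τ0 : 0 < τ := by have := sq_nonneg (rr θ n); nlinarith [sq_nonneg (rr θ n)]
  have τn : rr θ n ^ 2 ≤ τ := by linarith
  set F := dk θ (k + 1 < n) k with hF
  set F1 := dk1 θ (k + 1 < n) k with hF1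
  set v := ‖x - x0‖ ^ 2 + (t0 - s) with hv
  obtain ⟨H, hH⟩ : ∃ H : ℝ → ℝ, H = fun σ => Gh τ σ * F (σ + (t0 - s)) := ⟨_, rfl⟩
  have e : (fun y => hk ζ F (rr θ n ^ 2) t0 x0 y s) = fun y => H (‖y - x0‖ ^ 2) := by
    funext y; rw [hH]; simp only [hk]; rw [hζ, one_mul]
  have fb : ‖fderiv ℝ (fun y => hk ζ F (rr θ n ^ 2) t0 x0 y s) x‖ ≤ 2 * ‖x - x0‖ * |Gh τ (‖x - x0‖ ^ 2) * (-(1 / (4 * τ)) * F v + F1 v)| := by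
    rw [e]
    have hd : HasDerivAt H (Gh τ (‖x - x0‖ ^ 2) * (-(1 / (4 * τ)) * F v + F1 v)) (‖x - x0‖ ^ 2) := by
      rw [hH]
      exact GF_hd (F := F) (F1 := F1) τ (t0 - s) _ (dk_hd θ _ k _)
    exact fderiv_radial x0 x hd
  have z1 : F v = 0 ∧ F1 v = 0 → ‖fderiv ℝ (fun y => hk ζ F (rr θ n ^ 2) t0 x0 y s) x‖ ≤ 0 := fun hz => by
    refine fb.trans ?_
    rw [hz.1, hz.2]; simp
  have p0 := norm_nonneg (x - x0)
  refine ⟨?_, fun hc => ?_⟩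
  · have B0 : 0 ≤ 1728 * (16 * θ⁻¹ ^ 4 + 112 * K * θ⁻¹ ^ 5) * (rr θ k)⁻¹ ^ 4 := by positivity
    by_cases hv1 : (3/4 * rr θ k) ^ 2 ≤ v
    · exact (z1 (dk_zero h h4 _ k hv1)).trans B0
    rw [not_le] at hv1
    have hm : F v = 0 ∧ F1 v = 0 ∨ (θ * rr θ k / 2) ^ 2 ≤ τ + ‖x - x0‖ ^ 2 := by
      by_cases hb' : k + 1 < n
      · by_cases hv2 : v ≤ (θ * rr θ k / 2) ^ 2
        · left
          have := dk_zero' h h4 k hv2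
          simp only [hF, hF1, hb']
          exact this
        · right; linarith [sq_nonneg (rr θ n)]
      · right
        have : n = k + 1 := by omega
        rw [this, rr_succ] at τn
        nlinarith [sq_nonneg (θ * rr θ k), sq_nonneg ‖x - x0‖]
    rcases hm with hm | hm
    · exact (z1 hm).trans B0
    have pR : ‖x - x0‖ ≤ rr θ k := by
      apply le_of_sq_le_sq _ r0.le
      nlinarith
    refine fb.trans ((flux_bd τ0 p0 (by positivity) hm pR (dk_le θ _ k v) (dk1_le hK hb h h4 _ k v)).trans (le_of_eq ?_))
    field_simp
    ring
  · rw [← norm_le_zero_iff]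
    apply z1
    apply dk_zero h h4
    rcases hc with hc | hc
    · rw [mem_ball, dist_eq_norm, not_lt] at hc
      have : (3/4 * rr θ k) ^ 2 ≤ ‖x - x0‖ ^ 2 := by gcongr
      linarith
    · have : s ≤ t0 - rr θ k ^ 2 := by
        by_contra h3; exact hc ⟨by linarith, hs⟩
      nlinarith [sq_nonneg ‖x - x0‖, sq_nonneg (rr θ k)]

theorem main_bd {K : ℝ} (hK : 1 ≤ K) (hb : ∀ a b σ : ℝ, 0 < b ^ 2 - a ^ 2 →
    |cF1 a b σ| ≤ K * (b ^ 2 - a ^ 2)⁻¹ ∧ |cF2 a b σ| ≤ K * (b ^ 2 - a ^ 2)⁻¹ ^ 2) {θ : ℝ} (h : 0 < θ) (_h4 : θ ≤ 1/4)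
    {ζ : ℝ → ℝ} {t0 : ℝ} {n : ℕ} (x0 x : E3) {s : ℝ} (hs : s < t0) (hζ : ∀ s ≤ t0, ζ s = 1) :
    (deriv (fun s => hk ζ (ck θ 0) (rr θ n ^ 2) t0 x0 x s) s + lap (fun y => hk ζ (ck θ 0) (rr θ n ^ 2) t0 x0 y s) x ≤ 11000000000 * K) ∧
    (x ∉ ball x0 (rr θ 0) ∨ s ∉ Ioo (t0 - rr θ 0 ^ 2) t0 →
      deriv (fun s => hk ζ (ck θ 0) (rr θ n ^ 2) t0 x0 x s) s + lap (fun y => hk ζ (ck θ 0) (rr θ n ^ 2) t0 x0 y s) x = 0) := by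
  have rn := rr_pos h n
  have r0 := rr_pos h 0
  have e1 : (fun s => hk ζ (ck θ 0) (rr θ n ^ 2) t0 x0 x s) =ᶠ[nhds s] fun s => Gh (rr θ n ^ 2 + t0 - s) (‖x - x0‖ ^ 2) * ck θ 0 (‖x - x0‖ ^ 2 + (t0 - s)) := by
    filter_upwards [Iio_mem_nhds hs] with s' hs'
    rw [mem_Iio] at hs'
    rw [hk, hζ s' hs'.le, one_mul]
  have e2 : (fun y => hk ζ (ck θ 0) (rr θ n ^ 2) t0 x0 y s) = fun y => Gh (rr θ n ^ 2 + t0 - s) (‖y - x0‖ ^ 2) * ck θ 0 (‖y - x0‖ ^ 2 + (t0 - s)) := by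
    funext y
    rw [hk, hζ s hs.le, one_mul]
  have e := GF_heat (F := ck θ 0) (F1 := ck1 θ 0) (F2 := ck2 θ 0) (cF_hd _ _) (cF1_hd _ _) (rr θ n ^ 2) t0 x0 x
    (s := s) (by have := pow_pos rn 2; linarith)
  rw [e1.deriv_eq, e2, e]
  set τ := rr θ n ^ 2 + t0 - s with hτ
  have τ0 : 0 < τ := by have := pow_pos rn 2; linarith
  set p := ‖x - x0‖ with hp
  have p0 : 0 ≤ p := norm_nonneg _
  set v := p ^ 2 + (t0 - s) with hv
  have Z : ck1 θ 0 v = 0 ∧ ck2 θ 0 v = 0 → Gh τ (p ^ 2) * (5 * ck1 θ 0 v + 4 * p ^ 2 * ck2 θ 0 v) - 2 * (p ^ 2 / τ * Gh τ (p ^ 2)) * ck1 θ 0 v = 0 := by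
    rintro ⟨h1, h2⟩; rw [h1, h2]; ring
  refine ⟨?_, fun hc => ?_⟩
  · by_cases hv1 : (3/4 * rr θ 0) ^ 2 ≤ v
    · rw [Z (cF_zero (ck_d0 h 0) hv1).2]; positivity
    by_cases hv2 : v ≤ (rr θ 0 / 2) ^ 2
    · rw [Z (cF_one' (ck_d0 h 0) hv2)]; positivity
    rw [not_le] at hv1 hv2
    obtain ⟨b1, b2, -⟩ := Gh_bd τ0 p0 (m := rr θ 0 / 2) (by positivity) (by have := sq_nonneg (rr θ n); linarith)
    obtain ⟨c1, c2⟩ := hb _ _ v (ck_d0 h 0)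
    change |ck1 θ 0 v| ≤ _ at c1
    change |ck2 θ 0 v| ≤ _ at c2
    rw [ck_d h] at c1 c2
    rw [rr_zero] at b1 b2 c1 c2 hv1
    norm_num at b1 b2 c1 c2 hv1
    have p1 : p ^ 2 ≤ 1 := by linarith
    have g0 := Gh_pos τ (p ^ 2)
    have k1 : 5 * ck1 θ 0 v + 4 * p ^ 2 * ck2 θ 0 v ≤ 5 * (52 * K) + 4 * 1 * (2800 * K) := by
      have d1 : ck1 θ 0 v ≤ 52 * K := (le_abs_self _).trans (c1.trans (by linarith))
      have d2 : ck2 θ 0 v ≤ 2800 * K := (le_abs_self _).trans (c2.trans (by linarith))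
      calc _ ≤ 5 * (52 * K) + 4 * p ^ 2 * (2800 * K) := by gcongr
        _ ≤ _ := by gcongr
    have k2 : -(2 * (p ^ 2 / τ * Gh τ (p ^ 2)) * ck1 θ 0 v) ≤ 2 * 884736 * (52 * K) := by
      calc _ = 2 * (p ^ 2 / τ * Gh τ (p ^ 2)) * (-ck1 θ 0 v) := by ring
        _ ≤ 2 * (p ^ 2 / τ * Gh τ (p ^ 2)) * (52 * K) := by
          have d1 : -ck1 θ 0 v ≤ 52 * K := (neg_le_abs _).trans (c1.trans (by linarith))
          gcongr
        _ ≤ 2 * 884736 * (52 * K) := by gcongr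
    have k3 : Gh τ (p ^ 2) * (5 * ck1 θ 0 v + 4 * p ^ 2 * ck2 θ 0 v) ≤ 884736 * (5 * (52 * K) + 4 * 1 * (2800 * K)) := by
      calc _ ≤ Gh τ (p ^ 2) * (5 * (52 * K) + 4 * 1 * (2800 * K)) := by gcongr
        _ ≤ _ := by gcongr
    linarith
  · apply Z
    refine (cF_zero (ck_d0 h 0) ?_).2
    rcases hc with hc | hc
    · rw [mem_ball, dist_eq_norm, not_lt] at hc
      have : (rr θ 0) ^ 2 ≤ p ^ 2 := by gcongr
      nlinarith
    · have : s ≤ t0 - rr θ 0 ^ 2 := by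
        by_contra h3; exact hc ⟨by linarith, hs⟩
      nlinarith [sq_nonneg p, sq_nonneg (rr θ 0)]

theorem W_meas {u : ℝ → E3 → E3} {P : ℝ → E3 → ℝ} {c : ℝ → ℝ} (hu : Measurable (Function.uncurry u)) (hP : Measurable (Function.uncurry P))
    (hc : Measurable c) : Measurable (fun z : ℝ × E3 => ‖u z.1 z.2‖ₑ * (‖u z.1 z.2‖ₑ ^ 2 + 2 * ‖P z.1 z.2 - c z.1‖ₑ)) := by
  have h1 : Measurable fun z : ℝ × E3 => ‖u z.1 z.2‖ₑ := hu.enorm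
  have h2 : Measurable fun z : ℝ × E3 => ‖P z.1 z.2 - c z.1‖ₑ := (hP.sub (hc.comp measurable_fst)).enorm
  exact h1.mul ((h1.pow_const 2).add (h2.const_mul 2))

theorem heat (θ : ℝ) (h : 0 < θ) (h4 : θ ≤ 1/4) : ∃ C : ℝ, 0 ≤ C ∧ ∀ u g P, Good u g P → ∀ x0 ∈ ball (0:E3) (1/2), ∀ t0 ∈ Ioo (-(1/4):ℝ) 0,
    ∀ n : ℕ, 1 ≤ n → ∀ c : ℕ → ℝ → ℝ, (∀ k, Measurable (c k)) → ∀ D : ℝ≥0∞,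
    D = (∫⁻ s in Ioo (t0 - rr θ 0 ^ 2) t0, ∫⁻ x in ball x0 (rr θ 0), ‖u s x‖ₑ ^ 2)
      + ∑ k ∈ Finset.range n, ENNReal.ofReal ((rr θ k)⁻¹ ^ 4) * ∫⁻ s in Ioo (t0 - rr θ k ^ 2) t0, ∫⁻ x in ball x0 (3/4 * rr θ k),
          ‖u s x‖ₑ * (‖u s x‖ₑ ^ 2 + 2 * ‖P s x - c k s‖ₑ) →
    (∀ᵐ t ∂muT, t ∈ Ioo (t0 - rr θ n ^ 2) t0 → ∫⁻ x in ball x0 (rr θ n), ‖u t x‖ₑ ^ 2 ≤ ENNReal.ofReal (C * rr θ n ^ 3) * D) ∧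
    ∫⁻ s in Ioo (t0 - rr θ n ^ 2) t0, ∫⁻ x in ball x0 (rr θ n), gn (g s) x ^ 2 ≤ ENNReal.ofReal (C * rr θ n ^ 3) * D := by
  obtain ⟨K, hK, hb⟩ := cF_bdd
  set A : ℝ := 11000000000 * K with hA
  set L : ℝ := 1728 * (16 * θ⁻¹ ^ 4 + 112 * K * θ⁻¹ ^ 5) with hL
  have A0 : 0 ≤ A := by positivity
  have L0 : 0 ≤ L := by positivity
  refine ⟨16 * (A + L), by positivity, fun u g P H x0 hx0 t0 ht0 n hn c hc D hD => ?_⟩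
  have r0 := rr_pos h n
  set r2 := rr θ n ^ 2 with hr2
  have r20 : 0 < r2 := by positivity
  have r2s : r2 ≤ 1/256 := by
    obtain ⟨m, rfl⟩ : ∃ m, n = m + 1 := ⟨n - 1, by omega⟩
    have : rr θ (m + 1) ≤ 1/16 := by
      rw [rr_succ]; have := rr_le h (by linarith) m; have := rr_pos h m; nlinarith
    rw [hr2]; nlinarith
  set d := min r2 (-t0) / 2 with hd
  have d0 : 0 < d := by
    have : 0 < min r2 (-t0) := lt_min r20 (by linarith [ht0.2])
    linarith
  have dr : d < r2 := by have := min_le_left r2 (-t0); linarith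
  have dt : t0 + d < 0 := by have := min_le_right r2 (-t0); linarith
  set ζ : ℝ → ℝ := fun s => Th ((t0 + d - s) / d) with hζ
  have ζcd : ContDiff ℝ (⊤ : ℕ∞) ζ := Th_cd.comp (by fun_prop)
  have ζ0 : ∀ s, t0 + d ≤ s → ζ s = 0 := fun s hs =>
    Real.smoothTransition.zero_of_nonpos (div_nonpos_of_nonpos_of_nonneg (by linarith) d0.le)
  have ζ1 : ∀ s ≤ t0, ζ s = 1 := fun s hs => by
    apply Real.smoothTransition.one_of_one_le
    rw [one_le_div d0]; linarith
  have F0 : ∀ v, 9/256 ≤ v → ck θ 0 v = 0 := fun v hv => by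
    refine (cF_zero (ck_d0 h 0) ?_).1
    rw [rr_zero]; linarith
  have dk0 : ∀ k, ∀ v, 9/256 ≤ v → dk θ (k + 1 < n) k v = 0 := fun k v hv => by
    refine (dk_zero h h4 _ k ?_).1
    have := rr_le h (by linarith) k
    have := rr_pos h k
    nlinarith
  have TΦ := (hk_test hx0 ht0.1 ζcd (cF_cd _ _ : ContDiff ℝ (⊤ : ℕ∞) (ck θ 0)) r2s dr dt F0 ζ0).1
  have Tφ := fun k => (hk_test hx0 ht0.1 ζcd (dk_cd θ (k + 1 < n) k) r2s dr dt (dk0 k) ζ0).2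
  have hE := H.energy (hk ζ (ck θ 0) r2 t0 x0) n (fun k => hk ζ (dk θ (k + 1 < n) k) r2 t0 x0) c TΦ
    (fun x t => mul_nonneg (Real.smoothTransition.nonneg _) (mul_nonneg (Gh_pos _ _).le (cF_nonneg _ _ _)))
    Tφ (fun x s => by
      simp only [hk]
      rw [← Finset.mul_sum, ← Finset.mul_sum, dk_sum θ n hn])
  have low : ∀ s ∈ Ioo (t0 - r2) t0, ∀ x ∈ ball x0 (rr θ n), 1 / 16 * (rr θ n)⁻¹ ^ 3 ≤ hk ζ (ck θ 0) r2 t0 x0 x s := fun s hs x hx => by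
    rw [mem_ball, dist_eq_norm] at hx
    have hx2 : ‖x - x0‖ ^ 2 ≤ r2 := by rw [hr2]; gcongr
    rw [hk, ζ1 s hs.2.le, one_mul]
    have : ck θ 0 (‖x - x0‖ ^ 2 + (t0 - s)) = 1 := by
      apply cF_one (ck_d0 h 0)
      rw [rr_zero]
      have := hs.1
      linarith
    rw [this, mul_one]
    exact Gh_low r0 (by linarith [hs.2]) (by linarith [hs.1]) hx2
  have key : ∀ᵐ t ∂muT, t < t0 → (t ∈ Ioo (t0 - r2) t0 → ∫⁻ x in ball x0 (rr θ n), ‖u t x‖ₑ^2 ≤ ENNReal.ofReal (16 * (A + L) * rr θ n ^ 3) * D) ∧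
      ∫⁻ τ in Ioo (-1) t, (Ioo (t0 - r2) t0).indicator (fun τ => ∫⁻ x in ball x0 (rr θ n), gn (g τ) x^2) τ ≤ ENNReal.ofReal (16 * (A + L) * rr θ n ^ 3) * D := by
    filter_upwards [hE, ae_restrict_mem measurableSet_Ioo] with t ht htm htt
    have R1 : ∫⁻ s in Ioo (-1) t, ∫⁻ x, ‖u s x‖ₑ ^ 2 * ENNReal.ofReal (deriv (fun τ => hk ζ (ck θ 0) r2 t0 x0 x τ) s + lap (fun y => hk ζ (ck θ 0) r2 t0 x0 y s) x)
        ≤ ENNReal.ofReal A * ∫⁻ s in Ioo (t0 - rr θ 0 ^ 2) t0, ∫⁻ x in ball x0 (rr θ 0), ‖u s x‖ₑ ^ 2 := by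
      rw [← lintegral_const_mul' _ _ (by finiteness)]
      refine cmp_set measurableSet_Ioo measurableSet_Ioo (fun τ h1 h2 => ?_) (fun τ h1 h2 => ?_)
      · rw [← lintegral_const_mul' _ _ (by finiteness), ← setLIntegral_univ]
        refine cmp_set MeasurableSet.univ measurableSet_ball (fun x _ hx => ?_) (fun x _ hx => ?_)
        · rw [mul_comm]
          refine mul_le_mul' (ENNReal.ofReal_le_ofReal ?_) le_rfl
          exact (main_bd hK hb h h4 (n := n) x0 x (h1.2.trans htt) ζ1).1
        · rw [(main_bd hK hb h h4 (n := n) x0 x (h1.2.trans htt) ζ1).2 (Or.inl hx)]; simp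
      · refine (lintegral_congr fun x => ?_).trans lintegral_zero
        rw [(main_bd hK hb h h4 (n := n) x0 x (h1.2.trans htt) ζ1).2 (Or.inr h2)]; simp
    set W : ℕ → ℝ → E3 → ℝ≥0∞ := fun k s x => ‖u s x‖ₑ * (‖u s x‖ₑ ^ 2 + 2 * ‖P s x - c k s‖ₑ) with hW
    set Ψ : ℕ → ℝ × E3 → ℝ≥0∞ := fun k => (Ioo (t0 - rr θ k ^ 2) t0 ×ˢ ball x0 (3/4 * rr θ k)).indicator
      (fun z => ENNReal.ofReal (L * (rr θ k)⁻¹ ^ 4) * W k z.1 z.2) with hΨ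
    have Ψm : ∀ k, Measurable (Ψ k) := fun k =>
      ((W_meas H.mu H.mP (hc k)).const_mul _).indicator (measurableSet_Ioo.prod measurableSet_ball)
    have R2 : ∫⁻ s in Ioo (-1) t, ∫⁻ x, ∑ k ∈ Finset.range n, ‖u s x‖ₑ * ‖fderiv ℝ (fun y => hk ζ (dk θ (k + 1 < n) k) r2 t0 x0 y s) x‖ₑ * (‖u s x‖ₑ ^ 2 + 2 * ‖P s x - c k s‖ₑ)
        ≤ ENNReal.ofReal L * ∑ k ∈ Finset.range n, ENNReal.ofReal ((rr θ k)⁻¹ ^ 4) * ∫⁻ s in Ioo (t0 - rr θ k ^ 2) t0, ∫⁻ x in ball x0 (3/4 * rr θ k), W k s x := by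
      calc _ ≤ ∫⁻ s in Ioo (-1) t, ∫⁻ x, ∑ k ∈ Finset.range n, Ψ k (s, x) := by
            refine setLIntegral_mono' measurableSet_Ioo fun s hs => lintegral_mono fun x => Finset.sum_le_sum fun k hk' => ?_
            obtain ⟨b1, b2⟩ := piece_bd hK hb h h4 (ζ := ζ) (t0 := t0) (Finset.mem_range.1 hk') x0 x (hs.2.trans htt) (ζ1 s (hs.2.trans htt).le)
            by_cases hm : (s, x) ∈ Ioo (t0 - rr θ k ^ 2) t0 ×ˢ ball x0 (3/4 * rr θ k)
            · simp only [hΨ]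
              rw [indicator_of_mem hm]
              calc _ = ‖fderiv ℝ (fun y => hk ζ (dk θ (k + 1 < n) k) r2 t0 x0 y s) x‖ₑ * W k s x := by simp only [hW]; ring
                _ ≤ _ := by
                  refine mul_le_mul' ?_ le_rfl
                  rw [← ofReal_norm]
                  exact ENNReal.ofReal_le_ofReal b1
            · rw [b2 (by rw [mem_prod, not_and_or] at hm; exact hm.symm), ← ofReal_norm (0 : E3 →L[ℝ] ℝ), norm_zero, ENNReal.ofReal_zero, mul_zero, zero_mul]
              exact bot_le
        _ = ∑ k ∈ Finset.range n, ∫⁻ s in Ioo (-1) t, ∫⁻ x, Ψ k (s, x) := by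
            rw [← lintegral_finsetSum _ fun k _ => Measurable.lintegral_prod_right' (ν := volume) (Ψm k)]
            refine lintegral_congr fun s => ?_
            exact lintegral_finsetSum _ fun k _ => (Ψm k).comp measurable_prodMk_left
        _ ≤ _ := by
            rw [Finset.mul_sum]
            refine Finset.sum_le_sum fun k _ => ?_
            rw [← mul_assoc, ← ENNReal.ofReal_mul L0, ← lintegral_const_mul' _ _ (by finiteness)]
            refine cmp_set measurableSet_Ioo measurableSet_Ioo (fun τ h1 h2 => ?_) (fun τ h1 h2 => ?_)
            · rw [← lintegral_const_mul' _ _ (by finiteness), ← setLIntegral_univ]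
              refine cmp_set MeasurableSet.univ measurableSet_ball (fun x _ hx => ?_) (fun x _ hx => ?_)
              · simp only [hΨ]; rw [indicator_of_mem (show (τ, x) ∈ Ioo (t0 - rr θ k ^ 2) t0 ×ˢ ball x0 (3/4 * rr θ k) from ⟨h2, hx⟩)]
              · simp only [hΨ]; rw [indicator_of_notMem (fun hh => hx hh.2)]
            · refine (lintegral_congr fun x => ?_).trans lintegral_zero
              simp only [hΨ]; rw [indicator_of_notMem (fun hh => h2 hh.1)]
    have hn' : _ ≤ ENNReal.ofReal (A + L) * D := (ht.trans (add_le_add R1 R2)).trans (by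
      rw [hD, mul_add]
      gcongr <;> linarith)
    have cancel : ∀ X : ℝ≥0∞, ENNReal.ofReal (1 / 16 * (rr θ n)⁻¹ ^ 3) * X ≤ ENNReal.ofReal (A + L) * D → X ≤ ENNReal.ofReal (16 * (A + L) * rr θ n ^ 3) * D := by
      intro X hX
      calc X = ENNReal.ofReal (16 * rr θ n ^ 3) * (ENNReal.ofReal (1 / 16 * (rr θ n)⁻¹ ^ 3) * X) := by
            rw [← mul_assoc, ← ENNReal.ofReal_mul (by positivity), show 16 * rr θ n ^ 3 * (1 / 16 * (rr θ n)⁻¹ ^ 3) = 1 by field_simp, ENNReal.ofReal_one, one_mul]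
        _ ≤ ENNReal.ofReal (16 * rr θ n ^ 3) * (ENNReal.ofReal (A + L) * D) := by gcongr
        _ = _ := by
          rw [← mul_assoc, ← ENNReal.ofReal_mul (by positivity)]; congr 2; ring
    refine ⟨fun htI => cancel _ ?_, cancel _ ?_⟩
    · refine le_trans ?_ (le_self_add.trans hn')
      rw [← lintegral_const_mul' _ _ (by finiteness), ← setLIntegral_univ (f := fun x => ‖u t x‖ₑ ^ 2 * _)]
      refine cmp_set measurableSet_ball MeasurableSet.univ (fun x hx _ => ?_) (fun x _ hx => absurd (mem_univ _) hx)
      rw [mul_comm]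
      exact mul_le_mul' le_rfl (ENNReal.ofReal_le_ofReal (low t htI x hx))
    · refine le_trans ?_ (le_add_self.trans hn')
      refine le_trans ?_ (le_mul_of_one_le_left' one_le_two)
      rw [← lintegral_const_mul' _ _ (by finiteness)]
      refine setLIntegral_mono' measurableSet_Ioo fun τ hτ => ?_
      by_cases hi : τ ∈ Ioo (t0 - r2) t0
      · rw [indicator_of_mem hi, ← lintegral_const_mul' _ _ (by finiteness), ← setLIntegral_univ (f := fun x => gn (g τ) x ^ 2 * _)]
        refine cmp_set measurableSet_ball MeasurableSet.univ (fun x hx _ => ?_) (fun x _ hx => absurd (mem_univ _) hx)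
        rw [mul_comm]
        exact mul_le_mul' le_rfl (ENNReal.ofReal_le_ofReal (low τ hi x hx))
      · rw [indicator_of_notMem hi, mul_zero]; exact bot_le
  refine ⟨key.mono fun t hh ht => (hh ht.2).1 ht, ?_⟩
  have := limI' (by linarith [ht0.1]) ht0.2.le (key.mono fun t hh ht => (hh ht).2)
  refine le_trans ?_ this
  refine cmp_set measurableSet_Ioo measurableSet_Ioo (fun τ h1 h2 => ?_) (fun τ h1 h2 => ?_)
  · rw [indicator_of_mem h1]
  · exact absurd ⟨by have := h1.1; linarith [ht0.1], h1.2⟩ h2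

theorem level : ∃ C : ℝ, 1 ≤ C ∧ ∀ u g P, Good u g P → ∀ (x0 : E3) (t0 ρ θ α : ℝ) (c c' : ℝ → ℝ), 0 < ρ → ρ ^ 2 ≤ 1/4 → 
    x0 ∈ ball (0:E3) (1/2) → t0 ∈ Ioo (-(1/4):ℝ) 0 → 0 < θ → θ ≤ 1/4 → 0 < α → Measurable c →
    (∀ t, c' t = c0⁻¹ * ∫ y, P t y * rho (ρ ^ 2/8) (y - x0)) →
    (∀ᵐ t ∂muT, t ∈ Ioo (t0 - (ρ^2)^2) t0 → ∫⁻ x in ball x0 (ρ^2), ‖u t x‖ₑ ^ 2 ≤ ENNReal.ofReal ((ρ * α) ^ 2)) →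
    (∫⁻ t in Ioo (t0 - (ρ^2)^2) t0, ∫⁻ x in ball x0 (ρ^2), gn (g t) x ^ 2 ≤ ENNReal.ofReal ((ρ * α) ^ 2)) →
    (∀ z : ℝ, 0 ≤ z → (∫⁻ t in Ioo (t0 - (ρ^2)^2) t0, ∫⁻ x in ball x0 (ρ^2), ‖P t x - c t‖ₑ) ≤ ENNReal.ofReal (ρ ^ 6 * z) →
      (∫⁻ t in Ioo (t0 - (ρ^2)^2) t0, ∫⁻ x in ball x0 (3/4 * ρ^2), ‖u t x‖ₑ * (‖u t x‖ₑ ^ 2 + 2 * ‖P t x - c' t‖ₑ)) ≤ ENNReal.ofReal (C * (ρ ^ 4 * α * (z + 2 * α ^ 2))) ∧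
      (∫⁻ t in Ioo (t0 - (θ * ρ^2)^2) t0, ∫⁻ x in ball x0 (θ * ρ^2), ‖P t x - c' t‖ₑ) ≤ ENNReal.ofReal (C * (ρ ^ 6 * (θ ^ 4 * z + 2 * α ^ 2)))) ∧
    (∀ Z : ℝ, 0 ≤ Z → (∫⁻ t in Ioo (t0 - (ρ^2)^2) t0, (∫⁻ x in ball x0 (ρ^2), ‖P t x - c t‖ₑ) ^ (3/2:ℝ)) ≤ ENNReal.ofReal (ρ ^ 7 * Z) →
      (∫⁻ t in Ioo (t0 - (θ * ρ^2)^2) t0, (∫⁻ x in ball x0 (θ * ρ^2), ‖P t x - c' t‖ₑ) ^ (3/2:ℝ)) ≤ ENNReal.ofReal (C * (ρ ^ 7 * (θ ^ 6 * Z + 2 * α ^ 3)))) := by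
  obtain ⟨Cs, hCs, hs⟩ := slice2
  set c1 := Cs.toReal + 1 with hc1
  have c11 : 1 ≤ c1 := by rw [hc1]; linarith [ENNReal.toReal_nonneg (a := Cs)]
  have Csc : Cs ≤ ENNReal.ofReal c1 := by
    rw [← ENNReal.ofReal_toReal hCs]; exact ENNReal.ofReal_le_ofReal (by linarith)
  set C := 2 * c1 ^ 2 with hC
  have C1 : Cs ≤ ENNReal.ofReal C := Csc.trans (ENNReal.ofReal_le_ofReal (by rw [hC]; nlinarith))
  have C2 : Cs ^ (3/2:ℝ) * 2 ≤ ENNReal.ofReal C := by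
    calc Cs ^ (3/2:ℝ) * 2 ≤ (ENNReal.ofReal c1) ^ (2:ℝ) * 2 := by
          gcongr
          refine (ENNReal.rpow_le_rpow Csc (by norm_num)).trans (ENNReal.rpow_le_rpow_of_exponent_le ?_ (by norm_num))
          rw [← ENNReal.ofReal_one]; exact ENNReal.ofReal_le_ofReal c11
      _ = ENNReal.ofReal C := by
          rw [ENNReal.rpow_two, ← ENNReal.ofReal_pow (by linarith), show (2:ℝ≥0∞) = ENNReal.ofReal 2 by simp, ← ENNReal.ofReal_mul (by positivity), hC, mul_comm]
  have C0 : 0 ≤ C := by positivity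
  refine ⟨C, by rw [hC]; nlinarith, fun u g P H x0 t0 ρ θ α c c' hρ hρ4 hx0 ht0 hθ hθ4 hα mc hc' ha hg => ?_⟩
  set r := ρ ^ 2 with hr
  have r0 : 0 < r := by positivity
  have hball : ball x0 r ⊆ ball 0 1 := (ball_subset_closedBall.trans (closedBall_subset_closedBall hρ4)).trans (cb_sub hx0)
  set U := ENNReal.ofReal ((ρ * α) ^ 2) with hU
  have U0 : U ≠ 0 := by rw [hU, Ne, ENNReal.ofReal_eq_zero, not_le]; positivity
  have Ut : U ≠ ∞ := by finiteness
  set I := Ioo (t0 - r ^ 2) t0 with hI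
  have Isub : I ⊆ Ioo (-1) 0 := Ioo_subset_Ioo (by nlinarith [ht0.1]) ht0.2.le
  have mI : MeasurableSet I := measurableSet_Ioo
  set G : ℝ → ℝ≥0∞ := fun t => ∫⁻ x in ball x0 r, gn (g t) x ^ 2 with hG
  set N : ℝ → ℝ≥0∞ := fun t => ∫⁻ x in ball x0 r, ‖P t x - c t‖ₑ with hN
  have Gm : Measurable G := Measurable.lintegral_prod_right' (ν := volume.restrict (ball x0 r)) ((gn_meas2 H.mg).pow_const 2)
  have Nm : Measurable N := Measurable.lintegral_prod_right' (ν := volume.restrict (ball x0 r))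
    (f := fun z : ℝ × E3 => ‖P z.1 z.2 - c z.1‖ₑ) ((H.mP.sub (mc.comp measurable_fst)).enorm)
  set X : ℝ → ℝ≥0∞ := fun t => U + ENNReal.ofReal r ^ 2 * G t with hX
  have Xm : Measurable X := measurable_const.add (Gm.const_mul _)
  have UX : ∀ t, U ≤ X t := fun t => le_self_add
  have intX : ∫⁻ t in I, X t ≤ ENNReal.ofReal (2 * ρ ^ 6 * α ^ 2) := by
    rw [hX, lintegral_add_left measurable_const, lintegral_const_mul' _ _ (by finiteness), setLIntegral_const, hI, Real.volume_Ioo]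
    calc U * ENNReal.ofReal (t0 - (t0 - r ^ 2)) + ENNReal.ofReal r ^ 2 * ∫⁻ t in Ioo (t0 - r ^ 2) t0, G t
        ≤ U * ENNReal.ofReal (t0 - (t0 - r ^ 2)) + ENNReal.ofReal r ^ 2 * U := by gcongr
      _ = _ := by
        rw [hU, ← ENNReal.ofReal_pow r0.le, ← ENNReal.ofReal_mul (by positivity), ← ENNReal.ofReal_mul (by positivity), ← ENNReal.ofReal_add (mul_nonneg (by positivity) (by linarith [sq_nonneg r])) (by positivity)]
        congr 1
        rw [hr]; ring
  have sl : ∀ᵐ t ∂(volume.restrict I), (∫⁻ x in ball x0 (θ * r), ‖P t x - c' t‖ₑ ≤ Cs * (ENNReal.ofReal θ ^ 4 * N t + U ^ (1/3:ℝ) * (X t) ^ (2/3:ℝ))) ∧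
      ∫⁻ x in ball x0 (3/4 * r), ‖u t x‖ₑ * (‖u t x‖ₑ ^ 2 + 2 * ‖P t x - c' t‖ₑ) ≤ Cs * (ENNReal.ofReal r ^ (-3/2:ℝ) * U ^ (1/2:ℝ) * (N t + X t)) := by
    have A1 := ae_restrict_of_ae_restrict_of_subset Isub H.slice
    have A2 := ae_restrict_of_ae_restrict_of_subset Isub ha
    filter_upwards [A1, A2, ae_restrict_mem mI] with t h1 h2 h3
    obtain ⟨a1, a2⟩ := hs (u t) (g t) (P t) h1 x0 r U (c t) r0 hball U0 Ut (h2 h3) (N t) (G t) (c' t) rfl rfl (hc' t)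
    exact ⟨a1 θ hθ (by linarith), a2⟩
  have I'sub : Ioo (t0 - (θ * r) ^ 2) t0 ⊆ I := Ioo_subset_Ioo (by
    have : (θ * r) ^ 2 ≤ r ^ 2 := by gcongr; nlinarith
    linarith) le_rfl
  have Uh : U ^ (1/2:ℝ) = ENNReal.ofReal (ρ * α) := by
    rw [hU, ENNReal.ofReal_rpow_of_nonneg (by positivity) (by norm_num), ← Real.sqrt_eq_rpow, Real.sqrt_sq (by positivity)]
  have rh : ENNReal.ofReal r ^ (-3/2:ℝ) = ENNReal.ofReal (ρ⁻¹ ^ 3) := by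
    rw [ENNReal.ofReal_rpow_of_pos r0]
    congr 1
    rw [hr, ← Real.rpow_natCast, ← Real.rpow_natCast, ← Real.rpow_mul hρ.le, ← Real.rpow_neg_one, ← Real.rpow_mul hρ.le]
    norm_num
  have UX1 : ∀ t, U ^ (1/3:ℝ) * (X t) ^ (2/3:ℝ) ≤ X t := fun t => by
    calc U ^ (1/3:ℝ) * (X t) ^ (2/3:ℝ) ≤ (X t) ^ (1/3:ℝ) * (X t) ^ (2/3:ℝ) := by
          have := UX t
          gcongr
      _ = X t := by rw [← ENNReal.rpow_add_of_nonneg _ _ (by norm_num) (by norm_num)]; norm_num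
  refine ⟨fun z hz hNz => ⟨?_, ?_⟩, fun Z hZ hNZ => ?_⟩
  · calc _ ≤ ∫⁻ t in I, ENNReal.ofReal C * (ENNReal.ofReal (ρ⁻¹ ^ 3) * ENNReal.ofReal (ρ * α) * (N t + X t)) := by
          refine lintegral_mono_ae ?_
          filter_upwards [sl] with t ht
          rw [rh, Uh] at ht
          exact ht.2.trans (mul_le_mul' C1 le_rfl)
      _ = ENNReal.ofReal C * (ENNReal.ofReal (ρ⁻¹ ^ 3) * ENNReal.ofReal (ρ * α) * ((∫⁻ t in I, N t) + ∫⁻ t in I, X t)) := by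
          rw [lintegral_const_mul' _ _ (by finiteness), lintegral_const_mul' _ _ (by finiteness), lintegral_add_left Nm]
      _ ≤ ENNReal.ofReal C * (ENNReal.ofReal (ρ⁻¹ ^ 3) * ENNReal.ofReal (ρ * α) * (ENNReal.ofReal (ρ ^ 6 * z) + ENNReal.ofReal (2 * ρ ^ 6 * α ^ 2))) := by
          gcongr
      _ = _ := by
          rw [← ENNReal.ofReal_add (by positivity) (by positivity), ← ENNReal.ofReal_mul (by positivity), ← ENNReal.ofReal_mul (by positivity), ← ENNReal.ofReal_mul (by positivity)]
          congr 1
          field_simp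
  · calc _ ≤ ∫⁻ t in I, ∫⁻ x in ball x0 (θ * r), ‖P t x - c' t‖ₑ := lintegral_mono_set I'sub
      _ ≤ ∫⁻ t in I, ENNReal.ofReal C * (ENNReal.ofReal θ ^ 4 * N t + X t) := by
          refine lintegral_mono_ae ?_
          filter_upwards [sl] with t ht
          exact ht.1.trans (mul_le_mul' C1 (add_le_add le_rfl (UX1 t)))
      _ = ENNReal.ofReal C * (ENNReal.ofReal θ ^ 4 * (∫⁻ t in I, N t) + ∫⁻ t in I, X t) := by
          rw [lintegral_const_mul' _ _ (by finiteness), lintegral_add_left (Nm.const_mul _), lintegral_const_mul' _ _ (by finiteness)]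
      _ ≤ ENNReal.ofReal C * (ENNReal.ofReal θ ^ 4 * ENNReal.ofReal (ρ ^ 6 * z) + ENNReal.ofReal (2 * ρ ^ 6 * α ^ 2)) := by
          gcongr
      _ = _ := by
          rw [← ENNReal.ofReal_pow hθ.le, ← ENNReal.ofReal_mul (by positivity), ← ENNReal.ofReal_add (by positivity) (by positivity), ← ENNReal.ofReal_mul (by positivity)]
          congr 1
          ring
  · calc _ ≤ ∫⁻ t in I, (∫⁻ x in ball x0 (θ * r), ‖P t x - c' t‖ₑ) ^ (3/2:ℝ) := lintegral_mono_set I'sub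
      _ ≤ ∫⁻ t in I, ENNReal.ofReal C * (ENNReal.ofReal (θ ^ 6) * (N t) ^ (3/2:ℝ) + ENNReal.ofReal (ρ * α) * X t) := by
          refine lintegral_mono_ae ?_
          filter_upwards [sl] with t ht
          refine (ENNReal.rpow_le_rpow ht.1 (by norm_num)).trans ?_
          rw [ENNReal.mul_rpow_of_nonneg _ _ (by norm_num)]
          have e1 : (ENNReal.ofReal θ ^ 4 * N t) ^ (3/2:ℝ) = ENNReal.ofReal (θ ^ 6) * (N t) ^ (3/2:ℝ) := by
            rw [ENNReal.mul_rpow_of_nonneg _ _ (by norm_num), ← ENNReal.rpow_natCast, ← ENNReal.rpow_mul, ENNReal.ofReal_pow hθ.le, ← ENNReal.rpow_natCast]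
            norm_num
          have e2 : (U ^ (1/3:ℝ) * (X t) ^ (2/3:ℝ)) ^ (3/2:ℝ) = ENNReal.ofReal (ρ * α) * X t := by
            rw [ENNReal.mul_rpow_of_nonneg _ _ (by norm_num), ← ENNReal.rpow_mul, ← ENNReal.rpow_mul, ← Uh]
            norm_num
          have := ENNReal.rpow_add_le_mul_rpow_add_rpow (ENNReal.ofReal θ ^ 4 * N t) (U ^ (1/3:ℝ) * (X t) ^ (2/3:ℝ)) (p := 3/2) (by norm_num)
          rw [e1, e2] at this
          refine (mul_le_mul' le_rfl this).trans ?_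
          rw [← mul_assoc]
          refine mul_le_mul' (le_trans (mul_le_mul' le_rfl ?_) C2) le_rfl
          calc (2:ℝ≥0∞) ^ ((3:ℝ)/2 - 1) ≤ 2 ^ (1:ℝ) := ENNReal.rpow_le_rpow_of_exponent_le (by norm_num) (by norm_num)
            _ = 2 := ENNReal.rpow_one _
      _ = ENNReal.ofReal C * (ENNReal.ofReal (θ ^ 6) * (∫⁻ t in I, (N t) ^ (3/2:ℝ)) + ENNReal.ofReal (ρ * α) * ∫⁻ t in I, X t) := by
          rw [lintegral_const_mul' _ _ (by finiteness), lintegral_add_left ((Nm.pow_const _).const_mul _), lintegral_const_mul' _ _ (by finiteness), lintegral_const_mul' _ _ (by finiteness)]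
      _ ≤ ENNReal.ofReal C * (ENNReal.ofReal (θ ^ 6) * ENNReal.ofReal (ρ ^ 7 * Z) + ENNReal.ofReal (ρ * α) * ENNReal.ofReal (2 * ρ ^ 6 * α ^ 2)) := by
          gcongr
      _ = _ := by
          rw [← ENNReal.ofReal_mul (by positivity), ← ENNReal.ofReal_mul (by positivity), ← ENNReal.ofReal_add (by positivity) (by positivity), ← ENNReal.ofReal_mul (by positivity)]
          congr 1
          ring

theorem geo_a {v : ℝ} (hv : 0 < v) (hv2 : v ≤ 1/2) (n : ℕ) : ∑ k ∈ Finset.range n, (v⁻¹ ^ k) ^ 2 ≤ (v⁻¹ ^ n) ^ 2 := by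
  induction n with
  | zero => simp
  | succ n ih =>
    rw [Finset.sum_range_succ, pow_succ v⁻¹ n]
    have h2 : 2 ≤ v⁻¹ := by rw [le_inv_comm₀ (by norm_num) hv]; linarith
    have h0 : 0 ≤ (v⁻¹ ^ n) ^ 2 := by positivity
    have : (4:ℝ) ≤ v⁻¹ ^ 2 := by nlinarith
    nlinarith

theorem geo_b {v : ℝ} (hv : 0 < v) (hv2 : v ≤ 1/2) (n : ℕ) : ∑ k ∈ Finset.range n, v ^ k ≤ 2 := by
  have : ∑ k ∈ Finset.range n, v ^ k ≤ 2 - 2 * v ^ n := by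
    induction n with
    | zero => simp
    | succ n ih =>
      rw [Finset.sum_range_succ, pow_succ]
      have : 0 < v ^ n := by positivity
      nlinarith
  have h : 0 < v ^ n := by positivity
  linarith

/-- Sum of flux contributions. -/
theorem sum_flux {F : ℕ → ℝ≥0∞} {r f : ℕ → ℝ} {n : ℕ} {D1 : ℝ≥0∞} {η s : ℝ} (hη : 0 ≤ η) (hr : ∀ k, 0 < r k) (hf : ∀ k, 0 ≤ f k)
    (hD : D1 ≤ ENNReal.ofReal η) (h : ∀ k < n, F k ≤ ENNReal.ofReal (f k)) (hs : ∑ k ∈ Finset.range n, (r k)⁻¹ ^ 4 * f k ≤ s) :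
    D1 + ∑ k ∈ Finset.range n, ENNReal.ofReal ((r k)⁻¹ ^ 4) * F k ≤ ENNReal.ofReal (η + s) := by
  have nn : ∀ k ∈ Finset.range n, 0 ≤ (r k)⁻¹ ^ 4 * f k := fun k _ => mul_nonneg (by have := hr k; positivity) (hf k)
  rw [ENNReal.ofReal_add hη ((Finset.sum_nonneg nn).trans hs)]
  refine add_le_add hD (le_trans ?_ (ENNReal.ofReal_le_ofReal hs))
  rw [ENNReal.ofReal_sum_of_nonneg nn]
  refine Finset.sum_le_sum fun k hk => ?_
  rw [ENNReal.ofReal_mul (by have := hr k; positivity)]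
  exact mul_le_mul' le_rfl (h k (Finset.mem_range.1 hk))

set_option maxHeartbeats 1000000 in
theorem seqlem {v C H : ℝ} (hv : 0 < v) (hv2 : v ≤ 1/2) (hC : 1 ≤ C) (hCv : 2 * C * v ≤ 1) (hH : 1 ≤ H) :
    ∃ η : ℝ, 0 < η ∧ ∀ m0 : ℝ, 0 ≤ m0 → ∃ K : ℝ, 0 < K ∧ ∀ (ρ : ℕ → ℝ) (S : ℕ → ℝ → Prop) (F N M : ℕ → ℝ≥0∞) (D1 : ℝ≥0∞),
      (∀ k, ρ k = (v ^ k) ^ 2 / 2) →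
      (∀ k m m', S k m → m ≤ m' → S k m') →
      (∀ k α, 0 < α → S k ((ρ k * α) ^ 2) →
        (∀ z, 0 ≤ z → N k ≤ ENNReal.ofReal (ρ k ^ 6 * z) → F k ≤ ENNReal.ofReal (C * (ρ k ^ 4 * α * (z + 2 * α ^ 2))) ∧
          N (k + 1) ≤ ENNReal.ofReal (C * (ρ k ^ 6 * ((v ^ 4) ^ 4 * z + 2 * α ^ 2)))) ∧
        (∀ Z, 0 ≤ Z → M k ≤ ENNReal.ofReal (ρ k ^ 7 * Z) → M (k + 1) ≤ ENNReal.ofReal (C * (ρ k ^ 7 * ((v ^ 4) ^ 6 * Z + 2 * α ^ 3))))) →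
      (∀ n d, 1 ≤ n → 0 ≤ d → D1 + ∑ k ∈ Finset.range n, ENNReal.ofReal ((ρ k ^ 2)⁻¹ ^ 4) * F k ≤ ENNReal.ofReal d → S n (H * (ρ n ^ 2) ^ 3 * d)) →
      (∀ k s, 0 < s → N k ≤ ENNReal.ofReal (s ^ 2 * (ρ k ^ 2) ^ 2) + ENNReal.ofReal s⁻¹ * M k) →
      S 0 η → D1 ≤ ENNReal.ofReal η → N 0 ≤ ENNReal.ofReal η → M 0 ≤ ENNReal.ofReal m0 → ∀ n, 1 ≤ n → S n (K * (ρ n ^ 2) ^ 3) := by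
  have hC0 : 0 < C := by linarith
  have hH0 : 0 < H := by linarith
  obtain ⟨δ, hδ⟩ : ∃ δ : ℝ, δ = 1 / (4 * H * C) := ⟨_, rfl⟩
  have δ0 : 0 < δ := by rw [hδ]; positivity
  have δe : H * C * δ = 1/4 := by rw [hδ]; field_simp
  obtain ⟨a, ha⟩ : ∃ a : ℝ, a = δ * v ^ 15 / (4 * C) := ⟨_, rfl⟩
  have a0 : 0 < a := by rw [ha]; positivity
  have ae : 4 * C * a = δ * v ^ 15 := by rw [ha]; field_simp
  have v15 : v ^ 15 ≤ 1 := pow_le_one₀ hv.le (by linarith)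
  have aδ : 4 * a ≤ δ := by nlinarith
  obtain ⟨b, hb⟩ : ∃ b : ℝ, b = δ * a := ⟨_, rfl⟩
  have b0 : 0 < b := by rw [hb]; positivity
  have bv : 4 * C * a ^ 2 = v ^ 15 * b := by rw [hb]; linear_combination a * ae
  obtain ⟨η, hη⟩ : ∃ η : ℝ, η = a ^ 2 / (16 * H) := ⟨_, rfl⟩
  have η0 : 0 < η := by rw [hη]; positivity
  have ηe : H * η = a ^ 2 / 16 := by rw [hη]; field_simp
  have ηa : η ≤ a ^ 2 / 16 := by nlinarith
  have ηb : η ≤ b / 64 := by nlinarith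
  refine ⟨η, η0, fun m0 hm0 => ?_⟩
  obtain ⟨E, hE⟩ : ∃ E : ℝ, E = 1 + 128 * m0 + 4 * C * a ^ 3 / v ^ 23 := ⟨_, rfl⟩
  have t0 : 0 ≤ 4 * C * a ^ 3 / v ^ 23 := by positivity
  have E1 : 1 ≤ E := by rw [hE]; linarith
  have E3 : E ≤ E ^ 3 := by
    nlinarith [mul_nonneg (mul_nonneg (by linarith : (0:ℝ) ≤ E) (by linarith : (0:ℝ) ≤ E - 1)) (by linarith : (0:ℝ) ≤ E + 1)]
  have Ea : 4 * C * a ^ 3 ≤ v ^ 23 * E ^ 3 := by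
    have : 4 * C * a ^ 3 / v ^ 23 ≤ E ^ 3 := by linarith
    rw [div_le_iff₀ (by positivity)] at this; linarith
  obtain ⟨d, hd⟩ : ∃ d : ℝ, d = η + 64 * C * a * (E ^ 2 + a ^ 2) := ⟨_, rfl⟩
  have d0 : 0 < d := by rw [hd]; positivity
  refine ⟨H * d, by positivity, fun ρ S F N M D1 hρ mono lev heat NM s0 hD1 hN0 hM0 => ?_⟩
  have v0 : ∀ k, 0 < v ^ k := fun k => by positivity
  have v1 : ∀ k, v ^ k ≤ 1 := fun k => pow_le_one₀ hv.le (by linarith)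
  have ρ0 : ∀ k, 0 < ρ k := fun k => by rw [hρ]; positivity
  have P1 : ∀ n, S n ((ρ n * (a * (v ^ n) ^ 3)) ^ 2) ∧ N n ≤ ENNReal.ofReal (ρ n ^ 6 * (b * (v ^ n) ^ 3)) := by
    intro n
    induction n using Nat.strong_induction_on with
    | _ n ih =>
    rcases Nat.eq_zero_or_pos n with rfl | hn
    · rw [hρ]
      refine ⟨mono 0 _ _ s0 ?_, hN0.trans (ENNReal.ofReal_le_ofReal ?_)⟩
      · simp only [pow_zero, one_pow, mul_one]; nlinarith
      · simp only [pow_zero, one_pow, mul_one]; linarith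
    constructor
    · have := heat n (η + 16 * C * a * (b + 2 * a ^ 2) * (v⁻¹ ^ n) ^ 2) hn (by positivity) (by
        refine sum_flux (r := fun k => ρ k ^ 2) (f := fun k => C * (ρ k ^ 4 * (a * (v ^ k) ^ 3) * (b * (v ^ k) ^ 3 + 2 * (a * (v ^ k) ^ 3) ^ 2))) η0.le
          (fun k => by have := ρ0 k; positivity) (fun k => by have := ρ0 k; positivity) hD1 (fun k hk => ?_) ?_
        · obtain ⟨i1, i2⟩ := ih k hk
          exact (((lev k _ (by positivity) i1).1 _ (by positivity) i2).1)
        · calc _ ≤ ∑ k ∈ Finset.range n, 16 * C * a * (b + 2 * a ^ 2) * (v⁻¹ ^ k) ^ 2 := by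
                refine Finset.sum_le_sum fun k _ => ?_
                simp only [hρ, inv_pow]
                have x0 := v0 k
                have x1 := v1 k
                generalize v ^ k = x at x0 x1
                have e : (((x ^ 2 / 2) ^ 2) ^ 4)⁻¹ * (C * ((x ^ 2 / 2) ^ 4 * (a * x ^ 3) * (b * x ^ 3 + 2 * (a * x ^ 3) ^ 2))) = 16 * C * a * (b + 2 * a ^ 2 * x ^ 3) * (x ^ 2)⁻¹ := by
                  field_simp; ring
                rw [e]
                have : x ^ 3 ≤ 1 := pow_le_one₀ x0.le x1
                have h2 : 2 * a ^ 2 * x ^ 3 ≤ 2 * a ^ 2 := by nlinarith [sq_nonneg a]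
                gcongr
            _ = 16 * C * a * (b + 2 * a ^ 2) * ∑ k ∈ Finset.range n, (v⁻¹ ^ k) ^ 2 := by rw [Finset.mul_sum]
            _ ≤ _ := mul_le_mul_of_nonneg_left (geo_a hv hv2 n) (by positivity))
      refine mono n _ _ this ?_
      rw [hρ, inv_pow]
      have x0 := v0 n
      have x1 := v1 n
      generalize v ^ n = x at x0 x1
      have e : H * ((x ^ 2 / 2) ^ 2) ^ 3 * (η + 16 * C * a * (b + 2 * a ^ 2) * x⁻¹ ^ 2) = (x ^ 10 / 4) * ((H * η) * x ^ 2 / 16 + (H * C) * a * (b + 2 * a ^ 2)) := by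
        field_simp; ring
      have e2 : (x ^ 2 / 2 * (a * x ^ 3)) ^ 2 = (x ^ 10 / 4) * a ^ 2 := by ring
      rw [e, e2]
      refine mul_le_mul_of_nonneg_left ?_ (by positivity)
      have h1 : H * η * x ^ 2 / 16 ≤ a ^ 2 / 256 := by
        rw [ηe]
        have : x ^ 2 ≤ 1 := pow_le_one₀ x0.le x1
        nlinarith [sq_nonneg a]
      have h2 : H * C * a * (b + 2 * a ^ 2) = (H * C * δ) * a ^ 2 + 2 * (H * C * a) * a ^ 2 := by rw [hb]; ring
      have h3 : H * C * a ≤ 1/16 := by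
        have : 4 * a * (H * C) ≤ δ * (H * C) := mul_le_mul_of_nonneg_right aδ (by positivity)
        linarith
      rw [h2, δe]
      nlinarith [sq_nonneg a]
    · obtain ⟨k, rfl⟩ : ∃ k, n = k + 1 := ⟨n - 1, by omega⟩
      obtain ⟨i1, i2⟩ := ih k (by omega)
      refine (((lev k _ (by positivity) i1).1 _ (by positivity) i2).2).trans (ENNReal.ofReal_le_ofReal ?_)
      rw [hρ, hρ, pow_succ v k]
      have x0 := v0 k
      have x1 := v1 k
      generalize v ^ k = x at x0 x1
      have e1 : C * ((x ^ 2 / 2) ^ 6 * ((v ^ 4) ^ 4 * (b * x ^ 3) + 2 * (a * x ^ 3) ^ 2)) = (x ^ 15 / 64) * ((C * v) * (v ^ 15 * b) + (2 * C * a ^ 2) * x ^ 3) := by ring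
      have e2 : ((x * v) ^ 2 / 2) ^ 6 * (b * (x * v) ^ 3) = (x ^ 15 / 64) * (v ^ 15 * b) := by ring
      rw [e1, e2]
      refine mul_le_mul_of_nonneg_left ?_ (by positivity)
      have : x ^ 3 ≤ 1 := pow_le_one₀ x0.le x1
      have h1 : 2 * C * a ^ 2 * x ^ 3 ≤ 2 * C * a ^ 2 := mul_le_of_le_one_right (by positivity) this
      have h2 : 0 < v ^ 15 * b := by positivity
      nlinarith
  have P2 : ∀ k, M k ≤ ENNReal.ofReal (ρ k ^ 7 * (E ^ 3 * (v ^ k) ^ 9)) := by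
    intro k
    induction k with
    | zero =>
      refine hM0.trans (ENNReal.ofReal_le_ofReal ?_)
      rw [hρ]
      simp only [pow_zero, one_pow, mul_one]
      linarith
    | succ k ih =>
      refine ((lev k _ (by positivity) (P1 k).1).2 _ (by positivity) ih).trans (ENNReal.ofReal_le_ofReal ?_)
      rw [hρ, hρ, pow_succ v k]
      have x0 := v0 k
      generalize v ^ k = x at x0
      have e1 : C * ((x ^ 2 / 2) ^ 7 * ((v ^ 4) ^ 6 * (E ^ 3 * x ^ 9) + 2 * (a * x ^ 3) ^ 3)) = (x ^ 23 / 128) * ((C * v) * (v ^ 23 * E ^ 3) + 2 * C * a ^ 3) := by ring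
      have e2 : ((x * v) ^ 2 / 2) ^ 7 * (E ^ 3 * (x * v) ^ 9) = (x ^ 23 / 128) * (v ^ 23 * E ^ 3) := by ring
      rw [e1, e2]
      refine mul_le_mul_of_nonneg_left ?_ (by positivity)
      have h2 : 0 < v ^ 23 * E ^ 3 := by positivity
      nlinarith
  have P3 : ∀ k, N k ≤ ENNReal.ofReal (ρ k ^ 6 * (2 * E ^ 2 * (v ^ k) ^ 6)) := by
    intro k
    have r0 := ρ0 k
    have x0 := v0 k
    refine (NM k (ρ k * E * (v ^ k) ^ 3) (by positivity)).trans ?_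
    refine (add_le_add le_rfl (mul_le_mul' le_rfl (P2 k))).trans ?_
    rw [← ENNReal.ofReal_mul (by positivity), ← ENNReal.ofReal_add (by positivity) (by positivity)]
    refine ENNReal.ofReal_le_ofReal (le_of_eq ?_)
    generalize v ^ k = x at x0
    generalize ρ k = y at r0
    field_simp
    ring
  intro n hn
  have := heat n d hn d0.le (by
    rw [hd]
    refine sum_flux (r := fun k => ρ k ^ 2) (f := fun k => C * (ρ k ^ 4 * (a * (v ^ k) ^ 3) * (2 * E ^ 2 * (v ^ k) ^ 6 + 2 * (a * (v ^ k) ^ 3) ^ 2))) η0.le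
          (fun k => by have := ρ0 k; positivity) (fun k => by have := ρ0 k; positivity) hD1 (fun k hk => ?_) ?_
    · exact (((lev k _ (by positivity) (P1 k).1).1 _ (by positivity) (P3 k)).1)
    · calc _ = ∑ k ∈ Finset.range n, 32 * C * a * (E ^ 2 + a ^ 2) * v ^ k := by
            refine Finset.sum_congr rfl fun k _ => ?_
            simp only [hρ]
            have x0 := v0 k
            generalize v ^ k = x at x0
            field_simp
            ring
        _ = 32 * C * a * (E ^ 2 + a ^ 2) * ∑ k ∈ Finset.range n, v ^ k := by rw [Finset.mul_sum]
        _ ≤ 32 * C * a * (E ^ 2 + a ^ 2) * 2 := mul_le_mul_of_nonneg_left (geo_b hv hv2 n) (by positivity)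
        _ = _ := by ring)
  exact mono n _ _ this (le_of_eq (by ring))

def cc (P : ℝ → E3 → ℝ) (x0 : E3) (ρ : ℕ → ℝ) : ℕ → ℝ → ℝ
  | 0 => fun _ => 0
  | (k + 1) => fun t => c0⁻¹ * ∫ y, P t y * rho (ρ k ^ 2 / 8) (y - x0)

theorem cc_meas {P : ℝ → E3 → ℝ} (hP : Measurable (Function.uncurry P)) (x0 : E3) (ρ : ℕ → ℝ) (k : ℕ) : Measurable (cc P x0 ρ k) := by
  cases k with
  | zero => exact measurable_const
  | succ k =>
    have h : Measurable (fun z : ℝ × E3 => P z.1 z.2 * rho (ρ k ^ 2 / 8) (z.2 - x0)) :=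
      Measurable.mul hP ((rho_contDiff _).continuous.measurable.comp (measurable_snd.sub_const x0))
    exact ((StronglyMeasurable.integral_prod_right (ν := (volume : Measure E3)) (f := fun t y => P t y * rho (ρ k ^ 2 / 8) (y - x0)) h.stronglyMeasurable).measurable).const_mul _

theorem pt32 (n : ℝ≥0∞) {s : ℝ} (hs : 0 < s) : n ≤ ENNReal.ofReal (s ^ 2) + ENNReal.ofReal s⁻¹ * n ^ (3/2:ℝ) := by
  rcases le_total n (ENNReal.ofReal (s ^ 2)) with h | h
  · exact h.trans le_self_add
  · refine le_trans ?_ le_add_self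
    have h1 : ENNReal.ofReal s ≤ n ^ (1/2:ℝ) := by
      have := ENNReal.rpow_le_rpow h (by norm_num : (0:ℝ) ≤ 1/2)
      rwa [ENNReal.ofReal_rpow_of_nonneg (by positivity) (by norm_num), ← Real.sqrt_eq_rpow, Real.sqrt_sq hs.le] at this
    have h2 : n ^ (3/2:ℝ) = n ^ (1/2:ℝ) * n := by
      conv_rhs => rw [← ENNReal.rpow_one n, ← ENNReal.rpow_mul, one_mul]
      rw [← ENNReal.rpow_add_of_nonneg _ _ (by norm_num) (by norm_num)]; norm_num
    calc n = ENNReal.ofReal s⁻¹ * (ENNReal.ofReal s * n) := by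
          rw [← mul_assoc, ← ENNReal.ofReal_mul (by positivity), inv_mul_cancel₀ hs.ne', ENNReal.ofReal_one, one_mul]
      _ ≤ _ := by rw [h2]; exact mul_le_mul' le_rfl (mul_le_mul' h1 le_rfl)

theorem decay : ∃ v η : ℝ, 0 < v ∧ v ≤ 1/2 ∧ 0 < η ∧ ∀ m0 : ℝ, 0 ≤ m0 → ∃ K : ℝ, 0 < K ∧ ∀ u g P, Good u g P →
    EE u g (7/8) ≤ ENNReal.ofReal η → ∫⁻ t, (∫⁻ x, ‖P t x‖ₑ) ∂muT ≤ ENNReal.ofReal η →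
    ∫⁻ t, (∫⁻ x, ‖P t x‖ₑ) ^ (3/2:ℝ) ∂muT ≤ ENNReal.ofReal m0 →
    ∀ x0 ∈ ball (0:E3) (1/2), ∀ t0 ∈ Ioo (-(1/4):ℝ) 0, ∀ n : ℕ, 1 ≤ n →
    ∀ᵐ t ∂muT, t ∈ Ioo (t0 - rr (v^4) n ^ 2) t0 → ∫⁻ x in ball x0 (rr (v^4) n), ‖u t x‖ₑ ^ 2 ≤ ENNReal.ofReal (K * rr (v^4) n ^ 3) := by
  obtain ⟨C, hC, lev⟩ := level
  obtain ⟨v, hv⟩ : ∃ v : ℝ, v = 1 / (2 * C) := ⟨_, rfl⟩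
  have v0 : 0 < v := by rw [hv]; positivity
  have vC : 2 * C * v = 1 := by rw [hv]; field_simp
  have v2 : v ≤ 1/2 := by nlinarith
  have th0 : 0 < v ^ 4 := by positivity
  have th4 : v ^ 4 ≤ 1/4 := by
    calc v ^ 4 ≤ (1/2) ^ 4 := by gcongr
      _ ≤ 1/4 := by norm_num
  obtain ⟨Ch, Ch0, hheat⟩ := heat (v ^ 4) th0 th4
  obtain ⟨η, η0, h⟩ := seqlem v0 v2 hC vC.le (by linarith : 1 ≤ Ch + 1)
  refine ⟨v, η, v0, v2, η0, fun m0 hm0 => ?_⟩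
  obtain ⟨K, K0, hK⟩ := h m0 hm0
  refine ⟨K, K0, fun u g P H hE hP hM x0 hx0 t0 ht0 n hn => ?_⟩
  obtain ⟨ρ, hρ⟩ : ∃ ρ : ℕ → ℝ, ∀ k, ρ k = (v ^ k) ^ 2 / 2 := ⟨_, fun _ => rfl⟩
  have hr : ∀ k, rr (v ^ 4) k = ρ k ^ 2 := fun k => by rw [hρ, rr, ← pow_mul, mul_comm 4 k, pow_mul]; ring
  have ρ0 : ∀ k, 0 < ρ k := fun k => by rw [hρ]; positivity
  have ρ4 : ∀ k, ρ k ^ 2 ≤ 1/4 := fun k => by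
    have : (v ^ k) ≤ 1 := pow_le_one₀ v0.le (by linarith)
    have h0 : 0 < v ^ k := by positivity
    rw [hρ]
    have : (v ^ k) ^ 4 ≤ 1 := pow_le_one₀ h0.le this
    linarith [show ((v ^ k) ^ 2 / 2) ^ 2 = (v ^ k) ^ 4 / 4 by ring]
  have ρs : ∀ k, ρ (k + 1) ^ 2 = v ^ 4 * ρ k ^ 2 := fun k => by rw [hρ, hρ]; ring
  have r00 : ρ 0 ^ 2 = 1/4 := by rw [hρ]; norm_num
  have ccm := cc_meas H.mP x0 ρ
  have I0 : Ioo (t0 - (ρ 0 ^ 2) ^ 2) t0 ⊆ Ioo (-(7/8:ℝ)^2) 0 := Ioo_subset_Ioo (by rw [r00]; linarith [ht0.1]) ht0.2.le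
  have I1 : Ioo (t0 - (ρ 0 ^ 2) ^ 2) t0 ⊆ Ioo (-1) 0 := I0.trans (Ioo_subset_Ioo (by norm_num) le_rfl)
  have B0 : ball x0 (ρ 0 ^ 2) ⊆ ball 0 (7/8) := by
    intro y hy
    rw [r00] at hy
    rw [mem_ball_zero_iff] at *
    rw [mem_ball_iff_norm] at hy
    calc ‖y‖ = ‖(y - x0) + x0‖ := by rw [sub_add_cancel]
      _ ≤ ‖y - x0‖ + ‖x0‖ := norm_add_le _ _
      _ < 7/8 := by linarith
  have vI : volume (Ioo (t0 - (ρ 0 ^ 2) ^ 2) t0) ≤ 1 := by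
    rw [Real.volume_Ioo, r00, ← ENNReal.ofReal_one]; exact ENNReal.ofReal_le_ofReal (by linarith)
  have b1 : ∀ᵐ t ∂(volume.restrict (Ioo (-(7/8:ℝ)^2) 0)), ∫⁻ x in ball x0 (ρ 0 ^ 2), ‖u t x‖ₑ ^ 2 ≤ ENNReal.ofReal η := by
    filter_upwards [ENNReal.ae_le_essSup (μ := volume.restrict (Ioo (-(7/8:ℝ)^2) 0)) (fun t => ∫⁻ x in ball (0:E3) (7/8), ‖u t x‖ₑ ^ 2)] with t ht
    exact (lintegral_mono_set B0).trans (ht.trans (le_trans le_self_add hE))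
  have main := hK ρ (fun k m => (∀ᵐ t ∂muT, t ∈ Ioo (t0 - (ρ k ^ 2) ^ 2) t0 → ∫⁻ x in ball x0 (ρ k ^ 2), ‖u t x‖ₑ ^ 2 ≤ ENNReal.ofReal m) ∧
      ∫⁻ t in Ioo (t0 - (ρ k ^ 2) ^ 2) t0, ∫⁻ x in ball x0 (ρ k ^ 2), gn (g t) x ^ 2 ≤ ENNReal.ofReal m)
    (fun k => ∫⁻ t in Ioo (t0 - (ρ k ^ 2) ^ 2) t0, ∫⁻ x in ball x0 (3/4 * ρ k ^ 2), ‖u t x‖ₑ * (‖u t x‖ₑ ^ 2 + 2 * ‖P t x - cc P x0 ρ (k + 1) t‖ₑ))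
    (fun k => ∫⁻ t in Ioo (t0 - (ρ k ^ 2) ^ 2) t0, ∫⁻ x in ball x0 (ρ k ^ 2), ‖P t x - cc P x0 ρ k t‖ₑ)
    (fun k => ∫⁻ t in Ioo (t0 - (ρ k ^ 2) ^ 2) t0, (∫⁻ x in ball x0 (ρ k ^ 2), ‖P t x - cc P x0 ρ k t‖ₑ) ^ (3/2:ℝ))
    (∫⁻ t in Ioo (t0 - (ρ 0 ^ 2) ^ 2) t0, ∫⁻ x in ball x0 (ρ 0 ^ 2), ‖u t x‖ₑ ^ 2) hρ ?_ ?_ ?_ ?_ ?_ ?_ ?_ ?_ n hn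
  · rw [hr]; exact main.1
  · rintro k m m' ⟨h1, h2⟩ hm
    have hm' := ENNReal.ofReal_le_ofReal hm
    refine ⟨?_, h2.trans hm'⟩
    filter_upwards [h1] with t ht hti
    exact (ht hti).trans hm'
  · rintro k α hα ⟨h1, h2⟩
    obtain ⟨l1, l2⟩ := lev u g P H x0 t0 (ρ k) (v ^ 4) α (cc P x0 ρ k) (cc P x0 ρ (k + 1)) (ρ0 k) (ρ4 k) hx0 ht0 th0 th4 hα (ccm k) (fun t => rfl) h1 h2
    rw [ρs k]
    exact ⟨l1, l2⟩
  · intro n d hn hd hD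
    obtain ⟨h1, h2⟩ := hheat u g P H x0 hx0 t0 ht0 n hn (fun k => cc P x0 ρ (k + 1)) (fun k => ccm _) _ rfl
    simp only [hr] at h1 h2
    have key : ENNReal.ofReal (Ch * (ρ n ^ 2) ^ 3) * ((∫⁻ t in Ioo (t0 - (ρ 0 ^ 2) ^ 2) t0, ∫⁻ x in ball x0 (ρ 0 ^ 2), ‖u t x‖ₑ ^ 2) + ∑ k ∈ Finset.range n, ENNReal.ofReal ((ρ k ^ 2)⁻¹ ^ 4) * ∫⁻ t in Ioo (t0 - (ρ k ^ 2) ^ 2) t0, ∫⁻ x in ball x0 (3/4 * ρ k ^ 2), ‖u t x‖ₑ * (‖u t x‖ₑ ^ 2 + 2 * ‖P t x - cc P x0 ρ (k + 1) t‖ₑ)) ≤ ENNReal.ofReal ((Ch + 1) * (ρ n ^ 2) ^ 3 * d) := by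
      refine (mul_le_mul' le_rfl hD).trans ?_
      have := ρ0 n
      rw [← ENNReal.ofReal_mul (by positivity)]
      refine ENNReal.ofReal_le_ofReal ?_
      gcongr
      linarith
    refine ⟨?_, h2.trans key⟩
    filter_upwards [h1] with t ht hti
    exact (ht hti).trans key
  · intro k s hs
    calc _ ≤ ∫⁻ t in Ioo (t0 - (ρ k ^ 2) ^ 2) t0, (ENNReal.ofReal (s ^ 2) + ENNReal.ofReal s⁻¹ * (∫⁻ x in ball x0 (ρ k ^ 2), ‖P t x - cc P x0 ρ k t‖ₑ) ^ (3/2:ℝ)) :=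
          lintegral_mono fun t => pt32 _ hs
      _ = _ := by
        rw [lintegral_add_left measurable_const, lintegral_const_mul' _ _ (by finiteness), setLIntegral_const, Real.volume_Ioo, ← ENNReal.ofReal_mul (by positivity), _root_.sub_sub_cancel]
  · refine ⟨?_, ?_⟩
    · have := (ae_restrict_iff' measurableSet_Ioo).1 (ae_restrict_of_ae_restrict_of_subset I0 b1)
      exact ae_restrict_of_ae this
    · refine (lintegral_mono_set I0).trans (le_trans ?_ hE)
      exact (lintegral_mono fun t => lintegral_mono_set B0).trans le_add_self
  · calc _ ≤ ∫⁻ t in Ioo (t0 - (ρ 0 ^ 2) ^ 2) t0, ENNReal.ofReal η := lintegral_mono_ae (ae_restrict_of_ae_restrict_of_subset I0 b1)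
      _ = ENNReal.ofReal η * volume (Ioo (t0 - (ρ 0 ^ 2) ^ 2) t0) := setLIntegral_const _ _
      _ ≤ _ := mul_le_of_le_one_right bot_le vI
  · refine (lintegral_mono_set I1).trans (le_trans (lintegral_mono fun t => ?_) hP)
    simp only [cc, sub_zero]
    exact setLIntegral_le_lintegral _ _
  · refine (lintegral_mono_set I1).trans (le_trans (lintegral_mono fun t => ENNReal.rpow_le_rpow ?_ (by norm_num)) hM)
    simp only [cc, sub_zero]
    exact setLIntegral_le_lintegral _ _

theorem ptbound : ∃ η : ℝ, 0 < η ∧ ∀ m0 : ℝ, 0 ≤ m0 → ∃ M : ℝ, 0 ≤ M ∧ ∀ u g P, Good u g P →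
    EE u g (7/8) ≤ ENNReal.ofReal η → ∫⁻ t, (∫⁻ x, ‖P t x‖ₑ) ∂muT ≤ ENNReal.ofReal η →
    ∫⁻ t, (∫⁻ x, ‖P t x‖ₑ) ^ (3/2:ℝ) ∂muT ≤ ENNReal.ofReal m0 →
    ∀ᵐ t ∂muT, t ∈ Ioo (-(1/4):ℝ) 0 → ∀ᵐ x, x ∈ ball (0:E3) (1/2) → ‖u t x‖ ≤ M := by
  obtain ⟨v, η, v0, v2, η0, hd⟩ := decay
  refine ⟨η, η0, fun m0 hm0 => ?_⟩
  obtain ⟨K, K0, hK⟩ := hd m0 hm0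
  obtain ⟨B, hB⟩ : ∃ B : ℝ, B = (volume (ball (0:E3) 1)).toReal := ⟨_, rfl⟩
  have Bv : volume (ball (0:E3) 1) = ENNReal.ofReal B := by rw [hB, ENNReal.ofReal_toReal measure_ball_lt_top.ne]
  have B0 : 0 < B := by rw [hB]; exact ENNReal.toReal_pos (measure_ball_pos _ _ one_pos).ne' measure_ball_lt_top.ne
  refine ⟨√(64 * K / B), Real.sqrt_nonneg _, fun u g P H hE hP hM => ?_⟩
  have th0 : 0 < v ^ 4 := by positivity
  have rp := rr_pos th0
  have h1 : ∀ᵐ t ∂muT, ∀ (i n : ℕ) (q : ℚ), TopologicalSpace.denseSeq E3 i ∈ ball (0:E3) (1/2) → (q:ℝ) ∈ Ioo (-(1/4):ℝ) 0 →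
      t ∈ Ioo ((q:ℝ) - rr (v^4) (n + 1) ^ 2) q → ∫⁻ x in ball (TopologicalSpace.denseSeq E3 i) (rr (v^4) (n + 1)), ‖u t x‖ₑ ^ 2 ≤ ENNReal.ofReal (K * rr (v^4) (n + 1) ^ 3) := by
    rw [ae_all_iff]; intro i
    rw [ae_all_iff]; intro n
    rw [ae_all_iff]; intro q
    by_cases c1 : TopologicalSpace.denseSeq E3 i ∈ ball (0:E3) (1/2)
    · by_cases c2 : (q:ℝ) ∈ Ioo (-(1/4):ℝ) 0
      · filter_upwards [hK u g P H hE hP hM _ c1 _ c2 (n + 1) (by omega)] with t ht _ _ h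
        exact ht h
      · exact Eventually.of_forall fun t _ h => absurd h c2
    · exact Eventually.of_forall fun t h => absurd h c1
  filter_upwards [h1, H.slice] with t ht hs hti
  have hm : Measurable (fun x => ‖u t x‖ₑ ^ 2) := hs.mu.enorm.pow_const 2
  filter_upwards [VitaliFamily.ae_tendsto_lintegral_div (Besicovitch.vitaliFamily (volume : Measure E3)) hm.aemeasurable hs.Lu.ne] with x hx hxb
  have lim0 : Tendsto (fun n => rr (v^4) (n + 1) / 4) atTop (nhdsWithin 0 (Ioi 0)) := by
    refine tendsto_nhdsWithin_iff.2 ⟨?_, Eventually.of_forall fun n => ?_⟩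
    · have := (tendsto_pow_atTop_nhds_zero_of_lt_one th0.le (by
        calc v ^ 4 ≤ (1/2) ^ 4 := by gcongr
          _ < 1 := by norm_num)).comp (tendsto_add_atTop_nat 1)
      have := (this.div_const 4).div_const 4
      simpa [rr, Function.comp_def] using this
    · have := rp (n + 1)
      simp only [mem_Ioi]; positivity
  have lim := (hx.comp (Besicovitch.tendsto_filterAt volume x)).comp lim0
  have hle : ‖u t x‖ₑ ^ 2 ≤ ENNReal.ofReal (64 * K / B) := by
    refine le_of_tendsto lim (Eventually.of_forall fun n => ?_)
    simp only [Function.comp_def]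
    obtain ⟨r, hr⟩ : ∃ r, r = rr (v^4) (n + 1) := ⟨_, rfl⟩
    have r0 : 0 < r := by rw [hr]; exact rp _
    obtain ⟨y, hy, i, rfl⟩ := (TopologicalSpace.denseRange_denseSeq E3).inter_open_nonempty (ball x (r/2) ∩ ball 0 (1/2)) (isOpen_ball.inter isOpen_ball)
      ⟨x, mem_ball_self (by positivity), hxb⟩
    obtain ⟨q, q1, q2⟩ := exists_rat_btwn (show t < min 0 (t + r ^ 2) from lt_min hti.2 (by nlinarith))
    have hb := ht i n q hy.2 ⟨hti.1.trans q1, q2.trans_le (min_le_left _ _)⟩ ⟨by rw [← hr]; linarith [q2.trans_le (min_le_right 0 (t + r ^ 2))], q1⟩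
    rw [← hr] at hb ⊢
    have sub : closedBall x (r/4) ⊆ ball (TopologicalSpace.denseSeq E3 i) r := by
      refine closedBall_subset_ball' ?_
      have := mem_ball'.1 hy.1
      linarith
    have hv : volume (closedBall x (r/4)) = ENNReal.ofReal ((r/4) ^ 3 * B) := by
      rw [Measure.addHaar_closedBall _ _ (by positivity), Bv, ← ENNReal.ofReal_mul (by positivity)]; simp
    rw [hv]
    refine ENNReal.div_le_of_le_mul ?_
    refine (lintegral_mono_set sub).trans (hb.trans ?_)
    rw [← ENNReal.ofReal_mul (by positivity)]
    refine ENNReal.ofReal_le_ofReal (le_of_eq ?_)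
    field_simp
    ring
  have : ENNReal.ofReal (‖u t x‖ ^ 2) ≤ ENNReal.ofReal (64 * K / B) := by
    rwa [ENNReal.ofReal_pow (norm_nonneg _), ofReal_norm]
  rw [ENNReal.ofReal_le_ofReal_iff (by positivity)] at this
  exact Real.le_sqrt_of_sq_le this

theorem m0_fin {u P} (S : SuitableWeakSolution 1 u P) : ∫⁻ t, (∫⁻ x, ‖xt P t x‖ₑ) ^ (3/2:ℝ) ∂muT < ∞ := by
  have h := S.press_L32
  rw [one_neg_sq] at h
  have e : ∀ t, (∫⁻ x, ‖xt P t x‖ₑ) ^ (3/2:ℝ) ≤ volume (ball (0:E3) 1) ^ (1/2:ℝ) * ∫⁻ x in ball (0:E3) 1, ENNReal.ofReal |P x t| ^ (3/2:ℝ) := by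
    intro t
    have e1 : ∫⁻ x, ‖xt P t x‖ₑ = ∫⁻ x in ball (0:E3) 1, (fun x => ENNReal.ofReal |P x t|) x * (fun _ => 1) x := by
      rw [← lintegral_indicator measurableSet_ball]
      refine lintegral_congr fun x => ?_
      by_cases hx : x ∈ ball (0:E3) 1
      · rw [xt_in P t hx, indicator_of_mem hx, ← ofReal_norm, Real.norm_eq_abs, mul_one]
      · rw [xt_out P t hx, indicator_of_notMem hx]; simp
    have mP : Measurable (fun x => ENNReal.ofReal |P x t|) := by
      have : Measurable (fun x => P x t) := S.meas_press.comp (measurable_id.prodMk measurable_const)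
      exact ENNReal.measurable_ofReal.comp (measurable_norm.comp this)
    have hh := ENNReal.lintegral_mul_le_Lp_mul_Lq (volume.restrict (ball (0:E3) 1)) (p := 3/2) (q := 3) ⟨by norm_num, by norm_num, by norm_num⟩ mP.aemeasurable
      (g := fun _ => 1) aemeasurable_const
    have hh2 := ENNReal.rpow_le_rpow hh (by norm_num : (0:ℝ) ≤ 3/2)
    rw [e1]
    refine hh2.trans (le_of_eq ?_)
    rw [ENNReal.mul_rpow_of_nonneg _ _ (by norm_num), ← ENNReal.rpow_mul, ← ENNReal.rpow_mul, mul_comm]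
    simp only [ENNReal.one_rpow, lintegral_one, Measure.restrict_apply_univ]
    norm_num1
    rw [ENNReal.rpow_one]
  refine (lintegral_mono e).trans_lt ?_
  rw [lintegral_const_mul' _ _ (by finiteness [measure_ball_lt_top (μ := (volume : Measure E3)) (x := 0) (r := 1)])]
  exact ENNReal.mul_lt_top (by finiteness) h

theorem ptp (n : ℝ≥0∞) {s p : ℝ} (hs : 0 < s) (hp : 1 ≤ p) : n ≤ ENNReal.ofReal s + ENNReal.ofReal s ^ (1 - p) * n ^ p := by
  have s0 : ENNReal.ofReal s ≠ 0 := by simpa using hs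
  rcases le_total n (ENNReal.ofReal s) with h | h
  · exact h.trans le_self_add
  · refine le_trans ?_ le_add_self
    have h1 : ENNReal.ofReal s ^ (p - 1) ≤ n ^ (p - 1) := ENNReal.rpow_le_rpow h (by linarith)
    calc n = ENNReal.ofReal s ^ (1 - p) * (ENNReal.ofReal s ^ (p - 1) * n) := by
          rw [← mul_assoc, ← ENNReal.rpow_add _ _ s0 ENNReal.ofReal_ne_top]; simp
      _ ≤ ENNReal.ofReal s ^ (1 - p) * (n ^ (p - 1) * n ^ (1:ℝ)) := by rw [ENNReal.rpow_one]; exact mul_le_mul' le_rfl (mul_le_mul' h1 le_rfl)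
      _ = _ := by rw [← ENNReal.rpow_add_of_nonneg _ _ (by linarith) (by norm_num)]; simp

theorem time_red (p : ℝ≥0∞) (q1 q2 q3 : ℝ) (hp : 1 ≤ p) (hpq : 2 / p.toReal + (1/q1 + 1/q2 + 1/q3) < 2) :
    ∃ p' : ℝ, 0 < p' ∧ 2 / p' + (1/q1 + 1/q2 + 1/q3) < 2 ∧ ∀ u : E3 → ℝ → E3, ∀ s : ℝ, 0 < s → s ≤ 1 → 
      mixedNorm p q1 q2 q3 1 (fun x t => ‖u x t‖) ≤ ENNReal.ofReal s →
      ∫⁻ t, anisoNorm q1 q2 q3 (ball 0 1) (fun x => ‖u x t‖) ∂muT ≤ ENNReal.ofReal (2 * s) ∧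
      ∫⁻ t, anisoNorm q1 q2 q3 (ball 0 1) (fun x => ‖u x t‖) ^ p' ∂muT ≤ 1 := by
  have mu1 : muT univ = 1 := by simp [muT]
  by_cases hpt : p = ∞
  · rw [hpt] at hpq
    simp only [ENNReal.toReal_top] at hpq
    obtain ⟨w, hw⟩ : ∃ w, w = 2 - (1/q1 + 1/q2 + 1/q3) := ⟨_, rfl⟩
    have w0 : 0 < w := by linarith
    refine ⟨4 / w, by positivity, ?_, fun u s s0 s1 h => ?_⟩
    · have : 2 / (4 / w) = w / 2 := by field_simp; norm_num
      rw [this]; linarith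
    rw [mixedNorm, if_pos hpt, one_neg_sq] at h
    have hb : ∀ᵐ t ∂muT, anisoNorm q1 q2 q3 (ball 0 1) (fun x => ‖u x t‖) ≤ ENNReal.ofReal s := by
      filter_upwards [ENNReal.ae_le_essSup (μ := muT) (fun t => anisoNorm q1 q2 q3 (ball 0 1) (fun x => ‖u x t‖))] with t ht
      exact ht.trans h
    constructor
    · refine (lintegral_mono_ae hb).trans ?_
      rw [lintegral_const, mu1, mul_one]
      exact ENNReal.ofReal_le_ofReal (by linarith)
    · calc _ ≤ ∫⁻ t, 1 ∂muT := by
            refine lintegral_mono_ae ?_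
            filter_upwards [hb] with t ht
            refine ENNReal.rpow_le_one (ht.trans ?_) (by positivity)
            rw [← ENNReal.ofReal_one]; exact ENNReal.ofReal_le_ofReal s1
        _ = 1 := by rw [lintegral_one, mu1]
  · have p1 : 1 ≤ p.toReal := by
      have := ENNReal.toReal_mono hpt hp
      simpa using this
    have p0 : 0 < p.toReal := by linarith
    refine ⟨p.toReal, p0, hpq, fun u s s0 s1 h => ?_⟩
    rw [mixedNorm, if_neg hpt, one_neg_sq] at h
    have h2 : ∫⁻ t, anisoNorm q1 q2 q3 (ball 0 1) (fun x => ‖u x t‖) ^ p.toReal ∂muT ≤ ENNReal.ofReal s ^ p.toReal := by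
      have := ENNReal.rpow_le_rpow h p0.le
      rwa [← ENNReal.rpow_mul, one_div, inv_mul_cancel₀ p0.ne', ENNReal.rpow_one] at this
    have se : ENNReal.ofReal s ≠ 0 := by simpa using s0
    constructor
    · calc _ ≤ ∫⁻ t, (ENNReal.ofReal s + ENNReal.ofReal s ^ (1 - p.toReal) * anisoNorm q1 q2 q3 (ball 0 1) (fun x => ‖u x t‖) ^ p.toReal) ∂muT :=
            lintegral_mono fun t => ptp _ s0 p1
        _ = ENNReal.ofReal s + ENNReal.ofReal s ^ (1 - p.toReal) * ∫⁻ t, anisoNorm q1 q2 q3 (ball 0 1) (fun x => ‖u x t‖) ^ p.toReal ∂muT := by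
            rw [lintegral_add_left measurable_const, lintegral_const, mu1, mul_one, lintegral_const_mul']
            exact ENNReal.rpow_ne_top_of_ne_zero se ENNReal.ofReal_ne_top
        _ ≤ ENNReal.ofReal s + ENNReal.ofReal s ^ (1 - p.toReal) * ENNReal.ofReal s ^ p.toReal := add_le_add le_rfl (mul_le_mul' le_rfl h2)
        _ = _ := by
            rw [← ENNReal.rpow_add _ _ se ENNReal.ofReal_ne_top, sub_add_cancel, ENNReal.rpow_one, ← ENNReal.ofReal_add s0.le s0.le, two_mul]
    · refine h2.trans (ENNReal.rpow_le_one ?_ p0.le)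
      rw [← ENNReal.ofReal_one]; exact ENNReal.ofReal_le_ofReal s1

theorem eps_regularity_one_scale
    (p : ℝ≥0∞) (q1 q2 q3 : ℝ) (hp : 1 ≤ p)
    (hq1 : 1 < q1) (hq2 : 1 < q2) (hq3 : 1 < q3)
    (hpq : 2 / p.toReal + (1/q1 + 1/q2 + 1/q3) < 2) :
    ∃ ε : ℝ, 0 < ε ∧
      ∀ (u : E3 → ℝ → E3) (P : E3 → ℝ → ℝ),
        SuitableWeakSolution 1 u P →
        mixedNorm p q1 q2 q3 1 (fun x t => ‖u x t‖)
            + (∫⁻ t in Ioo (-(1:ℝ)) 0, ∫⁻ x in ball (0 : E3) 1,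
                ENNReal.ofReal |P x t|) ≤ ENNReal.ofReal ε →
        ∃ M : ℝ, ∀ᵐ z : E3 × ℝ
            ∂(volume.restrict ((ball (0 : E3) (1/2)) ×ˢ (Ioo (-((1:ℝ)/2)^2) 0))),
          ‖u z.1 z.2‖ ≤ M := by
  obtain ⟨p', hp', hpq', hred⟩ := time_red p q1 q2 q3 hp hpq
  obtain ⟨A, hA, hst⟩ := step1 hq1 hq2 hq3 hp' hpq'
  obtain ⟨η, η0, hpt⟩ := ptbound
  obtain ⟨a, ha⟩ : ∃ a : ℝ, a = A.toReal := ⟨_, rfl⟩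
  have a0 : 0 ≤ a := by rw [ha]; exact ENNReal.toReal_nonneg
  have Ae : A = ENNReal.ofReal a := by rw [ha, ENNReal.ofReal_toReal hA]
  obtain ⟨ε, hε⟩ : ∃ ε : ℝ, ε = min (1/2) (η / (2 * (a + 1))) := ⟨_, rfl⟩
  have ε0 : 0 < ε := by rw [hε]; exact lt_min (by norm_num) (by positivity)
  have ε1 : ε ≤ 1/2 := by rw [hε]; exact min_le_left _ _
  have ε2 : ε * (2 * (a + 1)) ≤ η := by
    have : ε ≤ η / (2 * (a + 1)) := by rw [hε]; exact min_le_right _ _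
    rwa [le_div_iff₀ (by positivity)] at this
  refine ⟨ε, ε0, fun u P S hs => ?_⟩
  have H := good_of S
  obtain ⟨n1, n2⟩ := hred u ε ε0 (by linarith) (le_trans le_self_add hs)
  have Pe : ∫⁻ t, (∫⁻ x, ‖xt P t x‖ₑ) ∂muT ≤ ENNReal.ofReal ε := by
    refine le_trans (le_of_eq ?_) (le_trans le_add_self hs)
    refine lintegral_congr fun t => ?_
    rw [← lintegral_indicator measurableSet_ball]
    refine lintegral_congr fun x => ?_
    by_cases hx : x ∈ ball (0:E3) 1
    · rw [xt_in P t hx, indicator_of_mem hx, ← ofReal_norm, Real.norm_eq_abs]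
    · rw [xt_out P t hx, indicator_of_notMem hx]; simp
  have Ne : ∀ t, anisoNorm q1 q2 q3 (ball 0 1) (fun x => ‖u x t‖) = anisoNorm q1 q2 q3 (ball 0 1) (fun x => ‖xt u t x‖) := by
    intro t
    have : (ball (0:E3) 1).indicator (fun x => ‖u x t‖) = (ball (0:E3) 1).indicator (fun x => ‖xt u t x‖) :=
      indicator_congr fun x hx => by rw [xt_in u t hx]
    unfold anisoNorm
    rw [this]
  have E2 := hst _ _ _ H _ Ne (ENNReal.ofReal (2 * ε)) (by rw [← ENNReal.ofReal_one]; exact ENNReal.ofReal_le_ofReal (by linarith)) n1 n2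
    (Pe.trans (ENNReal.ofReal_le_ofReal (by linarith)))
  have E3' : EE (xt u) (xt S.gu) (7/8) ≤ ENNReal.ofReal η := by
    refine E2.trans ?_
    rw [Ae, ← ENNReal.ofReal_mul a0]
    exact ENNReal.ofReal_le_ofReal (by nlinarith)
  obtain ⟨M, M0, hM⟩ := hpt (∫⁻ t, (∫⁻ x, ‖xt P t x‖ₑ) ^ (3/2:ℝ) ∂muT).toReal ENNReal.toReal_nonneg
  have fin := hM _ _ _ H E3' (Pe.trans (ENNReal.ofReal_le_ofReal (by nlinarith))) (by rw [ENNReal.ofReal_toReal (m0_fin S).ne])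
  refine ⟨M, ?_⟩
  have quarter : (-((1:ℝ)/2)^2) = -(1/4) := by norm_num
  rw [quarter, Measure.volume_eq_prod, ← Measure.prod_restrict]
  have ms : MeasurableSet {z : E3 × ℝ | ‖u z.1 z.2‖ ≤ M} := measurableSet_le S.meas_u.norm measurable_const
  rw [Measure.ae_prod_iff_ae_ae ms]
  refine (Measure.ae_ae_comm (p := fun x t => ‖u x t‖ ≤ M) ms).2 ?_
  have hsub : Ioo (-(1/4):ℝ) 0 ⊆ Ioo (-1) 0 := Ioo_subset_Ioo (by norm_num) le_rfl
  filter_upwards [ae_restrict_of_ae_restrict_of_subset hsub fin, ae_restrict_mem measurableSet_Ioo] with t ht hti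
  rw [ae_restrict_iff' measurableSet_ball]
  filter_upwards [ht hti] with x hx hxb
  have := hx hxb
  rwa [xt_in u t (ball_subset_ball (by norm_num) hxb)] at this
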